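/- Let A(t), B(t) ∈ ℤ[t] be such that Δ(t) = −16(4A(t)³ + 27B(t)²) is not the zero polynomial and the j-invariant j(t) = −6912·A(t)³/(4A(t)³ + 27B(t)²) is a non-constant rational function. Let 𝕂 be an imaginary quadratic field. Then for every ε > 0 there is a constant C > 0 (depending only on A, B, 𝕂, ε) such that for all real positive x and T, Σ_{τ ∈ F(T), Δ(τ) ≠ 0} Π_{E(τ)}(𝕂, x) ≤ C·(T²·x^{2/3} + T·x^{3/2+ε}). -/

import Mathlib

/-- The Farey pairs of order `T`: coprime pairs `(α, β)` of positive integers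
with `α, β ≤ T`; the pair `(α, β)` represents the Farey fraction `α/β ∈ F(T)`. -/
noncomputable def fareyPairs (T : ℝ) : Finset (ℕ × ℕ) :=
  (Finset.Icc 1 ⌊T⌋₊ ×ˢ Finset.Icc 1 ⌊T⌋₊).filter fun ab => Nat.Coprime ab.1 ab.2

/-- The Farey fraction `α/β ∈ ℚ` associated to a pair `(α, β)`. -/
def fareyFrac (ab : ℕ × ℕ) : ℚ := (ab.1 : ℚ) / (ab.2 : ℚ)

/-- Evaluation of an integer polynomial at a rational point. -/
def evalQ (A : Polynomial ℤ) (τ : ℚ) : ℚ := Polynomial.eval₂ (Int.castRingHom ℚ) τ A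

/-- The discriminant `Δ(τ) = −16(4A(τ)³ + 27B(τ)²)` of the specialized curve
`E(τ) : Y² = X³ + A(τ)X + B(τ)`. -/
def discQ (A B : Polynomial ℤ) (τ : ℚ) : ℚ :=
  -16 * (4 * evalQ A τ ^ 3 + 27 * evalQ B τ ^ 2)

/-- The reduction of a rational number modulo `p` (for `p` not dividing the
denominator this is the usual reduction). -/
def ratRed (p : ℕ) (q : ℚ) : ZMod p := (q.num : ZMod p) * ((q.den : ZMod p))⁻¹

/-- The curve `E(τ) : Y² = X³ + A(τ)X + B(τ)` has good reduction at `p` (for this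
model): `p` divides neither the denominators of `A(τ)`, `B(τ)` nor the
discriminant `Δ(τ)`, i.e. `p ∤ N(τ)`. -/
def goodRed (A B : Polynomial ℤ) (τ : ℚ) (p : ℕ) : Prop :=
  ¬ (p : ℤ) ∣ (evalQ A τ).den ∧ ¬ (p : ℤ) ∣ (evalQ B τ).den ∧
    ratRed p (discQ A B τ) ≠ 0

/-- The number of affine points `(x, y) ∈ 𝔽_p²` on `y² = x³ + a·x + b`. -/
def affinePoints (p : ℕ) (a b : ZMod p) : ℕ :=
  ((Finset.range p ×ˢ Finset.range p).filter fun xy =>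
    (xy.2 : ZMod p) ^ 2 = (xy.1 : ZMod p) ^ 3 + a * (xy.1 : ZMod p) + b).card

/-- The Frobenius trace `a_p(τ) = p + 1 − #E_p(τ)(𝔽_p)` of the reduction mod `p`
of the curve `E(τ) : Y² = X³ + A(τ)X + B(τ)` (the projective point count is the
affine count plus one, for the point at infinity). -/
def apFrob (A B : Polynomial ℤ) (τ : ℚ) (p : ℕ) : ℤ :=
  (p : ℤ) - affinePoints p (ratRed p (evalQ A τ)) (ratRed p (evalQ B τ))

open Classical in
/-- `Π_{E(τ)}(a, x)`: the number of primes `p ≤ x` of good reduction for `E(τ)`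
with `a_p(τ) = a`. -/
noncomputable def PiTrace (A B : Polynomial ℤ) (τ : ℚ) (a : ℤ) (x : ℝ) : ℕ :=
  ((Finset.range (⌊x⌋₊ + 1)).filter fun p =>
    p.Prime ∧ goodRed A B τ p ∧ apFrob A B τ p = a).card

/-- The `j`-invariant `j(t) = −6912·A(t)³/(4A(t)³ + 27B(t)²)` is a non-constant
rational function: for no constant `c ∈ ℚ` does `−6912·A(t)³ = c·(4A(t)³ + 27B(t)²)`
hold identically. -/
def jNonconstant (A B : Polynomial ℤ) : Prop :=
  ∀ c : ℚ, (-6912 : Polynomial ℚ) * (A.map (Int.castRingHom ℚ)) ^ 3 ≠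
    Polynomial.C c *
      (4 * (A.map (Int.castRingHom ℚ)) ^ 3 + 27 * (B.map (Int.castRingHom ℚ)) ^ 2)

open Classical in
/-- `Π_{E(τ)}(𝕂, x)` for the imaginary quadratic field `𝕂 = ℚ(√d)` (with `d` a
squarefree negative integer): the number of primes `p ≤ x` of good reduction for
`E(τ)` with `a_p(τ) ≠ 0` and `ℚ(√(a_p(τ)² − 4p)) = 𝕂`, the latter condition
being equivalent to `(a_p(τ)² − 4p)/d` being the square of a rational. -/
noncomputable def PiField (A B : Polynomial ℤ) (τ : ℚ) (d : ℤ) (x : ℝ) : ℕ :=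
  ((Finset.range (⌊x⌋₊ + 1)).filter fun p =>
    p.Prime ∧ goodRed A B τ p ∧ apFrob A B τ p ≠ 0 ∧
      ∃ r : ℚ, ((apFrob A B τ p : ℚ) ^ 2 - 4 * p) = d * r ^ 2).card

set_option linter.unusedSectionVars false

namespace FrobeniusField

open Polynomial
open scoped Classical

/-- The short Weierstrass curve `Y² = X³ + aX + b`. -/
abbrev SW {K : Type*} [CommRing K] (a b : K) : WeierstrassCurve K := ⟨0, 0, 0, a, b⟩

/-- The group of points of the short Weierstrass curve. -/
abbrev Pt {K : Type*} [CommRing K] (a b : K) : Type _ := WeierstrassCurve.Affine.Point (SW a b)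

section Points

variable {K : Type*} [Field K] {a b : K}

lemma SW_Δ (a b : K) : (SW a b).Δ = -16 * (4 * a ^ 3 + 27 * b ^ 2) := by
  simp only [WeierstrassCurve.Δ, WeierstrassCurve.b₂, WeierstrassCurve.b₄,
    WeierstrassCurve.b₆, WeierstrassCurve.b₈]
  ring

lemma isElliptic_of_ne (h2 : (2 : K) ≠ 0) (h : 4 * a ^ 3 + 27 * b ^ 2 ≠ 0) :
    (SW a b).IsElliptic := by
  rw [WeierstrassCurve.isElliptic_iff, SW_Δ, isUnit_iff_ne_zero]
  have : (-16 : K) = -(2 ^ 4) := by norm_num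
  rw [this]
  exact mul_ne_zero (neg_ne_zero.2 (pow_ne_zero _ h2)) h

lemma disc_ne_zero [h : (SW a b).IsElliptic] : 4 * a ^ 3 + 27 * b ^ 2 ≠ 0 := by
  rw [WeierstrassCurve.isElliptic_iff, SW_Δ, isUnit_iff_ne_zero] at h
  exact right_ne_zero_of_mul h

instance isElliptic_map {K' : Type*} [Field K'] (σ : K →+* K') [h : (SW a b).IsElliptic] :
    (SW (σ a) (σ b)).IsElliptic := by
  rw [WeierstrassCurve.isElliptic_iff, SW_Δ, isUnit_iff_ne_zero] at h ⊢
  have := (map_ne_zero σ).2 h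
  rwa [show -16 * (4 * σ a ^ 3 + 27 * σ b ^ 2) = σ (-16 * (4 * a ^ 3 + 27 * b ^ 2)) by
    simp only [map_mul, map_add, map_pow, map_neg, map_ofNat]]

/-- The `x`-coordinate of a point (zero at the point at infinity). -/
def px : Pt a b → K
  | .zero => 0
  | .some x _ _ => x

/-- The `y`-coordinate of a point (zero at the point at infinity). -/
def py : Pt a b → K
  | .zero => 0
  | .some _ y _ => y

@[simp] lemma px_zero : px (0 : Pt a b) = 0 := rfl
@[simp] lemma py_zero : py (0 : Pt a b) = 0 := rfl

lemma eqn {P : Pt a b} (h : P ≠ 0) : py P ^ 2 = px P ^ 3 + a * px P + b := by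
  rcases P with _ | ⟨x, y, hn⟩
  · exact absurd rfl h
  · have := (WeierstrassCurve.Affine.equation_iff _ _).1 hn.1
    simp only [px, py] at this ⊢
    linear_combination this

lemma pt_ext {P Q : Pt a b} (hP : P ≠ 0) (hQ : Q ≠ 0) (hx : px P = px Q) (hy : py P = py Q) :
    P = Q := by
  rcases P with _ | ⟨x, y, hn⟩
  · exact absurd rfl hP
  rcases Q with _ | ⟨x', y', hn'⟩
  · exact absurd rfl hQ
  simp only [px, py] at hx hy
  subst hx hy; rfl

section mk
variable [(SW a b).IsElliptic]

/-- The affine point with given coordinates. -/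
def mkP (x y : K) (h : y ^ 2 = x ^ 3 + a * x + b) : Pt a b :=
  .some x y ((WeierstrassCurve.Affine.equation_iff_nonsingular).1
    ((WeierstrassCurve.Affine.equation_iff _ _).2 (by simp only; linear_combination h)))

@[simp] lemma px_mkP (x y : K) (h : y ^ 2 = x ^ 3 + a * x + b) : px (mkP x y h) = x := rfl
@[simp] lemma py_mkP (x y : K) (h : y ^ 2 = x ^ 3 + a * x + b) : py (mkP x y h) = y := rfl
lemma mkP_ne_zero (x y : K) (h : y ^ 2 = x ^ 3 + a * x + b) : mkP x y h ≠ (0 : Pt a b) :=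
  WeierstrassCurve.Affine.Point.some_ne_zero _

end mk

@[simp] lemma px_neg (P : Pt a b) : px (-P) = px P := by
  rcases P with _ | ⟨x, y, hn⟩ <;> rfl

@[simp] lemma py_neg (P : Pt a b) : py (-P) = - py P := by
  rcases P with _ | ⟨x, y, hn⟩
  · exact neg_zero.symm
  · rw [WeierstrassCurve.Affine.Point.neg_some]
    simp [py, WeierstrassCurve.Affine.negY]

lemma eq_or_eq_neg {P Q : Pt a b} (hP : P ≠ 0) (hQ : Q ≠ 0) (hx : px P = px Q) :
    P = Q ∨ P = -Q := by
  have h1 := eqn hP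
  have h2 := eqn hQ
  have : (py P - py Q) * (py P + py Q) = 0 := by rw [hx] at h1; linear_combination h1 - h2
  rcases mul_eq_zero.1 this with h | h
  · exact .inl (pt_ext hP hQ hx (sub_eq_zero.1 h))
  · refine .inr (pt_ext hP (neg_ne_zero.2 hQ) (by simpa using hx) ?_)
    rw [py_neg]; linear_combination h

lemma add_ne {P Q : Pt a b} (hx : px P ≠ px Q) : P + Q ≠ 0 := by
  intro h
  apply hx
  rw [eq_neg_of_add_eq_zero_left h, px_neg]

/-- The slope of the chord through two points with distinct `x`-coordinates. -/
noncomputable def slp (P Q : Pt a b) : K := (py P - py Q) / (px P - px Q)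

lemma px_add {P Q : Pt a b} (hP : P ≠ 0) (hQ : Q ≠ 0) (hx : px P ≠ px Q) :
    px (P + Q) = slp P Q ^ 2 - px P - px Q := by
  rcases P with _ | ⟨x, y, hn⟩
  · exact absurd rfl hP
  rcases Q with _ | ⟨x', y', hn'⟩
  · exact absurd rfl hQ
  simp only [px] at hx
  rw [WeierstrassCurve.Affine.Point.add_of_X_ne hx]
  simp only [px, py, slp, WeierstrassCurve.Affine.addX, WeierstrassCurve.Affine.slope_of_X_ne hx]
  ring

lemma py_add {P Q : Pt a b} (hP : P ≠ 0) (hQ : Q ≠ 0) (hx : px P ≠ px Q) :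
    py (P + Q) = slp P Q * (px P - px (P + Q)) - py P := by
  rw [px_add hP hQ hx]
  rcases P with _ | ⟨x, y, hn⟩
  · exact absurd rfl hP
  rcases Q with _ | ⟨x', y', hn'⟩
  · exact absurd rfl hQ
  simp only [px] at hx
  rw [WeierstrassCurve.Affine.Point.add_of_X_ne hx]
  simp only [px, py, slp, WeierstrassCurve.Affine.addY, WeierstrassCurve.Affine.negAddY,
    WeierstrassCurve.Affine.addX, WeierstrassCurve.Affine.negY,
    WeierstrassCurve.Affine.slope_of_X_ne hx]
  ring

lemma add_self_eq_zero_iff {P : Pt a b} (h2 : (2 : K) ≠ 0) : P + P = 0 ↔ py P = 0 := by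
  rw [← eq_neg_iff_add_eq_zero]
  constructor
  · intro h
    have h1 : py P = - py P := by rw [← py_neg, ← h]
    have : 2 * py P = 0 := by linear_combination h1
    exact (mul_eq_zero.1 this).resolve_left h2
  · intro h
    by_cases hP : P = 0
    · simp [hP]
    · exact pt_ext hP (neg_ne_zero.2 hP) (px_neg P).symm (by simp [h])

lemma px_dbl {P : Pt a b} (hP : P ≠ 0) (h2 : (2 : K) ≠ 0) (hy : py P ≠ 0) :
    px (P + P) = ((3 * px P ^ 2 + a) / (2 * py P)) ^ 2 - 2 * px P := by
  rcases P with _ | ⟨x, y, hn⟩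
  · exact absurd rfl hP
  simp only [py] at hy
  have hy' : y ≠ (SW a b).toAffine.negY x y := by
    simp only [WeierstrassCurve.Affine.negY]
    intro h
    have : 2 * y = 0 := by linear_combination h
    exact (mul_ne_zero h2 hy) this
  rw [WeierstrassCurve.Affine.Point.add_self_of_Y_ne hy']
  simp only [px, py, WeierstrassCurve.Affine.addX, WeierstrassCurve.Affine.slope_of_Y_ne rfl hy',
    WeierstrassCurve.Affine.negY]
  have : y - (-y - 0 * x - 0) = 2 * y := by ring
  rw [this]; ring

lemma py_dbl {P : Pt a b} (hP : P ≠ 0) (h2 : (2 : K) ≠ 0) (hy : py P ≠ 0) :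
    py (P + P) = (3 * px P ^ 2 + a) / (2 * py P) * (px P - px (P + P)) - py P := by
  rw [px_dbl hP h2 hy]
  rcases P with _ | ⟨x, y, hn⟩
  · exact absurd rfl hP
  simp only [py] at hy
  have hy' : y ≠ (SW a b).toAffine.negY x y := by
    simp only [WeierstrassCurve.Affine.negY]
    intro h
    have : 2 * y = 0 := by linear_combination h
    exact (mul_ne_zero h2 hy) this
  rw [WeierstrassCurve.Affine.Point.add_self_of_Y_ne hy']
  simp only [px, py, WeierstrassCurve.Affine.addX, WeierstrassCurve.Affine.addY,
    WeierstrassCurve.Affine.negAddY, WeierstrassCurve.Affine.slope_of_Y_ne rfl hy',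
    WeierstrassCurve.Affine.negY]
  have : y - (-y - 0 * x - 0) = 2 * y := by ring
  rw [this]; ring

lemma add_mul_sub_sq {P Q : Pt a b} (hP : P ≠ 0) (hQ : Q ≠ 0) (hx : px P ≠ px Q) :
    px (P + Q) * (px P - px Q) ^ 2 =
      px P ^ 2 * px Q + px P * (px Q ^ 2 + a) + a * px Q + 2 * b - 2 * py P * py Q := by
  rw [px_add hP hQ hx, slp]
  have h : px P - px Q ≠ 0 := sub_ne_zero.2 hx
  field_simp
  linear_combination eqn hP + eqn hQ

end Points

section Map

variable {K K' K'' : Type*} [Field K] [Field K'] [Field K''] {a b : K} {a' b' : K'} {a'' b'' : K''}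

lemma SW_map (σ : K →+* K') (ha : σ a = a') (hb : σ b = b') : (SW a b).map σ = SW a' b' := by
  ext <;> simp [WeierstrassCurve.map, ha, hb]

/-- The homomorphism on points induced by a homomorphism of fields. -/
noncomputable def mapPt (σ : K →+* K') (ha : σ a = a') (hb : σ b = b') : Pt a b →+ Pt a' b' where
  toFun P := match P with
    | .zero => .zero
    | .some x y h => .some (σ x) (σ y) (by
        have := (WeierstrassCurve.Affine.map_nonsingular (SW a b) σ.injective x y).2 h
        rw [← SW_map σ ha hb]
        exact this)
  map_zero' := rfl
  map_add' := by
    subst ha hb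
    have key : ∀ x y, (SW (σ a) (σ b)).toAffine.negY (σ x) (σ y) =
        σ ((SW a b).toAffine.negY x y) := by
      intro x y; simp [WeierstrassCurve.Affine.negY]
    have hs := fun x₁ x₂ y₁ y₂ =>
      WeierstrassCurve.Affine.map_slope (W := SW a b) σ x₁ x₂ y₁ y₂
    simp only [SW_map σ rfl rfl] at hs
    rintro (_ | ⟨x₁, y₁, h₁⟩) (_ | ⟨x₂, y₂, h₂⟩)
    any_goals rfl
    by_cases hxy : x₁ = x₂ ∧ y₁ = (SW a b).toAffine.negY x₂ y₂
    · rw [WeierstrassCurve.Affine.Point.add_of_Y_eq hxy.left hxy.right]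
      dsimp only
      rw [WeierstrassCurve.Affine.Point.add_of_Y_eq (congr_arg _ hxy.left)
        (by rw [hxy.right, key])]
      rfl
    · rw [WeierstrassCurve.Affine.Point.add_some hxy]
      dsimp only
      rw [WeierstrassCurve.Affine.Point.add_some
        (fun h ↦ hxy ⟨σ.injective h.1, σ.injective (by rw [← key]; exact h.2)⟩)]
      congr 1
      · simp [WeierstrassCurve.Affine.addX, hs]
      · simp [WeierstrassCurve.Affine.addY, WeierstrassCurve.Affine.negAddY,
          WeierstrassCurve.Affine.negY, WeierstrassCurve.Affine.addX, hs]

@[simp] lemma px_mapPt (σ : K →+* K') (ha : σ a = a') (hb : σ b = b') (P : Pt a b) :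
    px (mapPt σ ha hb P) = σ (px P) := by
  rcases P with _ | ⟨x, y, h⟩
  · exact (map_zero σ).symm
  · rfl

@[simp] lemma py_mapPt (σ : K →+* K') (ha : σ a = a') (hb : σ b = b') (P : Pt a b) :
    py (mapPt σ ha hb P) = σ (py P) := by
  rcases P with _ | ⟨x, y, h⟩
  · exact (map_zero σ).symm
  · rfl

lemma mapPt_injective (σ : K →+* K') (ha : σ a = a') (hb : σ b = b') :
    Function.Injective (mapPt σ ha hb) := by
  rw [injective_iff_map_eq_zero]
  rintro (_ | ⟨x, y, h⟩) h0
  · rfl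
  · exact absurd h0 (WeierstrassCurve.Affine.Point.some_ne_zero _)

@[simp] lemma mapPt_eq_zero (σ : K →+* K') (ha : σ a = a') (hb : σ b = b') {P : Pt a b} :
    mapPt σ ha hb P = 0 ↔ P = 0 := by
  rw [← map_zero (mapPt σ ha hb), (mapPt_injective σ ha hb).eq_iff]

lemma mapPt_mapPt (σ : K →+* K') (ha : σ a = a') (hb : σ b = b') (ρ : K' →+* K'')
    (ha' : ρ a' = a'') (hb' : ρ b' = b'') (P : Pt a b) :
    mapPt ρ ha' hb' (mapPt σ ha hb P) =
      mapPt (ρ.comp σ) (by simp [ha, ha']) (by simp [hb, hb']) P := by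
  rcases P with _ | ⟨x, y, h⟩ <;> rfl

lemma mapPt_congr {σ ρ : K →+* K'} (h : σ = ρ) (ha : σ a = a') (hb : σ b = b') (P : Pt a b) :
    mapPt σ ha hb P = mapPt ρ (h ▸ ha) (h ▸ hb) P := by
  subst h; rfl

end Map

section AlgClosed

variable {K : Type*} [Field K] {a b : K}

lemma finite_two_torsion (h2 : (2 : K) ≠ 0) : {P : Pt a b | P + P = 0}.Finite := by
  have hp : (X ^ 3 + C a * X + C b : K[X]) ≠ 0 := by
    intro h
    have := congrArg (fun q => coeff q 3) h
    simp at this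
  have hfin := ((X ^ 3 + C a * X + C b : K[X]).roots.toFinset.finite_toSet.prod
    (Set.finite_singleton (0 : K)))
  refine Set.Finite.subset ((Set.finite_singleton (0 : Pt a b)).union
    (Set.Finite.of_finite_image (f := fun P : Pt a b => (px P, py P))
      (s := {P : Pt a b | P ≠ 0 ∧ P + P = 0}) (hfin.subset ?_) ?_)) ?_
  · rintro _ ⟨P, ⟨hP, hP2⟩, rfl⟩
    rw [add_self_eq_zero_iff h2] at hP2
    have := eqn hP
    simp only [Set.mem_prod, Finset.mem_coe, Multiset.mem_toFinset, Set.mem_singleton_iff,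
      mem_roots hp, IsRoot]
    refine ⟨?_, hP2⟩
    rw [hP2] at this
    simp only [eval_add, eval_mul, eval_pow, eval_X, eval_C]
    linear_combination -this
  · rintro P ⟨hP, -⟩ Q ⟨hQ, -⟩ h
    simp only [Prod.mk.injEq] at h
    exact pt_ext hP hQ h.1 h.2
  · intro P hP
    by_cases h : P = 0
    · exact .inl h
    · exact .inr ⟨h, hP⟩

lemma exists_pt_x [IsAlgClosed K] [(SW a b).IsElliptic] (x : K) :
    ∃ P : Pt a b, P ≠ 0 ∧ px P = x := by
  obtain ⟨y, hy⟩ := IsAlgClosed.exists_pow_nat_eq (x ^ 3 + a * x + b) (n := 2) (by norm_num)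
  exact ⟨mkP x y hy, mkP_ne_zero _ _ _, rfl⟩

instance infinite_pt [IsAlgClosed K] [(SW a b).IsElliptic] : Infinite (Pt a b) := by
  have := IsAlgClosed.instInfinite (K := K)
  choose g hg using fun x => exists_pt_x (a := a) (b := b) x
  exact Infinite.of_injective g fun x y h => by rw [← (hg x).2, h, (hg y).2]

/-- A point avoiding a finite set whose double avoids a finite set. -/
lemma exists_generic [IsAlgClosed K] [(SW a b).IsElliptic] (h2 : (2 : K) ≠ 0)
    (S S' : Finset (Pt a b)) : ∃ T : Pt a b, T ∉ S ∧ T + T ∉ S' := by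
  have hfin : ∀ R : Pt a b, {T : Pt a b | T + T = R}.Finite := by
    intro R
    rcases Set.eq_empty_or_nonempty {T : Pt a b | T + T = R} with h | ⟨T0, hT0⟩
    · rw [h]; exact Set.finite_empty
    · refine Set.Finite.subset ((finite_two_torsion (a := a) (b := b) h2).image (T0 + ·)) ?_
      intro T hT
      refine ⟨T - T0, ?_, by simp⟩
      simp only [Set.mem_ofPred_eq] at hT hT0 ⊢
      rw [← sub_eq_zero.2 (hT.trans hT0.symm)]; abel
  have : ((S : Set (Pt a b)) ∪ ⋃ R ∈ S', {T : Pt a b | T + T = R}).Finite :=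
    S.finite_toSet.union (S'.finite_toSet.biUnion fun R _ => hfin R)
  obtain ⟨T, hT⟩ := this.exists_notMem
  refine ⟨T, fun h => hT (.inl h), fun h => hT (.inr ?_)⟩
  simp only [Set.mem_iUnion]
  exact ⟨_, h, rfl⟩

end AlgClosed

/-- A place of a field `F` over a field of constants `k` with residue field `k`:
`Res x c` says that `x` is regular with residue `c`. -/
structure Place {k F : Type*} [Field k] [Field F] (ι : k →+* F) where
  /-- The residue relation. -/
  Res : F → k → Prop
  uniq : ∀ {x c d}, Res x c → Res x d → c = d
  const : ∀ c, Res (ι c) c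
  add : ∀ {x y c d}, Res x c → Res y d → Res (x + y) (c + d)
  mul : ∀ {x y c d}, Res x c → Res y d → Res (x * y) (c * d)
  inv : ∀ {x c}, Res x c → c ≠ 0 → Res x⁻¹ c⁻¹
  total : ∀ x, (∃ c, Res x c) ∨ Res x⁻¹ 0

namespace Place

variable {k F : Type*} [Field k] [Field F] {ι : k →+* F} (pl : Place ι)

lemma neg {x c} (h : pl.Res x c) : pl.Res (-x) (-c) := by
  have := pl.mul (pl.const (-1)) h
  simpa using this

lemma sub {x y c d} (h : pl.Res x c) (h' : pl.Res y d) : pl.Res (x - y) (c - d) := by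
  rw [sub_eq_add_neg, sub_eq_add_neg]; exact pl.add h (pl.neg h')

lemma zero : pl.Res 0 0 := by simpa using pl.const 0
lemma one : pl.Res 1 1 := by simpa using pl.const 1
lemma two : pl.Res 2 2 := by simpa only [map_ofNat] using pl.const 2
lemma three : pl.Res 3 3 := by simpa only [map_ofNat] using pl.const 3

lemma pow {x c} (h : pl.Res x c) (n : ℕ) : pl.Res (x ^ n) (c ^ n) := by
  induction n with
  | zero => simpa using pl.one
  | succ n ih => rw [pow_succ, pow_succ]; exact pl.mul ih h

lemma div {x y c d} (h : pl.Res x c) (h' : pl.Res y d) (hd : d ≠ 0) : pl.Res (x / y) (c / d) := by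
  rw [div_eq_mul_inv, div_eq_mul_inv]; exact pl.mul h (pl.inv h' hd)

lemma sum {α : Type*} (s : Finset α) {f : α → F} {g : α → k} (h : ∀ i ∈ s, pl.Res (f i) (g i)) :
    pl.Res (∑ i ∈ s, f i) (∑ i ∈ s, g i) := by
  induction s using Finset.induction_on with
  | empty => simpa using pl.zero
  | insert i s hi ih =>
    rw [Finset.sum_insert hi, Finset.sum_insert hi]
    exact pl.add (h i (Finset.mem_insert_self i s))
      (ih fun j hj => h j (Finset.mem_insert_of_mem hj))

lemma eval {x c} (h : pl.Res x c) (q : k[X]) : pl.Res (q.eval₂ ι x) (q.eval c) := by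
  induction q using Polynomial.induction_on' with
  | add p q hp hq => rw [eval₂_add, eval_add]; exact pl.add hp hq
  | monomial n r =>
    rw [eval₂_monomial, eval_monomial]; exact pl.mul (pl.const r) (pl.pow h n)

lemma not_res_inv {x c} (hx : x ≠ 0) (h : pl.Res x c) : ¬ pl.Res x⁻¹ 0 := by
  intro h'
  have := pl.mul h h'
  rw [mul_inv_cancel₀ hx, mul_zero] at this
  exact one_ne_zero (pl.uniq pl.one this)

lemma ne_zero_of_res {x c} (h : pl.Res x c) (hc : c ≠ 0) : x ≠ 0 := by
  rintro rfl; exact hc (pl.uniq h pl.zero)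

/-- A square root of a regular element is regular. -/
lemma res_of_sq {y c} (h : pl.Res (y ^ 2) c) : ∃ d, pl.Res y d := by
  rcases pl.total y with h' | h'
  · exact h'
  · by_cases hy : y = 0
    · exact ⟨0, hy ▸ pl.zero⟩
    · exfalso
      have := pl.mul (pl.pow h' 2) h
      rw [inv_pow, inv_mul_cancel₀ (pow_ne_zero _ hy)] at this
      have := pl.uniq this pl.one
      simp at this

variable {a b : k}

/-- The reduction relation on points: `Q` is the reduction of `P`. -/
def Sp (P : Pt (ι a) (ι b)) (Q : Pt a b) : Prop :=
  (P ≠ 0 ∧ Q ≠ 0 ∧ pl.Res (px P) (px Q) ∧ pl.Res (py P) (py Q)) ∨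
    (Q = 0 ∧ (P = 0 ∨ (px P ≠ 0 ∧ pl.Res (px P)⁻¹ 0)))

/-- The constant point of `E(F)` attached to a point of `E(k)`. -/
noncomputable abbrev _root_.FrobeniusField.cst (ι : k →+* F) {a b : k} : Pt a b →+ Pt (ι a) (ι b) :=
  mapPt ι rfl rfl

lemma sp_zero : pl.Sp (0 : Pt (ι a) (ι b)) 0 := .inr ⟨rfl, .inl rfl⟩

lemma sp_cst (T : Pt a b) : pl.Sp (cst ι T) T := by
  by_cases h : T = 0
  · subst h; rw [map_zero]; exact pl.sp_zero
  · exact .inl ⟨by simpa using h, h, by simpa using pl.const _, by simpa using pl.const _⟩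

variable {pl}

lemma Sp.neg {P : Pt (ι a) (ι b)} {Q : Pt a b} (h : pl.Sp P Q) : pl.Sp (-P) (-Q) := by
  rcases h with ⟨h1, h2, h3, h4⟩ | ⟨rfl, rfl | h⟩
  · exact .inl ⟨neg_ne_zero.2 h1, neg_ne_zero.2 h2, by simpa using h3, by simpa using pl.neg h4⟩
  · simpa using pl.sp_zero
  · exact .inr ⟨neg_zero, .inr (by simpa using h)⟩

lemma Sp.unique {P : Pt (ι a) (ι b)} {Q Q' : Pt a b} (h : pl.Sp P Q) (h' : pl.Sp P Q') :
    Q = Q' := by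
  rcases h with ⟨h1, h2, h3, h4⟩ | ⟨h0, h⟩ <;> rcases h' with ⟨g1, g2, g3, g4⟩ | ⟨g0, g⟩
  · exact pt_ext h2 g2 (pl.uniq h3 g3) (pl.uniq h4 g4)
  · rcases g with g | g
    · exact absurd g h1
    · exact absurd g.2 (pl.not_res_inv g.1 h3)
  · rcases h with h | h
    · exact absurd h g1
    · exact absurd h.2 (pl.not_res_inv h.1 g3)
  · rw [h0, g0]

lemma Sp.total [(SW a b).IsElliptic] (P : Pt (ι a) (ι b)) : ∃ Q : Pt a b, pl.Sp P Q := by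
  by_cases hP : P = 0
  · exact ⟨0, .inr ⟨rfl, .inl hP⟩⟩
  · have regular : ∀ c, pl.Res (px P) c → ∃ Q : Pt a b, pl.Sp P Q := by
      intro c hc
      have he := eqn hP
      have h2 : pl.Res (py P ^ 2) (c ^ 3 + a * c + b) := by
        rw [he]
        exact pl.add (pl.add (pl.pow hc 3) (pl.mul (pl.const a) hc)) (pl.const b)
      obtain ⟨d, hd⟩ := pl.res_of_sq h2
      exact ⟨mkP c d (pl.uniq (pl.pow hd 2) h2), .inl ⟨hP, mkP_ne_zero _ _ _, hc, hd⟩⟩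
    rcases pl.total (px P) with ⟨c, hc⟩ | h
    · exact regular c hc
    · by_cases hx : px P = 0
      · exact regular 0 (hx ▸ pl.zero)
      · exact ⟨0, .inr ⟨rfl, .inr ⟨hx, h⟩⟩⟩

lemma Sp.add_of_ne {P Q : Pt (ι a) (ι b)} {P' Q' : Pt a b} (hP : pl.Sp P P') (hQ : pl.Sp Q Q')
    (hP0 : P' ≠ 0) (hQ0 : Q' ≠ 0) (hx : px P' ≠ px Q') : pl.Sp (P + Q) (P' + Q') := by
  rcases hP with ⟨h1, h2, h3, h4⟩ | ⟨rfl, h⟩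
  swap
  · exact absurd rfl hP0
  rcases hQ with ⟨g1, g2, g3, g4⟩ | ⟨rfl, g⟩
  swap
  · exact absurd rfl hQ0
  have hx' : px P ≠ px Q := by
    intro h; rw [h] at h3; exact hx (pl.uniq h3 g3)
  have hs : pl.Res (slp P Q) (slp P' Q') :=
    pl.div (pl.sub h4 g4) (pl.sub h3 g3) (sub_ne_zero.2 hx)
  have hX : pl.Res (px (P + Q)) (px (P' + Q')) := by
    rw [px_add h1 g1 hx', px_add h2 g2 hx]
    exact pl.sub (pl.sub (pl.pow hs 2) h3) g3
  refine .inl ⟨add_ne hx', add_ne hx, hX, ?_⟩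
  rw [py_add h1 g1 hx', py_add h2 g2 hx]
  exact pl.sub (pl.mul hs (pl.sub h3 hX)) h4

lemma Sp.pole_add {P Q : Pt (ι a) (ι b)} {Q' : Pt a b} (hP : pl.Sp P 0) (hQ : pl.Sp Q Q')
    (hQ0 : Q' ≠ 0) : pl.Sp (P + Q) Q' := by
  rcases hP with ⟨_, h2, _⟩ | ⟨-, rfl | ⟨hp, hr⟩⟩
  · exact absurd rfl h2
  · simpa using hQ
  have hQ' := hQ
  rcases hQ' with ⟨g1, g2, g3, g4⟩ | ⟨rfl, g⟩
  swap
  · exact absurd rfl hQ0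
  have hP0 : P ≠ 0 := by rintro rfl; exact hp rfl
  have hx : px P ≠ px Q := fun h => pl.not_res_inv hp (h ▸ g3) hr
  have e1 := eqn hP0
  have e2 := eqn g1
  have hX := px_add hP0 g1 hx
  have hY := py_add hP0 g1 hx
  rw [hX, slp] at hY
  rw [slp] at hX
  obtain ⟨r, hr_def⟩ : ∃ r, r = (px P)⁻¹ := ⟨_, rfl⟩
  have hxr : px P = r⁻¹ := by rw [hr_def, inv_inv]
  have hr0 : r ≠ 0 := by rw [hr_def]; exact inv_ne_zero hp
  rw [← hr_def] at hr
  obtain ⟨w, hw⟩ : ∃ w, w = py P * r ^ 2 := ⟨_, rfl⟩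
  have hyw : py P = w / r ^ 2 := by rw [hw]; field_simp
  have hw2 : w ^ 2 = r + ι a * r ^ 3 + ι b * r ^ 4 := by
    rw [hw, mul_pow, e1, hxr]; field_simp
  have hRw2 : pl.Res (w ^ 2) 0 := by
    rw [hw2]
    have := pl.add (pl.add hr (pl.mul (pl.const a) (pl.pow hr 3)))
      (pl.mul (pl.const b) (pl.pow hr 4))
    simpa using this
  have hRw : pl.Res w 0 := by
    obtain ⟨d, hd⟩ := pl.res_of_sq hRw2
    have := pl.uniq (pl.pow hd 2) hRw2
    rw [pow_eq_zero_iff (by norm_num)] at this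
    exact this ▸ hd
  set x₂ := px Q
  set y₂ := py Q
  have hden : pl.Res (1 - x₂ * r) 1 := by
    have := pl.sub pl.one (pl.mul g3 hr)
    simpa using this
  have hden0 : 1 - x₂ * r ≠ 0 := pl.ne_zero_of_res hden one_ne_zero
  obtain ⟨m, hm⟩ : ∃ m, m = (w - y₂ * r ^ 2) / (1 - x₂ * r) ^ 2 := ⟨_, rfl⟩
  obtain ⟨n, hn⟩ : ∃ n, n = (1 + ι a * r ^ 2 + ι b * r ^ 3 - 2 * y₂ * w * r + y₂ ^ 2 * r ^ 3) /
    (1 - x₂ * r) ^ 3 := ⟨_, rfl⟩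
  obtain ⟨q, hq⟩ : ∃ q, q = r / (1 - x₂ * r) := ⟨_, rfl⟩
  have hRm : pl.Res m 0 := by
    rw [hm]
    have := pl.div (pl.sub hRw (pl.mul g4 (pl.pow hr 2))) (pl.pow hden 2) (by simp)
    simpa using this
  have hRn : pl.Res n 1 := by
    rw [hn]
    have := pl.div (pl.add (pl.sub (pl.add (pl.add pl.one (pl.mul (pl.const a) (pl.pow hr 2)))
      (pl.mul (pl.const b) (pl.pow hr 3))) (pl.mul (pl.mul (pl.mul pl.two g4) hRw) hr))
      (pl.mul (pl.pow g4 2) (pl.pow hr 3))) (pl.pow hden 3) (by simp)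
    simpa using this
  have hRq : pl.Res q 0 := by
    rw [hq]; simpa using pl.div hr hden (by simp)
  have he : px P - x₂ ≠ 0 := sub_ne_zero.2 hx
  have her : px P - x₂ = (1 - x₂ * r) / r := by rw [hxr]; field_simp
  have hm' : (py P - y₂) / (px P - x₂) / (px P - x₂) = m := by
    rw [hm, her, hyw]; field_simp
  have hn' : ((py P - y₂) / (px P - x₂)) ^ 2 / (px P - x₂) = n := by
    rw [hn, her, hyw]
    generalize 1 - x₂ * r = d at hden0
    have hw3 : w ^ 2 / r = 1 + ι a * r ^ 2 + ι b * r ^ 3 := by rw [hw2]; field_simp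
    rw [← hw3]
    field_simp
    ring
  have hq' : 1 / (px P - x₂) = q := by
    rw [hq, her]; field_simp
  have hX' : px (P + Q) = x₂ - 2 * y₂ * m + (3 * x₂ ^ 2 + ι a) * q := by
    rw [hX, ← hm', ← hq']
    field_simp
    linear_combination e1 - e2
  have hY' : py (P + Q) = 2 * y₂ * n - (3 * x₂ ^ 2 + ι a) * m - y₂ := by
    have h1 : py (P + Q) = (py P - y₂) / (px P - x₂) * (x₂ - px (P + Q)) - y₂ := by
      rw [hY, ← hX]; field_simp; ring
    rw [h1, hX', ← hn', ← hm', ← hq']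
    field_simp
    ring
  have hRX : pl.Res (px (P + Q)) (px Q') := by
    rw [hX']
    have := pl.add (pl.sub g3 (pl.mul (pl.mul pl.two g4) hRm))
      (pl.mul (pl.add (pl.mul pl.three (pl.pow g3 2)) (pl.const a)) hRq)
    simpa using this
  have hRY : pl.Res (py (P + Q)) (py Q') := by
    rw [hY']
    have := pl.sub (pl.sub (pl.mul (pl.mul pl.two g4) hRn)
      (pl.mul (pl.add (pl.mul pl.three (pl.pow g3 2)) (pl.const a)) hRm)) g4
    convert this using 1; ring
  exact .inl ⟨add_ne hx, hQ0, hRX, hRY⟩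

section Additive

variable [IsAlgClosed k] [(SW a b).IsElliptic] (h2 : (2 : k) ≠ 0)
include h2

lemma Sp.add_cst_aux {P : Pt (ι a) (ι b)} {P' : Pt a b} (hP : pl.Sp P P') {T : Pt a b}
    (h : P' + T ≠ 0) : pl.Sp (P + cst ι T) (P' + T) := by
  by_cases hP0 : P' = 0
  · subst hP0
    rw [zero_add] at h ⊢
    exact Sp.pole_add hP (pl.sp_cst T) h
  by_cases hT0 : T = 0
  · simpa [hT0] using hP
  obtain ⟨T', hT', hT2⟩ := exists_generic h2 {0, P', -P', T} {T - P'}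
  simp only [Finset.mem_insert, Finset.mem_singleton, not_or] at hT' hT2
  obtain ⟨t0, t1, t2, t3⟩ := hT'
  have key1 : pl.Sp (P + cst ι T') (P' + T') := by
    refine Sp.add_of_ne hP (pl.sp_cst T') hP0 t0 fun hx => ?_
    rcases eq_or_eq_neg hP0 t0 hx with h | h
    · exact t1 h.symm
    · exact t2 (by rw [h, neg_neg])
  have n1 : P' + T' ≠ 0 := fun h => t2 (eq_neg_of_add_eq_zero_right h)
  have n2 : T - T' ≠ 0 := fun h => t3 (sub_eq_zero.1 h).symm
  have key2 : pl.Sp (P + cst ι T' + cst ι (T - T')) (P' + T' + (T - T')) := by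
    refine Sp.add_of_ne key1 (pl.sp_cst _) n1 n2 fun hx => ?_
    rcases eq_or_eq_neg n1 n2 hx with h' | h'
    · exact hT2 (by rw [eq_sub_iff_add_eq] at h' ⊢; rw [← h']; abel)
    · apply h; rw [eq_neg_iff_add_eq_zero] at h'; rw [← h']; abel
  have e1 : P + cst ι T' + cst ι (T - T') = P + cst ι T := by rw [map_sub]; abel
  have e2 : P' + T' + (T - T') = P' + T := by abel
  rwa [e1, e2] at key2

lemma Sp.add_cst {P : Pt (ι a) (ι b)} {P' : Pt a b} (hP : pl.Sp P P') (T : Pt a b) :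
    pl.Sp (P + cst ι T) (P' + T) := by
  by_cases h : P' + T = 0
  swap
  · exact Sp.add_cst_aux h2 hP h
  obtain ⟨S', hS⟩ := Sp.total (pl := pl) (P + cst ι T)
  by_cases hS0 : S' = 0
  · rwa [h, ← hS0]
  exfalso
  obtain ⟨T', hT', -⟩ := exists_generic h2 {0, -S'} ∅
  simp only [Finset.mem_insert, Finset.mem_singleton, not_or] at hT'
  have k1 := Sp.add_cst_aux h2 hS (T := T') fun h => hT'.2 (eq_neg_of_add_eq_zero_right h)
  have k2 := Sp.add_cst_aux h2 hP (T := T + T') (by rw [← add_assoc, h, zero_add]; exact hT'.1)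
  rw [map_add, ← add_assoc] at k2
  have := k1.unique k2
  rw [← add_assoc, h] at this
  exact hS0 (add_right_cancel this)

lemma Sp.add {P Q : Pt (ι a) (ι b)} {P' Q' : Pt a b} (hP : pl.Sp P P') (hQ : pl.Sp Q Q') :
    pl.Sp (P + Q) (P' + Q') := by
  have main : ∀ {Q : Pt (ι a) (ι b)} {Q' : Pt a b}, pl.Sp Q Q' → P' + Q' ≠ 0 →
      pl.Sp (P + Q) (P' + Q') := by
    intro Q Q' hQ h
    obtain ⟨T, hT, hT2⟩ := exists_generic h2 {-P', Q'} {Q' - P'}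
    simp only [Finset.mem_insert, Finset.mem_singleton, not_or] at hT hT2
    have k1 := Sp.add_cst h2 hP T
    have k2 := Sp.add_cst h2 hQ (-T)
    have n1 : P' + T ≠ 0 := fun h => hT.1 (eq_neg_of_add_eq_zero_right h)
    have n2 : Q' + -T ≠ 0 := fun h => hT.2 (by rw [← sub_eq_add_neg, sub_eq_zero] at h; exact h.symm)
    have k3 := Sp.add_of_ne k1 k2 n1 n2 fun hx => by
      rcases eq_or_eq_neg n1 n2 hx with h' | h'
      · exact hT2 (by rw [← sub_eq_add_neg, eq_sub_iff_add_eq] at h'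
                      rw [eq_sub_iff_add_eq, ← h']; abel)
      · apply h; rw [eq_neg_iff_add_eq_zero] at h'; rw [← h']; abel
    have e1 : P + cst ι T + (Q + cst ι (-T)) = P + Q := by rw [map_neg]; abel
    have e2 : P' + T + (Q' + -T) = P' + Q' := by abel
    rwa [e1, e2] at k3
  by_cases h : P' + Q' = 0
  swap
  · exact main hQ h
  obtain ⟨T, hT, -⟩ := exists_generic (a := a) (b := b) h2 {0} ∅
  rw [Finset.mem_singleton] at hT
  have k1 := main (Sp.add_cst h2 hQ T) (by rw [← add_assoc, h, zero_add]; exact hT)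
  have k2 := Sp.add_cst h2 k1 (-T)
  have e1 : P + (Q + cst ι T) + cst ι (-T) = P + Q := by rw [map_neg]; abel
  have e2 : P' + (Q' + T) + -T = P' + Q' := by abel
  rwa [e1, e2] at k2

end Additive

end Place

section FunctionField

variable {k : Type*} [Field k]

/-- The cubic `X³ + aX + b`. -/
noncomputable def fpoly (a b : k) : k[X] := X ^ 3 + C a * X + C b

lemma fpoly_natDegree (a b : k) : (fpoly a b).natDegree = 3 := by
  unfold fpoly; compute_degree!

lemma fpoly_monic (a b : k) : (fpoly a b).Monic := by
  unfold fpoly; monicity!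

lemma fpoly_ne_zero (a b : k) : fpoly a b ≠ 0 := (fpoly_monic a b).ne_zero

lemma not_sq_fpoly (a b : k) (r : RatFunc k) : r ^ 2 ≠ algebraMap k[X] (RatFunc k) (fpoly a b) := by
  intro h
  have hf : algebraMap k[X] (RatFunc k) (fpoly a b) ≠ 0 := by
    simpa using fpoly_ne_zero a b
  have hr : r ≠ 0 := by rintro rfl; apply hf; rw [← h]; simp
  have := congrArg RatFunc.intDegree h
  rw [pow_two, RatFunc.intDegree_mul hr hr, RatFunc.intDegree_polynomial, fpoly_natDegree] at this
  omega

variable (a b : k)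

/-- The defining polynomial of the function field over `k(X)`. -/
noncomputable abbrev defPoly : (RatFunc k)[X] := X ^ 2 - C (algebraMap k[X] (RatFunc k) (fpoly a b))

instance : Fact (Irreducible (defPoly a b)) :=
  ⟨X_pow_sub_C_irreducible_of_prime Nat.prime_two (not_sq_fpoly a b)⟩

/-- The function field of the curve `Y² = X³ + aX + b`. -/
abbrev FF : Type _ := AdjoinRoot (defPoly a b)

/-- The embedding of `k(X)` in the function field. -/
noncomputable def emb : RatFunc k →+* FF a b := AdjoinRoot.of _

/-- The embedding of the constants in the function field. -/
noncomputable def io : k →+* FF a b := (emb a b).comp (RatFunc.C)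

/-- The `x`-coordinate function. -/
noncomputable def xx : FF a b := emb a b RatFunc.X

/-- The `y`-coordinate function. -/
noncomputable def yy : FF a b := AdjoinRoot.root _

variable {a b}

lemma emb_poly (q : k[X]) : emb a b (algebraMap k[X] (RatFunc k) q) = q.eval₂ (io a b) (xx a b) := by
  induction q using Polynomial.induction_on' with
  | add p q hp hq => simp [hp, hq, eval₂_add]
  | monomial n r =>
    rw [eval₂_monomial, ← C_mul_X_pow_eq_monomial]
    simp [io, xx]

lemma eval₂_fpoly {R : Type*} [CommRing R] (φ : k →+* R) (x : R) :
    (fpoly a b).eval₂ φ x = x ^ 3 + φ a * x + φ b := by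
  simp [fpoly, eval₂_add, eval₂_mul, eval₂_pow]

lemma yy_sq : yy a b ^ 2 = xx a b ^ 3 + io a b a * xx a b + io a b b := by
  have h : (defPoly a b).eval₂ (AdjoinRoot.of _) (AdjoinRoot.root (defPoly a b)) = 0 :=
    AdjoinRoot.eval₂_root _
  rw [eval₂_sub, eval₂_pow, eval₂_X, eval₂_C, sub_eq_zero] at h
  have h' : yy a b ^ 2 = emb a b (algebraMap k[X] (RatFunc k) (fpoly a b)) := h
  rw [h', emb_poly, eval₂_fpoly]

lemma exists_repr (ξ : FF a b) : ∃ A B : RatFunc k, ξ = emb a b A + emb a b B * yy a b := by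
  obtain ⟨g, rfl⟩ := AdjoinRoot.mk_surjective ξ
  have hm : (defPoly a b).Monic := monic_X_pow_sub_C _ (by norm_num)
  have h : AdjoinRoot.mk (defPoly a b) g = AdjoinRoot.mk _ (g %ₘ defPoly a b) := by
    rw [AdjoinRoot.mk_eq_mk]
    exact ⟨g /ₘ defPoly a b, by rw [sub_eq_iff_eq_add', modByMonic_add_div]⟩
  have hd : (g %ₘ defPoly a b).natDegree ≤ 1 := by
    have := natDegree_modByMonic_lt g hm (by
      intro h; have := congrArg natDegree h; simp at this)
    rw [natDegree_X_pow_sub_C] at this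
    omega
  obtain ⟨B, A, hBA⟩ := exists_eq_X_add_C_of_natDegree_le_one hd
  refine ⟨A, B, ?_⟩
  rw [h, hBA, map_add, map_mul, AdjoinRoot.mk_C, AdjoinRoot.mk_C, AdjoinRoot.mk_X, add_comm]
  rfl

lemma emb_injective : Function.Injective (emb a b) := (emb a b).injective

lemma yy_notMem (r : RatFunc k) : emb a b r ≠ yy a b := by
  intro h
  apply not_sq_fpoly a b r
  apply emb_injective (a := a) (b := b)
  rw [map_pow, h, yy_sq, emb_poly, eval₂_fpoly]

lemma repr_unique {A B A' B' : RatFunc k}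
    (h : emb a b A + emb a b B * yy a b = emb a b A' + emb a b B' * yy a b) : A = A' ∧ B = B' := by
  have hB : B = B' := by
    by_contra hB
    have hB' : emb a b (B - B') ≠ 0 := by
      rw [Ne, map_eq_zero]; exact sub_ne_zero.2 hB
    apply yy_notMem (a := a) (b := b) ((A' - A) / (B - B'))
    rw [map_div₀, div_eq_iff hB']
    simp only [map_sub]
    linear_combination -h
  subst hB
  exact ⟨emb_injective (add_right_cancel h), rfl⟩

/-- Ring homomorphisms out of the function field, given the images of the coordinates. -/
theorem exists_hom [IsAlgClosed k] {R : Type*} [CommRing R] (φ : k →+* R) (x y : R)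
    (hx : ∀ c, IsUnit (x - φ c)) (h : y ^ 2 = x ^ 3 + φ a * x + φ b) :
    ∃ θ : FF a b →+* R, (∀ c, θ (io a b c) = φ c) ∧ θ (xx a b) = x ∧ θ (yy a b) = y := by
  have hu : ∀ q : nonZeroDivisors k[X], IsUnit (eval₂RingHom φ x q) := by
    rintro ⟨q, hq⟩
    have hq0 := nonZeroDivisors.ne_zero hq
    obtain ⟨s, hs⟩ : ∃ s : Multiset k, q = C q.leadingCoeff * (s.map fun c => X - C c).prod :=
      ⟨q.roots, ((IsAlgClosed.splits q).eq_prod_roots)⟩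
    change IsUnit (eval₂RingHom φ x q)
    rw [hs]
    simp only [coe_eval₂RingHom, eval₂_mul, eval₂_C]
    refine ((leadingCoeff_ne_zero.2 hq0).isUnit.map φ).mul ?_
    clear hs
    induction s using Multiset.induction_on with
    | empty => simp
    | cons c s ih =>
      rw [Multiset.map_cons, Multiset.prod_cons, eval₂_mul]
      refine IsUnit.mul ?_ ih
      simpa using hx c
  let θ₀ : RatFunc k →+* R := IsLocalization.lift hu
  have h0 : ∀ q : k[X], θ₀ (algebraMap k[X] (RatFunc k) q) = q.eval₂ φ x := fun q =>
    IsLocalization.lift_eq hu q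
  have hroot : (defPoly a b).eval₂ θ₀ y = 0 := by
    rw [eval₂_sub, eval₂_pow, eval₂_X, eval₂_C, h0, eval₂_fpoly, h, sub_self]
  refine ⟨AdjoinRoot.lift θ₀ y hroot, fun c => ?_, ?_, ?_⟩
  · have : io a b c = AdjoinRoot.of (defPoly a b) (RatFunc.C c) := rfl
    rw [this, AdjoinRoot.lift_of, ← RatFunc.algebraMap_C, h0, eval₂_C]
  · have : xx a b = AdjoinRoot.of (defPoly a b) RatFunc.X := rfl
    rw [this, AdjoinRoot.lift_of, ← RatFunc.algebraMap_X, h0, eval₂_X]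
  · exact AdjoinRoot.lift_root hroot

theorem hom_ext {R : Type*} [CommRing R] {θ θ' : FF a b →+* R}
    (h : ∀ c, θ (io a b c) = θ' (io a b c)) (hx : θ (xx a b) = θ' (xx a b))
    (hy : θ (yy a b) = θ' (yy a b)) : θ = θ' := by
  have hK : θ.comp (emb a b) = θ'.comp (emb a b) := by
    apply IsLocalization.ringHom_ext (nonZeroDivisors k[X])
    refine Polynomial.ringHom_ext (fun c => ?_) ?_
    · simpa [io] using h c
    · simpa [xx] using hx
  refine RingHom.ext fun ξ => ?_
  obtain ⟨A, B, rfl⟩ := exists_repr ξ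
  have hA := fun A => RingHom.congr_fun hK A
  simp only [RingHom.comp_apply] at hA
  rw [map_add, map_mul, map_add, map_mul, hA, hA, hy]

end FunctionField

/-- Additive maps satisfying the Leibniz rule. -/
structure Der (F : Type*) [Field F] where
  /-- the underlying additive map -/
  f : F →+ F
  leib : ∀ x y, f (x * y) = x * f y + y * f x

instance (F : Type*) [Field F] : CoeFun (Der F) (fun _ => F → F) := ⟨fun D => D.f⟩

section Derivation

variable {k : Type*} [Field k] [IsAlgClosed k] {a b : k}

lemma xx_ne_io (c : k) : xx a b ≠ io a b c := by
  intro h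
  have h1 : (RatFunc.X : RatFunc k) = RatFunc.C c := emb_injective (a := a) (b := b) h
  rw [← RatFunc.algebraMap_X, ← RatFunc.algebraMap_C] at h1
  exact X_ne_C c (RatFunc.algebraMap_injective k h1)

lemma yy_ne_zero : yy a b ≠ 0 := by
  have := yy_notMem (a := a) (b := b) 0
  rw [map_zero] at this; exact this.symm

/-- The invariant derivation of the function field: `D x = y`. -/
theorem exists_derivation (h2 : (2 : k) ≠ 0) : ∃ D : Der (FF a b),
    (∀ c, D (io a b c) = 0) ∧ D (xx a b) = yy a b ∧
      2 * D (yy a b) = 3 * xx a b ^ 2 + io a b a := by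
  have h2' : (2 : FF a b) ≠ 0 := by
    have := (map_ne_zero (io a b)).2 h2
    simpa only [map_ofNat] using this
  obtain ⟨e, he⟩ : ∃ e : FF a b, 2 * e = 1 := ⟨2⁻¹, mul_inv_cancel₀ h2'⟩
  let φ : k →+* TrivSqZeroExt (FF a b) (FF a b) :=
    (TrivSqZeroExt.inlHom (FF a b) (FF a b)).comp (io a b)
  have hφ : ∀ c, φ c = TrivSqZeroExt.inl (io a b c) := fun c => rfl
  obtain ⟨Ψ, h0, hx, hy⟩ := exists_hom (a := a) (b := b) φ
    (TrivSqZeroExt.inl (xx a b) + TrivSqZeroExt.inr (yy a b))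
    (TrivSqZeroExt.inl (yy a b) + TrivSqZeroExt.inr ((3 * xx a b ^ 2 + io a b a) * e))
    (by
      intro c
      rw [TrivSqZeroExt.isUnit_iff_isUnit_fst, hφ]
      have : (TrivSqZeroExt.inl (xx a b) + TrivSqZeroExt.inr (yy a b) -
        TrivSqZeroExt.inl (io a b c) : TrivSqZeroExt (FF a b) (FF a b)).fst = xx a b - io a b c := by
        simp
      rw [this]
      exact isUnit_iff_ne_zero.2 (sub_ne_zero.2 (xx_ne_io c)))
    (by
      rw [hφ, hφ]
      ext
      · simpa [pow_succ] using yy_sq (a := a) (b := b)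
      · simp [pow_succ]
        linear_combination (yy a b * (3 * xx a b ^ 2 + io a b a)) * he)
  let fs : TrivSqZeroExt (FF a b) (FF a b) →+* FF a b :=
    { toFun := TrivSqZeroExt.fst, map_one' := rfl, map_mul' := fun _ _ => rfl, map_zero' := rfl
      map_add' := fun _ _ => rfl }
  have hfst : fs.comp Ψ = RingHom.id _ := by
    refine hom_ext (fun c => ?_) ?_ ?_
    · change (Ψ (io a b c)).fst = _
      rw [h0, hφ]; simp
    · change (Ψ (xx a b)).fst = _
      rw [hx]; simp
    · change (Ψ (yy a b)).fst = _
      rw [hy]; simp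
  have hf : ∀ ξ, (Ψ ξ).fst = ξ := fun ξ => RingHom.congr_fun hfst ξ
  let D₀ : FF a b →+ FF a b :=
    { toFun := fun ξ => (Ψ ξ).snd, map_zero' := by simp, map_add' := by simp }
  refine ⟨⟨D₀, fun ξ η => ?_⟩, fun c => ?_, ?_, ?_⟩
  · change (Ψ (ξ * η)).snd = ξ * (Ψ η).snd + η * (Ψ ξ).snd
    rw [map_mul, TrivSqZeroExt.snd_mul, hf, hf]
    simp [mul_comm]
  · change (Ψ (io a b c)).snd = 0
    rw [h0, hφ]; simp
  · change (Ψ (xx a b)).snd = _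
    rw [hx]; simp
  · change 2 * (Ψ (yy a b)).snd = _
    rw [hy]; simp
    linear_combination (3 * xx a b ^ 2 + io a b a) * he

/-- The involution `y ↦ -y` of the function field. -/
theorem exists_conj : ∃ σ : FF a b →+* FF a b, (∀ c, σ (io a b c) = io a b c) ∧
    σ (xx a b) = xx a b ∧ σ (yy a b) = - yy a b :=
  exists_hom (io a b) (xx a b) (-yy a b)
    (fun c => isUnit_iff_ne_zero.2 (sub_ne_zero.2 (xx_ne_io c))) (by rw [neg_sq, yy_sq])

/-- The involution `y ↦ -y` of the function field. -/
noncomputable def cj : FF a b →+* FF a b := exists_conj.choose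

lemma cj_io (c : k) : cj (io a b c) = io a b c := exists_conj.choose_spec.1 c
lemma cj_xx : cj (xx a b) = xx a b := exists_conj.choose_spec.2.1
lemma cj_yy : cj (yy a b) = - yy a b := exists_conj.choose_spec.2.2

lemma cj_emb (r : RatFunc k) : cj (emb a b r) = emb a b r := by
  have : (cj (a := a) (b := b)).comp (emb a b) = emb a b := by
    apply IsLocalization.ringHom_ext (nonZeroDivisors k[X])
    refine Polynomial.ringHom_ext (fun c => ?_) ?_
    · simpa [io] using cj_io (a := a) (b := b) c
    · simpa [xx] using cj_xx (a := a) (b := b)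
  exact RingHom.congr_fun this r

variable [(SW a b).IsElliptic]

/-- The generic point. -/
noncomputable def gam : Pt (io a b a) (io a b b) := mkP (xx a b) (yy a b) yy_sq

@[simp] lemma px_gam : px (gam (a := a) (b := b)) = xx a b := rfl
@[simp] lemma py_gam : py (gam (a := a) (b := b)) = yy a b := rfl
lemma gam_ne_zero : gam (a := a) (b := b) ≠ 0 := mkP_ne_zero _ _ _

/-- The specialization of the function field at a nonconstant point. -/
theorem exists_theta {F : Type*} [Field F] (φ : k →+* F) (u : Pt (φ a) (φ b)) (hu : u ≠ 0)
    (hx : ∀ c, px u ≠ φ c) :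
    ∃ θ : FF a b →+* F, (∀ c, θ (io a b c) = φ c) ∧ θ (xx a b) = px u ∧ θ (yy a b) = py u :=
  exists_hom φ _ _ (fun c => isUnit_iff_ne_zero.2 (sub_ne_zero.2 (hx c))) (eqn hu)

end Derivation

section PlaceAtInfinity

variable {k : Type*} [Field k]

/-- A square root of a power series with constant coefficient one. -/
lemma exists_sqrt_powerSeries (h2 : (2 : k) ≠ 0) (c : PowerSeries k)
    (hc : PowerSeries.constantCoeff c = 1) :
    ∃ s : PowerSeries k, s ^ 2 = c ∧ PowerSeries.constantCoeff s = 1 := by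
  let S : ℕ → k := fun n => Nat.strongRec (motive := fun _ => k) (fun n ih =>
    if n = 0 then 1 else (PowerSeries.coeff n c -
      ∑ i : Fin n, if h : i.1 ≠ 0 then ih i.1 i.2 * ih (n - i.1) (by have := i.2; omega) else 0) / 2) n
  have hS : ∀ n, S n = if n = 0 then 1 else (PowerSeries.coeff n c -
      ∑ i : Fin n, if i.1 ≠ 0 then S i.1 * S (n - i.1) else 0) / 2 := by
    intro n
    change Nat.strongRec (motive := fun _ => k) _ n = _
    rw [Nat.strongRec_eq]
    rfl
  refine ⟨PowerSeries.mk S, ?_, ?_⟩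
  · ext n
    rw [pow_two, PowerSeries.coeff_mul, Finset.Nat.sum_antidiagonal_eq_sum_range_succ_mk]
    simp only [PowerSeries.coeff_mk]
    have h0 : S 0 = 1 := by rw [hS]; simp
    rcases Nat.eq_zero_or_pos n with rfl | hn
    · simp [h0, hc]
    · rw [Finset.sum_range_succ, Nat.sub_self, h0]
      have hn' := hS n
      rw [if_neg hn.ne', Finset.sum_fin_eq_sum_range] at hn'
      have hsum : ∑ i ∈ Finset.range n, S i * S (n - i) = S n +
          ∑ i ∈ Finset.range n, (if h : i < n then (if i ≠ 0 then S i * S (n - i) else 0) else 0) := by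
        obtain ⟨m, rfl⟩ : ∃ m, n = m + 1 := ⟨n - 1, by omega⟩
        rw [Finset.sum_range_succ', Finset.sum_range_succ' _ m]
        simp only [h0, Nat.sub_zero, one_mul]
        rw [add_comm]
        congr 1
        simp only [ne_eq, not_true_eq_false, if_false, dite_eq_ite, ite_self, add_zero]
        refine Finset.sum_congr rfl fun i hi => ?_
        rw [Finset.mem_range] at hi
        rw [if_pos (by omega), if_pos (by omega)]
      rw [hsum]
      rw [eq_div_iff h2] at hn'
      linear_combination hn'
  · rw [← PowerSeries.coeff_zero_eq_constantCoeff_apply, PowerSeries.coeff_mk, hS]; simp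

open scoped LaurentSeries PowerSeries

/-- The place of the field of Laurent series. -/
theorem exists_laurent_place : ∃ pl : Place (HahnSeries.C : k →+* k⸨X⸩),
    ∀ s : k⟦X⟧, pl.Res (s : k⸨X⸩) (PowerSeries.constantCoeff s) := by
  have hinj : Function.Injective (HahnSeries.ofPowerSeries ℤ k) :=
    HahnSeries.ofPowerSeries_injective
  refine ⟨
    { Res := fun x c => ∃ s : k⟦X⟧, HahnSeries.ofPowerSeries ℤ k s = x ∧
        PowerSeries.constantCoeff s = c
      uniq := ?_, const := ?_, add := ?_, mul := ?_, inv := ?_, total := ?_ }, fun s => ⟨s, rfl, rfl⟩⟩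
  · rintro x c d ⟨s, rfl, rfl⟩ ⟨t, h, rfl⟩
    rw [hinj h]
  · intro c
    exact ⟨PowerSeries.C c, by simp, by simp⟩
  · rintro x y c d ⟨s, rfl, rfl⟩ ⟨t, rfl, rfl⟩
    exact ⟨s + t, by simp, by simp⟩
  · rintro x y c d ⟨s, rfl, rfl⟩ ⟨t, rfl, rfl⟩
    exact ⟨s * t, by simp, by simp⟩
  · rintro x c ⟨s, rfl, rfl⟩ hc
    refine ⟨s⁻¹, ?_, by simp⟩
    apply eq_inv_of_mul_eq_one_left
    rw [← map_mul, PowerSeries.inv_mul_cancel s hc, map_one]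
  · intro x
    rcases le_or_gt 0 x.order with hx | hx
    · left
      obtain ⟨n, hn⟩ := Int.eq_ofNat_of_zero_le hx
      refine ⟨_, PowerSeries.X ^ n * (LaurentSeries.powerSeriesPart x), ?_, rfl⟩
      exact LaurentSeries.X_order_mul_powerSeriesPart hn.symm
    · right
      have hx0 : x ≠ 0 := by rintro rfl; simp at hx
      obtain ⟨n, hn⟩ : ∃ n : ℕ, -x.order = n := Int.eq_ofNat_of_zero_le (by omega)
      have h := LaurentSeries.ofPowerSeries_powerSeriesPart x
      have hc : PowerSeries.constantCoeff (LaurentSeries.powerSeriesPart x) ≠ 0 := by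
        rw [← PowerSeries.coeff_zero_eq_constantCoeff_apply, LaurentSeries.powerSeriesPart_coeff]
        simpa using HahnSeries.coeff_order_eq_zero.not.2 hx0
      have hn0 : n ≠ 0 := by omega
      refine ⟨PowerSeries.X ^ n * ((LaurentSeries.powerSeriesPart x))⁻¹, ?_, by simp [hn0]⟩
      apply eq_inv_of_mul_eq_one_left
      have h1 : x = HahnSeries.single (x.order) 1 * HahnSeries.ofPowerSeries ℤ k (LaurentSeries.powerSeriesPart x) :=
        (LaurentSeries.single_order_mul_powerSeriesPart x).symm
      have h2 : HahnSeries.ofPowerSeries ℤ k (PowerSeries.X ^ n) = HahnSeries.single (-x.order) 1 := by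
        rw [HahnSeries.ofPowerSeries_X_pow, hn]
      have h3 : HahnSeries.single (-x.order) (1 : k) * HahnSeries.single x.order 1 = 1 := by
        rw [HahnSeries.single_mul_single]; simp
      have h4 : HahnSeries.ofPowerSeries ℤ k ((LaurentSeries.powerSeriesPart x))⁻¹ *
          HahnSeries.ofPowerSeries ℤ k (LaurentSeries.powerSeriesPart x) = 1 := by
        rw [← map_mul, PowerSeries.inv_mul_cancel _ hc, map_one]
      rw [map_mul, h2]
      generalize HahnSeries.ofPowerSeries ℤ k (LaurentSeries.powerSeriesPart x) = u at *
      generalize HahnSeries.ofPowerSeries ℤ k (LaurentSeries.powerSeriesPart x)⁻¹ = v at *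
      generalize HahnSeries.single (-x.order) (1 : k) = s at *
      generalize HahnSeries.single x.order (1 : k) = t at *
      rw [h1]
      linear_combination (v * u) * h3 + h4

/-- Places pull back along field homomorphisms. -/
def Place.pull {k F G : Type*} [Field k] [Field F] [Field G] {ι : k →+* F} {κ : k →+* G}
    (pl : Place κ) (θ : F →+* G) (h : ∀ c, θ (ι c) = κ c) : Place ι where
  Res x c := pl.Res (θ x) c
  uniq h h' := pl.uniq h h'
  const c := by rw [h]; exact pl.const c
  add h h' := by rw [map_add]; exact pl.add h h'
  mul h h' := by rw [map_mul]; exact pl.mul h h'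
  inv h h' := by rw [map_inv₀]; exact pl.inv h h'
  total x := by rw [map_inv₀]; exact pl.total (θ x)

/-- The place at infinity of the function field. -/
theorem exists_place [IsAlgClosed k] {a b : k} (h2 : (2 : k) ≠ 0) :
    ∃ pl : Place (io a b), pl.Res (xx a b)⁻¹ 0 := by
  obtain ⟨s, hs, -⟩ := exists_sqrt_powerSeries h2
    (1 + PowerSeries.C a * PowerSeries.X ^ 4 + PowerSeries.C b * PowerSeries.X ^ 6) (by simp)
  obtain ⟨pl, hpl⟩ := exists_laurent_place (k := k)
  have hs' := congrArg (HahnSeries.ofPowerSeries ℤ k) hs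
  simp only [map_add, map_mul, map_pow, map_one, HahnSeries.ofPowerSeries_C,
    HahnSeries.ofPowerSeries_X] at hs'
  set z : k⸨X⸩ := HahnSeries.single 1 1 with hz
  have hz0 : z ≠ 0 := by rw [hz]; exact HahnSeries.single_ne_zero one_ne_zero
  have hzr : pl.Res z 0 := by
    have := hpl PowerSeries.X
    simpa [HahnSeries.ofPowerSeries_X] using this
  have hne : ∀ c : k, (z ^ 2)⁻¹ ≠ (HahnSeries.C : k →+* k⸨X⸩) c := by
    intro c hc
    have h1 : z ^ 2 * (HahnSeries.C : k →+* k⸨X⸩) c = 1 := by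
      rw [← hc, mul_inv_cancel₀ (pow_ne_zero 2 hz0)]
    have := pl.mul (pl.pow hzr 2) (pl.const c)
    rw [h1] at this
    have := pl.uniq this pl.one
    simp at this
  obtain ⟨θ, hθ, hx, hy⟩ := exists_hom (a := a) (b := b) (HahnSeries.C : k →+* k⸨X⸩) (z ^ 2)⁻¹
    ((z ^ 3)⁻¹ * HahnSeries.ofPowerSeries ℤ k s)
    (fun c => isUnit_iff_ne_zero.2 (sub_ne_zero.2 (hne c))) (by
      rw [mul_pow, hs']
      field_simp)
  refine ⟨pl.pull θ hθ, ?_⟩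
  change pl.Res (θ (xx a b)⁻¹) 0
  rw [map_inv₀, hx, inv_inv]
  simpa using pl.pow hzr 2

end PlaceAtInfinity

namespace Der

variable {F : Type*} [Field F] (D : Der F)

lemma sq (x : F) : D (x ^ 2) = 2 * x * D x := by rw [pow_two, D.leib]; ring
lemma cube (x : F) : D (x ^ 3) = 3 * x ^ 2 * D x := by rw [pow_succ, D.leib, D.sq]; ring

lemma one : D 1 = 0 := by
  have := D.leib 1 1
  simp only [one_mul] at this
  simpa using this

lemma div {x y z : F} (h : z * y = x) : D z * y = D x - z * D y := by
  rw [← h, D.leib]; ring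

variable {k : Type*} [Field k] (ι : k →+* F)

lemma const_mul (hD : ∀ c, D (ι c) = 0) (c : k) (x : F) : D (ι c * x) = ι c * D x := by
  rw [D.leib, hD]; ring

lemma pow (x : F) (n : ℕ) : D (x ^ n) = n * x ^ (n - 1) * D x := by
  induction n with
  | zero => simp [one]
  | succ n ih =>
    rw [pow_succ, D.leib, ih]
    rcases n with _ | n
    · simp
    · simp only [Nat.add_sub_cancel]; push_cast; ring

lemma eval₂ (hD : ∀ c, D (ι c) = 0) (q : k[X]) (x : F) :
    D (q.eval₂ ι x) = q.derivative.eval₂ ι x * D x := by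
  induction q using Polynomial.induction_on' with
  | add p q hp hq => simp only [eval₂_add, map_add, hp, hq]; ring
  | monomial n r =>
    rw [derivative_monomial, eval₂_monomial, eval₂_monomial, D.const_mul ι hD, D.pow]
    simp only [map_mul, map_natCast]; ring

end Der

section LogDerivative

variable {F : Type*} [Field F] {k : Type*} [Field k] {ι : k →+* F} {D : Der F}
  {a b : k}

/-- The logarithmic derivative of a point with respect to the invariant differential. -/
noncomputable def lg (D : Der F) (P : Pt (ι a) (ι b)) : F := D (px P) / py P

lemma lg_zero : lg D (0 : Pt (ι a) (ι b)) = 0 := by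
  have : px (0 : Pt (ι a) (ι b)) = 0 := rfl
  rw [lg, this, map_zero, zero_div]

variable (hD : ∀ c, D (ι c) = 0)
include hD

lemma two_mul_py (P : Pt (ι a) (ι b)) : 2 * py P * D (py P) = (3 * px P ^ 2 + ι a) * D (px P) := by
  by_cases hP : P = 0
  · subst hP
    have : px (0 : Pt (ι a) (ι b)) = 0 := rfl
    have h' : py (0 : Pt (ι a) (ι b)) = 0 := rfl
    rw [this, h', map_zero]; ring
  have h := congrArg D (eqn hP)
  rw [D.sq, map_add, map_add, D.cube, D.const_mul ι hD, hD] at h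
  linear_combination h

lemma lg_cst (T : Pt a b) : lg D (cst ι T) = 0 := by
  have : px (cst ι T) = ι (px T) := by simp [cst]
  rw [lg, this, hD, zero_div]

lemma lg_neg (P : Pt (ι a) (ι b)) : lg D (-P) = - lg D P := by
  rw [lg, lg, px_neg, py_neg, div_neg]

variable [(SW a b).IsElliptic] (h2 : (2 : F) ≠ 0)
include h2

omit hD h2 in
lemma deriv_ne_zero {P : Pt (ι a) (ι b)} (hP : P ≠ 0) (hy : py P = 0) : 3 * px P ^ 2 + ι a ≠ 0 := by
  intro h
  have hd := disc_ne_zero (a := ι a) (b := ι b)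
  have he := eqn hP
  rw [hy] at he
  apply hd
  linear_combination (4 * (3 * px P ^ 2 + ι a) ^ 2 - 9 * (3 * px P ^ 2 + ι a) * px P ^ 2) * h -
    (27 * (px P ^ 3 + ι a * px P + ι b) + 108 * px P ^ 3 - 54 * (3 * px P ^ 2 + ι a) * px P) * he

lemma lg_spec {P : Pt (ι a) (ι b)} (hP : P ≠ 0) :
    D (px P) = lg D P * py P ∧ 2 * D (py P) = (3 * px P ^ 2 + ι a) * lg D P := by
  have h := two_mul_py hD P
  by_cases hy : py P = 0
  · have h' := deriv_ne_zero hP hy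
    rw [hy, mul_zero, zero_mul] at h
    have hx : D (px P) = 0 := (mul_eq_zero.1 h.symm).resolve_left h'
    rw [lg, hy, hx, map_zero]; simp
  · have hl : D (px P) = lg D P * py P := by rw [lg, div_mul_cancel₀ _ hy]
    refine ⟨hl, mul_left_cancel₀ hy ?_⟩
    rw [hl] at h
    linear_combination h

lemma lg_eq {P : Pt (ι a) (ι b)} (hP : P ≠ 0) {l : F} (h : D (px P) = l * py P)
    (h' : 2 * D (py P) = (3 * px P ^ 2 + ι a) * l) : lg D P = l := by
  by_cases hy : py P = 0
  · have hd := deriv_ne_zero hP hy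
    rw [hy, map_zero, mul_zero, eq_comm, mul_eq_zero] at h'
    rw [lg, hy, div_zero, h'.resolve_left hd]
  · rw [lg, h, mul_div_cancel_right₀ _ hy]

lemma lg_add (P Q : Pt (ι a) (ι b)) : lg D (P + Q) = lg D P + lg D Q := by
  by_cases hP : P = 0
  · rw [hP, lg_zero]; simp
  by_cases hQ : Q = 0
  · rw [hQ, lg_zero]; simp
  obtain ⟨p1, p2⟩ := lg_spec hD h2 hP
  obtain ⟨q1, q2⟩ := lg_spec hD h2 hQ
  have eP := eqn hP
  have eQ := eqn hQ
  by_cases hx : px P = px Q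
  · rcases eq_or_eq_neg hP hQ hx with rfl | rfl
    · by_cases hy : py P = 0
      · rw [(add_self_eq_zero_iff h2).2 hy, lg_zero, lg, hy]; simp
      · have hne : P + P ≠ 0 := fun h => hy ((add_self_eq_zero_iff h2).1 h)
        have e1 := px_dbl hP h2 hy
        have e2 := py_dbl hP h2 hy
        obtain ⟨m, hm⟩ : ∃ m, m = (3 * px P ^ 2 + ι a) / (2 * py P) := ⟨_, rfl⟩
        have hm2 : m * (2 * py P) = 3 * px P ^ 2 + ι a := by
          rw [hm, div_mul_cancel₀ _ (mul_ne_zero h2 hy)]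
        rw [← hm] at e1 e2
        have k0 : m * (py P + py P) = px P ^ 2 + px P ^ 2 + px P ^ 2 + ι a := by
          linear_combination hm2
        have k2 := congrArg D k0
        simp only [D.leib, map_add, D.sq, hD] at k2
        have k3 : D m = lg D P * (px P - px (P + P)) := by
          apply mul_left_cancel₀ (mul_ne_zero h2 hy)
          linear_combination k2 + (6 * px P) * p1 - m * p2 + m * lg D P * k0 + 2 * py P * lg D P * e1
        have e1' := congrArg D e1
        have e2' := congrArg D e2
        have e0 : m ^ 2 - 2 * px P = m ^ 2 - px P - px P := by ring
        rw [e0, map_sub, map_sub, D.sq] at e1'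
        rw [map_sub, D.leib, map_sub] at e2'
        have g : D (px (P + P)) = (lg D P + lg D P) * py (P + P) := by
          linear_combination e1' + 2 * m * k3 - 2 * p1 - 2 * lg D P * e2
        refine lg_eq hD h2 hne g ?_
        linear_combination 2 * e2' + 2 * (px P - px (P + P)) * k3 + 2 * m * p1 - p2 - 2 * m * g +
          lg D P * (-4 * m * e2 + 3 * k0 - (4 * px (P + P) - 4 * px P) * e1)
    · rw [lg_neg hD]; simp [lg_zero]
  · have hne := add_ne hx
    have hx' : px P - px Q ≠ 0 := sub_ne_zero.2 hx
    have e1 := px_add hP hQ hx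
    have e2 := py_add hP hQ hx
    have e3 : slp P Q * (px P - px Q) = py P - py Q := by
      rw [slp, div_mul_cancel₀ _ hx']
    generalize slp P Q = m at *
    have k1 : m * (py P + py Q) = px P ^ 2 + px P * px Q + px Q ^ 2 + ι a := by
      apply mul_left_cancel₀ hx'
      linear_combination (py P + py Q) * e3 + eP - eQ
    have k2 := congrArg D e3
    rw [D.leib, map_sub, map_sub] at k2
    have k3 : 2 * D m = lg D P * (px P - px (P + Q)) + lg D Q * (px Q - px (P + Q)) := by
      apply mul_left_cancel₀ hx'
      rw [e1]
      linear_combination 2 * k2 - 2 * m * p1 + 2 * m * q1 + p2 - q2 - lg D P * k1 + m * lg D P * e3 + lg D Q * k1 + m * lg D Q * e3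
    have g : D (px (P + Q)) = (lg D P + lg D Q) * py (P + Q) := by
      rw [e2]
      have := congrArg D e1
      rw [map_sub, map_sub, D.sq] at this
      linear_combination this + m * k3 - p1 - q1 - lg D Q * e3
    refine lg_eq hD h2 hne g ?_
    have := congrArg D e2
    rw [map_sub, D.leib, map_sub, g] at this
    linear_combination 2 * this + (px P - px (P + Q)) * k3 + 2 * m * p1 - p2 +
      lg D P * (-2 * m * e2 + 2 * k1 - 2 * m * e3 - 2 * (px (P + Q) - px Q) * e1) +
      lg D Q * (-2 * m * e2 + k1 - m * e3 - (2 * px (P + Q) - px P - px Q) * e1)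

end LogDerivative

section Parallelogram

variable {K : Type*} [Field K] {a b : K} [(SW a b).IsElliptic]

/-- Homogeneous coordinates for the `x`-coordinate of a point. -/
def Xr (P : Pt a b) (u v : K) : Prop := (P = 0 ∧ v = 0 ∧ u ≠ 0) ∨ (P ≠ 0 ∧ v ≠ 0 ∧ px P * v = u)

lemma Xr.neg {P : Pt a b} {u v : K} (h : Xr P u v) : Xr (-P) u v := by
  rcases h with ⟨rfl, h⟩ | ⟨h, h'⟩
  · left; simpa using h
  · right; rw [px_neg]; exact ⟨by simpa using h, h'⟩

/-- Two triples are proportional. -/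
def Prop3 {R : Type*} [CommRing R] (g0 g1 g2 h0 h1 h2 : R) : Prop :=
  g0 * h1 = g1 * h0 ∧ g0 * h2 = g2 * h0 ∧ g1 * h2 = g2 * h1

/-- First component of the biquadratic forms. -/
def H0 {R : Type*} [CommRing R] (u1 v1 u2 v2 : R) : R := (u1 * v2 - u2 * v1) ^ 2
/-- Second component of the biquadratic forms. -/
def H1 {R : Type*} [CommRing R] (a b u1 v1 u2 v2 : R) : R :=
  2 * ((u1 * u2 + a * (v1 * v2)) * (u1 * v2 + u2 * v1) + 2 * b * (v1 ^ 2 * v2 ^ 2))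
/-- Third component of the biquadratic forms. -/
def H2 {R : Type*} [CommRing R] (a b u1 v1 u2 v2 : R) : R :=
  (u1 * u2 - a * (v1 * v2)) ^ 2 - 4 * b * (v1 * v2 * (u1 * v2 + u2 * v1))

theorem prop3_of_xr (h2 : (2 : K) ≠ 0) {P Q : Pt a b} {u1 v1 u2 v2 u3 v3 u4 v4 : K}
    (hP : Xr P u1 v1) (hQ : Xr Q u2 v2) (hs : Xr (P + Q) u3 v3) (hd : Xr (P - Q) u4 v4) :
    Prop3 (v3 * v4) (u3 * v4 + u4 * v3) (u3 * u4)
      (H0 u1 v1 u2 v2) (H1 a b u1 v1 u2 v2) (H2 a b u1 v1 u2 v2) := by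
  unfold Prop3 H0 H1 H2
  -- doubling
  have hdbl : ∀ {u v u' v' u3 v3 u4 v4 : K} {P : Pt a b}, Xr P u v → Xr P u' v' → Xr (P + P) u3 v3 →
      v4 = 0 → Prop3 (v3 * v4) (u3 * v4 + u4 * v3) (u3 * u4)
      (H0 u v u' v') (H1 a b u v u' v') (H2 a b u v u' v') := by
    intro u v u' v' u3 v3 u4 v4 P h h' h3 h4
    subst h4
    unfold Prop3 H0 H1 H2
    rcases h with ⟨rfl, rfl, hu⟩ | ⟨hP, hv, rfl⟩
    · rcases h' with ⟨_, rfl, hu'⟩ | ⟨h, _⟩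
      · rcases h3 with ⟨_, rfl, hu3⟩ | ⟨h, _⟩
        · refine ⟨?_, ?_, ?_⟩ <;> ring
        · simp at h
      · exact absurd rfl h
    · rcases h' with ⟨h, _⟩ | ⟨_, hv', rfl⟩
      · exact absurd h hP
      · have e := eqn hP
        rcases h3 with ⟨h0, rfl, hu3⟩ | ⟨h0, hv3, rfl⟩
        · rw [add_self_eq_zero_iff h2] at h0
          rw [h0] at e
          refine ⟨by ring, by ring, ?_⟩
          linear_combination -(4 * u3 * u4 * v ^ 2 * v' ^ 2) * e * (-1)
        · have hy : py P ≠ 0 := fun h => h0 ((add_self_eq_zero_iff h2).2 h)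
          have e1 := px_dbl hP h2 hy
          obtain ⟨m, hm⟩ : ∃ m, m = (3 * px P ^ 2 + a) / (2 * py P) := ⟨_, rfl⟩
          have hm2 : m * (2 * py P) = 3 * px P ^ 2 + a := by
            rw [hm, div_mul_cancel₀ _ (mul_ne_zero h2 hy)]
          rw [← hm] at e1
          have e3 : px (P + P) * (4 * (px P ^ 3 + a * px P + b)) =
              (px P ^ 2 - a) ^ 2 - 8 * b * px P := by
            rw [e1, ← e]
            linear_combination (m * (2 * py P) + 3 * px P ^ 2 + a) * hm2 - 8 * px P * e
          refine ⟨by ring, by ring, ?_⟩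
          linear_combination -(u4 * v3 * v ^ 2 * v' ^ 2) * e3
  by_cases hx : P = Q
  · subst hx
    refine hdbl hP hQ hs ?_
    rcases hd with ⟨_, h, _⟩ | ⟨h, _⟩
    · exact h
    · simp at h
  by_cases hx' : P = -Q
  · have hQ' := hQ.neg
    rw [← hx'] at hQ'
    have e : P - Q = P + P := by rw [sub_eq_add_neg, ← hx']
    rw [e] at hd
    have hv : v3 = 0 := by
      rcases hs with ⟨_, h, _⟩ | ⟨h, _⟩
      · exact h
      · rw [hx'] at h; simp at h
    have := hdbl (u4 := u3) hP hQ' hd hv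
    unfold Prop3 H0 H1 H2 at this
    obtain ⟨h1, h2, h3⟩ := this
    refine ⟨by linear_combination h1, by linear_combination h2, by linear_combination h3⟩
  rcases hP with ⟨rfl, rfl, hu1⟩ | ⟨hP, hv1, rfl⟩
  · have hQ0 : Q ≠ 0 := fun h => hx h.symm
    rcases hQ with ⟨h, _⟩ | ⟨_, hv2, rfl⟩
    · exact absurd h hQ0
    rw [zero_add] at hs
    rw [zero_sub] at hd
    rcases hs with ⟨h, _⟩ | ⟨_, hv3, rfl⟩
    · exact absurd h hQ0
    rcases hd with ⟨h, _⟩ | ⟨_, hv4, rfl⟩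
    · exact absurd (neg_eq_zero.1 h) hQ0
    rw [px_neg]
    refine ⟨?_, ?_, ?_⟩ <;> ring
  rcases hQ with ⟨rfl, rfl, hu2⟩ | ⟨hQ, hv2, rfl⟩
  · rw [add_zero] at hs
    rw [sub_zero] at hd
    rcases hs with ⟨h, _⟩ | ⟨_, hv3, rfl⟩
    · exact absurd h hP
    rcases hd with ⟨h, _⟩ | ⟨_, hv4, rfl⟩
    · exact absurd h hP
    refine ⟨?_, ?_, ?_⟩ <;> ring
  have hxx : px P ≠ px Q := fun h => by
    rcases eq_or_eq_neg hP hQ h with h | h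
    · exact hx h
    · exact hx' h
  rcases hs with ⟨h, _⟩ | ⟨_, hv3, rfl⟩
  · exact absurd h (add_ne hxx)
  have hQn : -Q ≠ 0 := by simpa using hQ
  have hxn : px P ≠ px (-Q) := by rwa [px_neg]
  rw [sub_eq_add_neg] at hd
  rcases hd with ⟨h, _⟩ | ⟨_, hv4, rfl⟩
  · exact absurd h (add_ne hxn)
  have s1 := add_mul_sub_sq hP hQ hxx
  have s2 := add_mul_sub_sq hP hQn hxn
  rw [px_neg, py_neg] at s2
  rw [sub_eq_add_neg]
  have eP := eqn hP
  have eQ := eqn hQ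
  generalize px (P + Q) = x3 at *
  generalize px (P + -Q) = x4 at *
  have hsub : px P - px Q ≠ 0 := sub_ne_zero.2 hxx
  have t1 : (x3 + x4) * (px P - px Q) ^ 2 = 2 * ((px P * px Q + a) * (px P + px Q) + 2 * b) := by
    linear_combination s1 + s2
  have t2 : x3 * x4 * (px P - px Q) ^ 2 = (px P * px Q - a) ^ 2 - 4 * b * (px P + px Q) := by
    apply mul_left_cancel₀ (pow_ne_zero 2 hsub)
    linear_combination (x4 * (px P - px Q) ^ 2) * s1 + (px P ^ 2 * px Q + px P * (px Q ^ 2 + a) +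
      a * px Q + 2 * b - 2 * py P * py Q) * s2 - 4 * py Q ^ 2 * eP -
      4 * (px P ^ 3 + a * px P + b) * eQ
  refine ⟨?_, ?_, ?_⟩
  · linear_combination -(v3 * v4 * v1 ^ 2 * v2 ^ 2) * t1
  · linear_combination -(v3 * v4 * v1 ^ 2 * v2 ^ 2) * t2
  · linear_combination (v3 * v4 * v1 ^ 2 * v2 ^ 2 * x3 * x4) * t1 - (v3 * v4 * v1 ^ 2 * v2 ^ 2 * (x3 + x4)) * t2

end Parallelogram

section Prim

variable {k : Type*} [Field k] [IsAlgClosed k]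

lemma exists_bezout3 {g0 g1 g2 : k[X]} (h : ∀ c, ¬ (g0.eval c = 0 ∧ g1.eval c = 0 ∧ g2.eval c = 0)) :
    ∃ r s t : k[X], r * g0 + s * g1 + t * g2 = 1 := by
  set I : Ideal k[X] := Ideal.span {g0, g1, g2} with hI
  have hm : g0 ∈ I ∧ g1 ∈ I ∧ g2 ∈ I :=
    ⟨Ideal.subset_span (by simp), Ideal.subset_span (by simp), Ideal.subset_span (by simp)⟩
  have hg := (IsPrincipalIdealRing.principal I).principal
  obtain ⟨g, hg⟩ := hg
  rw [hg] at hm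
  simp only [Submodule.mem_span_singleton, smul_eq_mul] at hm
  obtain ⟨⟨c0, e0⟩, ⟨c1, e1⟩, ⟨c2, e2⟩⟩ := hm
  have hu : IsUnit g := by
    by_contra hu
    obtain ⟨c, hc⟩ : ∃ c, g.eval c = 0 := by
      by_cases hg0 : g = 0
      · exact ⟨0, by simp [hg0]⟩
      · refine IsAlgClosed.exists_root g fun hd => hu ?_
        rw [isUnit_iff_degree_eq_zero]; exact hd
    apply h c
    rw [← e0, ← e1, ← e2]
    simp [hc]
  have h1 : (1 : k[X]) ∈ I := by
    rw [hg, Submodule.mem_span_singleton]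
    obtain ⟨g', hg'⟩ := hu.exists_left_inv
    exact ⟨g', hg'⟩
  rw [hI, Ideal.mem_span_insert] at h1
  obtain ⟨r, z, hz, h1⟩ := h1
  rw [Ideal.mem_span_pair] at hz
  obtain ⟨s, t, rfl⟩ := hz
  exact ⟨r, s, t, by rw [h1]; ring⟩

/-- A triple of polynomials of degree at most `d` with no common zero, including at infinity. -/
def Prim3 (d : ℕ) (g0 g1 g2 : k[X]) : Prop :=
  (g0.natDegree ≤ d ∧ g1.natDegree ≤ d ∧ g2.natDegree ≤ d) ∧
  ¬ (g0.coeff d = 0 ∧ g1.coeff d = 0 ∧ g2.coeff d = 0) ∧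
  ∀ c, ¬ (g0.eval c = 0 ∧ g1.eval c = 0 ∧ g2.eval c = 0)

lemma Prim3.le {d d' : ℕ} {g0 g1 g2 h0 h1 h2 : k[X]} (hg : Prim3 d g0 g1 g2)
    (hh : Prim3 d' h0 h1 h2) (hp : Prop3 g0 g1 g2 h0 h1 h2) : d ≤ d' := by
  obtain ⟨hg1, hg2, hg3⟩ := hg
  obtain ⟨hh1, hh2, hh3⟩ := hh
  obtain ⟨p1, p2, p3⟩ := hp
  obtain ⟨r, s, t, e⟩ := exists_bezout3 hg3
  obtain ⟨r', s', t', e'⟩ := exists_bezout3 hh3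
  set m := r' * g0 + s' * g1 + t' * g2 with hm
  have q0 : g0 = m * h0 := by linear_combination -g0 * e' + s' * p1 + t' * p2
  have q1 : g1 = m * h1 := by linear_combination -g1 * e' - r' * p1 + t' * p3
  have q2 : g2 = m * h2 := by linear_combination -g2 * e' - r' * p2 - s' * p3
  have hu : IsUnit m := by
    refine IsUnit.of_mul_eq_one (r * h0 + s * h1 + t * h2) ?_
    linear_combination e - r * q0 - s * q1 - t * q2
  obtain ⟨c, hc, hcm⟩ := isUnit_iff.1 hu
  by_contra hlt
  push Not at hlt
  apply hg2
  rw [q0, q1, q2, ← hcm]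
  simp only [coeff_C_mul]
  rw [coeff_eq_zero_of_natDegree_lt (by omega), coeff_eq_zero_of_natDegree_lt (by omega),
    coeff_eq_zero_of_natDegree_lt (by omega)]
  simp

/-- A pair of polynomials of degree at most `d` with no common zero, including at infinity. -/
def Prim2 (d : ℕ) (u v : k[X]) : Prop :=
  (u.natDegree ≤ d ∧ v.natDegree ≤ d) ∧ ¬ (u.coeff d = 0 ∧ v.coeff d = 0) ∧
  ∀ c, ¬ (u.eval c = 0 ∧ v.eval c = 0)

omit [IsAlgClosed k] in
lemma natDegree_mul_le' {f g : k[X]} {m n : ℕ} (hf : f.natDegree ≤ m) (hg : g.natDegree ≤ n) :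
    (f * g).natDegree ≤ m + n := natDegree_mul_le.trans (add_le_add hf hg)

lemma prim3_prod {d d' : ℕ} {u v u' v' : k[X]} (h : Prim2 d u v) (h' : Prim2 d' u' v') :
    Prim3 (d + d') (v * v') (u * v' + u' * v) (u * u') := by
  obtain ⟨⟨a1, a2⟩, a3, a4⟩ := h
  obtain ⟨⟨b1, b2⟩, b3, b4⟩ := h'
  have key : ∀ {x y x' y' : k}, ¬ (x = 0 ∧ y = 0) → ¬ (x' = 0 ∧ y' = 0) →
      ¬ (y * y' = 0 ∧ x * y' + x' * y = 0 ∧ x * x' = 0) := by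
    rintro x y x' y' h h' ⟨e1, e2, e3⟩
    rcases mul_eq_zero.1 e1 with rfl | rfl <;> rcases mul_eq_zero.1 e3 with rfl | rfl <;> simp_all
  have c2 : (u' * v).natDegree ≤ d + d' := by rw [add_comm]; exact natDegree_mul_le' b1 a2
  refine ⟨⟨natDegree_mul_le' a2 b2, natDegree_add_le_of_degree_le (natDegree_mul_le' a1 b2) c2,
    natDegree_mul_le' a1 b1⟩, ?_, fun c => ?_⟩
  · have e : (u' * v).coeff (d + d') = u'.coeff d' * v.coeff d := by
      rw [add_comm, coeff_mul_add_eq_of_natDegree_le b1 a2]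
    rw [coeff_add, e, coeff_mul_add_eq_of_natDegree_le a2 b2, coeff_mul_add_eq_of_natDegree_le a1 b2,
      coeff_mul_add_eq_of_natDegree_le a1 b1]
    exact key a3 b3
  · simp only [eval_mul, eval_add]
    exact key (a4 c) (b4 c)

lemma coeff_mul_eq {f g : k[X]} {m n N : ℕ} (hf : f.natDegree ≤ m) (hg : g.natDegree ≤ n) (h : m + n = N) :
    (f * g).natDegree ≤ N ∧ (f * g).coeff N = f.coeff m * g.coeff n := by
  subst h
  exact ⟨natDegree_mul_le' hf hg, coeff_mul_add_eq_of_natDegree_le hf hg⟩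

lemma prim3_H (a b : k) (hd : 4 * a ^ 3 + 27 * b ^ 2 ≠ 0) (h2 : (2 : k) ≠ 0) {d d' : ℕ} {u v u' v' : k[X]}
    (h : Prim2 d u v) (h' : Prim2 d' u' v') :
    Prim3 (2 * (d + d')) (H0 u v u' v') (H1 (C a) (C b) u v u' v') (H2 (C a) (C b) u v u' v') := by
  obtain ⟨⟨a1, a2⟩, a3, a4⟩ := h
  obtain ⟨⟨b1, b2⟩, b3, b4⟩ := h'
  have key : ∀ {x y x' y' : k}, ¬ (x = 0 ∧ y = 0) → ¬ (x' = 0 ∧ y' = 0) →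
      ¬ (H0 x y x' y' = 0 ∧ H1 a b x y x' y' = 0 ∧ H2 a b x y x' y' = 0) := by
    rintro x y x' y' h h' ⟨e1, e2, e3⟩
    unfold H0 at e1; unfold H1 at e2; unfold H2 at e3
    have e1' : x * y' = x' * y := by
      have := pow_eq_zero_iff (two_ne_zero) |>.1 e1
      linear_combination this
    by_cases hy : y = 0
    · subst hy
      have hx : x ≠ 0 := fun h0 => h ⟨h0, rfl⟩
      have hy' : y' = 0 := by
        have : x * y' = 0 := by rw [e1']; ring
        exact (mul_eq_zero.1 this).resolve_left hx
      have : (x * x') ^ 2 = 0 := by linear_combination e3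
      have := pow_eq_zero_iff (two_ne_zero) |>.1 this
      exact h' ⟨(mul_eq_zero.1 this).resolve_left hx, hy'⟩
    · have hy' : y' ≠ 0 := by
        rintro rfl
        have : x' * y = 0 := by rw [← e1']; ring
        exact h' ⟨(mul_eq_zero.1 this).resolve_right hy, rfl⟩
      obtain ⟨z, rfl⟩ : ∃ z, x = z * y := ⟨x / y, by field_simp⟩
      obtain rfl : x' = z * y' := by
        apply mul_right_cancel₀ hy; linear_combination -e1'
      have f0 : z ^ 3 + a * z + b = 0 := by
        have : (2 * 2 * (y ^ 2 * y' ^ 2)) * (z ^ 3 + a * z + b) = 0 := by linear_combination e2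
        exact (mul_eq_zero.1 this).resolve_left
          (mul_ne_zero (mul_ne_zero h2 h2) (mul_ne_zero (pow_ne_zero 2 hy) (pow_ne_zero 2 hy')))
      have f1 : (z ^ 2 - a) ^ 2 - 8 * b * z = 0 := by
        have : (y ^ 2 * y' ^ 2) * ((z ^ 2 - a) ^ 2 - 8 * b * z) = 0 := by linear_combination e3
        exact (mul_eq_zero.1 this).resolve_left (mul_ne_zero (pow_ne_zero 2 hy) (pow_ne_zero 2 hy'))
      have f2 : (3 * z ^ 2 + a) ^ 2 = 0 := by linear_combination f1 + 8 * z * f0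
      have f3 := pow_eq_zero_iff (two_ne_zero) |>.1 f2
      apply hd
      linear_combination (4 * (3 * z ^ 2 + a) ^ 2 - 9 * (3 * z ^ 2 + a) * z ^ 2) * f3 +
        (27 * (z ^ 3 + a * z + b) + 108 * z ^ 3 - 54 * (3 * z ^ 2 + a) * z) * f0
  have c1 := coeff_mul_eq a1 b2 rfl
  have c2 := coeff_mul_eq b1 a2 (add_comm d' d)
  have c3 := coeff_mul_eq a1 b1 rfl
  have c4 := coeff_mul_eq a2 b2 rfl
  have s1 : (u * v' - u' * v).natDegree ≤ d + d' := (natDegree_sub_le_of_le c1.1 c2.1).trans (max_self _).le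
  have s2 : (u * v' + u' * v).natDegree ≤ d + d' := natDegree_add_le_of_degree_le c1.1 c2.1
  have hC : ∀ {q : k[X]} {N : ℕ} (c : k), q.natDegree ≤ N → (C c * q).natDegree ≤ N := fun c h =>
    (natDegree_C_mul_le _ _).trans h
  have s3 : (u * u' + C a * (v * v')).natDegree ≤ d + d' :=
    natDegree_add_le_of_degree_le c3.1 (hC a c4.1)
  have s4 : (u * u' - C a * (v * v')).natDegree ≤ d + d' :=
    (natDegree_sub_le_of_le c3.1 (hC a c4.1)).trans (max_self _).le
  have e2 : d + d' + (d + d') = 2 * (d + d') := by ring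
  have t1 := coeff_mul_eq s1 s1 e2
  have t2 := coeff_mul_eq s3 s2 e2
  have t3 := coeff_mul_eq c4.1 c4.1 e2
  have t4 := coeff_mul_eq s4 s4 e2
  have t5 := coeff_mul_eq c4.1 s2 e2
  have w0 : H0 u v u' v' = (u * v' - u' * v) * (u * v' - u' * v) := by unfold H0; ring
  have w1 : H1 (C a) (C b) u v u' v' = C 2 * ((u * u' + C a * (v * v')) * (u * v' + u' * v) +
      C (2 * b) * ((v * v') * (v * v'))) := by unfold H1; rw [C_mul, map_ofNat C 2]; ring
  have w2 : H2 (C a) (C b) u v u' v' = (u * u' - C a * (v * v')) * (u * u' - C a * (v * v')) -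
      C (4 * b) * ((v * v') * (u * v' + u' * v)) := by unfold H2; rw [C_mul, map_ofNat C 4]; ring
  refine ⟨⟨?_, ?_, ?_⟩, ?_, fun c => ?_⟩
  · rw [w0]; exact t1.1
  · rw [w1]; exact hC _ (natDegree_add_le_of_degree_le t2.1 (hC _ t3.1))
  · rw [w2]; exact (natDegree_sub_le_of_le t4.1 (hC _ t5.1)).trans (max_self _).le
  · rw [w0, w1, w2]
    simp only [coeff_C_mul, coeff_add, coeff_sub, t1.2, t2.2, t3.2, t4.2, t5.2, c1.2, c2.2, c3.2, c4.2]
    refine fun h => key a3 b3 ⟨?_, ?_, ?_⟩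
    · rw [← h.1, H0]; ring
    · rw [← h.2.1, H1]; ring
    · rw [← h.2.2, H2]; ring
  · refine fun h => key (a4 c) (b4 c) ⟨?_, ?_, ?_⟩
    · rw [← h.1]; simp [H0]
    · rw [← h.2.1]; simp [H1]
    · rw [← h.2.2]; simp [H2]

end Prim

section Quad

variable {A : Type*} [AddCommGroup A] {q : A → ℤ} (hq : ∀ x y, q (x + y) + q (x - y) = 2 * (q x + q y))
include hq

lemma quad_zero : q 0 = 0 := by
  have := hq 0 0; simp only [add_zero, sub_zero] at this; omega

lemma quad_neg (x : A) : q (-x) = q x := by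
  have := hq 0 x; rw [zero_add, zero_sub, quad_zero hq] at this; omega

lemma quad_add_three (x y z : A) : q (x + y + z) + q x + q y + q z = q (x + y) + q (y + z) + q (x + z) := by
  have L1 := hq (x + z) y
  have L2 := hq x (z - y)
  have L3 := hq (x + y) z
  have L4 := hq z y
  rw [show x + z + y = x + y + z by abel] at L1
  rw [show x + (z - y) = x + z - y by abel, show x - (z - y) = x + y - z by abel] at L2
  rw [add_comm z y] at L4
  linarith

/-- The polar form of a quadratic function. -/
def pol (q : A → ℤ) (x y : A) : ℤ := q (x + y) - q x - q y

lemma pol_add_left (x y z : A) : pol q (x + y) z = pol q x z + pol q y z := by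
  have := quad_add_three hq x y z
  unfold pol; linarith

lemma pol_comm (x y : A) : pol q x y = pol q y x := by
  unfold pol; rw [add_comm]; ring

lemma pol_zsmul_left (n : ℤ) (x y : A) : pol q (n • x) y = n * pol q x y := by
  let g : A →+ ℤ := { toFun := fun x => pol q x y, map_zero' := by
                        unfold pol; rw [zero_add, quad_zero hq]; ring
                      map_add' := fun x z => pol_add_left hq x z y }
  have : g (n • x) = n • g x := map_zsmul g n x
  simpa [g] using this

lemma pol_zsmul_right (n : ℤ) (x y : A) : pol q x (n • y) = n * pol q x y := by
  rw [pol_comm hq, pol_zsmul_left hq, pol_comm hq]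

lemma pol_self (x : A) : pol q x x = 2 * q x := by
  have := hq x x
  rw [sub_self, quad_zero hq] at this
  unfold pol; linarith

lemma quad_zsmul (n : ℤ) (x : A) : q (n • x) = n ^ 2 * q x := by
  have := pol_self hq (n • x)
  rw [pol_zsmul_left hq, pol_zsmul_right hq, pol_self hq] at this
  linarith

lemma quad_add (x y : A) : q (x + y) = q x + q y + pol q x y := by unfold pol; ring

end Quad

section Height

variable {k : Type*} [Field k] [IsAlgClosed k] {a b : k}

variable (a b) in
/-- Polynomials in `x` as elements of the function field. -/
noncomputable def pe : k[X] →+* FF a b := eval₂RingHom (io a b) (xx a b)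

lemma pe_eq (q : k[X]) : pe a b q = emb a b (algebraMap k[X] (RatFunc k) q) := (emb_poly q).symm

lemma pe_injective : Function.Injective (pe a b) := fun p q h => by
  rw [pe_eq, pe_eq] at h
  exact RatFunc.algebraMap_injective k (emb_injective h)

@[simp] lemma pe_C (c : k) : pe a b (C c) = io a b c := by simp [pe]
@[simp] lemma pe_X : pe a b X = xx a b := by simp [pe]

variable [(SW a b).IsElliptic]

/-- A point whose `x`-coordinate is a rational function of height `d`. -/
def Ht (w : Pt (io a b a) (io a b b)) (d : ℕ) : Prop :=
  ∃ u v : k[X], Prim2 d u v ∧ Xr w (pe a b u) (pe a b v)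

omit [(SW a b).IsElliptic] in
lemma ff_two_ne_zero (h2 : (2 : k) ≠ 0) : (2 : FF a b) ≠ 0 := by
  have := (map_ne_zero (io a b)).2 h2
  simpa only [map_ofNat] using this

lemma Ht.parallelogram (h2 : (2 : k) ≠ 0) {P Q : Pt (io a b a) (io a b b)} {d1 d2 d3 d4 : ℕ}
    (hP : Ht P d1) (hQ : Ht Q d2) (hs : Ht (P + Q) d3) (hd : Ht (P - Q) d4) :
    d3 + d4 = 2 * (d1 + d2) := by
  obtain ⟨u1, v1, p1, x1⟩ := hP
  obtain ⟨u2, v2, p2, x2⟩ := hQ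
  obtain ⟨u3, v3, p3, x3⟩ := hs
  obtain ⟨u4, v4, p4, x4⟩ := hd
  have G := prim3_prod p3 p4
  have H := prim3_H a b disc_ne_zero h2 p1 p2
  have hp : Prop3 (v3 * v4) (u3 * v4 + u4 * v3) (u3 * u4)
      (H0 u1 v1 u2 v2) (H1 (C a) (C b) u1 v1 u2 v2) (H2 (C a) (C b) u1 v1 u2 v2) := by
    have := prop3_of_xr (ff_two_ne_zero h2) x1 x2 x3 x4
    unfold Prop3 at this ⊢
    unfold H0 H1 H2 at this ⊢
    have t2 : pe a b 2 = 2 := map_ofNat _ 2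
    have t4 : pe a b 4 = 4 := map_ofNat _ 4
    refine ⟨pe_injective (a := a) (b := b) ?_, pe_injective (a := a) (b := b) ?_, pe_injective (a := a) (b := b) ?_⟩
    · simpa [t2, t4] using this.1
    · simpa [t2, t4] using this.2.1
    · simpa [t2, t4] using this.2.2
  have hp' : Prop3 (H0 u1 v1 u2 v2) (H1 (C a) (C b) u1 v1 u2 v2) (H2 (C a) (C b) u1 v1 u2 v2)
      (v3 * v4) (u3 * v4 + u4 * v3) (u3 * u4) := by
    obtain ⟨h1, h2, h3⟩ := hp
    exact ⟨by rw [mul_comm, ← h1, mul_comm], by rw [mul_comm, ← h2, mul_comm],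
      by rw [mul_comm, ← h3, mul_comm]⟩
  exact le_antisymm (G.le H hp) (H.le G hp')

lemma ht_zero : Ht (0 : Pt (io a b a) (io a b b)) 0 :=
  ⟨1, 0, ⟨⟨by simp, by simp⟩, by simp, by simp⟩, .inl ⟨rfl, by simp, by simp⟩⟩

lemma Ht.unique (h2 : (2 : k) ≠ 0) {P : Pt (io a b a) (io a b b)} {d d' : ℕ} (h : Ht P d) (h' : Ht P d') :
    d = d' := by
  have := Ht.parallelogram h2 (P := P) (Q := 0) h ht_zero (by simpa using h') (by simpa using h')
  omega

lemma exists_ht {w : Pt (io a b a) (io a b b)} {r : RatFunc k} (hr : px w = emb a b r) :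
    ∃ d, Ht w d := by
  by_cases hw : w = 0
  · exact ⟨0, hw ▸ ht_zero⟩
  have hcop : IsCoprime r.num r.denom := r.isCoprime_num_denom
  have hden : r.denom ≠ 0 := r.denom_ne_zero
  refine ⟨max r.num.natDegree r.denom.natDegree, r.num, r.denom,
    ⟨⟨le_max_left _ _, le_max_right _ _⟩, ?_, ?_⟩, .inr ⟨hw, ?_, ?_⟩⟩
  · rintro ⟨e1, e2⟩
    rcases max_choice r.num.natDegree r.denom.natDegree with h | h <;> rw [h] at e1 e2
    · rw [coeff_natDegree, leadingCoeff_eq_zero] at e1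
      have h0 : r.denom.natDegree = 0 := by
        have := le_max_right r.num.natDegree r.denom.natDegree
        rw [h, e1] at this; simpa using this
      rw [e1] at e2
      rw [natDegree_zero, ← h0, coeff_natDegree, leadingCoeff_eq_zero] at e2
      exact hden e2
    · rw [coeff_natDegree, leadingCoeff_eq_zero] at e2
      exact hden e2
  · rintro c ⟨e1, e2⟩
    obtain ⟨s, t, h⟩ := hcop
    have := congrArg (eval c) h
    simp [e1, e2] at this
  · rw [Ne, map_eq_zero_iff _ (pe_injective (a := a) (b := b))]; exact hden
  · rw [hr, pe_eq, pe_eq, ← map_mul]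
    congr 1
    nth_rewrite 1 [← RatFunc.num_div_denom r]
    rw [div_mul_cancel₀]
    simpa using hden

variable (a b) in
/-- The odd points of the curve over its function field. -/
noncomputable def MM : AddSubgroup (Pt (io a b a) (io a b b)) :=
  AddMonoidHom.ker (mapPt cj (cj_io a) (cj_io b) + AddMonoidHom.id _)

lemma mem_MM {w : Pt (io a b a) (io a b b)} : w ∈ MM a b ↔ mapPt cj (cj_io a) (cj_io b) w = - w := by
  rw [MM, AddMonoidHom.mem_ker, AddMonoidHom.add_apply, AddMonoidHom.id_apply, add_eq_zero_iff_eq_neg]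

lemma MM_px (h2 : (2 : k) ≠ 0) {w : Pt (io a b a) (io a b b)} (hw : w ∈ MM a b) :
    ∃ r s, px w = emb a b r ∧ py w = emb a b s * yy a b := by
  rw [mem_MM] at hw
  have h2' := ff_two_ne_zero (a := a) (b := b) h2
  have h2'' : (2 : RatFunc k) ≠ 0 := by
    intro h; apply h2'; rw [← map_ofNat (emb a b) 2, h, map_zero]
  obtain ⟨A, B, e⟩ := exists_repr (px w)
  obtain ⟨A', B', e'⟩ := exists_repr (py w)
  have h1 := congrArg px hw
  have h1' := congrArg py hw
  rw [px_mapPt, px_neg, e, map_add, map_mul, cj_emb, cj_emb, cj_yy] at h1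
  rw [py_mapPt, py_neg, e', map_add, map_mul, cj_emb, cj_emb, cj_yy] at h1'
  have g1 := repr_unique (a := a) (b := b) (A := A) (B := -B) (A' := A) (B' := B)
    (by rw [map_neg]; linear_combination h1)
  have g2 := repr_unique (a := a) (b := b) (A := A') (B := -B') (A' := -A') (B' := -B')
    (by rw [map_neg, map_neg]; linear_combination h1')
  have hB : B = 0 := by
    have : 2 * B = 0 := by linear_combination -g1.2
    exact (mul_eq_zero.1 this).resolve_left h2''
  have hA : A' = 0 := by
    have : 2 * A' = 0 := by linear_combination g2.1
    exact (mul_eq_zero.1 this).resolve_left h2''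
  exact ⟨A, B', by rw [e, hB]; simp, by rw [e', hA]; simp⟩

lemma gam_mem_MM : gam (a := a) (b := b) ∈ MM a b := by
  rw [mem_MM]
  refine pt_ext ?_ ?_ ?_ ?_
  · rw [Ne, mapPt_eq_zero]; exact gam_ne_zero
  · rw [Ne, neg_eq_zero]; exact gam_ne_zero
  · rw [px_mapPt, px_neg, px_gam, cj_xx]
  · rw [py_mapPt, py_neg, py_gam, cj_yy]

/-- The height of an odd point. -/
noncomputable def hh (w : Pt (io a b a) (io a b b)) : ℕ := if h : ∃ d, Ht w d then h.choose else 0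

lemma hh_spec (h2 : (2 : k) ≠ 0) {w : Pt (io a b a) (io a b b)} (hw : w ∈ MM a b) : Ht w (hh w) := by
  obtain ⟨r, s, h, -⟩ := MM_px h2 hw
  have := exists_ht h
  rw [hh, dif_pos this]
  exact this.choose_spec

lemma Ht.hh_eq (h2 : (2 : k) ≠ 0) {w : Pt (io a b a) (io a b b)} {d : ℕ} (h : Ht w d) : hh w = d := by
  have h' : ∃ d, Ht w d := ⟨d, h⟩
  rw [hh, dif_pos h']
  exact h'.choose_spec.unique h2 h

/-- The height as a function on the group of odd points. -/
noncomputable def qh (w : MM a b) : ℤ := hh (w : Pt (io a b a) (io a b b))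

lemma qh_parallelogram (h2 : (2 : k) ≠ 0) (x y : MM a b) :
    qh (x + y) + qh (x - y) = 2 * (qh x + qh y) := by
  have := Ht.parallelogram h2 (hh_spec h2 x.2) (hh_spec h2 y.2) (hh_spec h2 (x + y).2)
    (hh_spec h2 (x - y).2)
  unfold qh
  exact_mod_cast this

lemma ht_gam : Ht (gam (a := a) (b := b)) 1 := by
  refine ⟨X, 1, ⟨⟨natDegree_X_le, by simp⟩, by simp, by simp⟩, .inr ⟨gam_ne_zero, by simp, by simp⟩⟩

lemma Ht.eq_cst (h2 : (2 : k) ≠ 0) {w : Pt (io a b a) (io a b b)} (hw : w ∈ MM a b) (h : Ht w 0) :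
    ∃ T : Pt a b, w = cst (io a b) T := by
  obtain ⟨u, v, ⟨⟨hu, hv⟩, hc, -⟩, hx⟩ := h
  rw [natDegree_le_iff_degree_le] at hu hv
  rcases hx with ⟨rfl, -⟩ | ⟨h0, hv0, hx⟩
  · exact ⟨0, by simp [cst]⟩
  rw [eq_C_of_degree_le_zero hu, eq_C_of_degree_le_zero hv, pe_C, pe_C] at hx
  rw [eq_C_of_degree_le_zero hv, pe_C] at hv0
  have hx' : px w = io a b (u.coeff 0 / v.coeff 0) := by rw [map_div₀, ← hx, mul_div_cancel_right₀ _ hv0]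
  generalize u.coeff 0 / v.coeff 0 = c at hx'
  obtain ⟨r, s, -, hy⟩ := MM_px h2 hw
  have e := eqn h0
  rw [hx', hy] at e
  have hs : s = 0 := by
    by_contra hs
    obtain ⟨e0, he0⟩ := IsAlgClosed.exists_pow_nat_eq (c ^ 3 + a * c + b) (n := 2) (by norm_num)
    apply not_sq_fpoly a b (RatFunc.C e0 / s)
    apply emb_injective (a := a) (b := b)
    have hs' : emb a b s ≠ 0 := by simpa using hs
    rw [map_pow, map_div₀, emb_poly, eval₂_fpoly, ← yy_sq, div_pow, div_eq_iff (pow_ne_zero 2 hs')]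
    change (io a b e0) ^ 2 = _
    rw [← map_pow, he0, map_add, map_add, map_pow, map_mul]
    linear_combination -e
  rw [hs, map_zero, zero_mul] at hy
  rw [hs] at e
  have ec : (0 : k) ^ 2 = c ^ 3 + a * c + b := by
    apply (io a b).injective
    rw [map_add, map_add, map_pow, map_mul, map_pow, ← e]; simp
  refine ⟨mkP c 0 ec, pt_ext h0 ?_ ?_ ?_⟩
  · rw [cst, Ne, mapPt_eq_zero]; exact mkP_ne_zero _ _ _
  · rw [hx', cst, px_mapPt, px_mkP]
  · rw [hy, cst, py_mapPt, py_mkP, map_zero]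

end Height

section Endo

variable {k : Type*} [Field k] [IsAlgClosed k] [NeZero (2 : k)] {a b : k}

instance : NeZero (2 : FF a b) := ⟨ff_two_ne_zero two_ne_zero⟩

variable (a b) in
/-- A place of the function field at infinity. -/
noncomputable def pp : Place (io a b) := (exists_place (two_ne_zero (α := k))).choose

lemma pp_xx : (pp a b).Res (xx a b)⁻¹ 0 := (exists_place (two_ne_zero (α := k))).choose_spec

variable (a b) in
/-- The invariant derivation of the function field. -/
noncomputable def DD : Der (FF a b) := (exists_derivation (two_ne_zero (α := k))).choose

lemma DD_io (c : k) : DD a b (io a b c) = 0 :=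
  (exists_derivation (two_ne_zero (α := k))).choose_spec.1 c
lemma DD_xx : DD a b (xx a b) = yy a b := (exists_derivation (two_ne_zero (α := k))).choose_spec.2.1
lemma DD_yy : 2 * DD a b (yy a b) = 3 * xx a b ^ 2 + io a b a :=
  (exists_derivation (two_ne_zero (α := k))).choose_spec.2.2

lemma xx_ne_zero : xx a b ≠ 0 := by simpa using xx_ne_io (a := a) (b := b) 0

lemma DD_pe (q : k[X]) : DD a b (pe a b q) = pe a b q.derivative * yy a b := by
  have := (DD a b).eval₂ (io a b) DD_io q (xx a b)
  rw [DD_xx] at this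
  simpa [pe] using this

variable [(SW a b).IsElliptic]

lemma lg_gam : lg (DD a b) (gam (a := a) (b := b)) = 1 :=
  lg_eq DD_io (ff_two_ne_zero two_ne_zero) gam_ne_zero (by rw [px_gam, py_gam, DD_xx, one_mul])
    (by rw [px_gam, py_gam, DD_yy, mul_one])

/-- Nonconstant points. -/
def NC (u : Pt (io a b a) (io a b b)) : Prop := ∀ T : Pt a b, u ≠ cst (io a b) T

lemma NC.ne_zero {u : Pt (io a b a) (io a b b)} (h : NC u) : u ≠ 0 := fun h0 => h 0 (by simpa using h0)

lemma NC.px_ne {u : Pt (io a b a) (io a b b)} (h : NC u) (c : k) : px u ≠ io a b c := by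
  intro hx
  obtain ⟨T, hT, hc⟩ := exists_pt_x (a := a) (b := b) c
  have hT' : cst (io a b) T ≠ 0 := by simpa [cst, mapPt_eq_zero] using hT
  rcases eq_or_eq_neg h.ne_zero hT' (by rw [hx]; simp [cst, hc]) with e | e
  · exact h T e
  · exact h (-T) (by rw [e, map_neg])

lemma NC.add_cst {u : Pt (io a b a) (io a b b)} (h : NC u) (P : Pt a b) : NC (u + cst (io a b) P) := by
  intro T hT
  exact h (T - P) (by rw [map_sub, ← hT, add_sub_cancel_right])

lemma nc_of_px {u : Pt (io a b a) (io a b b)} (h : ∀ c, px u ≠ io a b c) : NC u := by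
  rintro T rfl
  exact h (px T) (by simp [cst])

lemma nc_gam : NC (gam (a := a) (b := b)) := nc_of_px fun c => by rw [px_gam]; exact xx_ne_io c

/-- Substitution of a point for the generic point. -/
noncomputable def th (u : Pt (io a b a) (io a b b)) : FF a b →+* FF a b :=
  if h : NC u then (exists_theta (io a b) u h.ne_zero h.px_ne).choose else RingHom.id _

lemma NC.th_spec {u : Pt (io a b a) (io a b b)} (h : NC u) :
    (∀ c, th u (io a b c) = io a b c) ∧ th u (xx a b) = px u ∧ th u (yy a b) = py u := by
  rw [th, dif_pos h]
  exact (exists_theta (io a b) u h.ne_zero h.px_ne).choose_spec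

lemma th_io (u : Pt (io a b a) (io a b b)) (c : k) : th u (io a b c) = io a b c := by
  by_cases h : NC u
  · exact h.th_spec.1 c
  · rw [th, dif_neg h]; rfl

/-- The place above the point `P`. -/
noncomputable def plc (P : Pt a b) : Place (io a b) :=
  (pp a b).pull (th (gam + cst (io a b) P)) (th_io _)

lemma pp_sp_gam : (pp a b).Sp (gam (a := a) (b := b)) 0 :=
  .inr ⟨rfl, .inr ⟨by rw [px_gam]; exact xx_ne_zero, by rw [px_gam]; exact pp_xx⟩⟩

lemma plc_sp_gam (P : Pt a b) : (plc P).Sp (gam (a := a) (b := b)) P := by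
  have h := (pp_sp_gam (a := a) (b := b)).add_cst two_ne_zero P
  rw [zero_add] at h
  have hs := (nc_gam (a := a) (b := b).add_cst P).th_spec
  rcases h with ⟨h1, h2, h3, h4⟩ | ⟨rfl, h | ⟨h1, h2⟩⟩
  · refine .inl ⟨gam_ne_zero, h2, ?_, ?_⟩
    · change (pp a b).Res (th _ _) _; rwa [px_gam, hs.2.1]
    · change (pp a b).Res (th _ _) _; rwa [py_gam, hs.2.2]
  · exact absurd h (nc_gam (a := a) (b := b).add_cst 0).ne_zero
  · refine .inr ⟨rfl, .inr ⟨by rw [px_gam]; exact xx_ne_zero, ?_⟩⟩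
    change (pp a b).Res (th _ _) _; rwa [px_gam, map_inv₀, hs.2.1]

lemma plc_xx {P : Pt a b} (hP : P ≠ 0) : (plc P).Res (xx a b) (px P) := by
  rcases plc_sp_gam P with ⟨-, -, h, -⟩ | ⟨h, -⟩
  · rwa [px_gam] at h
  · exact absurd h hP

lemma plc_zero_xx : (plc (0 : Pt a b)).Res (xx a b)⁻¹ 0 := by
  rcases plc_sp_gam (0 : Pt a b) with ⟨-, h, -⟩ | ⟨-, h | ⟨-, h⟩⟩
  · exact absurd rfl h
  · exact absurd h gam_ne_zero
  · rwa [px_gam] at h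

lemma plc_pe {P : Pt a b} (hP : P ≠ 0) (q : k[X]) : (plc P).Res (pe a b q) (q.eval (px P)) :=
  (plc P).eval (plc_xx hP) q

omit [(SW a b).IsElliptic] in
lemma res_coeff {pl : Place (io a b)} (h : pl.Res (xx a b)⁻¹ 0) {q : k[X]} {m : ℕ}
    (hq : q.natDegree ≤ m) : pl.Res (pe a b q * (xx a b)⁻¹ ^ m) (q.coeff m) := by
  have h1 : pe a b q * (xx a b)⁻¹ ^ m =
      ∑ i ∈ Finset.range (m + 1), io a b (q.coeff i) * (xx a b)⁻¹ ^ (m - i) := by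
    conv_lhs => rw [q.as_sum_range' (m + 1) (by omega)]
    rw [map_sum, Finset.sum_mul]
    refine Finset.sum_congr rfl fun i hi => ?_
    rw [← C_mul_X_pow_eq_monomial, map_mul, map_pow, pe_C, pe_X, mul_assoc]
    congr 1
    have hi' : i ≤ m := by simpa [Nat.lt_succ_iff] using hi
    nth_rewrite 1 [← Nat.sub_add_cancel hi']
    rw [pow_add, mul_left_comm, ← mul_pow, mul_inv_cancel₀ xx_ne_zero, one_pow, mul_one]
  have h2 : q.coeff m = ∑ i ∈ Finset.range (m + 1), q.coeff i * 0 ^ (m - i) := by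
    rw [Finset.sum_range_succ, Finset.sum_eq_zero]
    · simp
    · intro i hi
      have : i < m := by simpa using hi
      rw [zero_pow (by omega), mul_zero]
  rw [h1, h2]
  exact pl.sum _ fun i _ => pl.mul (pl.const _) (pl.pow h _)

/-- Translation by `P` on the points over the function field. -/
noncomputable def tpt (P : Pt a b) : Pt (io a b a) (io a b b) →+ Pt (io a b a) (io a b b) :=
  mapPt (th (gam + cst (io a b) P)) (th_io _ _) (th_io _ _)

lemma tpt_gam (P : Pt a b) : tpt P gam = gam + cst (io a b) P := by
  have h := (nc_gam (a := a) (b := b)).add_cst P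
  refine pt_ext ?_ h.ne_zero ?_ ?_
  · rw [Ne, tpt, mapPt_eq_zero]; exact gam_ne_zero
  · rw [tpt, px_mapPt, px_gam, h.th_spec.2.1]
  · rw [tpt, py_mapPt, py_gam, h.th_spec.2.2]

omit [NeZero (2 : k)] in
lemma mapPt_cst {θ : FF a b →+* FF a b} (h : ∀ c, θ (io a b c) = io a b c) (T : Pt a b) :
    mapPt θ (h a) (h b) (cst (io a b) T) = cst (io a b) T := by
  rw [cst, mapPt_mapPt]
  exact mapPt_congr (RingHom.ext h) _ _ _

lemma tpt_cst (P T : Pt a b) : tpt P (cst (io a b) T) = cst (io a b) T := mapPt_cst (th_io _) T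

/-- The endomorphism `ψ` of `E(k)` is given by the odd point `w` of `E(k(E))` and has derivative `c`. -/
structure IsEndo (w : Pt (io a b a) (io a b b)) (ψ : Pt a b →+ Pt a b) (c : k) : Prop where
  mem : w ∈ MM a b
  sp : ∀ P, (plc P).Sp w (ψ P)
  lgd : lg (DD a b) w = io a b c
  tr : ∀ P, tpt P w = w + cst (io a b) (ψ P)

lemma isEndo_gam : IsEndo (gam (a := a) (b := b)) (AddMonoidHom.id _) 1 :=
  ⟨gam_mem_MM, plc_sp_gam, by rw [lg_gam, map_one], tpt_gam⟩

lemma isEndo_zero : IsEndo (0 : Pt (io a b a) (io a b b)) 0 0 :=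
  ⟨zero_mem _, fun P => (plc P).sp_zero, by rw [lg_zero, map_zero],
    fun P => by rw [map_zero, AddMonoidHom.zero_apply, map_zero, add_zero]⟩

namespace IsEndo

variable {w w' : Pt (io a b a) (io a b b)} {ψ ψ' : Pt a b →+ Pt a b} {c c' : k}

lemma add (h : IsEndo w ψ c) (h' : IsEndo w' ψ' c') : IsEndo (w + w') (ψ + ψ') (c + c') :=
  ⟨add_mem h.mem h'.mem, fun P => (h.sp P).add two_ne_zero (h'.sp P), by
    rw [lg_add DD_io two_ne_zero, h.lgd, h'.lgd, map_add],
    fun P => by rw [map_add, h.tr, h'.tr, AddMonoidHom.add_apply, map_add]; abel⟩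

lemma neg (h : IsEndo w ψ c) : IsEndo (-w) (-ψ) (-c) :=
  ⟨neg_mem h.mem, fun P => (h.sp P).neg, by rw [lg_neg DD_io, h.lgd, map_neg],
    fun P => by rw [map_neg, h.tr, AddMonoidHom.neg_apply, map_neg]; abel⟩

lemma sub (h : IsEndo w ψ c) (h' : IsEndo w' ψ' c') : IsEndo (w - w') (ψ - ψ') (c - c') := by
  rw [sub_eq_add_neg, sub_eq_add_neg, sub_eq_add_neg]; exact h.add h'.neg

lemma nsmul (h : IsEndo w ψ c) (n : ℕ) : IsEndo (n • w) (n • ψ) (n * c) := by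
  induction n with
  | zero => simpa using isEndo_zero
  | succ n ih =>
    rw [succ_nsmul, succ_nsmul, Nat.cast_succ, add_mul, one_mul]
    exact ih.add h

lemma zsmul (h : IsEndo w ψ c) (n : ℤ) : IsEndo (n • w) (n • ψ) (n * c) := by
  rcases n with n | n
  · simpa using h.nsmul n
  · rw [negSucc_zsmul, negSucc_zsmul]
    have := (h.nsmul (n + 1)).neg
    convert this using 1
    push_cast; ring

lemma eq_zero_of_height (h : IsEndo w ψ c) (h0 : hh w = 0) : w = 0 ∧ ψ = 0 := by
  obtain ⟨T, rfl⟩ := Ht.eq_cst two_ne_zero h.mem (h0 ▸ hh_spec two_ne_zero h.mem)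
  have hT : ∀ P, ψ P = T := fun P => (h.sp P).unique ((plc P).sp_cst T)
  have : T = 0 := by rw [← hT 0, map_zero]
  subst this
  exact ⟨map_zero _, by ext P : 1; rw [hT]; rfl⟩

lemma ne_zero (h : IsEndo w ψ c) (hc : c ≠ 0) : w ≠ 0 := by
  rintro rfl
  have := h.lgd
  rw [lg_zero] at this
  exact hc ((io a b).injective (by rw [← this, map_zero]))

/-- The differential equation satisfied by the `x`-coordinate of a point. -/
lemma ode (hl : lg (DD a b) w = io a b c) (hw : w ≠ 0) {U V : k[X]}
    (hx : px w * pe a b V = pe a b U) :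
    fpoly a b * (derivative U * V - U * derivative V) ^ 2 =
      C (c ^ 2) * V * (U ^ 3 + C a * U * V ^ 2 + C b * V ^ 3) := by
  apply pe_injective (a := a) (b := b)
  have h1 := (DD a b).div hx
  rw [DD_pe, DD_pe, (lg_spec DD_io two_ne_zero hw).1, hl] at h1
  have h2 := eqn hw
  have h3 : pe a b (fpoly a b) = yy a b ^ 2 := by rw [yy_sq]; exact eval₂_fpoly _ _
  simp only [map_mul, map_pow, map_sub, map_add, pe_C, h3]
  have h4 : yy a b * (pe a b (derivative U) * pe a b V - pe a b U * pe a b (derivative V)) =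
      io a b c * py w * pe a b V ^ 2 := by
    rw [← hx]; linear_combination -(pe a b V) * h1
  calc _ = (yy a b * (pe a b (derivative U) * pe a b V - pe a b U * pe a b (derivative V))) ^ 2 := by
        ring
    _ = io a b c ^ 2 * pe a b V ^ 4 * py w ^ 2 := by rw [h4]; ring
    _ = _ := by rw [h2, ← hx]; ring

end IsEndo

end Endo

section PolyOde

variable {k : Type*} [Field k] {a b : k}

lemma fpoly_rootMultiplicity_le [(SW a b).IsElliptic] (e : k) : (fpoly a b).rootMultiplicity e ≤ 1 := by
  by_contra! h
  rw [one_lt_rootMultiplicity_iff_isRoot (fpoly_ne_zero a b)] at h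
  obtain ⟨h1, h2⟩ := h
  simp only [fpoly, IsRoot.def, derivative_add, derivative_X_pow, derivative_mul, derivative_C,
    derivative_X, eval_add, eval_mul, eval_pow, eval_X, eval_C] at h1 h2
  apply disc_ne_zero (a := a) (b := b)
  have ha : a = -3 * e ^ 2 := by
    simp at h2; linear_combination h2
  have hb : b = 2 * e ^ 3 := by linear_combination h1 - e * ha
  rw [ha, hb]; ring

lemma ode_mult {f U V G : k[X]} {c e : k} (hc : c ≠ 0) (hV : V ≠ 0) (hG : G.eval e ≠ 0)
    (hVe : V.eval e = 0) (hf : f.rootMultiplicity e ≤ 1)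
    (h : f * (derivative U * V - U * derivative V) ^ 2 = C (c ^ 2) * V * G) :
    V.rootMultiplicity e + f.rootMultiplicity e = 2 := by
  set W := derivative U * V - U * derivative V
  have hG0 : G ≠ 0 := by rintro rfl; simp at hG
  have hR : C (c ^ 2) * V * G ≠ 0 :=
    mul_ne_zero (mul_ne_zero (by simpa using hc) hV) hG0
  have hL : f * W ^ 2 ≠ 0 := h ▸ hR
  have hW : W ≠ 0 := by
    rintro e0; rw [e0] at hL; simp at hL
  have h1 := congrArg (rootMultiplicity e) h
  rw [rootMultiplicity_mul hL, rootMultiplicity_mul hR, rootMultiplicity_mul (left_ne_zero_of_mul hR),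
    pow_two, rootMultiplicity_mul (mul_ne_zero hW hW), rootMultiplicity_C,
    rootMultiplicity_eq_zero (p := G) (by simpa [IsRoot] using hG)] at h1
  have h2 : V.rootMultiplicity e - 1 ≤ W.rootMultiplicity e := by
    rw [le_rootMultiplicity_iff hW]
    have hd := pow_rootMultiplicity_dvd V e
    exact dvd_sub (dvd_mul_of_dvd_right ((pow_dvd_pow _ (Nat.sub_le _ _)).trans hd) _)
      (dvd_mul_of_dvd_right (pow_sub_one_dvd_derivative_of_pow_dvd hd) _)
  have h3 : 0 < V.rootMultiplicity e := (rootMultiplicity_pos hV).2 hVe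
  omega

lemma ode_deg {a₀ b₀ : k} {U V : k[X]} {c : k} (hc : c ≠ 0) (hV : V ≠ 0) (hlt : V.natDegree < U.natDegree)
    (h : fpoly a₀ b₀ * (derivative U * V - U * derivative V) ^ 2 =
      C (c ^ 2) * V * (U ^ 3 + C a * U * V ^ 2 + C b * V ^ 3)) :
    U.natDegree = V.natDegree + 1 ∧ U.leadingCoeff * c ^ 2 = V.leadingCoeff := by
  set W := derivative U * V - U * derivative V with hWdef
  set G := U ^ 3 + C a * U * V ^ 2 + C b * V ^ 3 with hGdef
  have hU : U ≠ 0 := by rintro rfl; simp at hlt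
  have hu : U.leadingCoeff ≠ 0 := leadingCoeff_ne_zero.2 hU
  have hv : V.leadingCoeff ≠ 0 := leadingCoeff_ne_zero.2 hV
  obtain ⟨n, hn⟩ : ∃ n, U.natDegree = n := ⟨_, rfl⟩
  obtain ⟨m, hm⟩ : ∃ m, V.natDegree = m := ⟨_, rfl⟩
  rw [hn, hm] at hlt ⊢
  have hG : G.natDegree ≤ 3 * n := by
    refine natDegree_add_le_of_degree_le (natDegree_add_le_of_degree_le ?_ ?_) ?_
    · exact natDegree_pow_le_of_le 3 hn.le
    · refine (natDegree_mul_le' (natDegree_mul_le' (natDegree_C a).le hn.le)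
        (natDegree_pow_le_of_le 2 hm.le)).trans ?_
      omega
    · refine (natDegree_mul_le' (natDegree_C b).le (natDegree_pow_le_of_le 3 hm.le)).trans ?_
      omega
  have hGc : G.coeff (3 * n) = U.leadingCoeff ^ 3 := by
    have e1 : (C a * U * V ^ 2).coeff (3 * n) = 0 := by
      refine coeff_eq_zero_of_natDegree_lt ((natDegree_mul_le' (natDegree_mul_le' (natDegree_C a).le hn.le)
        (natDegree_pow_le_of_le 2 hm.le)).trans_lt ?_)
      omega
    have e2 : (C b * V ^ 3).coeff (3 * n) = 0 := by
      refine coeff_eq_zero_of_natDegree_lt ((natDegree_mul_le' (natDegree_C b).le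
        (natDegree_pow_le_of_le 3 hm.le)).trans_lt ?_)
      omega
    rw [hGdef, coeff_add, coeff_add, e1, e2, coeff_pow_of_natDegree_le hn.le, ← hn, leadingCoeff,
      add_zero, add_zero]
  have hRc : (C (c ^ 2) * V * G).coeff (m + 3 * n) =
      c ^ 2 * V.leadingCoeff * U.leadingCoeff ^ 3 := by
    rw [coeff_mul_add_eq_of_natDegree_le _ hG, hGc, coeff_C_mul, ← hm]; · rfl
    exact (natDegree_C_mul_le _ _).trans hm.le
  have hRc0 : (C (c ^ 2) * V * G).coeff (m + 3 * n) ≠ 0 := by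
    rw [hRc]; exact mul_ne_zero (mul_ne_zero (pow_ne_zero 2 hc) hv) (pow_ne_zero 3 hu)
  have hdU : (derivative U).natDegree ≤ n - 1 := (natDegree_derivative_le U).trans (by omega)
  have hdV : (U * derivative V).natDegree ≤ n + m - 1 := by
    rcases Nat.eq_zero_or_pos m with h0 | h0
    · rw [h0] at hm
      rw [natDegree_eq_zero.1 hm |>.choose_spec.symm]; simp
    · refine (natDegree_mul_le' hn.le ((natDegree_derivative_le V).trans_eq (by rw [hm]))).trans ?_
      omega
  have hW : W.natDegree ≤ n + m - 1 := by
    refine (natDegree_sub_le_of_le ((natDegree_mul_le' hdU hm.le).trans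
      (by omega : _ ≤ n + m - 1)) hdV).trans (max_self _).le
  have hL : (fpoly a₀ b₀ * W ^ 2).natDegree ≤ 3 + 2 * (n + m - 1) :=
    natDegree_mul_le' (fpoly_natDegree a₀ b₀).le (natDegree_pow_le_of_le 2 hW)
  have hnm : n = m + 1 := by
    rw [← h] at hRc0
    have := (le_natDegree_of_ne_zero hRc0).trans hL
    omega
  refine ⟨hnm, ?_⟩
  subst hnm
  have hWc : W.coeff (m + m) = U.leadingCoeff * V.leadingCoeff := by
    rw [hWdef, coeff_sub, coeff_mul_add_eq_of_natDegree_le (by simpa using hdU) hm.le, coeff_derivative]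
    have e1 : (U * derivative V).coeff (m + m) = U.leadingCoeff * (m * V.leadingCoeff) := by
      rcases Nat.eq_zero_or_pos m with h0 | h0
      · rw [h0] at hm
        rw [natDegree_eq_zero.1 hm |>.choose_spec.symm]; simp [h0]
      · rw [show m + m = (m + 1) + (m - 1) by omega,
          coeff_mul_add_eq_of_natDegree_le hn.le ((natDegree_derivative_le V).trans_eq (by rw [hm])),
          coeff_derivative, leadingCoeff, leadingCoeff, hn, hm]
        obtain ⟨m', rfl⟩ : ∃ m', m = m' + 1 := ⟨m - 1, by omega⟩
        simp [add_assoc, mul_comm]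
    rw [e1, leadingCoeff, leadingCoeff, hn, hm]; ring
  have hW' : W.natDegree ≤ m + m := hW.trans (by omega)
  have hLc : (fpoly a₀ b₀ * W ^ 2).coeff (3 + 2 * (m + m)) = (U.leadingCoeff * V.leadingCoeff) ^ 2 := by
    rw [coeff_mul_add_eq_of_natDegree_le (fpoly_natDegree a₀ b₀).le (natDegree_pow_le_of_le 2 hW'),
      coeff_pow_of_natDegree_le hW', hWc]
    have : (fpoly a₀ b₀).coeff 3 = 1 := by
      have := fpoly_monic a₀ b₀
      rwa [Monic, leadingCoeff, fpoly_natDegree] at this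
    rw [this, one_mul]
  rw [h, show 3 + 2 * (m + m) = m + 3 * (m + 1) by ring, hRc] at hLc
  have h5 : U.leadingCoeff ^ 2 * V.leadingCoeff ≠ 0 := mul_ne_zero (pow_ne_zero 2 hu) hv
  apply mul_left_cancel₀ h5
  linear_combination hLc

end PolyOde

section Count

variable {k : Type*} [Field k] [IsAlgClosed k] [NeZero (2 : k)] {a b : k} [(SW a b).IsElliptic]

lemma fiber_px (e : k) : ∃ S : Finset (Pt a b), (∀ P, P ∈ S ↔ P ≠ 0 ∧ px P = e) ∧
    S.card + (fpoly a b).rootMultiplicity e = 2 := by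
  obtain ⟨P, hP, hx⟩ := exists_pt_x (a := a) (b := b) e
  have he := eqn hP
  refine ⟨{P, -P}, fun Q => ?_, ?_⟩
  · rw [Finset.mem_insert, Finset.mem_singleton]
    constructor
    · rintro (rfl | rfl)
      · exact ⟨hP, hx⟩
      · exact ⟨neg_ne_zero.2 hP, by rw [px_neg, hx]⟩
    · rintro ⟨h1, h2⟩
      exact eq_or_eq_neg h1 hP (h2.trans hx.symm)
  · have hev : (fpoly a b).eval e = py P ^ 2 := by
      rw [he, hx]; simp [fpoly]
    have hiff : P = -P ↔ py P = 0 := by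
      rw [eq_neg_iff_add_eq_zero, add_self_eq_zero_iff two_ne_zero]
    by_cases hy : py P = 0
    · have h1 : 0 < (fpoly a b).rootMultiplicity e :=
        (rootMultiplicity_pos (fpoly_ne_zero a b)).2 (by rw [IsRoot, hev, hy]; ring)
      have h2 := fpoly_rootMultiplicity_le (a := a) (b := b) e
      rw [← hiff.2 hy, Finset.pair_eq_singleton, Finset.card_singleton]
      omega
    · rw [Finset.card_pair (fun h => hy (hiff.1 h)), rootMultiplicity_eq_zero]
      rw [IsRoot, hev]; exact pow_ne_zero 2 hy

/-- A polynomial with prescribed multiplicities counts points. -/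
lemma card_of_mult {V : k[X]} (hV : V ≠ 0)
    (h : ∀ e, V.eval e = 0 → V.rootMultiplicity e + (fpoly a b).rootMultiplicity e = 2) :
    {P : Pt a b | P ≠ 0 ∧ V.eval (px P) = 0}.Finite ∧
      {P : Pt a b | P ≠ 0 ∧ V.eval (px P) = 0}.ncard = V.natDegree := by
  choose S hS hc using fiber_px (a := a) (b := b)
  have e : {P : Pt a b | P ≠ 0 ∧ V.eval (px P) = 0} = ↑(V.roots.toFinset.biUnion S) := by
    ext P
    simp only [Set.mem_ofPred_eq, Finset.coe_biUnion, Set.mem_iUnion, Finset.mem_coe,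
      Multiset.mem_toFinset, mem_roots hV, hS, IsRoot]
    constructor
    · rintro ⟨h1, h2⟩; exact ⟨px P, by simpa [hV] using h2, h1, rfl⟩
    · rintro ⟨e, h1, h2, rfl⟩; exact ⟨h2, by simpa [hV] using h1⟩
  rw [e]
  refine ⟨Finset.finite_toSet _, ?_⟩
  rw [Set.ncard_coe_finset, Finset.card_biUnion]
  · rw [← IsAlgClosed.card_roots_eq_natDegree, ← Multiset.toFinset_sum_count_eq]
    refine Finset.sum_congr rfl fun e he => ?_
    have h1 := h e (by simpa [hV] using he)
    have h2 := hc e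
    rw [count_roots]
    omega
  · intro x _ y _ hxy
    rw [Function.onFun, Finset.disjoint_left]
    intro P h1 h2
    exact hxy (((hS x P).1 h1).2.symm.trans ((hS y P).1 h2).2)

variable {w : Pt (io a b a) (io a b b)} {ψ : Pt a b →+ Pt a b} {c : k}

theorem IsEndo.exists_poly (h : IsEndo w ψ c) (hc : c ≠ 0) : ∃ U V : k[X], Prim2 (hh w) U V ∧ V ≠ 0 ∧
    px w * pe a b V = pe a b U ∧ (∀ P, P ≠ 0 → (V.eval (px P) = 0 ↔ ψ P = 0)) ∧
    (∀ P, P ≠ 0 → ψ P ≠ 0 → U.eval (px P) = px (ψ P) * V.eval (px P)) ∧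
    U.natDegree = hh w ∧ U.natDegree = V.natDegree + 1 ∧ U.leadingCoeff * c ^ 2 = V.leadingCoeff ∧
    ∀ e, V.eval e = 0 → V.rootMultiplicity e + (fpoly a b).rootMultiplicity e = 2 := by
  have hw := h.ne_zero hc
  obtain ⟨U, V, hp, hx⟩ := hh_spec two_ne_zero h.mem
  rcases hx with ⟨h0, -⟩ | ⟨-, hV, hx⟩
  · exact absurd h0 hw
  have hV0 : V ≠ 0 := by rintro rfl; simp at hV
  have hode := IsEndo.ode h.lgd hw hx
  have hx' : px w = pe a b U / pe a b V := by rw [← hx, mul_div_cancel_right₀ _ hV]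
  have hiff : ∀ P, P ≠ 0 → (V.eval (px P) = 0 ↔ ψ P = 0) := by
    intro P hP
    have r1 := plc_pe hP U
    have r2 := plc_pe hP V
    constructor
    · intro h0
      have hU : U.eval (px P) ≠ 0 := fun h => hp.2.2 _ ⟨h, h0⟩
      have r3 := (plc P).div r2 r1 hU
      rw [h0, zero_div] at r3
      have hne : pe a b U ≠ 0 := (plc P).ne_zero_of_res r1 hU
      refine (h.sp P).unique (.inr ⟨rfl, .inr ⟨?_, ?_⟩⟩)
      · rw [hx']; exact div_ne_zero hne hV
      · rw [hx', inv_div]; exact r3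
    · intro h0
      by_contra hne
      have r3 := (plc P).div r1 r2 hne
      rw [← hx'] at r3
      rcases h.sp P with ⟨-, h1, -⟩ | ⟨-, h1 | ⟨h1, h2⟩⟩
      · exact h1 h0
      · exact hw h1
      · exact (plc P).not_res_inv h1 r3 h2
  have hval : ∀ P, P ≠ 0 → ψ P ≠ 0 → U.eval (px P) = px (ψ P) * V.eval (px P) := by
    intro P hP hψ
    rcases h.sp P with ⟨-, -, h1, -⟩ | ⟨h1, -⟩
    · have := (plc P).mul h1 (plc_pe hP V)
      rw [hx] at this
      exact (plc P).uniq (plc_pe hP U) this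
    · exact absurd h1 hψ
  have hlt : V.natDegree < U.natDegree := by
    by_contra! hle
    have r1 := res_coeff (plc_zero_xx (a := a) (b := b)) hle
    have r2 := res_coeff (plc_zero_xx (a := a) (b := b)) (le_refl V.natDegree)
    have r3 := (plc 0).div r1 r2 (leadingCoeff_ne_zero.2 hV0)
    rw [mul_div_mul_right _ _ (pow_ne_zero _ (inv_ne_zero xx_ne_zero)), ← hx'] at r3
    have hs := h.sp 0
    rw [map_zero] at hs
    rcases hs with ⟨-, h1, -⟩ | ⟨-, h1 | ⟨h1, h2⟩⟩
    · exact h1 rfl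
    · exact hw h1
    · exact (plc 0).not_res_inv h1 r3 h2
  obtain ⟨d1, d2⟩ := ode_deg hc hV0 hlt hode
  refine ⟨U, V, hp, hV0, hx, hiff, hval, ?_, d1, d2, fun e he => ?_⟩
  · by_contra hne
    refine hp.2.1 ⟨coeff_eq_zero_of_natDegree_lt ?_, coeff_eq_zero_of_natDegree_lt ?_⟩
    · exact lt_of_le_of_ne hp.1.1 hne
    · exact hlt.trans_le hp.1.1
  · refine ode_mult hc hV0 ?_ he (fpoly_rootMultiplicity_le e) hode
    have hU : U.eval e ≠ 0 := fun h => hp.2.2 _ ⟨h, he⟩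
    simpa [he] using hU

theorem IsEndo.ker_card (h : IsEndo w ψ c) (hc : c ≠ 0) :
    Finite ψ.ker ∧ Nat.card ψ.ker = hh w := by
  obtain ⟨U, V, hp, hV0, -, hiff, -, d0, d1, d2, hm⟩ := h.exists_poly hc
  obtain ⟨f1, f2⟩ := card_of_mult hV0 hm
  have e : (ψ.ker : Set (Pt a b)) = insert 0 {P : Pt a b | P ≠ 0 ∧ V.eval (px P) = 0} := by
    ext P
    simp only [SetLike.mem_coe, AddMonoidHom.mem_ker, Set.mem_insert_iff, Set.mem_ofPred_eq]
    by_cases hP : P = 0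
    · simp [hP]
    · simp [hP, hiff P hP]
  have hfin : (ψ.ker : Set (Pt a b)).Finite := by rw [e]; exact f1.insert 0
  refine ⟨hfin, ?_⟩
  change (ψ.ker : Set (Pt a b)).ncard = _
  rw [e, Set.ncard_insert_of_notMem (by simp) f1, f2, ← d0, d1]

theorem IsEndo.surjective (h : IsEndo w ψ c) (hc : c ≠ 0) : Function.Surjective ψ := by
  obtain ⟨U, V, hp, hV0, -, hiff, hval, d0, d1, d2, hm⟩ := h.exists_poly hc
  intro Q
  by_cases hQ : Q = 0
  · exact ⟨0, by rw [map_zero, hQ]⟩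
  have hd : (U - C (px Q) * V).natDegree = U.natDegree := by
    apply natDegree_sub_eq_left_of_natDegree_lt
    exact (natDegree_C_mul_le _ _).trans_lt (by omega)
  obtain ⟨e, he⟩ := IsAlgClosed.exists_root (U - C (px Q) * V)
    (fun h0 => by have := natDegree_eq_of_degree_eq_some (n := 0) h0; omega)
  simp only [IsRoot, eval_sub, eval_mul, eval_C, sub_eq_zero] at he
  obtain ⟨P, hP, rfl⟩ := exists_pt_x (a := a) (b := b) e
  have hVe : V.eval (px P) ≠ 0 := fun h0 => hp.2.2 _ ⟨by rw [he, h0, mul_zero], h0⟩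
  have hψ : ψ P ≠ 0 := fun h0 => hVe ((hiff P hP).2 h0)
  have h1 := hval P hP hψ
  rw [he] at h1
  have h2 := mul_right_cancel₀ hVe h1
  rcases eq_or_eq_neg hψ hQ h2.symm with h3 | h3
  · exact ⟨P, h3⟩
  · exact ⟨-P, by rw [map_neg, h3, neg_neg]⟩

lemma hh_gam : hh (gam (a := a) (b := b)) = 1 := (ht_gam (a := a) (b := b)).hh_eq two_ne_zero

lemma hh_zsmul {w : Pt (io a b a) (io a b b)} (hw : w ∈ MM a b) (n : ℤ) :
    (hh (n • w) : ℤ) = n ^ 2 * hh w :=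
  quad_zsmul (qh_parallelogram two_ne_zero) n (⟨w, hw⟩ : MM a b)

theorem torsion_card {n : ℕ} (hn : (n : k) ≠ 0) :
    Finite (nsmulAddMonoidHom (α := Pt a b) n).ker ∧
      Nat.card (nsmulAddMonoidHom (α := Pt a b) n).ker = n ^ 2 := by
  have h := (isEndo_gam (a := a) (b := b)).nsmul n
  have e : n • AddMonoidHom.id (Pt a b) = nsmulAddMonoidHom n := by ext P : 1; simp
  rw [e, mul_one] at h
  have := h.ker_card hn
  refine ⟨this.1, this.2.trans ?_⟩
  have h2 := hh_zsmul (gam_mem_MM (a := a) (b := b)) n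
  rw [hh_gam] at h2
  have h3 : (n : ℤ) • gam (a := a) (b := b) = n • gam := natCast_zsmul _ _
  rw [h3] at h2
  exact_mod_cast h2.trans (mul_one _)

theorem nsmul_surjective {n : ℕ} (hn : (n : k) ≠ 0) (Q : Pt a b) : ∃ P, n • P = Q := by
  have h := (isEndo_gam (a := a) (b := b)).nsmul n
  obtain ⟨P, hP⟩ := h.surjective (by simpa using hn) Q
  exact ⟨P, by simpa using hP⟩

end Count

section Frob

variable {k : Type*} [Field k] {a b : k} {p : ℕ} [Fact p.Prime] [CharP k p]

instance charP_FF : CharP (FF a b) p := charP_of_injective_ringHom (io a b).injective p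

variable [IsAlgClosed k] [NeZero (2 : k)] [(SW a b).IsElliptic] (ha : a ^ p = a) (hb : b ^ p = b)

variable (p) in
/-- Frobenius on constant points. -/
noncomputable def frk : Pt a b →+ Pt a b :=
  mapPt (frobenius k p) (by rw [frobenius_def, ha]) (by rw [frobenius_def, hb])

variable (p) in
/-- Frobenius on points over the function field. -/
noncomputable def frF : Pt (io a b a) (io a b b) →+ Pt (io a b a) (io a b b) :=
  mapPt (frobenius (FF a b) p) (by rw [frobenius_def, ← map_pow, ha])
    (by rw [frobenius_def, ← map_pow, hb])

lemma frF_mem {w : Pt (io a b a) (io a b b)} (hw : w ∈ MM a b) : frF p ha hb w ∈ MM a b := by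
  rw [mem_MM] at hw ⊢
  rw [← map_neg, ← hw, frF, mapPt_mapPt, mapPt_mapPt]
  refine mapPt_congr ?_ _ _ _
  refine RingHom.ext fun x => ?_
  simp [frobenius_def]

lemma ht_frF {w : Pt (io a b a) (io a b b)} {d : ℕ} (h : Ht w d) : Ht (frF p ha hb w) (p * d) := by
  have hp : p ≠ 0 := (Fact.out : p.Prime).ne_zero
  obtain ⟨U, V, ⟨h1, h2, h3⟩, hx⟩ := h
  refine ⟨U ^ p, V ^ p, ⟨⟨natDegree_pow_le_of_le p h1.1, natDegree_pow_le_of_le p h1.2⟩, ?_, ?_⟩, ?_⟩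
  · rintro ⟨e1, e2⟩
    rw [coeff_pow_of_natDegree_le h1.1] at e1
    rw [coeff_pow_of_natDegree_le h1.2] at e2
    exact h2 ⟨pow_eq_zero_iff hp |>.1 e1, pow_eq_zero_iff hp |>.1 e2⟩
  · rintro c ⟨e1, e2⟩
    rw [eval_pow] at e1 e2
    exact h3 c ⟨pow_eq_zero_iff hp |>.1 e1, pow_eq_zero_iff hp |>.1 e2⟩
  · rw [map_pow, map_pow]
    rcases hx with ⟨rfl, e1, e2⟩ | ⟨e0, e1, e2⟩
    · exact .inl ⟨map_zero _, by rw [e1, zero_pow hp], pow_ne_zero p e2⟩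
    · refine .inr ⟨by rwa [Ne, frF, mapPt_eq_zero], pow_ne_zero p e1, ?_⟩
      rw [frF, px_mapPt, frobenius_def, ← mul_pow, e2]

lemma sp_frob {pl : Place (io a b)} {w : Pt (io a b a) (io a b b)} {Q : Pt a b} (h : pl.Sp w Q) :
    pl.Sp (frF p ha hb w) (frk p ha hb Q) := by
  have hp : p ≠ 0 := (Fact.out : p.Prime).ne_zero
  rcases h with ⟨h1, h2, h3, h4⟩ | ⟨rfl, rfl | ⟨h1, h2⟩⟩
  · refine .inl ⟨by rwa [Ne, frF, mapPt_eq_zero], by rwa [Ne, frk, mapPt_eq_zero], ?_, ?_⟩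
    · rw [frF, frk, px_mapPt, px_mapPt]; exact pl.pow h3 p
    · rw [frF, frk, py_mapPt, py_mapPt]; exact pl.pow h4 p
  · rw [map_zero, map_zero]; exact pl.sp_zero
  · rw [map_zero]
    refine .inr ⟨rfl, .inr ⟨?_, ?_⟩⟩
    · rw [frF, px_mapPt, frobenius_def]; exact pow_ne_zero p h1
    · rw [frF, px_mapPt, frobenius_def, ← inv_pow]
      simpa [hp] using pl.pow h2 p

lemma isEndo_frob {w : Pt (io a b a) (io a b b)} {ψ : Pt a b →+ Pt a b} {c : k} (h : IsEndo w ψ c) :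
    IsEndo (frF p ha hb w) ((frk p ha hb).comp ψ) 0 := by
  refine ⟨frF_mem ha hb h.mem, fun P => sp_frob ha hb (h.sp P), ?_, fun P => ?_⟩
  swap
  · have e : ∀ u : Pt (io a b a) (io a b b), tpt P (frF p ha hb u) = frF p ha hb (tpt P u) := by
      intro u
      rw [frF, tpt, mapPt_mapPt, mapPt_mapPt]
      exact mapPt_congr (RingHom.ext fun x => by simp [frobenius_def]) _ _ _
    rw [e, h.tr, map_add]
    congr 1
    rw [frF, cst, mapPt_mapPt, AddMonoidHom.comp_apply, frk, mapPt_mapPt]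
    exact mapPt_congr (RingHom.ext fun x => by simp [frobenius_def]) _ _ _
  rw [lg, frF, px_mapPt, frobenius_def, Der.pow, CharP.cast_eq_zero]
  simp

/-- The characteristic equation of Frobenius, in terms of the number of fixed points. -/
theorem frob_char : Finite (AddMonoidHom.id (Pt a b) - frk p ha hb).ker ∧
    ∀ t : ℤ, t = p + 1 - Nat.card (AddMonoidHom.id (Pt a b) - frk p ha hb).ker →
    ∃ (w : Pt (io a b a) (io a b b)) (ψ : Pt a b →+ Pt a b), IsEndo w ψ (-t : k) ∧
      (∀ P, ψ (ψ P) = (t ^ 2 - 4 * p) • P) ∧ (hh w : ℤ) = 4 * p - t ^ 2 := by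
  set g := gam (a := a) (b := b)
  set F := frk (a := a) (b := b) p ha hb
  set G := frF (a := a) (b := b) p ha hb
  have i1 : IsEndo g (AddMonoidHom.id _) (1 : k) := isEndo_gam
  have i2 : IsEndo (G g) F 0 := by simpa using isEndo_frob ha hb i1
  have i3 : IsEndo (G (G g)) (F.comp F) 0 := isEndo_frob ha hb i2
  have i4 := i1.sub i2
  rw [sub_zero] at i4
  obtain ⟨fin, hN⟩ := i4.ker_card one_ne_zero
  refine ⟨fin, fun t ht => ?_⟩
  rw [hN] at ht
  have hq := qh_parallelogram (a := a) (b := b) (two_ne_zero (α := k))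
  let e1 : MM a b := ⟨g, i1.mem⟩
  let e2 : MM a b := ⟨G g, i2.mem⟩
  let e3 : MM a b := ⟨G (G g), i3.mem⟩
  have hG : ∀ x y : MM a b, (y : Pt _ _) = G x → qh y = p * qh x := by
    intro x y h
    have := (ht_frF ha hb (hh_spec two_ne_zero x.2)).hh_eq two_ne_zero
    unfold qh
    rw [h]; exact_mod_cast this
  have q1 : qh e1 = 1 := by
    have := hh_gam (a := a) (b := b)
    unfold qh; exact_mod_cast this
  have q2 : qh e2 = p := by rw [hG e1 e2 rfl, q1, mul_one]
  have q3 : qh e3 = p * p := by rw [hG e2 e3 rfl, q2]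
  have p12 : pol qh e1 e2 = t := by
    have h1 := quad_add hq e1 (-e2)
    have h2 : pol qh e1 (-e2) = - pol qh e1 e2 := by
      have := pol_zsmul_right hq (-1) e1 e2
      simpa using this
    rw [h2, quad_neg hq, q1, q2] at h1
    have h3 : qh (e1 + -e2) = hh (g - G g) := by
      unfold qh; rw [sub_eq_add_neg]; rfl
    rw [h3] at h1
    linarith
  have p23 : pol qh e2 e3 = p * t := by
    have h1 := quad_add hq e2 e3
    rw [hG (e1 + e2) (e2 + e3) (by simp [e1, e2, e3]), quad_add hq e1 e2, q1, q2, q3, p12] at h1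
    linarith
  have p13 : pol qh e1 e3 = t ^ 2 - 2 * p := by
    have j := (i4.sub (i2.sub i3))
    rw [sub_zero, sub_zero] at j
    have hc := (j.ker_card one_ne_zero).2
    have ecomp : AddMonoidHom.id (Pt a b) - F - (F - F.comp F) =
        (AddMonoidHom.id (Pt a b) - F).comp (AddMonoidHom.id (Pt a b) - F) := by
      ext P : 1; simp
    have hcard : Nat.card (AddMonoidHom.id (Pt a b) - F - (F - F.comp F)).ker =
        hh (g - G g) * hh (g - G g) := by
      rw [ecomp, ← hN]
      set ψ := AddMonoidHom.id (Pt a b) - F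
      have hs : Function.Surjective ψ := i4.surjective one_ne_zero
      let f : (ψ.comp ψ).ker →+ ψ.ker :=
        (ψ.comp (ψ.comp ψ).ker.subtype).codRestrict ψ.ker (fun x => x.2)
      have hf : Function.Surjective f := by
        rintro ⟨y, hy⟩
        obtain ⟨x, rfl⟩ := hs y
        exact ⟨⟨x, hy⟩, rfl⟩
      have hk : Nat.card f.ker = Nat.card ψ.ker := by
        refine Nat.card_congr ⟨fun x => ⟨x.1.1, ?_⟩, fun x => ⟨⟨x.1, ?_⟩, ?_⟩, ?_, ?_⟩
        · have := x.2
          rw [AddMonoidHom.mem_ker] at this ⊢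
          exact congrArg Subtype.val this
        · have := x.2
          rw [AddMonoidHom.mem_ker] at this ⊢
          simp [this]
        · have := x.2
          rw [AddMonoidHom.mem_ker] at this ⊢
          exact Subtype.ext this
        · intro x; rfl
        · intro x; rfl
      have := AddSubgroup.card_eq_card_quotient_mul_card_addSubgroup f.ker
      rw [this, hk, Nat.card_congr (QuotientAddGroup.quotientKerEquivOfSurjective f hf).toEquiv]
    rw [hcard] at hc
    have h1 : qh (e1 - e2 - (e2 - e3)) = (hh (g - G g) : ℤ) * hh (g - G g) := by
      unfold qh; exact_mod_cast hc.symm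
    have h2 : e1 - e2 - (e2 - e3) = (e1 + e3) + (-2 : ℤ) • e2 := by
      rw [neg_zsmul, two_zsmul]; abel
    rw [h2, quad_add hq, quad_add hq, pol_add_left hq, pol_zsmul_right hq, pol_zsmul_right hq,
      pol_comm hq e3 e2, quad_zsmul hq, q1, q2, q3, p12, p23] at h1
    have h3 : (hh (g - G g) : ℤ) = p + 1 - t := by linarith
    rw [h3] at h1
    linarith
  have hrel : ∀ P, F (F P) = t • F P - (p : ℤ) • P := by
    have j := (i3.add (i2.zsmul (-t))).add (i1.zsmul p)
    have h0 : qh (e3 + (-t) • e2 + (p : ℤ) • e1) = 0 := by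
      rw [quad_add hq, quad_add hq, pol_add_left hq, pol_zsmul_right hq, pol_zsmul_right hq,
        pol_zsmul_right hq, pol_zsmul_left hq, pol_comm hq e3 e2, pol_comm hq e3 e1,
        pol_comm hq e2 e1, quad_zsmul hq, quad_zsmul hq, q1, q2, q3, p12, p23, p13]
      ring
    have h1 : hh (G (G g) + (-t) • G g + (p : ℤ) • g) = 0 := by
      unfold qh at h0; exact_mod_cast h0
    have h2 := (j.eq_zero_of_height h1).2
    intro P
    have h3 := DFunLike.congr_fun h2 P
    simp only [AddMonoidHom.add_apply, AddMonoidHom.coe_comp, Function.comp_apply,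
      AddMonoidHom.smul_apply, AddMonoidHom.id_apply, AddMonoidHom.zero_apply, neg_zsmul,
      AddMonoidHom.neg_apply] at h3
    rw [← sub_eq_zero, ← h3]; abel
  refine ⟨(2 : ℤ) • G g + (-t) • g, (2 : ℤ) • F + (-t) • AddMonoidHom.id _, ?_, ?_, ?_⟩
  · have := (i2.zsmul 2).add (i1.zsmul (-t))
    convert this using 1
    push_cast; ring
  · intro P
    simp only [AddMonoidHom.add_apply, AddMonoidHom.smul_apply, AddMonoidHom.id_apply, map_add,
      map_zsmul, hrel]
    module
  · have h1 : qh ((2 : ℤ) • e2 + (-t) • e1) = 4 * p - t ^ 2 := by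
      rw [quad_add hq, pol_zsmul_right hq, pol_zsmul_left hq, pol_comm hq, quad_zsmul hq,
        quad_zsmul hq, q1, q2, p12]
      ring
    unfold qh at h1; exact h1

end Frob

section Fixed

variable {p : ℕ} [Fact p.Prime]

lemma affinePoints_eq (a b : ZMod p) :
    affinePoints p a b = Nat.card {xy : ZMod p × ZMod p // xy.2 ^ 2 = xy.1 ^ 3 + a * xy.1 + b} := by
  rw [Nat.card_eq_fintype_card, Fintype.card_subtype, affinePoints]
  refine Finset.card_bij (fun xy _ => ((xy.1 : ZMod p), (xy.2 : ZMod p))) ?_ ?_ ?_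
  · intro xy h
    rw [Finset.mem_filter] at h
    exact Finset.mem_filter.2 ⟨Finset.mem_univ _, h.2⟩
  · intro x hx y hy h
    rw [Finset.mem_filter, Finset.mem_product, Finset.mem_range, Finset.mem_range] at hx hy
    have h' := Prod.mk.inj h
    rw [ZMod.natCast_eq_natCast_iff, ZMod.natCast_eq_natCast_iff] at h'
    exact Prod.ext (h'.1.eq_of_lt_of_lt hx.1.1 hy.1.1) (h'.2.eq_of_lt_of_lt hx.1.2 hy.1.2)
  · intro xy h
    have hp := (Fact.out : p.Prime).pos
    refine ⟨(xy.1.val, xy.2.val), ?_, ?_⟩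
    · rw [Finset.mem_filter, Finset.mem_product, Finset.mem_range, Finset.mem_range]
      refine ⟨⟨xy.1.val_lt, xy.2.val_lt⟩, ?_⟩
      simpa using (Finset.mem_filter.1 h).2
    · simp

variable {k : Type*} [Field k] [IsAlgClosed k] [NeZero (2 : k)] [CharP k p] [Algebra (ZMod p) k]

lemma pow_eq_self_iff (x : k) : x ^ p = x ↔ ∃ u : ZMod p, algebraMap (ZMod p) k u = x := by
  constructor
  · intro h
    have h1 : (Finset.univ.image (algebraMap (ZMod p) k)).card = p := by
      rw [Finset.card_image_of_injective _ (algebraMap (ZMod p) k).injective, Finset.card_univ,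
        ZMod.card]
    have hp := (Fact.out : p.Prime).one_lt
    have h0 : (X ^ p - X : k[X]) ≠ 0 := FiniteField.X_pow_card_sub_X_ne_zero k hp
    have h2 : Finset.univ.image (algebraMap (ZMod p) k) = (X ^ p - X : k[X]).roots.toFinset := by
      refine Finset.eq_of_subset_of_card_le ?_ ?_
      · intro y hy
        obtain ⟨u, -, rfl⟩ := Finset.mem_image.1 hy
        rw [Multiset.mem_toFinset, mem_roots h0]
        simp [← map_pow]
      · rw [h1]
        refine (Multiset.toFinset_card_le _).trans ((card_roots' _).trans ?_)
        rw [FiniteField.X_pow_card_sub_X_natDegree_eq k hp]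
    have h3 : x ∈ (X ^ p - X : k[X]).roots.toFinset := by
      rw [Multiset.mem_toFinset, mem_roots h0]; simp [h]
    rw [← h2] at h3
    obtain ⟨u, -, hu⟩ := Finset.mem_image.1 h3
    exact ⟨u, hu⟩
  · rintro ⟨u, rfl⟩
    rw [← map_pow, ZMod.pow_card]

variable {a b : k} [(SW a b).IsElliptic] (ha : a ^ p = a) (hb : b ^ p = b)

/-- The fixed points of Frobenius are the rational points. -/
theorem card_fixed {a₀ b₀ : ZMod p} (ha₀ : algebraMap (ZMod p) k a₀ = a)
    (hb₀ : algebraMap (ZMod p) k b₀ = b) :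
    Nat.card (AddMonoidHom.id (Pt a b) - frk p ha hb).ker = affinePoints p a₀ b₀ + 1 := by
  rw [affinePoints_eq, ← Finite.card_option]
  symm
  set ι := algebraMap (ZMod p) k
  have hker : ∀ P : Pt a b, P ∈ (AddMonoidHom.id (Pt a b) - frk p ha hb).ker ↔ frk p ha hb P = P := by
    intro P
    rw [AddMonoidHom.mem_ker, AddMonoidHom.sub_apply, AddMonoidHom.id_apply, sub_eq_zero, eq_comm]
  have heq : ∀ x y : ZMod p, y ^ 2 = x ^ 3 + a₀ * x + b₀ ↔ ι y ^ 2 = ι x ^ 3 + a * ι x + b := by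
    intro x y
    rw [← ha₀, ← hb₀, ← map_pow, ← map_pow, ← map_mul, ← map_add, ← map_add, ι.injective.eq_iff]
  let f : Option {xy : ZMod p × ZMod p // xy.2 ^ 2 = xy.1 ^ 3 + a₀ * xy.1 + b₀} →
      (AddMonoidHom.id (Pt a b) - frk p ha hb).ker := fun o => match o with
    | none => 0
    | some xy => ⟨mkP (ι xy.1.1) (ι xy.1.2) ((heq _ _).1 xy.2), by
        rw [hker]
        refine pt_ext ?_ (mkP_ne_zero _ _ _) ?_ ?_
        · rw [Ne, frk, mapPt_eq_zero]; exact mkP_ne_zero _ _ _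
        · rw [frk, px_mapPt, px_mkP, frobenius_def, ← map_pow, ZMod.pow_card]
        · rw [frk, py_mapPt, py_mkP, frobenius_def, ← map_pow, ZMod.pow_card]⟩
  refine Nat.card_eq_of_bijective f ⟨?_, ?_⟩
  · rintro (_ | x) (_ | y) h
    · rfl
    · exact absurd (congrArg Subtype.val h).symm
        (mkP_ne_zero _ _ ((heq _ _).1 y.2))
    · exact absurd (congrArg Subtype.val h) (mkP_ne_zero _ _ ((heq _ _).1 x.2))
    · have h' := congrArg Subtype.val h
      have h1 := congrArg px h'
      have h2 := congrArg py h'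
      simp only [f, px_mkP, py_mkP] at h1 h2
      exact congrArg some (Subtype.ext (Prod.ext (ι.injective h1) (ι.injective h2)))
  · rintro ⟨P, hP⟩
    by_cases h0 : P = 0
    · exact ⟨none, Subtype.ext h0.symm⟩
    · have h1 := (hker P).1 hP
      obtain ⟨x, hx⟩ := (pow_eq_self_iff (p := p) (px P)).1 (by
        have := congrArg px h1
        rwa [frk, px_mapPt] at this)
      obtain ⟨y, hy⟩ := (pow_eq_self_iff (p := p) (py P)).1 (by
        have := congrArg py h1
        rwa [frk, py_mapPt] at this)
      have e := eqn h0
      rw [← hx, ← hy] at e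
      refine ⟨some ⟨(x, y), (heq _ _).2 e⟩, Subtype.ext ?_⟩
      exact pt_ext (mkP_ne_zero _ _ e) h0 hx hy

end Fixed

namespace Place

variable {k F : Type*} [Field k] [Field F] {ι : k →+* F} (pl : Place ι)

/-- Elements which are regular at a place. -/
def Reg : Subring F where
  carrier := {x | ∃ c, pl.Res x c}
  mul_mem' := fun ⟨c, hc⟩ ⟨d, hd⟩ => ⟨c * d, pl.mul hc hd⟩
  one_mem' := ⟨1, pl.one⟩
  add_mem' := fun ⟨c, hc⟩ ⟨d, hd⟩ => ⟨c + d, pl.add hc hd⟩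
  zero_mem' := ⟨0, pl.zero⟩
  neg_mem' := fun ⟨c, hc⟩ => ⟨-c, pl.neg hc⟩

lemma const_mem (c : k) : ι c ∈ pl.Reg := ⟨c, pl.const c⟩

end Place

section Even

variable {k : Type*} [Field k] [IsAlgClosed k] [NeZero (2 : k)] {a b : k}

lemma even_repr {ξ : FF a b} (h : cj ξ = ξ) :
    ∃ U V : k[X], IsCoprime U V ∧ V ≠ 0 ∧ ξ * pe a b V = pe a b U := by
  obtain ⟨A, B, rfl⟩ := exists_repr ξ
  rw [map_add, map_mul, cj_emb, cj_emb, cj_yy] at h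
  have h2 : emb a b B * yy a b = 0 := by
    have h3 : (2 : FF a b) * (emb a b B * yy a b) = 0 := by linear_combination -h
    exact (mul_eq_zero.1 h3).resolve_left two_ne_zero
  refine ⟨A.num, A.denom, A.isCoprime_num_denom, A.denom_ne_zero, ?_⟩
  rw [h2, add_zero, pe_eq, pe_eq, ← map_mul]
  congr 1
  have := A.num_div_denom
  nth_rewrite 1 [← this]
  rw [div_mul_cancel₀]
  exact (map_ne_zero_iff _ (RatFunc.algebraMap_injective k)).2 A.denom_ne_zero

lemma pe_ne_zero {V : k[X]} (h : V ≠ 0) : pe a b V ≠ 0 := (map_ne_zero_iff _ pe_injective).2 h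

/-- Rational functions of `x` of nonpositive degree. -/
def EvReg (ξ : FF a b) : Prop :=
  ∃ U V : k[X], V ≠ 0 ∧ ξ * pe a b V = pe a b U ∧ U.natDegree ≤ V.natDegree

lemma EvReg.reg {ξ : FF a b} (h : EvReg ξ) {pl : Place (io a b)} (hpl : pl.Res (xx a b)⁻¹ 0) :
    ξ ∈ pl.Reg := by
  obtain ⟨U, V, hV, hx, hd⟩ := h
  have h1 := res_coeff hpl hd
  have h2 := res_coeff hpl (le_refl V.natDegree)
  have h3 : V.coeff V.natDegree ≠ 0 := leadingCoeff_ne_zero.2 hV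
  have h4 := pl.div h1 h2 h3
  rw [mul_div_mul_right _ _ (pow_ne_zero _ (inv_ne_zero xx_ne_zero)), ← hx,
    mul_div_cancel_right₀ _ (pe_ne_zero hV)] at h4
  exact ⟨_, h4⟩

lemma evReg_of_reg {ξ : FF a b} {pl : Place (io a b)} (hpl : pl.Res (xx a b)⁻¹ 0)
    (h : ξ ∈ pl.Reg) {U V : k[X]} (hV : V ≠ 0) (hx : ξ * pe a b V = pe a b U) :
    U.natDegree ≤ V.natDegree := by
  by_contra! hlt
  obtain ⟨c, hc⟩ := h
  have hU : U ≠ 0 := by rintro rfl; simp at hlt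
  have h1 := res_coeff hpl hlt.le
  have h2 := res_coeff hpl (le_refl U.natDegree)
  have h3 : U.coeff U.natDegree ≠ 0 := leadingCoeff_ne_zero.2 hU
  rw [coeff_eq_zero_of_natDegree_lt hlt] at h1
  rw [← hx, mul_assoc] at h2
  have h4 := pl.mul hc h1
  rw [mul_zero] at h4
  exact h3 (pl.uniq h2 h4)

lemma evReg_of_even {ξ : FF a b} (he : cj ξ = ξ) {pl : Place (io a b)} (hpl : pl.Res (xx a b)⁻¹ 0)
    (h : ξ ∈ pl.Reg) : EvReg ξ := by
  obtain ⟨U, V, -, hV, hx⟩ := even_repr he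
  exact ⟨U, V, hV, hx, evReg_of_reg hpl h hV hx⟩

lemma EvReg.sub {ξ η : FF a b} (h : EvReg ξ) (h' : EvReg η) : EvReg (ξ - η) := by
  obtain ⟨U, V, hV, hx, hd⟩ := h
  obtain ⟨U', V', hV', hx', hd'⟩ := h'
  refine ⟨U * V' - U' * V, V * V', mul_ne_zero hV hV', ?_, ?_⟩
  · rw [map_sub, map_mul, map_mul, map_mul, ← hx, ← hx']; ring
  · rw [natDegree_mul hV hV']
    refine (natDegree_sub_le _ _).trans (max_le ?_ ?_)
    · exact natDegree_mul_le.trans (by omega)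
    · exact natDegree_mul_le.trans (by omega)

lemma EvReg.expand {ξ : FF a b} (h : EvReg ξ) : ∃ (s : k) (σ : FF a b), EvReg σ ∧
    ξ = io a b s + σ * (xx a b)⁻¹ := by
  obtain ⟨U, V, hV, hx, hd⟩ := h
  have h3 : V.coeff V.natDegree ≠ 0 := leadingCoeff_ne_zero.2 hV
  set s := U.coeff V.natDegree / V.coeff V.natDegree with hs
  refine ⟨s, (ξ - io a b s) * xx a b, ⟨(U - C s * V) * X, V, hV, ?_, ?_⟩, ?_⟩
  · rw [map_mul, map_sub, map_mul, pe_C, pe_X, ← hx]; ring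
  · by_cases h0 : U - C s * V = 0
    · rw [h0, zero_mul, natDegree_zero]; exact Nat.zero_le _
    · rw [natDegree_mul_X h0, Nat.succ_le_iff]
      by_contra! hle
      have hle' : (U - C s * V).natDegree = V.natDegree := le_antisymm
        ((natDegree_sub_le _ _).trans (max_le hd (natDegree_C_mul_le _ _))) hle
      have := leadingCoeff_ne_zero.2 h0
      rw [leadingCoeff, hle', coeff_sub, coeff_C_mul, hs, div_mul_cancel₀ _ h3, sub_self] at this
      exact this rfl
  · rw [mul_inv_cancel_right₀ xx_ne_zero]; ring

lemma EvReg.deriv {ξ : FF a b} (h : EvReg ξ) : ∃ ρ : FF a b, EvReg ρ ∧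
    DD a b ξ * xx a b = ρ * yy a b := by
  obtain ⟨U, V, hV, hx, hd⟩ := h
  have hV' := pe_ne_zero (a := a) (b := b) hV
  refine ⟨DD a b ξ * xx a b / yy a b, ⟨(derivative U * V - U * derivative V) * X, V ^ 2,
    pow_ne_zero 2 hV, ?_, ?_⟩, by rw [div_mul_cancel₀ _ yy_ne_zero]⟩
  · have h1 := (DD a b).div hx
    rw [DD_pe, DD_pe] at h1
    rw [div_mul_eq_mul_div, div_eq_iff yy_ne_zero, map_mul, map_sub, map_mul, map_mul, map_pow, pe_X,
      ← hx]
    linear_combination xx a b * pe a b V * h1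
  · rw [natDegree_pow]
    by_cases h0 : derivative U * V - U * derivative V = 0
    · rw [h0, zero_mul, natDegree_zero]; exact Nat.zero_le _
    · rw [natDegree_mul_X h0]
      have e1 : (derivative U * V - U * derivative V).natDegree + 1 ≤ U.natDegree + V.natDegree := by
        by_cases hz : U.natDegree = 0 ∧ V.natDegree = 0
        · rw [eq_C_of_natDegree_eq_zero hz.1, eq_C_of_natDegree_eq_zero hz.2] at h0
          simp at h0
        have : (derivative U * V - U * derivative V).natDegree ≤ U.natDegree + V.natDegree - 1 := by
          refine (natDegree_sub_le _ _).trans (max_le ?_ ?_)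
          · by_cases h : U.natDegree = 0
            · rw [eq_C_of_natDegree_eq_zero h]; simp
            · have := natDegree_derivative_le U
              exact natDegree_mul_le.trans (by omega)
          · by_cases h : V.natDegree = 0
            · rw [eq_C_of_natDegree_eq_zero h]; simp
            · have := natDegree_derivative_le V
              exact natDegree_mul_le.trans (by omega)
        omega
      omega

variable [(SW a b).IsElliptic]

/-- An even function without poles is constant. -/
theorem liouville {ξ : FF a b} (he : cj ξ = ξ) (h : ∀ P, ξ ∈ (plc P).Reg) : ∃ c, ξ = io a b c := by
  obtain ⟨U, V, hc, hV, hx⟩ := even_repr he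
  have hd := evReg_of_reg plc_zero_xx (h 0) hV hx
  have hv : V.natDegree = 0 := by
    by_contra hv
    obtain ⟨e, he⟩ := IsAlgClosed.exists_root V (by rwa [degree_eq_natDegree hV, Nat.cast_ne_zero])
    obtain ⟨P, hP, rfl⟩ := exists_pt_x (a := a) (b := b) e
    obtain ⟨c, hcc⟩ := h P
    have h1 := (plc P).mul hcc (plc_pe hP V)
    rw [hx, he, mul_zero] at h1
    have h2 := (plc P).uniq (plc_pe hP U) h1
    obtain ⟨α, β, hαβ⟩ := hc
    have := congrArg (eval (px P)) hαβ
    rw [eval_add, eval_mul, eval_mul, h2, he] at this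
    simp at this
  rw [hv, Nat.le_zero] at hd
  rw [eq_C_of_natDegree_eq_zero hv, eq_C_of_natDegree_eq_zero hd, pe_C, pe_C] at hx
  have hv0 : V.coeff 0 ≠ 0 := fun h0 => hV (by rw [eq_C_of_natDegree_eq_zero hv, h0, C_0])
  refine ⟨U.coeff 0 / V.coeff 0, ?_⟩
  rw [map_div₀, ← hx, mul_div_cancel_right₀]
  exact (_root_.map_ne_zero _).2 hv0

lemma th_comp (P Q : Pt a b) (ξ : FF a b) :
    th (gam + cst (io a b) P) (th (gam + cst (io a b) Q) ξ) = th (gam + cst (io a b) (P + Q)) ξ := by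
  have hP := (nc_gam (a := a) (b := b)).add_cst P
  have hQ := ((nc_gam (a := a) (b := b)).add_cst Q).th_spec
  have hPQ := ((nc_gam (a := a) (b := b)).add_cst (P + Q)).th_spec
  have e : tpt P (gam + cst (io a b) Q) = gam + cst (io a b) (P + Q) := by
    rw [map_add, tpt_gam, tpt_cst, map_add, add_assoc]
  refine RingHom.congr_fun (f := (th (gam + cst (io a b) P)).comp (th (gam + cst (io a b) Q)))
    (hom_ext (fun c => ?_) ?_ ?_) ξ
  · rw [RingHom.comp_apply, th_io, th_io, th_io]
  · rw [RingHom.comp_apply, hQ.2.1, hPQ.2.1, ← e, tpt, px_mapPt]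
  · rw [RingHom.comp_apply, hQ.2.2, hPQ.2.2, ← e, tpt, py_mapPt]

lemma plc_translate {P Q : Pt a b} {ξ : FF a b} {c : k} :
    (plc (P + Q)).Res ξ c ↔ (plc P).Res (th (gam + cst (io a b) Q) ξ) c := by
  change (pp a b).Res _ c ↔ (pp a b).Res _ c
  rw [th_comp]

/-- Regularity of a translation invariant function. -/
lemma reg_of_invariant {P Q : Pt a b} {ξ : FF a b} (h : th (gam + cst (io a b) Q) ξ = ξ)
    (hP : ξ ∈ (plc P).Reg) : ξ ∈ (plc (P + Q)).Reg := by
  obtain ⟨c, hc⟩ := hP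
  exact ⟨c, plc_translate.2 (by rwa [h])⟩

end Even

section Sums

variable {k F : Type*} [Field k] [Field F] {ι : k →+* F} {a b : k} (H : AddSubgroup (Pt a b)) [Finite H]

/-- The elements of a finite subgroup. -/
noncomputable def fs : Finset (Pt a b) := (Set.toFinite (H : Set (Pt a b))).toFinset

variable {H} in
lemma mem_fs {P : Pt a b} : P ∈ fs H ↔ P ∈ H := by simp [fs]

/-- The sum of the `x`-coordinates over the coset of a finite subgroup. -/
noncomputable def xs (u : Pt (ι a) (ι b)) : F := ∑ Q ∈ fs H, px (u + cst ι Q)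

/-- The sum of the `y`-coordinates over the coset of a finite subgroup. -/
noncomputable def ys (u : Pt (ι a) (ι b)) : F := ∑ Q ∈ fs H, py (u + cst ι Q)

/-- The sum of the `x`-coordinates over the coset of a constant point. -/
noncomputable def xk (P : Pt a b) : k := ∑ Q ∈ fs H, px (P + Q)

/-- The sum of the `y`-coordinates over the coset of a constant point. -/
noncomputable def yk (P : Pt a b) : k := ∑ Q ∈ fs H, py (P + Q)

lemma sum_fs_shift {M : Type*} [AddCommMonoid M] (f : Pt a b → M) {R : Pt a b} (hR : R ∈ H) :
    ∑ Q ∈ fs H, f (R + Q) = ∑ Q ∈ fs H, f Q := by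
  refine Finset.sum_bij (fun Q _ => R + Q) (fun _ hQ => mem_fs.2 (H.add_mem hR (mem_fs.1 hQ)))
    (fun _ _ _ _ h => add_left_cancel h) (fun Q hQ => ?_) (fun _ _ => rfl)
  exact ⟨-R + Q, mem_fs.2 (H.add_mem (H.neg_mem hR) (mem_fs.1 hQ)), by abel⟩

lemma sum_fs_neg {M : Type*} [AddCommMonoid M] (f : Pt a b → M) :
    ∑ Q ∈ fs H, f (-Q) = ∑ Q ∈ fs H, f Q :=
  Finset.sum_bij (fun Q _ => -Q) (fun Q hQ => mem_fs.2 (H.neg_mem (mem_fs.1 hQ)))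
    (fun _ _ _ _ h => neg_injective h)
    (fun Q hQ => ⟨-Q, mem_fs.2 (H.neg_mem (mem_fs.1 hQ)), neg_neg Q⟩) (fun _ _ => rfl)

variable {H}

lemma xs_add_cst (u : Pt (ι a) (ι b)) {R : Pt a b} (hR : R ∈ H) : xs H (u + cst ι R) = xs H u := by
  refine Eq.trans ?_ (sum_fs_shift H (fun Q => px (u + cst ι Q)) hR)
  simp only [xs, map_add, add_assoc]

lemma xs_neg (u : Pt (ι a) (ι b)) : xs H (-u) = xs H u := by
  rw [xs, xs, ← sum_fs_neg H]
  refine Finset.sum_congr rfl fun Q _ => ?_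
  rw [map_neg, ← neg_add, px_neg]

lemma ys_add_cst (u : Pt (ι a) (ι b)) {R : Pt a b} (hR : R ∈ H) : ys H (u + cst ι R) = ys H u := by
  refine Eq.trans ?_ (sum_fs_shift H (fun Q => py (u + cst ι Q)) hR)
  simp only [ys, map_add, add_assoc]

lemma ys_neg (u : Pt (ι a) (ι b)) : ys H (-u) = - ys H u := by
  rw [ys, ys, ← sum_fs_neg H, ← Finset.sum_neg_distrib]
  refine Finset.sum_congr rfl fun Q _ => ?_
  rw [map_neg, ← neg_add, py_neg]

lemma xs_split (u : Pt (ι a) (ι b)) :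
    xs H u = px u + ∑ Q ∈ (fs H).erase 0, px (u + cst ι Q) := by
  rw [xs, ← Finset.add_sum_erase _ _ (mem_fs.2 H.zero_mem), map_zero, add_zero]

variable [IsAlgClosed k] [NeZero (2 : k)] [(SW a b).IsElliptic]

lemma sp_px {pl : Place ι} {u : Pt (ι a) (ι b)} {P : Pt a b} (h : pl.Sp u P) (hP : P ≠ 0) :
    pl.Res (px u) (px P) ∧ pl.Res (py u) (py P) := by
  rcases h with ⟨-, -, h1, h2⟩ | ⟨h, -⟩
  · exact ⟨h1, h2⟩
  · exact absurd h hP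

lemma res_xs {pl : Place ι} {u : Pt (ι a) (ι b)} {P : Pt a b} (h : pl.Sp u P) (hP : P ∉ H) :
    pl.Res (xs H u) (xk H P) ∧ pl.Res (ys H u) (yk H P) := by
  have h1 : ∀ Q ∈ fs H, P + Q ≠ 0 := fun Q hQ h0 => hP (by
    rw [eq_neg_of_add_eq_zero_left h0]; exact H.neg_mem (mem_fs.1 hQ))
  exact ⟨pl.sum _ fun Q hQ => (sp_px (h.add_cst two_ne_zero Q) (h1 Q hQ)).1,
    pl.sum _ fun Q hQ => (sp_px (h.add_cst two_ne_zero Q) (h1 Q hQ)).2⟩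

lemma reg_tail {pl : Place ι} {u : Pt (ι a) (ι b)} (h : pl.Sp u 0) :
    ∑ Q ∈ (fs H).erase 0, px (u + cst ι Q) ∈ pl.Reg := by
  refine sum_mem fun Q hQ => ?_
  have := h.add_cst two_ne_zero Q
  rw [zero_add] at this
  exact ⟨_, (sp_px this (Finset.ne_of_mem_erase hQ)).1⟩

lemma not_reg_xs {pl : Place ι} {u : Pt (ι a) (ι b)} (h : pl.Sp u 0) (hu : u ≠ 0) :
    xs H u ∉ pl.Reg := by
  intro hr
  rw [xs_split] at hr
  have h1 := sub_mem hr (reg_tail (H := H) h)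
  rw [add_sub_cancel_right] at h1
  obtain ⟨c, hc⟩ := h1
  rcases h with ⟨-, h, -⟩ | ⟨-, h | ⟨h, h'⟩⟩
  · exact h rfl
  · exact hu h
  · exact pl.not_res_inv h hc h'

end Sums

section Generic

variable {k : Type*} [Field k] [IsAlgClosed k] [NeZero (2 : k)] {a b : k} [(SW a b).IsElliptic]
  {H : AddSubgroup (Pt a b)} [Finite H]

variable {F F' : Type*} [Field F] [Field F'] {ι : k →+* F} {ι' : k →+* F'} {a' b' : k}
  [(SW a' b').IsElliptic] {H' : AddSubgroup (Pt a' b')} [Finite H']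

lemma mapPt_cst' {θ : F →+* F'} (h : ∀ c, θ (ι c) = ι' c) (T : Pt a b) :
    mapPt θ (h a) (h b) (cst ι T) = cst ι' T := by
  rw [cst, mapPt_mapPt]
  exact mapPt_congr (RingHom.ext h) _ _ _

lemma map_xs {θ : F →+* F'} (h : ∀ c, θ (ι c) = ι' c)
    (u : Pt (ι a) (ι b)) : θ (xs H u) = xs H (mapPt θ (h a) (h b) u) := by
  rw [xs, xs, map_sum]
  refine Finset.sum_congr rfl fun Q _ => ?_
  rw [← px_mapPt θ (h a) (h b), map_add, mapPt_cst' h]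

lemma map_ys {θ : F →+* F'} (h : ∀ c, θ (ι c) = ι' c)
    (u : Pt (ι a) (ι b)) : θ (ys H u) = ys H (mapPt θ (h a) (h b) u) := by
  rw [ys, ys, map_sum]
  refine Finset.sum_congr rfl fun Q _ => ?_
  rw [← py_mapPt θ (h a) (h b), map_add, mapPt_cst' h]

lemma cj_xs {w : Pt (io a b a') (io a b b')}
    (hw : mapPt cj (cj_io a') (cj_io b') w = -w) : cj (xs H' w) = xs H' w := by
  rw [map_xs cj_io, hw, xs_neg]

lemma cj_ys {w : Pt (io a b a') (io a b b')}
    (hw : mapPt cj (cj_io a') (cj_io b') w = -w) : cj (ys H' w) = - ys H' w := by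
  rw [map_ys cj_io, hw, ys_neg]

lemma deriv_xs (u : Pt (io a b a') (io a b b'))
    (hu : ∀ T : Pt a' b', u ≠ cst (io a b) T) :
    DD a b (xs H' u) = lg (DD a b) u * ys H' u := by
  rw [xs, ys, map_sum, Finset.mul_sum]
  refine Finset.sum_congr rfl fun Q _ => ?_
  have : u + cst (io a b) Q ≠ 0 := fun h => hu (-Q) (by rw [map_neg]; exact eq_neg_of_add_eq_zero_left h)
  rw [(lg_spec DD_io two_ne_zero this).1, lg_add DD_io two_ne_zero, lg_cst DD_io, add_zero]

lemma xs_nonconst (c : k) : xs H (gam (a := a) (b := b)) ≠ io a b c := by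
  intro h
  apply not_reg_xs (H := H) (plc_sp_gam (a := a) (b := b) 0) gam_ne_zero
  rw [h]; exact Place.const_mem _ c

/-- The differential equation of the coordinate function on the quotient by a finite subgroup. -/
theorem xs_ode : ∃ κ α β : k, ys H (gam (a := a) (b := b)) ^ 2 =
    (xs H gam - io a b κ) ^ 3 + io a b α * (xs H gam - io a b κ) + io a b β := by
  set g := gam (a := a) (b := b)
  have hg : g ∈ MM a b := gam_mem_MM
  have h0 : (plc (0 : Pt a b)).Sp g 0 := plc_sp_gam 0
  have hD : DD a b (xs H g) = ys H g := by rw [deriv_xs g nc_gam, lg_gam, one_mul]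
  set S := ∑ Q ∈ (fs H).erase 0, px (g + cst (io a b) Q) with hS
  have hXS : xs H g = xx a b + S := xs_split g
  have hSe : cj S = S := by
    have := cj_xs (H' := H) (mem_MM.1 hg)
    rwa [hXS, map_add, cj_xx, add_right_inj] at this
  have hSr : EvReg S := evReg_of_even hSe plc_zero_xx (reg_tail h0)
  obtain ⟨κ, σ, hσ, hSσ⟩ := hSr.expand
  obtain ⟨s1, σ2, hσ2, hσσ⟩ := hσ.expand
  obtain ⟨ρ0, hρ0, hDσ⟩ := hσ2.deriv
  set w := (xx a b)⁻¹ with hw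
  have hxw : xx a b * w = 1 := mul_inv_cancel₀ xx_ne_zero
  have hDw : DD a b w = - w ^ 2 * yy a b := by
    have := (DD a b).div (show w * xx a b = 1 from by rw [mul_comm, hxw])
    rw [(DD a b).one, DD_xx] at this
    linear_combination w * this - (DD a b w) * hxw
  set ρ := ρ0 - σ2 with hρ
  have hDσ' : DD a b σ = ρ * w ^ 2 * yy a b := by
    rw [hσσ, map_add, DD_io, (DD a b).leib, hDw, hρ]
    linear_combination w ^ 2 * hDσ - (DD a b σ2 * w) * hxw
  set μ := ρ * w - σ with hμ
  have hY : ys H g = yy a b * (1 + w ^ 2 * μ) := by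
    rw [← hD, hXS, map_add, DD_xx, hSσ, map_add, DD_io, (DD a b).leib, hDσ', hDw, hμ]
    ring
  set α := a - 5 * s1 with hα
  have hT : xs H g - io a b κ = xx a b + σ * w := by rw [hXS, hSσ]; ring
  set G := ys H g ^ 2 - (xs H g - io a b κ) ^ 3 - io a b α * (xs H g - io a b κ) with hG
  have hG0 : G = 2 * ρ + w * μ ^ 2 + io a b b + (io a b a * w + io a b b * w ^ 2) *
      (2 * μ + w ^ 2 * μ ^ 2) - 3 * σ ^ 2 * w - σ ^ 3 * w ^ 3 - io a b α * σ * w - 5 * σ2 := by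
    rw [hG, hY, hT, mul_pow, yy_sq, hα, map_sub, map_mul, map_ofNat]
    have hx3 : xx a b ^ 3 * w ^ 2 = xx a b := by
      linear_combination (xx a b ^ 2 * w + xx a b) * hxw
    have e1 : xx a b * (io a b s1 + σ2 * w) = xx a b * io a b s1 + σ2 := by
      linear_combination σ2 * hxw
    rw [← hσσ] at e1
    have hx : (xx a b ^ 3 + io a b a * xx a b + io a b b) * (1 + w ^ 2 * μ) ^ 2 =
        xx a b ^ 3 + io a b a * xx a b + io a b b + 2 * xx a b * μ + w * μ ^ 2 +
          (io a b a * w + io a b b * w ^ 2) * (2 * μ + w ^ 2 * μ ^ 2) := by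
      linear_combination (2 * μ + w ^ 2 * μ ^ 2) * hx3 + (w * μ ^ 2 + io a b a * w *
        (2 * μ + w ^ 2 * μ ^ 2)) * hxw
    rw [hx, hμ]
    linear_combination (2 * ρ - 3 * xx a b * σ - 3 * σ ^ 2 * w) * hxw - 5 * e1
  have hGr : G ∈ (plc (0 : Pt a b)).Reg := by
    have r1 : ∀ c, io a b c ∈ (plc (0 : Pt a b)).Reg := fun c => Place.const_mem _ c
    have r2 : w ∈ (plc (0 : Pt a b)).Reg := ⟨0, plc_zero_xx⟩
    have r3 := hσ.reg (plc_zero_xx (a := a) (b := b))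
    have r4 := hσ2.reg (plc_zero_xx (a := a) (b := b))
    have r5 : ρ ∈ (plc (0 : Pt a b)).Reg := (hρ0.sub hσ2).reg plc_zero_xx
    have r6 : μ ∈ (plc (0 : Pt a b)).Reg := sub_mem (mul_mem r5 r2) r3
    have rn : ∀ n : ℕ, (n : FF a b) ∈ (plc (0 : Pt a b)).Reg := fun n => natCast_mem _ n
    have rn2 : (2 : FF a b) ∈ (plc (0 : Pt a b)).Reg := by exact_mod_cast rn 2
    have rn3 : (3 : FF a b) ∈ (plc (0 : Pt a b)).Reg := by exact_mod_cast rn 3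
    have rn5 : (5 : FF a b) ∈ (plc (0 : Pt a b)).Reg := by exact_mod_cast rn 5
    rw [hG0]
    exact sub_mem (sub_mem (sub_mem (sub_mem (add_mem (add_mem (add_mem (mul_mem rn2 r5)
      (mul_mem r2 (pow_mem r6 2))) (r1 b)) (mul_mem (add_mem (mul_mem (r1 a) r2)
      (mul_mem (r1 b) (pow_mem r2 2))) (add_mem (mul_mem rn2 r6) (mul_mem (pow_mem r2 2)
      (pow_mem r6 2))))) (mul_mem (mul_mem rn3 (pow_mem r3 2)) r2)) (mul_mem (pow_mem r3 3)
      (pow_mem r2 3))) (mul_mem (mul_mem (r1 α) r3) r2)) (mul_mem rn5 r4)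
  have hGe : cj G = G := by
    rw [hG]
    simp only [map_sub, map_mul, map_pow, cj_io, cj_xs (mem_MM.1 hg), cj_ys (mem_MM.1 hg), neg_sq]
  have hGi : ∀ Q ∈ H, th (gam + cst (io a b) Q) G = G := by
    intro Q hQ
    have e1 : th (gam + cst (io a b) Q) (xs H g) = xs H g := by
      rw [map_xs (th_io _)]; change xs H (tpt Q g) = _; rw [tpt_gam, xs_add_cst _ hQ]
    have e2 : th (gam + cst (io a b) Q) (ys H g) = ys H g := by
      rw [map_ys (th_io _)]; change ys H (tpt Q g) = _; rw [tpt_gam, ys_add_cst _ hQ]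
    rw [hG]
    simp only [map_sub, map_mul, map_pow, th_io, e1, e2]
  have hreg : ∀ P, G ∈ (plc P).Reg := by
    intro P
    by_cases hP : P ∈ H
    · have := reg_of_invariant (hGi P hP) hGr
      rwa [zero_add] at this
    · obtain ⟨h1, h2⟩ := res_xs (plc_sp_gam P) hP
      have h1' : xs H g ∈ (plc P).Reg := ⟨_, h1⟩
      have h2' : ys H g ∈ (plc P).Reg := ⟨_, h2⟩
      have r1 : ∀ c, io a b c ∈ (plc P).Reg := fun c => Place.const_mem _ c
      exact sub_mem (sub_mem (pow_mem h2' 2) (pow_mem (sub_mem h1' (r1 κ)) 3))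
        (mul_mem (r1 α) (sub_mem h1' (r1 κ)))
  obtain ⟨β, hβ⟩ := liouville hGe hreg
  exact ⟨κ, α, β, by rw [← hβ, hG]; ring⟩

end Generic

section Transport

variable {k : Type*} [Field k] [IsAlgClosed k] [NeZero (2 : k)] {a b a' b' : k}
  [(SW a b).IsElliptic] [(SW a' b').IsElliptic]

/-- A nonconstant element of the function field is transcendental. -/
lemma poly_zero_of_nonconst {X : FF a b} (hX : ∀ c, X ≠ io a b c) {q : k[X]}
    (hq : q.eval₂ (io a b) X = 0) : q = 0 := by
  by_contra h0
  have h1 := (IsAlgClosed.splits q).eq_prod_roots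
  rw [h1, eval₂_mul, eval₂_C, mul_eq_zero] at hq
  rcases hq with hq | hq
  · exact leadingCoeff_ne_zero.2 h0 ((map_eq_zero _).1 hq)
  · rw [eval₂_multiset_prod, Multiset.prod_eq_zero_iff] at hq
    simp only [Multiset.map_map, Multiset.mem_map, Function.comp, eval₂_sub, eval₂_X, eval₂_C] at hq
    obtain ⟨c, -, hc⟩ := hq
    exact hX c (sub_eq_zero.1 hc)

/-- The differential equation of the coordinate function on the quotient by `H`. -/
def Ode (H : AddSubgroup (Pt a b)) [Finite H] (κ α β : k) : Prop :=
  ys H (gam (a := a) (b := b)) ^ 2 =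
    (xs H gam - io a b κ) ^ 3 + io a b α * (xs H gam - io a b κ) + io a b β

lemma Ode.unique {H : AddSubgroup (Pt a b)} [Finite H] (h3 : (3 : k) ≠ 0) {κ α β κ' α' β' : k}
    (h : Ode H κ α β) (h' : Ode H κ' α' β') : κ = κ' ∧ α = α' ∧ β = β' := by
  have hq := poly_zero_of_nonconst (xs_nonconst (H := H))
    (q := (X - C κ) ^ 3 + C α * (X - C κ) + C β - ((X - C κ') ^ 3 + C α' * (X - C κ') + C β')) (by
      simp only [eval₂_sub, eval₂_add, eval₂_mul, eval₂_pow, eval₂_X, eval₂_C]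
      rw [← h, ← h', sub_self])
  have hp : C (3 * (κ' - κ)) * X ^ 2 + C (3 * κ ^ 2 - 3 * κ' ^ 2 + α - α') * X +
      C (κ' ^ 3 - κ ^ 3 - α * κ + α' * κ' + β - β') = 0 := by
    rw [← hq]
    simp only [map_mul, map_sub, map_add, map_pow, map_ofNat]
    ring
  have e2 := congrArg (coeff · 2) hp
  have e1 := congrArg (coeff · 1) hp
  have e0 := congrArg (coeff · 0) hp
  simp only [coeff_add, coeff_C_mul, coeff_X_pow, coeff_X, coeff_C, coeff_zero] at e0 e1 e2
  norm_num at e0 e1 e2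
  have hκ : κ' = κ := sub_eq_zero.1 (e2.resolve_left h3)
  subst hκ
  have hα : α = α' := by linear_combination e1
  subst hα
  exact ⟨rfl, rfl, by linear_combination e0⟩

lemma ode_bot : Ode (⊥ : AddSubgroup (Pt a b)) 0 a b := by
  have h : fs (⊥ : AddSubgroup (Pt a b)) = {0} := by
    ext P; rw [mem_fs, AddSubgroup.mem_bot, Finset.mem_singleton]
  rw [Ode, xs, ys, h, Finset.sum_singleton, Finset.sum_singleton, map_zero, add_zero, map_zero,
    sub_zero]
  exact eqn gam_ne_zero

/-- The homomorphism `φ` is given by the odd point `w` over the function field, and has derivative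
`c`. -/
structure IsIsog (w : Pt (io a b a') (io a b b')) (φ : Pt a b →+ Pt a' b') (c : k) : Prop where
  odd : mapPt cj (cj_io a') (cj_io b') w = -w
  sp : ∀ P, (plc P).Sp w (φ P)
  lgd : lg (DD a b) w = io a b c
  tr : ∀ P, mapPt (th (gam + cst (io a b) P)) (th_io _ a') (th_io _ b') w = w + cst (io a b) (φ P)
  ne : c ≠ 0
  reg : xx a b - io a b (c ^ 2) * px w ∈ (plc (0 : Pt a b)).Reg

lemma IsEndo.isIsog {w : Pt (io a b a) (io a b b)} {ψ : Pt a b →+ Pt a b} {c : k}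
    (h : IsEndo w ψ c) (hc : c ≠ 0) : IsIsog w ψ c := by
  refine ⟨mem_MM.1 h.mem, h.sp, h.lgd, h.tr, hc, ?_⟩
  obtain ⟨U, V, hp, hV0, hx, -, -, d0, d1, d2, -⟩ := h.exists_poly hc
  refine EvReg.reg ⟨X * V - C (c ^ 2) * U, V, hV0, ?_, ?_⟩ plc_zero_xx
  · rw [map_sub, map_mul, map_mul, pe_C, pe_X, ← hx]; ring
  · have hU : U ≠ 0 := by rintro rfl; simp at d1
    have e1 : (X * V).natDegree = U.natDegree := by rw [mul_comm, natDegree_mul_X hV0, d1]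
    by_cases h0 : X * V - C (c ^ 2) * U = 0
    · rw [h0]; simp
    · by_contra! hlt
      have hle : (X * V - C (c ^ 2) * U).natDegree ≤ U.natDegree :=
        (natDegree_sub_le _ _).trans (max_le e1.le (natDegree_C_mul_le _ _))
      have he : (X * V - C (c ^ 2) * U).natDegree = U.natDegree := by omega
      have := leadingCoeff_ne_zero.2 h0
      rw [leadingCoeff, he, coeff_sub, coeff_C_mul, d1, coeff_X_mul, ← d1] at this
      rw [leadingCoeff, leadingCoeff] at d2
      exact this (by rw [← d2]; ring)

namespace IsIsog

variable {w : Pt (io a b a') (io a b b')} {φ : Pt a b →+ Pt a' b'} {c : k}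

lemma ne_cst (h : IsIsog w φ c) (T : Pt a' b') : w ≠ cst (io a b) T := by
  rintro rfl
  have := h.lgd
  rw [lg_cst DD_io, eq_comm, map_eq_zero] at this
  exact h.ne this

lemma px_ne (h : IsIsog w φ c) (e : k) : px w ≠ io a b e := by
  intro he
  have := h.lgd
  rw [lg, he, DD_io, zero_div, eq_comm, map_eq_zero] at this
  exact h.ne this

/-- Comparison of the quotients of two curves which are related by an isogeny. -/
theorem transport (h : IsIsog w φ c) {H' : AddSubgroup (Pt a' b')} [Finite H']
    {H : AddSubgroup (Pt a b)} [Finite H] (hH : ∀ P, P ∈ H ↔ φ P ∈ H') {κ' α' β' : k}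
    (ho : Ode H' κ' α' β') : ∃ κ, Ode H κ (c ^ 4 * α') (c ^ 6 * β') := by
  have hw0 : w ≠ 0 := fun h0 => h.ne_cst 0 (by rw [h0, map_zero])
  obtain ⟨θ, ht, htx, hty⟩ := exists_theta (io a b) w hw0 h.px_ne
  have hg : mapPt θ (ht a') (ht b') gam = w := by
    refine pt_ext (by rw [Ne, mapPt_eq_zero]; exact gam_ne_zero) hw0 ?_ ?_
    · rw [px_mapPt, px_gam, htx]
    · rw [py_mapPt, py_gam, hty]
  have hw2 : ys H' w ^ 2 = (xs H' w - io a b κ') ^ 3 + io a b α' * (xs H' w - io a b κ') +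
      io a b β' := by
    have h1 : θ (ys H' gam) = ys H' w := by rw [map_ys ht, hg]
    have h2 : θ (xs H' gam) = xs H' w := by rw [map_xs ht, hg]
    have := congrArg θ (show _ = _ from ho)
    rw [map_pow, h1, map_add, map_add, map_mul, map_pow, map_sub, h2, ht, ht, ht] at this
    exact this
  set Z := xs H (gam (a := a) (b := b)) - io a b (c ^ 2) * xs H' w with hZ
  have hodd := mem_MM.1 (gam_mem_MM (a := a) (b := b))
  have hev : cj Z = Z := by
    rw [hZ, map_sub, map_mul, cj_io, cj_xs hodd, cj_xs h.odd]
  have hr0 : Z ∈ (plc (0 : Pt a b)).Reg := by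
    have s1 := reg_tail (H := H) (plc_sp_gam (a := a) (b := b) 0)
    have s2 := h.sp 0
    rw [map_zero] at s2
    have s2 := reg_tail (H := H') s2
    have := sub_mem (add_mem h.reg s1) (mul_mem (Place.const_mem _ (c ^ 2)) s2)
    convert this using 1
    rw [hZ, xs_split, xs_split, px_gam]; ring
  have hreg : ∀ P, Z ∈ (plc P).Reg := by
    intro P
    by_cases hP : P ∈ H
    · have hi : th (gam + cst (io a b) P) Z = Z := by
        have e1 : mapPt (th (gam + cst (io a b) P)) (th_io _ a) (th_io _ b) gam =
          gam + cst (io a b) P := tpt_gam P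
        rw [hZ, map_sub, map_mul, th_io, map_xs (th_io _), map_xs (th_io _), h.tr, e1,
          xs_add_cst _ hP, xs_add_cst _ ((hH P).1 hP)]
      have := reg_of_invariant hi hr0
      rwa [zero_add] at this
    · have h1 : xs H (gam (a := a) (b := b)) ∈ (plc P).Reg := ⟨_, (res_xs (plc_sp_gam P) hP).1⟩
      have h2 : xs H' w ∈ (plc P).Reg := ⟨_, (res_xs (h.sp P) (fun h' => hP ((hH P).2 h'))).1⟩
      exact sub_mem h1 (mul_mem (Place.const_mem _ _) h2)
  obtain ⟨e, he⟩ := liouville hev hreg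
  have hx : xs H (gam (a := a) (b := b)) = io a b (c ^ 2) * xs H' w + io a b e := by
    rw [← he, hZ]; ring
  have hy : ys H (gam (a := a) (b := b)) = io a b (c ^ 3) * ys H' w := by
    have h1 := deriv_xs (H' := H) (gam (a := a) (b := b)) nc_gam
    rw [lg_gam, one_mul] at h1
    rw [← h1, hx, map_add, DD_io, (DD a b).leib, DD_io, deriv_xs w h.ne_cst, h.lgd]
    simp only [map_pow]; ring
  refine ⟨c ^ 2 * κ' + e, ?_⟩
  rw [Ode, hy, hx, mul_pow, hw2]
  simp only [map_pow, map_mul, map_add]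
  ring

end IsIsog

end Transport

section Complexity

/-- Positive integers up to `N` are invertible. -/
def Big (k : Type*) [Field k] (N : ℕ) : Prop := ∀ n : ℕ, n ≠ 0 → n ≤ N → (n : k) ≠ 0

lemma Big.mono {k : Type*} [Field k] {M N : ℕ} (h : Big k N) (hMN : M ≤ N) : Big k M :=
  fun n hn hnM => h n hn (hnM.trans hMN)

/-- Two polynomials of small degree with the same logarithmic derivative are proportional. -/
lemma proportional {k : Type*} [Field k] {N : ℕ} (hN : Big k N) {A V : k[X]} (hV : V ≠ 0)
    (hA : A.natDegree ≤ N) (hVN : V.natDegree ≤ N) (h : A * derivative V = V * derivative A) :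
    ∃ c, A = C c * V := by
  obtain ⟨c, hc⟩ : ∃ c, A - C c * V = 0 ∨ (A - C c * V ≠ 0 ∧
      (A - C c * V).natDegree ≠ V.natDegree) := by
    by_cases he : A.natDegree = V.natDegree
    · refine ⟨A.leadingCoeff / V.leadingCoeff, ?_⟩
      by_contra! hn
      have := leadingCoeff_ne_zero.2 hn.1
      rw [leadingCoeff, hn.2 hn.1, coeff_sub, coeff_C_mul, coeff_natDegree,
        div_mul_cancel₀ _ (leadingCoeff_ne_zero.2 hV), leadingCoeff, he, sub_self] at this
      exact this rfl
    · refine ⟨0, ?_⟩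
      rw [C_0, zero_mul, sub_zero]
      by_cases h0 : A = 0
      · exact .inl h0
      · exact .inr ⟨h0, he⟩
  refine ⟨c, sub_eq_zero.1 (hc.resolve_right fun hne => ?_)⟩
  have hBN : (A - C c * V).natDegree ≤ N :=
    (natDegree_sub_le _ _).trans (max_le hA ((natDegree_C_mul_le _ _).trans hVN))
  have hB : (A - C c * V) * derivative V = V * derivative (A - C c * V) := by
    simp only [derivative_sub, derivative_mul, derivative_C, zero_mul, zero_add]
    linear_combination h
  generalize A - C c * V = B at *
  obtain ⟨hB0, hne⟩ := hne
  have key : ∀ q : k[X], (X * derivative q).natDegree ≤ q.natDegree ∧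
      (X * derivative q).coeff q.natDegree = q.natDegree * q.leadingCoeff := by
    intro q
    have hc : ∀ n, (X * derivative q).coeff n = n * q.coeff n := by
      rintro (_ | n)
      · simp
      · rw [coeff_X_mul, coeff_derivative]; push_cast; ring
    refine ⟨natDegree_le_iff_coeff_eq_zero.2 fun n hn => ?_, hc _⟩
    rw [hc, coeff_eq_zero_of_natDegree_lt hn, mul_zero]
  have e1 := coeff_mul_add_eq_of_natDegree_le (le_refl B.natDegree) (key V).1
  have e2 := coeff_mul_add_eq_of_natDegree_le (le_refl V.natDegree) (key B).1
  rw [(key V).2] at e1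
  rw [(key B).2] at e2
  have e3 : B * (X * derivative V) = V * (X * derivative B) := by linear_combination X * hB
  rw [e3, add_comm, e2] at e1
  have h1 := leadingCoeff_ne_zero.2 hB0
  have h2 := leadingCoeff_ne_zero.2 hV
  have e4 : ((B.natDegree : k) - V.natDegree) * (B.leadingCoeff * V.leadingCoeff) = 0 := by
    simp only [leadingCoeff] at e1 ⊢
    linear_combination e1
  have e5 := sub_eq_zero.1 ((mul_eq_zero.1 e4).resolve_right (mul_ne_zero h1 h2))
  rcases lt_or_gt_of_ne hne with hlt | hlt
  · refine hN (V.natDegree - B.natDegree) (by omega) (by omega) ?_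
    rw [Nat.cast_sub hlt.le, e5, sub_self]
  · refine hN (B.natDegree - V.natDegree) (by omega) (by omega) ?_
    rw [Nat.cast_sub hlt.le, e5, sub_self]

variable {k : Type*} [Field k] [IsAlgClosed k] [NeZero (2 : k)] {a b : k}

/-- Elements of the function field of complexity at most `n`. -/
def Cx (n : ℕ) (ξ : FF a b) : Prop := ∃ A B V : k[X], V ≠ 0 ∧ A.natDegree ≤ n ∧ B.natDegree ≤ n ∧
  V.natDegree ≤ n ∧ ξ * pe a b V = pe a b A + pe a b B * yy a b

namespace Cx

variable {m n : ℕ} {ξ η : FF a b}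

lemma mono (h : Cx m ξ) (hmn : m ≤ n) : Cx n ξ := by
  obtain ⟨A, B, V, hV, h1, h2, h3, h4⟩ := h
  exact ⟨A, B, V, hV, h1.trans hmn, h2.trans hmn, h3.trans hmn, h4⟩

lemma const (c : k) : Cx 0 (io a b c) :=
  ⟨C c, 0, 1, one_ne_zero, by simp, by simp, by simp, by simp⟩

lemma xx : Cx 1 (xx a b) := ⟨X, 0, 1, one_ne_zero, by simp, by simp, by simp, by simp⟩

lemma yy : Cx 0 (yy a b) := ⟨0, 1, 1, one_ne_zero, by simp, by simp, by simp, by simp⟩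

lemma zero : Cx 0 (0 : FF a b) := by simpa using const (0 : k)

lemma const_mul (c : k) (h : Cx n ξ) : Cx n (io a b c * ξ) := by
  obtain ⟨A, B, V, hV, h1, h2, h3, h4⟩ := h
  refine ⟨C c * A, C c * B, V, hV, (natDegree_C_mul_le _ _).trans h1,
    (natDegree_C_mul_le _ _).trans h2, h3, ?_⟩
  rw [map_mul, map_mul, pe_C, mul_assoc, h4]; ring

lemma neg (h : Cx n ξ) : Cx n (-ξ) := by
  have := h.const_mul (-1 : k)
  rwa [map_neg, map_one, neg_one_mul] at this

lemma mul_le {p q : k[X]} {m n : ℕ} (hp : p.natDegree ≤ m) (hq : q.natDegree ≤ n) :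
    (p * q).natDegree ≤ m + n := natDegree_mul_le.trans (add_le_add hp hq)

lemma add (h : Cx m ξ) (h' : Cx n η) : Cx (m + n) (ξ + η) := by
  obtain ⟨A, B, V, hV, h1, h2, h3, h4⟩ := h
  obtain ⟨A', B', V', hV', h1', h2', h3', h4'⟩ := h'
  refine ⟨A * V' + V * A', B * V' + V * B', V * V', mul_ne_zero hV hV',
    natDegree_add_le_of_degree_le (mul_le h1 h3') (mul_le h3 h1'),
    natDegree_add_le_of_degree_le (mul_le h2 h3') (mul_le h3 h2'), mul_le h3 h3', ?_⟩
  simp only [map_mul, map_add]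
  linear_combination (pe a b V') * h4 + (pe a b V) * h4'

lemma sub (h : Cx m ξ) (h' : Cx n η) : Cx (m + n) (ξ - η) := by
  rw [sub_eq_add_neg]; exact h.add h'.neg

lemma pe_fpoly : pe a b (fpoly a b) = FrobeniusField.yy a b ^ 2 := by rw [yy_sq]; exact eval₂_fpoly _ _

lemma mul (h : Cx m ξ) (h' : Cx n η) : Cx (m + n + 3) (ξ * η) := by
  obtain ⟨A, B, V, hV, h1, h2, h3, h4⟩ := h
  obtain ⟨A', B', V', hV', h1', h2', h3', h4'⟩ := h'
  have hf : (fpoly a b).natDegree ≤ 3 := (fpoly_natDegree a b).le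
  refine ⟨A * A' + B * B' * fpoly a b, A * B' + B * A', V * V', mul_ne_zero hV hV',
    natDegree_add_le_of_degree_le ((mul_le h1 h1').trans (by omega)) (mul_le (mul_le h2 h2') hf),
    (natDegree_add_le_of_degree_le (mul_le h1 h2') (mul_le h2 h1')).trans (by omega),
    (mul_le h3 h3').trans (by omega), ?_⟩
  simp only [map_mul, map_add, pe_fpoly]
  linear_combination (η * pe a b V') * h4 + (pe a b A + pe a b B * FrobeniusField.yy a b) * h4'

lemma inv (h : Cx n ξ) : Cx (2 * n + 3) ξ⁻¹ := by
  by_cases h0 : ξ = 0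
  · rw [h0, inv_zero]; exact zero.mono (by omega)
  obtain ⟨A, B, V, hV, h1, h2, h3, h4⟩ := h
  have hf : (fpoly a b).natDegree ≤ 3 := (fpoly_natDegree a b).le
  have hne : pe a b A + pe a b B * FrobeniusField.yy a b ≠ 0 := by
    rw [← h4]; exact mul_ne_zero h0 (pe_ne_zero hV)
  have hN : A * A - B * B * fpoly a b ≠ 0 := by
    intro hz
    have hz' := congrArg (pe a b) hz
    simp only [map_sub, map_mul, pe_fpoly, map_zero] at hz'
    have e : (pe a b A + pe a b B * FrobeniusField.yy a b) * (pe a b A - pe a b B * FrobeniusField.yy a b) = 0 := by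
      linear_combination hz'
    have e2 := (mul_eq_zero.1 e).resolve_left hne
    have e3 := congrArg cj e2
    rw [map_sub, map_mul, cj_yy, map_zero, pe_eq, pe_eq, cj_emb, cj_emb, ← pe_eq, ← pe_eq] at e3
    exact hne (by linear_combination e3)
  refine ⟨V * A, - (V * B), A * A - B * B * fpoly a b, hN, (mul_le h3 h1).trans (by omega),
    (natDegree_neg _).le.trans ((mul_le h3 h2).trans (by omega)),
    (natDegree_sub_le _ _).trans (max_le ((mul_le h1 h1).trans (by omega))
      ((mul_le (mul_le h2 h2) hf).trans (by omega))), ?_⟩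
  simp only [map_mul, map_sub, map_neg, pe_fpoly]
  have e : ξ * (pe a b V * (pe a b A - pe a b B * FrobeniusField.yy a b)) =
    pe a b A * pe a b A - pe a b B * pe a b B * FrobeniusField.yy a b ^ 2 := by
    linear_combination (pe a b A - pe a b B * FrobeniusField.yy a b) * h4
  rw [← e, inv_mul_cancel_left₀ h0]; ring

lemma sum {ι : Type*} (s : Finset ι) {f : ι → FF a b} (h : ∀ i ∈ s, Cx n (f i)) :
    Cx (n * s.card) (∑ i ∈ s, f i) := by
  induction s using Finset.induction_on with
  | empty => simpa using zero
  | insert i s hi ih =>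
    rw [Finset.sum_insert hi, Finset.card_insert_of_notMem hi, Nat.mul_succ, Nat.add_comm]
    exact (h i (Finset.mem_insert_self _ _)).add
      (ih fun j hj => h j (Finset.mem_insert_of_mem hj))

/-- The numerator and the denominator of an even function are bounded by its complexity. -/
lemma even (h : Cx n ξ) (he : cj ξ = ξ) : ∃ U V : k[X], IsCoprime U V ∧ V ≠ 0 ∧
    ξ * pe a b V = pe a b U ∧ U.natDegree ≤ n ∧ V.natDegree ≤ n := by
  obtain ⟨U, V, hc, hV, hx⟩ := even_repr he
  obtain ⟨A, B, V', hV', h1, h2, h3, h4⟩ := h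
  have e1 : U * V' = A * V := by
    have e := repr_unique (a := a) (b := b) (A := algebraMap _ _ (U * V')) (B := algebraMap k[X] _ 0)
      (A' := algebraMap _ _ (A * V)) (B' := algebraMap _ _ (B * V)) (by
        rw [← pe_eq, ← pe_eq, ← pe_eq, ← pe_eq]
        simp only [map_mul, map_zero, ← hx]
        linear_combination pe a b V * h4)
    exact RatFunc.algebraMap_injective k e.1
  refine ⟨U, V, hc, hV, hx, ?_, ?_⟩
  · by_cases hA : A = 0
    · rw [hA, zero_mul, mul_eq_zero] at e1
      rw [e1.resolve_right hV']; simp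
    · exact (natDegree_le_of_dvd (hc.dvd_of_dvd_mul_right ⟨V', e1.symm⟩) hA).trans h1
  · exact (natDegree_le_of_dvd (hc.symm.dvd_of_dvd_mul_left ⟨A, by rw [e1, mul_comm]⟩) hV').trans h3

/-- An element of small complexity with vanishing derivative is constant. -/
lemma eq_const (h : Cx n ξ) (hN : Big k (2 * n + 3)) (h0 : DD a b ξ = 0) : ∃ c, ξ = io a b c := by
  obtain ⟨A, B, V, hV, h1, h2, h3, h4⟩ := h
  have hd := (DD a b).div h4
  have hyy := DD_yy (a := a) (b := b)
  rw [h0, map_add, (DD a b).leib, DD_pe, DD_pe, DD_pe] at hd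
  have hf2 : pe a b (derivative (fpoly a b)) = 3 * FrobeniusField.xx a b ^ 2 + io a b a := by
    have : derivative (fpoly a b) = 3 * X ^ 2 + C a := by
      simp [fpoly]; rw [map_ofNat]; norm_num
    rw [this, map_add, map_mul, map_pow, pe_X, pe_C, map_ofNat]
  have e := repr_unique (a := a) (b := b)
    (A := algebraMap _ _ (2 * B * derivative V * fpoly a b))
    (B := algebraMap _ _ (2 * (A * derivative V)))
    (A' := algebraMap _ _ (V * (2 * derivative B * fpoly a b + B * derivative (fpoly a b))))
    (B' := algebraMap _ _ (2 * (V * derivative A))) (by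
      simp only [← pe_eq, map_mul, map_add, pe_fpoly, hf2, map_ofNat]
      linear_combination 2 * (pe a b V) * hd + (pe a b V) * (pe a b B) * hyy
        - 2 * (pe a b (derivative V)) * (FrobeniusField.yy a b) * h4)
  have f1 := RatFunc.algebraMap_injective k e.1
  have f2 := RatFunc.algebraMap_injective k e.2
  have h20 : (2 : k[X]) ≠ 0 := by
    intro h; have := congrArg (eval 0) h; simp at this; exact two_ne_zero this
  obtain ⟨c, hc⟩ := proportional hN hV (h1.trans (by omega)) (h3.trans (by omega))
    (mul_left_cancel₀ h20 f2)
  have hB : B = 0 := by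
    by_contra hB
    have hf : (fpoly a b).natDegree = 3 := fpoly_natDegree a b
    obtain ⟨d, hd⟩ := proportional hN (A := B ^ 2 * fpoly a b) (V := V ^ 2) (pow_ne_zero 2 hV)
      ((mul_le (natDegree_pow_le_of_le 2 h2) hf.le).trans (by omega))
      ((natDegree_pow_le_of_le 2 h3).trans (by omega)) (by
        simp only [derivative_mul, derivative_pow, Nat.cast_ofNat, map_ofNat]
        norm_num
        linear_combination (B * V) * f1)
    have hne : B ^ 2 * fpoly a b ≠ 0 := mul_ne_zero (pow_ne_zero 2 hB) (fpoly_ne_zero a b)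
    have hd0 : d ≠ 0 := by rintro rfl; rw [C_0, zero_mul] at hd; exact hne hd
    have := congrArg natDegree hd
    rw [natDegree_mul (pow_ne_zero 2 hB) (fpoly_ne_zero a b), natDegree_C_mul hd0, natDegree_pow,
      natDegree_pow, hf] at this
    omega
  refine ⟨c, ?_⟩
  rw [hB, map_zero, zero_mul, add_zero, hc, map_mul, pe_C] at h4
  exact mul_right_cancel₀ (pe_ne_zero hV) h4

/-- The complexity of a sum of points. -/
lemma add_pt {a' b' : k} [(SW a' b').IsElliptic] {P Q : Pt (io a b a') (io a b b')} (hP : P ≠ 0)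
    (hQ : Q ≠ 0) (hx : px P ≠ px Q) (h1 : Cx n (px P)) (h2 : Cx n (py P)) (h3 : Cx n (px Q))
    (h4 : Cx n (py Q)) : Cx (22 * n + 24) (px (P + Q)) ∧ Cx (22 * n + 24) (py (P + Q)) := by
  have hs : Cx (6 * n + 6) (slp P Q) := by
    rw [slp, div_eq_mul_inv]
    exact ((h2.sub h4).mul (h1.sub h3).inv).mono (by omega)
  have hx' : Cx (14 * n + 15) (px (P + Q)) := by
    rw [px_add hP hQ hx, pow_two]
    exact (((hs.mul hs).sub h1).sub h3).mono (by omega)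
  refine ⟨hx'.mono (by omega), ?_⟩
  rw [py_add hP hQ hx]
  exact ((hs.mul (h1.sub hx')).sub h2).mono (by omega)

variable [(SW a b).IsElliptic]

lemma gam_add (Q : Pt a b) : Cx 46 (px (gam + cst (io a b) Q)) ∧ Cx 46 (py (gam + cst (io a b) Q)) := by
  by_cases hQ : Q = 0
  · rw [hQ, map_zero, add_zero, px_gam, py_gam]
    exact ⟨xx.mono (by omega), yy.mono (by omega)⟩
  have h1 : px (cst (io a b) Q) = io a b (px Q) := by simp [cst]
  have h2 : py (cst (io a b) Q) = io a b (py Q) := by simp [cst]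
  refine add_pt (a' := a) (b' := b) (P := gam) (Q := cst (io a b) Q) (n := 1) gam_ne_zero
    (by simpa using hQ) ?_ 
    (by rw [px_gam]; exact xx) (by rw [py_gam]; exact yy.mono (by omega)) (by rw [h1]; exact (const _).mono (by omega))
    (by rw [h2]; exact (const _).mono (by omega))
  rw [h1, px_gam]; exact xx_ne_io (a := a) (b := b) _

lemma xs (H : AddSubgroup (Pt a b)) [Finite H] (Q : Pt a b) :
    Cx (46 * (fs H).card) (xs H (gam + cst (io a b) Q)) ∧
    Cx (46 * (fs H).card) (ys H (gam + cst (io a b) Q)) := by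
  constructor
  · refine sum _ fun R _ => ?_
    rw [add_assoc, ← map_add]; exact (gam_add _).1
  · refine sum _ fun R _ => ?_
    rw [add_assoc, ← map_add]; exact (gam_add _).2

end Cx

end Complexity

section Nonsingular

variable {k : Type*} [Field k] [IsAlgClosed k] [NeZero (2 : k)] {a b : k} [(SW a b).IsElliptic]
  {H : AddSubgroup (Pt a b)} [Finite H]

lemma gam_ne_cst (T : Pt a b) : gam ≠ cst (io a b) T := by
  intro h
  have := lg_gam (a := a) (b := b)
  rw [h, lg_cst DD_io] at this
  exact zero_ne_one this

lemma DD_xs_gam : DD a b (xs H gam) = ys H gam := by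
  rw [deriv_xs gam gam_ne_cst, lg_gam, one_mul]

lemma cx_xs_gam : Cx (46 * (fs H).card) (xs H (gam (a := a) (b := b))) := by
  have := (Cx.xs H (0 : Pt a b)).1
  rwa [map_zero, add_zero] at this

lemma cx_ys_gam : Cx (46 * (fs H).card) (ys H (gam (a := a) (b := b))) := by
  have := (Cx.xs H (0 : Pt a b)).2
  rwa [map_zero, add_zero] at this

lemma xs_gam_not_reg : xs H (gam (a := a) (b := b)) ∉ (plc (0 : Pt a b)).Reg :=
  not_reg_xs (plc_sp_gam 0) gam_ne_zero

/-- The differential equation of the coordinate function on a quotient, in terms of polynomials. -/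
theorem Ode.exists_poly {κ α β : k} (h : Ode H κ α β) : ∃ U V : k[X], IsCoprime U V ∧ V ≠ 0 ∧
    (xs H gam - io a b κ) * pe a b V = pe a b U ∧ U.natDegree ≤ 46 * (fs H).card ∧
    V.natDegree < U.natDegree ∧
    fpoly a b * (derivative U * V - U * derivative V) ^ 2 =
      V * (U ^ 3 + C α * U * V ^ 2 + C β * V ^ 3) := by
  have hodd := mem_MM.1 (gam_mem_MM (a := a) (b := b))
  have hev : cj (xs H gam - io a b κ) = xs H gam - io a b κ := by
    rw [map_sub, cj_io, cj_xs hodd]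
  have hc : Cx (46 * (fs H).card) (xs H gam - io a b κ) :=
    (cx_xs_gam.sub (Cx.const κ)).mono le_rfl
  obtain ⟨U, V, hUV, hV, hx, hU, -⟩ := hc.even hev
  refine ⟨U, V, hUV, hV, hx, hU, ?_, ?_⟩
  · by_contra! hle
    have := EvReg.reg ⟨U, V, hV, hx, hle⟩ (plc_zero_xx (a := a) (b := b))
    have := add_mem this (Place.const_mem _ κ)
    rw [sub_add_cancel] at this
    exact xs_gam_not_reg this
  · have hd := (DD a b).div hx
    rw [map_sub, DD_xs_gam, DD_io, sub_zero, DD_pe, DD_pe] at hd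
    have ho : ys H gam ^ 2 = _ := h
    apply pe_injective (a := a) (b := b)
    simp only [map_mul, map_pow, map_sub, map_add, Cx.pe_fpoly, pe_C, ← hx]
    generalize xs H gam - io a b κ = R at *
    have e : ys H gam * pe a b V ^ 2 = (pe a b (derivative U) * pe a b V -
      R * pe a b V * pe a b (derivative V)) * yy a b := by linear_combination (pe a b V) * hd
    have e2 := congrArg (· ^ 2) e
    linear_combination -e2 + (pe a b V) ^ 4 * ho

/-- The quotient of an elliptic curve by a small subgroup is nonsingular. -/
theorem Ode.nonsing {κ α β : k} (h : Ode H κ α β) (hN : Big k (46 * (fs H).card + 3)) :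
    4 * α ^ 3 + 27 * β ^ 2 ≠ 0 := by
  intro h0
  have h2 : (2 : k) ≠ 0 := two_ne_zero
  have h3 : (3 : k) ≠ 0 := by simpa using hN 3 (by norm_num) (by omega)
  obtain ⟨e, he1, he2⟩ : ∃ e, α = -3 * e ^ 2 ∧ β = 2 * e ^ 3 := by
    by_cases hα : α = 0
    · have : β = 0 := by
        have : 3 ^ 3 * β ^ 2 = 0 := by rw [hα] at h0; linear_combination h0
        simpa [h3] using this
      exact ⟨0, by simp [hα], by simp [this]⟩
    · refine ⟨-3 * β / (2 * α), ?_, ?_⟩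
      · field_simp
        linear_combination h0
      · field_simp
        linear_combination β * h0
  obtain ⟨U, V, hUV, hV, -, hU, hlt, hode⟩ := h.exists_poly
  set W := U - C e * V with hW
  have hdeg : W.natDegree = U.natDegree :=
    natDegree_sub_eq_left_of_natDegree_lt ((natDegree_C_mul_le _ _).trans_lt hlt)
  have hW0 : W ≠ 0 := by rintro h; rw [h, natDegree_zero] at hdeg; omega
  obtain ⟨x, hx⟩ := IsAlgClosed.exists_root W (by
    rw [degree_eq_natDegree hW0]; exact_mod_cast (by omega : W.natDegree ≠ 0))
  have hVx : V.eval x ≠ 0 := by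
    intro hv
    obtain ⟨A, B, hAB⟩ := hUV
    have hu : U.eval x = 0 := by
      have : W.eval x = 0 := hx
      rwa [hW, eval_sub, eval_mul, hv, mul_zero, sub_zero] at this
    have := congrArg (eval x) hAB
    simp [hu, hv] at this
  obtain ⟨G, hG, hGx⟩ := exists_eq_pow_rootMultiplicity_mul_and_not_dvd W hW0 x
  rw [dvd_iff_isRoot, IsRoot.def] at hGx
  have hn0 : W.rootMultiplicity x ≠ 0 := by
    rw [Ne, rootMultiplicity_eq_zero_iff]; push Not; exact ⟨hx, hW0⟩
  have hn1 : W.rootMultiplicity x ≤ 46 * (fs H).card + 3 := by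
    have := natDegree_le_of_dvd (pow_rootMultiplicity_dvd W x) hW0
    rw [natDegree_pow, natDegree_X_sub_C] at this
    omega
  generalize W.rootMultiplicity x = n at hG hn0 hn1
  obtain ⟨m, rfl⟩ := Nat.exists_eq_succ_of_ne_zero hn0
  set M := C ((m + 1 : ℕ) : k) * G * V + (X - C x) * (derivative G * V - G * derivative V) with hM
  have hω : derivative U * V - U * derivative V = (X - C x) ^ m * M := by
    have : derivative U * V - U * derivative V = derivative W * V - W * derivative V := by
      simp only [hW, derivative_sub, derivative_mul, derivative_C, zero_mul, zero_add]; ring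
    rw [this, hG, hM]
    simp only [derivative_mul, derivative_X_sub_C_pow, Nat.succ_eq_add_one, Nat.add_sub_cancel]
    push_cast
    simp only [map_add, map_natCast, map_one]
    ring
  have hMx : M.eval x ≠ 0 := by
    rw [hM]
    simp only [eval_add, eval_mul, eval_C, eval_sub, eval_X, sub_self, zero_mul, add_zero]
    exact mul_ne_zero (mul_ne_zero (hN _ hn0 hn1) hGx) hVx
  have hXx : (X - C x) ≠ 0 := X_sub_C_ne_zero x
  have key : fpoly a b * M ^ 2 = (X - C x) ^ 2 * (V * G ^ 2 * (U + C (2 * e) * V)) := by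
    have hU' : U = (X - C x) ^ (m + 1) * G + C e * V := by rw [← hG, hW]; ring
    apply mul_left_cancel₀ (pow_ne_zero 2 (pow_ne_zero m hXx))
    have : U ^ 3 + C α * U * V ^ 2 + C β * V ^ 3 = W ^ 2 * (U + C (2 * e) * V) := by
      rw [hW, he1, he2]
      simp only [map_mul, map_pow, map_neg, map_ofNat]
      ring
    rw [hω, this, hG, Nat.succ_eq_add_one] at hode
    linear_combination hode
  have hc : IsCoprime ((X - C x) ^ 2) (M ^ 2) := by
    refine IsCoprime.pow ?_
    rw [(irreducible_X_sub_C x).coprime_iff_not_dvd, dvd_iff_isRoot]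
    exact hMx
  have hdvd : (X - C x) ^ 2 ∣ fpoly a b := hc.dvd_of_dvd_mul_right ⟨_, key⟩
  have := (le_rootMultiplicity_iff (fpoly_ne_zero a b)).2 hdvd
  have := fpoly_rootMultiplicity_le (a := a) (b := b) x
  omega

end Nonsingular

section Quotient

variable {k : Type*} [Field k] [IsAlgClosed k] [NeZero (2 : k)] {a b a' b' : k}
  [(SW a b).IsElliptic] [(SW a' b').IsElliptic] {H : AddSubgroup (Pt a b)} [Finite H]

lemma sp_translate {w : Pt (io a b a') (io a b b')} {P Q : Pt a b} {R : Pt a' b'} :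
    (plc (P + Q)).Sp w R ↔
      (plc P).Sp (mapPt (th (gam + cst (io a b) Q)) (th_io _ a') (th_io _ b') w) R := by
  simp only [Place.Sp, plc_translate, Ne, mapPt_eq_zero, px_mapPt, py_mapPt, map_inv₀,
    map_eq_zero_iff _ (th (gam + cst (io a b) Q)).injective]

lemma lg_gam_add (Q : Pt a b) : lg (DD a b) (gam + cst (io a b) Q) = 1 := by
  rw [lg_add DD_io (ff_two_ne_zero two_ne_zero), lg_gam, lg_cst DD_io, add_zero]

lemma DD_xs_gam_add (Q : Pt a b) :
    DD a b (xs H (gam + cst (io a b) Q)) = ys H (gam + cst (io a b) Q) := by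
  rw [deriv_xs _ fun T h => ?_, lg_gam_add, one_mul]
  have := lg_gam_add Q
  rw [h, lg_cst DD_io] at this
  exact zero_ne_one this

lemma th_xs_gam (Q : Pt a b) :
    th (gam + cst (io a b) Q) (xs H gam) = xs H (gam + cst (io a b) Q) := by
  rw [map_xs (th_io _)]
  exact congrArg _ (tpt_gam Q)

lemma th_ys_gam (Q : Pt a b) :
    th (gam + cst (io a b) Q) (ys H gam) = ys H (gam + cst (io a b) Q) := by
  rw [map_ys (th_io _)]
  exact congrArg _ (tpt_gam Q)

lemma ys_gam_ne_zero (hN : Big k (92 * (fs H).card + 3)) : ys H (gam (a := a) (b := b)) ≠ 0 := by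
  intro h0
  obtain ⟨c, hc⟩ := (cx_xs_gam (a := a) (b := b) (H := H)).eq_const (hN.mono (by omega))
    (by rw [DD_xs_gam, h0])
  exact xs_nonconst c hc

lemma xs_gam_reg_iff (Q : Pt a b) : xs H (gam (a := a) (b := b)) ∈ (plc Q).Reg ↔ Q ∉ H := by
  refine ⟨fun h hQ => ?_, fun h => ⟨_, (res_xs (plc_sp_gam Q) h).1⟩⟩
  obtain ⟨c, hc⟩ := h
  rw [← zero_add Q, plc_translate, th_xs_gam, xs_add_cst _ hQ] at hc
  exact xs_gam_not_reg ⟨c, hc⟩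

/-- The quotient isogeny by a small finite subgroup. -/
theorem Ode.exists_isog {κ α β l : k} (h : Ode H κ α β) (hl : l ≠ 0)
    (hN : Big k (2024 * (fs H).card + 51)) (ha : a' = l ^ 4 * α) (hb : b' = l ^ 6 * β) :
    ∃ (w : Pt (io a b a') (io a b b')) (φ : Pt a b →+ Pt a' b'), IsIsog w φ l⁻¹ ∧
      ∀ P, φ P = 0 ↔ P ∈ H := by
  have h2 : (2 : k) ≠ 0 := two_ne_zero
  have h2F := ff_two_ne_zero (a := a) (b := b) h2
  have hl' : io a b l ≠ 0 := (_root_.map_ne_zero _).2 hl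
  have hodd := mem_MM.1 (gam_mem_MM (a := a) (b := b))
  have hy0 := ys_gam_ne_zero (a := a) (b := b) (H := H) (hN.mono (by omega))
  have ho : ys H gam ^ 2 = _ := h
  obtain ⟨w, hw0, hwx, hwy⟩ : ∃ w : Pt (io a b a') (io a b b'), w ≠ 0 ∧
      px w = io a b (l ^ 2) * (xs H gam - io a b κ) ∧ py w = io a b (l ^ 3) * ys H gam := by
    refine ⟨mkP (io a b (l ^ 2) * (xs H gam - io a b κ)) (io a b (l ^ 3) * ys H gam) ?_,
      mkP_ne_zero _ _ _, rfl, rfl⟩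
    rw [ha, hb]
    simp only [map_mul, map_pow]
    linear_combination (io a b l) ^ 6 * ho
  have htx : ∀ Q, px (mapPt (th (gam + cst (io a b) Q)) (th_io _ a') (th_io _ b') w) =
      io a b (l ^ 2) * (xs H (gam + cst (io a b) Q) - io a b κ) := fun Q => by
    rw [px_mapPt, hwx, map_mul, map_sub, th_io, th_io, th_xs_gam]
  have hty : ∀ Q, py (mapPt (th (gam + cst (io a b) Q)) (th_io _ a') (th_io _ b') w) =
      io a b (l ^ 3) * ys H (gam + cst (io a b) Q) := fun Q => by
    rw [py_mapPt, hwy, map_mul, th_io, th_ys_gam]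
  have hreg : ∀ (pl : Place (io a b)) (ξ : FF a b),
      io a b (l ^ 2) * (ξ - io a b κ) ∈ pl.Reg ↔ ξ ∈ pl.Reg := by
    intro pl ξ
    refine ⟨fun h => ?_, fun h => mul_mem (pl.const_mem _) (sub_mem h (pl.const_mem _))⟩
    have := add_mem (mul_mem (pl.const_mem (l ^ 2)⁻¹) h) (pl.const_mem κ)
    rwa [← mul_assoc, ← map_mul, inv_mul_cancel₀ (pow_ne_zero 2 hl), map_one, one_mul,
      sub_add_cancel] at this
  have hlg : lg (DD a b) w = io a b l⁻¹ := by
    rw [lg, hwx, hwy, (DD a b).leib, map_sub, DD_io, DD_io, DD_xs_gam]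
    simp only [map_pow, map_inv₀]
    field_simp
    ring
  have hlgt : ∀ Q, lg (DD a b) (mapPt (th (gam + cst (io a b) Q)) (th_io _ a') (th_io _ b') w) =
      io a b l⁻¹ := by
    intro Q
    have : ys H (gam + cst (io a b) Q) ≠ 0 := by
      rw [← th_ys_gam]; exact (_root_.map_ne_zero _).2 hy0
    rw [lg, htx, hty, (DD a b).leib, map_sub, DD_io, DD_io, DD_xs_gam_add]
    simp only [map_pow, map_inv₀]
    field_simp
    ring
  choose φ hφ using fun P : Pt a b => Place.Sp.total (pl := plc P) w
  have hker : ∀ P, φ P = 0 ↔ P ∈ H := by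
    intro P
    rw [← not_iff_not, ← xs_gam_reg_iff, ← hreg, ← hwx]
    rcases hφ P with ⟨-, h2, h3, -⟩ | ⟨h1, h2⟩
    · exact ⟨fun _ => ⟨_, h3⟩, fun _ => h2⟩
    · refine ⟨fun h => absurd h1 h, fun h => ?_⟩
      obtain ⟨h3, h4⟩ := h2.resolve_left hw0
      obtain ⟨c, hc⟩ := h
      exact absurd h4 ((plc P).not_res_inv h3 hc)
  have hcx : Cx (46 * (fs H).card) (px w) ∧ Cx (46 * (fs H).card) (py w) := by
    rw [hwx, hwy]
    exact ⟨((cx_xs_gam.sub (Cx.const κ)).mono le_rfl).const_mul _, cx_ys_gam.const_mul _⟩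
  have htr : ∀ Q, mapPt (th (gam + cst (io a b) Q)) (th_io _ a') (th_io _ b') w =
      w + cst (io a b) (φ Q) := by
    intro Q
    have hne : mapPt (th (gam + cst (io a b) Q)) (th_io _ a') (th_io _ b') w ≠ 0 := by
      rwa [Ne, mapPt_eq_zero]
    by_cases hQ : Q ∈ H
    · rw [(hker Q).2 hQ, map_zero, add_zero]
      refine pt_ext hne hw0 ?_ ?_
      · rw [htx, hwx, xs_add_cst _ hQ]
      · rw [hty, hwy, ys_add_cst _ hQ]
    · have hx : px (mapPt (th (gam + cst (io a b) Q)) (th_io _ a') (th_io _ b') w) ≠ px (-w) := by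
        rw [px_neg]
        intro he
        have h1 : px w ∉ (plc (0 : Pt a b)).Reg := by
          rw [hwx, hreg]; exact xs_gam_not_reg
        refine h1 ?_
        rw [← he, htx, hreg, ← th_xs_gam]
        obtain ⟨c, hc⟩ := (xs_gam_reg_iff (H := H) Q).2 hQ
        rw [← zero_add Q, plc_translate] at hc
        exact ⟨c, hc⟩
      have hcx' : Cx (46 * (fs H).card)
            (px (mapPt (th (gam + cst (io a b) Q)) (th_io _ a') (th_io _ b') w)) ∧
          Cx (46 * (fs H).card)
            (py (mapPt (th (gam + cst (io a b) Q)) (th_io _ a') (th_io _ b') w)) := by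
        rw [htx, hty]
        exact ⟨(((Cx.xs H Q).1.sub (Cx.const κ)).mono le_rfl).const_mul _,
          (Cx.xs H Q).2.const_mul _⟩
      have hlt := hlgt Q
      have hsp : (plc (0 : Pt a b)).Sp
          (mapPt (th (gam + cst (io a b) Q)) (th_io _ a') (th_io _ b') w) (φ Q) := by
        rw [← sp_translate, zero_add]; exact hφ Q
      generalize mapPt (th (gam + cst (io a b) Q)) (th_io _ a') (th_io _ b') w = u at *
      have hc := Cx.add_pt hne (neg_ne_zero.2 hw0) hx hcx'.1 hcx'.2 (by rw [px_neg]; exact hcx.1)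
        (by rw [py_neg]; exact hcx.2.neg)
      have hz0 := add_ne hx
      have hlz : lg (DD a b) (u + -w) = 0 := by
        rw [lg_add DD_io h2F, lg_neg DD_io, hlg, hlt, add_neg_cancel]
      have hsz := (hsp.add two_ne_zero (hφ 0).neg)
      rw [(hker 0).2 H.zero_mem, neg_zero, add_zero] at hsz
      have hs := lg_spec DD_io h2F hz0
      rw [hlz, zero_mul, mul_zero] at hs
      obtain ⟨x, hx1⟩ := hc.1.eq_const (hN.mono (by omega)) hs.1
      obtain ⟨y, hy1⟩ := hc.2.eq_const (hN.mono (by omega))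
        ((mul_eq_zero.1 hs.2).resolve_left h2F)
      have he := eqn hz0
      rw [hx1, hy1, ← map_pow, ← map_pow, ← map_mul, ← map_add, ← map_add] at he
      have hT : u + -w = cst (io a b) (mkP x y ((io a b).injective he)) := by
        refine pt_ext hz0 ?_ ?_ ?_
        · rw [Ne, cst, mapPt_eq_zero]; exact mkP_ne_zero _ _ _
        · rw [hx1, cst, px_mapPt, px_mkP]
        · rw [hy1, cst, py_mapPt, py_mkP]
      rw [hT] at hsz
      rw [hsz.unique ((plc 0).sp_cst _), ← hT]
      abel
  have hadd : ∀ P Q, φ (P + Q) = φ P + φ Q := by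
    intro P Q
    have h1 := hφ (P + Q)
    rw [sp_translate, htr] at h1
    exact h1.unique ((hφ P).add_cst two_ne_zero _)
  refine ⟨w, AddMonoidHom.mk' φ hadd, ⟨?_, hφ, hlg, htr, inv_ne_zero hl, ?_⟩, hker⟩
  · refine pt_ext (by rwa [Ne, mapPt_eq_zero]) (neg_ne_zero.2 hw0) ?_ ?_
    · rw [px_mapPt, px_neg, hwx, map_mul, map_sub, cj_io, cj_io, cj_xs hodd]
    · rw [py_mapPt, py_neg, hwy, map_mul, cj_io, cj_ys hodd]; ring
  · have s1 := reg_tail (H := H) (plc_sp_gam (a := a) (b := b) 0)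
    have := sub_mem (Place.const_mem (plc (0 : Pt a b)) κ) s1
    convert this using 1
    rw [hwx, xs_split, px_gam]
    simp only [map_pow, map_inv₀]
    field_simp
    ring

end Quotient

lemma comap_card {G G' : Type*} [AddCommGroup G] [AddCommGroup G'] (f : G →+ G') [Finite f.ker]
    (L : AddSubgroup G') [Finite L] (hL : ∀ y ∈ L, ∃ x, f x = y) :
    Finite (L.comap f) ∧ Nat.card (L.comap f) = Nat.card L * Nat.card f.ker := by
  let r : L.comap f →+ L := (f.comp (L.comap f).subtype).codRestrict L (fun x => x.2)
  have hr : Function.Surjective r := by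
    rintro ⟨y, hy⟩
    obtain ⟨x, rfl⟩ := hL y hy
    exact ⟨⟨x, hy⟩, rfl⟩
  have e1 : r.ker ≃ f.ker :=
    { toFun := fun x => ⟨x.1.1, congrArg Subtype.val x.2⟩
      invFun := fun x => ⟨⟨x.1, by rw [AddSubgroup.mem_comap, x.2]; exact L.zero_mem⟩,
        Subtype.ext x.2⟩
      left_inv := fun _ => rfl
      right_inv := fun _ => rfl }
  have e : L.comap f ≃ L × f.ker :=
    AddSubgroup.addGroupEquivQuotientProdAddSubgroup.trans
      ((QuotientAddGroup.quotientKerEquivOfSurjective r hr).toEquiv.prodCongr e1)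
  exact ⟨Finite.of_equiv _ e.symm, by rw [Nat.card_congr e, Nat.card_prod]⟩

section Chain

variable {k : Type*} [Field k] [IsAlgClosed k] [NeZero (2 : k)] {a b : k} [(SW a b).IsElliptic]

lemma card_fs (H : AddSubgroup (Pt a b)) [Finite H] : (fs H).card = Nat.card H :=
  (Set.ncard_eq_toFinset_card _ _).symm.trans (Nat.card_coe_set_eq _).symm

/-- The multiplication by `n`. -/
noncomputable abbrev mulBy (a b : k) [(SW a b).IsElliptic] (n : ℕ) : Pt a b →+ Pt a b :=
  nsmulAddMonoidHom n

lemma mulBy_isIsog {n : ℕ} (hn : (n : k) ≠ 0) : ∃ w, IsIsog w (mulBy a b n) (n : k) := by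
  have h := (isEndo_gam (a := a) (b := b)).nsmul n
  rw [mul_one] at h
  have e : n • AddMonoidHom.id (Pt a b) = mulBy a b n := by ext P : 1; simp
  rw [e] at h
  exact ⟨_, h.isIsog hn⟩

/-- The curves appearing in the construction of an isogeny from `E` to a curve with multiplication
by `√-D`. -/
theorem exists_chain {D m : ℕ} {t : k} (ht : t ≠ 0) (hm : (m : k) ≠ 0)
    (htm : t ^ 2 = -D * m ^ 2) {w : Pt (io a b a) (io a b b)} {δ : Pt a b →+ Pt a b}
    (hδ : IsEndo w δ (-t)) (hδδ : ∀ P, δ (δ P) = -((D * m ^ 2 : ℕ) • P)) (hw : hh w = D * m ^ 2)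
    (hN : Big k (2024 * m + 51)) :
    ∃ α β : k, 4 * α ^ 3 + 27 * β ^ 2 ≠ 0 ∧ ∀ (l a' b' : k) [(SW a' b').IsElliptic], l ≠ 0 →
      a' = l ^ 4 * α → b' = l ^ 6 * β →
      (∃ (K : AddSubgroup (Pt a' b')) (_ : Finite K) (κ : k), Nat.card K = D ∧
        Ode K κ (D ^ 2 * a') (-D ^ 3 * b')) ∧
      ∃ (C : AddSubgroup (Pt a' b')) (_ : Finite C) (κ : k), (∀ P ∈ C, m • P = 0) ∧
        Ode C κ ((l * m) ^ 4 * a) ((l * m) ^ 6 * b) := by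
  have h3 : (3 : k) ≠ 0 := by simpa using hN 3 (by norm_num) (by omega)
  have hc : -t ≠ 0 := neg_ne_zero.2 ht
  have hm0 : m ≠ 0 := by rintro rfl; simp at hm
  obtain ⟨fm, cm⟩ := torsion_card (a := a) (b := b) hm
  obtain ⟨fδ, cδ⟩ := hδ.ker_card hc
  have sδ := hδ.surjective hc
  have sm := nsmul_surjective (a := a) (b := b) hm
  obtain ⟨wm, him⟩ := mulBy_isIsog (a := a) (b := b) hm
  set M := (mulBy a b m).ker with hM
  have memM : ∀ P, P ∈ M ↔ m • P = 0 := fun P => Iff.rfl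
  set C := M.map δ with hC
  have fC : Finite C := by
    have : (C : Set (Pt a b)).Finite := by
      rw [hC, AddSubgroup.coe_map]; exact (Set.toFinite (M : Set (Pt a b))).image _
    exact this.to_subtype
  have memC : ∀ P, P ∈ C ↔ ∃ Q, m • Q = 0 ∧ δ Q = P := fun P => Iff.rfl
  have hCM : ∀ P ∈ C, m • P = 0 := by
    rintro _ ⟨Q, hQ, rfl⟩
    rw [← map_nsmul, show m • Q = 0 from hQ, map_zero]
  have hCδ : ∀ P ∈ C, δ P = 0 := by
    rintro _ ⟨Q, hQ, rfl⟩
    rw [hδδ, pow_two, ← mul_assoc, mul_smul, show m • Q = 0 from hQ, smul_zero, neg_zero]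
  have cC : Nat.card C ≤ m := by
    have e := comap_card (δ.comp M.subtype) C (by
      rintro _ ⟨Q, hQ, rfl⟩
      exact ⟨⟨Q, hQ⟩, rfl⟩)
    have e1 : C.comap (δ.comp M.subtype) = ⊤ := by
      ext x; simp only [AddSubgroup.mem_comap, AddSubgroup.mem_top, iff_true]
      exact ⟨x.1, x.2, rfl⟩
    have e2 : Nat.card C ≤ Nat.card (δ.comp M.subtype).ker :=
      Nat.card_le_card_of_injective
        (fun x : C => (⟨⟨x.1, hCM _ x.2⟩, hCδ _ x.2⟩ : (δ.comp M.subtype).ker))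
        (fun x y hxy => Subtype.ext (congrArg (fun z => z.1.1) hxy))
    have e3 := e.2
    rw [e1, AddSubgroup.card_top, cm] at e3
    by_contra! hlt
    nlinarith
  have hNC : Big k (2024 * (fs C).card + 51) := hN.mono (by rw [card_fs]; omega)
  obtain ⟨κ, α, β, hCo⟩ := xs_ode (H := C)
  have hCo : Ode C κ α β := hCo
  refine ⟨α, β, hCo.nonsing (hNC.mono (by omega)), ?_⟩
  intro l a' b' _ hl ha hb
  obtain ⟨w', φ, hφ, hker⟩ := hCo.exists_isog hl hNC ha hb
  obtain ⟨fB, cB⟩ := comap_card δ C (fun y _ => sδ y)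
  obtain ⟨κB, hBo⟩ := (hδ.isIsog hc).transport (H' := C) (H := C.comap δ) (fun P => Iff.rfl) hCo
  set DG := (C.comap δ).map (mulBy a b m) with hDG
  have fDG : Finite DG := by
    have : (DG : Set (Pt a b)).Finite := by
      rw [hDG, AddSubgroup.coe_map]; exact (Set.toFinite (C.comap δ : Set (Pt a b))).image _
    exact this.to_subtype
  have hBD : ∀ P, P ∈ C.comap δ ↔ mulBy a b m P ∈ DG := by
    intro P
    refine ⟨fun h => ⟨P, h, rfl⟩, ?_⟩
    rintro ⟨Q, hQ, hQP⟩
    have h1 : m • (P - Q) = 0 := by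
      have : m • Q = m • P := hQP
      rw [smul_sub, this, sub_self]
    have h2 : P - Q ∈ C.comap δ := (memC _).2 ⟨P - Q, h1, rfl⟩
    simpa using add_mem h2 hQ
  obtain ⟨κD, αD, βD, hDo⟩ := xs_ode (H := DG)
  have hDo : Ode DG κD αD βD := hDo
  obtain ⟨κB', hBo'⟩ := him.transport hBD hDo
  obtain ⟨-, hα, hβ⟩ := hBo.unique h3 hBo'
  have hαD : αD = D ^ 2 * α := by
    apply mul_left_cancel₀ (pow_ne_zero 4 hm)
    linear_combination -hα + α * (t ^ 2 - D * m ^ 2) * htm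
  have hβD : βD = -D ^ 3 * β := by
    apply mul_left_cancel₀ (pow_ne_zero 6 hm)
    linear_combination -hβ + β * (t ^ 4 - t ^ 2 * D * m ^ 2 + D ^ 2 * m ^ 4) * htm
  have hCD : C ≤ DG := by
    rintro _ ⟨f, hf, rfl⟩
    obtain ⟨f', hf'⟩ := sm f
    refine ⟨δ f', ⟨0, M.zero_mem, ?_⟩, ?_⟩
    · rw [map_zero, hδδ, pow_two, ← mul_assoc, mul_smul, hf',
        mul_smul, show m • f = 0 from hf, smul_zero, neg_zero]
    · change m • δ f' = _
      rw [← map_nsmul, hf']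
  have cDG : Nat.card DG = D * Nat.card C := by
    have e := (comap_card (mulBy a b m) DG (fun y _ => sm y)).2
    have e1 : DG.comap (mulBy a b m) = C.comap δ := by ext P; exact (hBD P).symm
    rw [e1, cB, cδ, hw, ← hM, cm] at e
    have : 0 < m ^ 2 := by positivity
    nlinarith
  refine ⟨?_, ?_⟩
  · have fK : Finite (DG.map φ) := by
      have : ((DG.map φ : AddSubgroup _) : Set (Pt a' b')).Finite := by
        rw [AddSubgroup.coe_map]; exact (Set.toFinite (DG : Set (Pt a b))).image _
      exact this.to_subtype
    have hDK : ∀ P, P ∈ DG ↔ φ P ∈ DG.map φ := by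
      intro P
      refine ⟨fun h => ⟨P, h, rfl⟩, ?_⟩
      rintro ⟨Q, hQ, hQP⟩
      have h2 : P - Q ∈ DG := hCD ((hker _).1 (by rw [map_sub, hQP, sub_self]))
      simpa using add_mem h2 hQ
    obtain ⟨κK, αK, βK, hKo⟩ := xs_ode (H := DG.map φ)
    have hKo : Ode (DG.map φ) κK αK βK := hKo
    obtain ⟨κ', ho'⟩ := hφ.transport hDK hKo
    obtain ⟨-, h1, h2⟩ := hDo.unique h3 ho'
    refine ⟨DG.map φ, fK, κK, ?_, ?_⟩
    · have hkerC : φ.ker = C := by ext P; exact hker P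
      have fk : Finite φ.ker := by rw [hkerC]; exact fC
      have e := (comap_card φ (DG.map φ) (by rintro _ ⟨x, -, rfl⟩; exact ⟨x, rfl⟩)).2
      have e1 : (DG.map φ).comap φ = DG := by ext P; exact (hDK P).symm
      rw [e1, hkerC, cDG] at e
      exact (Nat.eq_of_mul_eq_mul_right Nat.card_pos e).symm
    · convert hKo using 1
      · rw [ha]
        have : αK = l ^ 4 * αD := by rw [h1]; field_simp
        rw [this, hαD]; ring
      · rw [hb]
        have : βK = l ^ 6 * βD := by rw [h2]; field_simp
        rw [this, hβD]; ring
  · have fK : Finite (M.map φ) := by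
      have : ((M.map φ : AddSubgroup _) : Set (Pt a' b')).Finite := by
        rw [AddSubgroup.coe_map]; exact (Set.toFinite (M : Set (Pt a b))).image _
      exact this.to_subtype
    have hDK : ∀ P, P ∈ M ↔ φ P ∈ M.map φ := by
      intro P
      refine ⟨fun h => ⟨P, h, rfl⟩, ?_⟩
      rintro ⟨Q, hQ, hQP⟩
      have h2 : P - Q ∈ M := hCM _ ((hker _).1 (by rw [map_sub, hQP, sub_self]))
      simpa using add_mem h2 hQ
    obtain ⟨κK, αK, βK, hKo⟩ := xs_ode (H := M.map φ)
    have hKo : Ode (M.map φ) κK αK βK := hKo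
    obtain ⟨κ', ho'⟩ := hφ.transport hDK hKo
    obtain ⟨κ'', ho''⟩ := him.transport (H' := ⊥) (H := M) (fun P => Iff.rfl) ode_bot
    obtain ⟨-, h1, h2⟩ := ho''.unique h3 ho'
    refine ⟨M.map φ, fK, κK, ?_, ?_⟩
    · rintro _ ⟨x, hx, rfl⟩
      rw [← map_nsmul, show m • x = 0 from hx, map_zero]
    · convert hKo using 1
      · rw [mul_pow, mul_assoc, h1]; field_simp
      · rw [mul_pow, mul_assoc, h2]; field_simp

end Chain

section Node

variable {k : Type*} [Field k] {R : Type*} [CommRing R]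

/-- The bilinear differential expression attached to `P / Q` at infinity. -/
noncomputable def br (P Q : R[X]) : R[X] := P * Q - X * (derivative P * Q - P * derivative Q)

/-- The differential equation at infinity for the curve `y² = x³ + c x + c`. -/
noncomputable def EE (c d : R) (P Q : R[X]) : R[X] :=
  (1 + C c * X ^ 2 + C c * X ^ 3) * br P Q ^ 2 -
    Q * (P ^ 3 + C (d ^ 2 * c) * X ^ 2 * P * Q ^ 2 - C (d ^ 3 * c) * X ^ 3 * Q ^ 3)

lemma br_mul (G P Q : R[X]) : br (G * P) (G * Q) = G ^ 2 * br P Q := by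
  simp only [br, derivative_mul]; ring

lemma EE_mul (c d : R) (G P Q : R[X]) : EE c d (G * P) (G * Q) = G ^ 4 * EE c d P Q := by
  simp only [EE, br_mul]; ring

lemma br_add (P Q : R[X]) (c : R) : br (P + C c * X * Q) Q = br P Q := by
  simp only [br, derivative_add, derivative_mul, derivative_C, derivative_X]; ring

lemma br_root_left {x : k} {n : ℕ} {G Q : k[X]} : ∃ M : k[X],
    br ((X - C x) ^ (n + 1) * G) Q = (X - C x) ^ n * M ∧
      M.eval x = -(x * ((n + 1 : ℕ) : k) * G.eval x * Q.eval x) := by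
  refine ⟨(X - C x) * G * Q - X * (C ((n + 1 : ℕ) : k) * G * Q +
    (X - C x) * (derivative G * Q - G * derivative Q)), ?_, ?_⟩
  · simp only [br, derivative_mul, derivative_X_sub_C_pow, Nat.add_sub_cancel]
    simp only [map_natCast]
    ring
  · simp only [eval_add, eval_mul, eval_sub, eval_X, eval_C, sub_self]; ring

lemma br_root_right {x : k} {n : ℕ} {G P : k[X]} : ∃ M : k[X],
    br P ((X - C x) ^ (n + 1) * G) = (X - C x) ^ n * M ∧
      M.eval x = x * ((n + 1 : ℕ) : k) * G.eval x * P.eval x := by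
  refine ⟨(X - C x) * G * P + X * (C ((n + 1 : ℕ) : k) * G * P +
    (X - C x) * (derivative G * P - G * derivative P)), ?_, ?_⟩
  · simp only [br, derivative_mul, derivative_X_sub_C_pow, Nat.add_sub_cancel]
    simp only [map_natCast]
    ring
  · simp only [eval_add, eval_mul, eval_sub, eval_X, eval_C, sub_self]; ring

lemma exists_root_factor {x : k} {P : k[X]} (hP : P ≠ 0) (hx : P.eval x = 0) :
    ∃ (n : ℕ) (G : k[X]), P = (X - C x) ^ (n + 1) * G ∧ G.eval x ≠ 0 ∧ n + 1 ≤ P.natDegree := by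
  obtain ⟨G, hG, hGx⟩ := exists_eq_pow_rootMultiplicity_mul_and_not_dvd P hP x
  have h1 : P.rootMultiplicity x ≠ 0 := by
    rw [Ne, rootMultiplicity_eq_zero_iff]; push Not; exact ⟨hx, hP⟩
  obtain ⟨n, hn⟩ := Nat.exists_eq_succ_of_ne_zero h1
  have h2 := natDegree_le_of_dvd (pow_rootMultiplicity_dvd P x) hP
  rw [natDegree_pow, natDegree_X_sub_C, mul_one, hn] at h2
  rw [hn] at hG
  exact ⟨n, G, hG, fun h => hGx (dvd_iff_isRoot.2 h), h2⟩

lemma node_coprime {ν d : k} {n : ℕ} (hν : ν ≠ 0) (h3 : (3 : k) ≠ 0) (hd : d ≠ 0)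
    (hs : ∀ s : ℕ, s ≤ n + 1 → (s : k) ^ 2 ≠ -d) {P Q : k[X]}
    (hPQ : IsCoprime P Q) (hQ : Q ≠ 0) (hP0 : P.eval 0 ≠ 0) (hPn : P.natDegree ≤ n) (hQn : Q.natDegree ≤ n)
    (h : (1 - C ν * X) ^ 2 * (1 + C (2 * ν) * X) * br P Q ^ 2 =
      Q * ((P + C (d * ν) * X * Q) ^ 2 * (P - C (2 * d * ν) * X * Q))) : False := by
  set x := ν⁻¹ with hx
  have hx0 : x ≠ 0 := inv_ne_zero hν
  have hνx : ν * x = 1 := mul_inv_cancel₀ hν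
  have e1 : (1 - C ν * X) ^ 2 = C (ν ^ 2) * (X - C x) ^ 2 := by
    have : (1 : k[X]) = C ν * C x := by rw [← C_mul, hνx, C_1]
    rw [this, C_pow]; ring
  have hXx : X - C x ≠ 0 := X_sub_C_ne_zero x
  have hcop : P.eval x = 0 → Q.eval x = 0 → False := by
    intro h1 h2
    obtain ⟨A, B, hAB⟩ := hPQ
    have := congrArg (eval x) hAB
    simp [h1, h2] at this
  rw [e1] at h
  have h0 := congrArg (eval x) h
  simp only [eval_mul, eval_pow, eval_sub, eval_X, eval_C, sub_self, eval_add, eval_one] at h0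
  rw [zero_pow two_ne_zero, mul_zero, zero_mul, zero_mul, eq_comm, mul_eq_zero, mul_eq_zero,
    pow_eq_zero_iff two_ne_zero] at h0
  by_cases hQx : Q.eval x = 0
  · obtain ⟨s, G, hG, hGx, hsn⟩ := exists_root_factor hQ hQx
    obtain ⟨M, hM, -⟩ := br_root_right (x := x) (n := s) (G := G) (P := P)
    rw [← hG] at hM
    have h' : (X - C x) ^ (s + 1) * (C (ν ^ 2) * (1 + C (2 * ν) * X) * M ^ 2) =
        G * ((P + C (d * ν) * X * Q) ^ 2 * (P - C (2 * d * ν) * X * Q)) := by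
      apply mul_left_cancel₀ (pow_ne_zero (s + 1) hXx)
      rw [hM] at h
      conv_rhs => rw [← mul_assoc, ← hG]
      rw [← h]; ring
    have := congrArg (eval x) h'
    simp only [eval_mul, eval_pow, eval_sub, eval_X, eval_C, sub_self, eval_add, hQx] at this
    rw [zero_pow (by omega), zero_mul, mul_zero, add_zero, mul_zero, sub_zero, eq_comm, mul_eq_zero,
      mul_eq_zero, pow_eq_zero_iff two_ne_zero, or_self] at this
    exact hcop (this.resolve_left hGx) hQx
  have hne : ∀ {e f : k}, e ≠ f → (P + C (e * ν) * X * Q).eval x = 0 →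
      (P + C (f * ν) * X * Q).eval x ≠ 0 := by
    intro e f hef h1 h2
    simp only [eval_add, eval_mul, eval_C, eval_X] at h1 h2
    have : (e - f) * (ν * x) * Q.eval x = 0 := by linear_combination h1 - h2
    rw [hνx, mul_one, mul_eq_zero] at this
    exact hQx (this.resolve_left (sub_ne_zero.2 hef))
  have hdeg : ∀ e : k, (P + C (e * ν) * X * Q).natDegree ≤ n + 1 := fun e => by
    refine natDegree_add_le_of_degree_le (by omega) ?_
    rw [mul_assoc]
    refine (natDegree_C_mul_le _ _).trans (natDegree_mul_le.trans ?_)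
    rw [natDegree_X]; omega
  have hd2 : d ≠ -2 * d := fun h => by
    have : 3 * d = 0 := by linear_combination h
    exact (mul_ne_zero h3 hd) this
  have hrw : P - C (2 * d * ν) * X * Q = P + C (-2 * d * ν) * X * Q := by
    simp only [map_mul, map_neg]; ring
  rw [hrw] at h
  have h0 : (P + C (d * ν) * X * Q).eval x = 0 ∨ (P + C (-2 * d * ν) * X * Q).eval x = 0 := by
    simp only [eval_add, eval_mul, eval_C, eval_X]
    exact (h0.resolve_left hQx).imp_right fun h => by linear_combination h
  have hz : ∀ e : k, P + C e * X * Q ≠ 0 := fun e h => hP0 (by simpa using congrArg (eval 0) h)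
  rcases h0 with h0 | h0
  · obtain ⟨s, G, hG, hGx, hsn⟩ := exists_root_factor (hz _) h0
    obtain ⟨M, hM, hMx⟩ := br_root_left (x := x) (n := s) (G := G) (Q := Q)
    rw [← hG, br_add] at hM
    have h' : C (ν ^ 2) * (1 + C (2 * ν) * X) * M ^ 2 =
        Q * (G ^ 2 * (P + C (-2 * d * ν) * X * Q)) := by
      apply mul_left_cancel₀ (pow_ne_zero 2 (pow_ne_zero (s + 1) hXx))
      rw [hM, hG] at h
      linear_combination h
    have h1 := congrArg (eval x) h'
    simp only [eval_mul, eval_pow, eval_X, eval_C, eval_add, eval_one, hMx] at h1 h0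
    refine hs (s + 1) (hsn.trans (hdeg d)) ?_
    have h2 : (3 * (G.eval x) ^ 2 * (Q.eval x) ^ 2) * (((s + 1 : ℕ) : k) ^ 2 + d) = 0 := by
      have hP : P.eval x = - (d * Q.eval x) := by linear_combination h0 - d * Q.eval x * hνx
      rw [hP] at h1
      push_cast at h1 ⊢
      linear_combination h1 - ((2 * (ν * x) ^ 2 + 3 * (ν * x) + 3) * ((s : k) + 1) ^ 2 + 2 * d) *
        (G.eval x) ^ 2 * (Q.eval x) ^ 2 * hνx
    exact eq_neg_of_add_eq_zero_left ((mul_eq_zero.1 h2).resolve_left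
      (mul_ne_zero (mul_ne_zero h3 (pow_ne_zero 2 hGx)) (pow_ne_zero 2 hQx)))
  · obtain ⟨s, G, hG, hGx, hsn⟩ := exists_root_factor (hz _) h0
    obtain ⟨M, hM, -⟩ := br_root_left (x := x) (n := s) (G := G) (Q := Q)
    rw [← hG, br_add] at hM
    have h' : (X - C x) ^ (s + 1) * (C (ν ^ 2) * (1 + C (2 * ν) * X) * M ^ 2) =
        Q * ((P + C (d * ν) * X * Q) ^ 2 * G) := by
      apply mul_left_cancel₀ (pow_ne_zero (s + 1) hXx)
      rw [hM, hG] at h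
      linear_combination h
    have h1 := congrArg (eval x) h'
    have h2 := hne hd2.symm h0
    rw [eval_mul, eval_pow, eval_sub, eval_X, eval_C, sub_self, zero_pow (by omega), zero_mul,
      eq_comm, eval_mul, eval_mul, eval_pow] at h1
    exact mul_ne_zero hQx (mul_ne_zero (pow_ne_zero 2 h2) hGx) h1

end Node

section Expansion

variable {k : Type*} [Field k] {R : Type*} [CommRing R]

lemma EE_step (c d : R) (P Q S : R[X]) (n : ℕ) : ∃ Z : R[X],
    EE c d (P + X ^ (n + 1) * S) Q = EE c d P Q +
      X ^ (n + 1) * (2 * br P Q * (-(n : R[X]) * S * Q) - 3 * Q * P ^ 2 * S) +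
        X ^ (n + 2) * Z := by
  have hb : br (P + X ^ (n + 1) * S) Q = br P Q + X ^ (n + 1) *
      (-(n : R[X]) * S * Q - X * (derivative S * Q - S * derivative Q)) := by
    simp only [br, derivative_add, derivative_mul, derivative_X_pow, Nat.add_sub_cancel, map_natCast]
    push_cast
    ring
  set B := br P Q
  set e := derivative S * Q - S * derivative Q
  refine ⟨2 * B * (C c * X + C c * X ^ 2) * (-(n : R[X]) * S * Q - X * e) - 2 * B * e +
    (1 + C c * X ^ 2 + C c * X ^ 3) * X ^ n * (-(n : R[X]) * S * Q - X * e) ^ 2 -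
    Q * (3 * P * X ^ n * S ^ 2 + X ^ n * X ^ (n + 1) * S ^ 3 + C (d ^ 2 * c) * X * S * Q ^ 2), ?_⟩
  rw [EE, hb, EE]
  ring

lemma eval_zero_br (P Q : R[X]) : (br P Q).eval 0 = P.eval 0 * Q.eval 0 := by
  simp [br]

lemma EE_map {R' : Type*} [CommRing R'] (φ : R →+* R') (c d : R) (P Q : R[X]) :
    (EE c d P Q).map φ = EE (φ c) (φ d) (P.map φ) (Q.map φ) := by
  simp only [EE, br, Polynomial.map_sub, Polynomial.map_mul, Polynomial.map_add,
    Polynomial.map_pow, Polynomial.map_one, map_X, map_C, derivative_map, map_mul, map_pow]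

/-- Polynomials over `k[c]` whose `i`-th coefficient has degree at most `i` in `c`. -/
def graded (k : Type*) [Field k] : Subring k[X][X] where
  carrier := {H | ∀ i, (H.coeff i).natDegree ≤ i}
  mul_mem' := by
    intro a b ha hb i
    rw [coeff_mul]
    refine natDegree_sum_le_of_forall_le _ _ fun x hx => ?_
    rw [← Finset.HasAntidiagonal.mem_antidiagonal.1 hx]
    exact natDegree_mul_le.trans (add_le_add (ha _) (hb _))
  one_mem' := by
    intro i
    rw [coeff_one]; split_ifs <;> simp
  add_mem' := by
    intro a b ha hb i
    rw [coeff_add]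
    exact natDegree_add_le_of_degree_le (ha i) (hb i)
  zero_mem' := by intro i; simp
  neg_mem' := by intro a ha i; rw [coeff_neg, natDegree_neg]; exact ha i

lemma graded_monomial {f : k[X]} {i : ℕ} (h : f.natDegree ≤ i) : C f * X ^ i ∈ graded k := by
  intro j
  rw [coeff_C_mul_X_pow]
  split_ifs with hj
  · rw [hj]; exact h
  · simp

lemma graded_X_mul_derivative {H : k[X][X]} (h : H ∈ graded k) :
    X * derivative H ∈ graded k := by
  intro i
  rcases i with _ | i
  · simp
  · rw [coeff_X_mul, coeff_derivative]
    refine natDegree_mul_le.trans ?_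
    have : ((i : k[X]) + 1).natDegree = 0 := by exact_mod_cast natDegree_natCast (i + 1)
    rw [this]
    exact h (i + 1)

lemma graded_br {H : k[X][X]} (h : H ∈ graded k) : br H 1 ∈ graded k := by
  have : br H 1 = H - X * derivative H := by simp [br]
  rw [this]
  exact sub_mem h (graded_X_mul_derivative h)

lemma graded_EE {H : k[X][X]} (h : H ∈ graded k) (d : k) : EE X (C d) H 1 ∈ graded k := by
  have h1 : C X * X ^ 2 ∈ graded k := graded_monomial (by rw [natDegree_X]; omega)
  have h2 : C X * X ^ 3 ∈ graded k := graded_monomial (by rw [natDegree_X]; omega)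
  have h3 : C (C d ^ 2 * X) * X ^ 2 ∈ graded k := graded_monomial (by
    rw [← C_pow]; exact (natDegree_C_mul_le _ _).trans (by rw [natDegree_X]; omega))
  have h4 : C (C d ^ 3 * X) * X ^ 3 ∈ graded k := graded_monomial (by
    rw [← C_pow]; exact (natDegree_C_mul_le _ _).trans (by rw [natDegree_X]; omega))
  have e : EE X (C d) H 1 = (1 + C X * X ^ 2 + C X * X ^ 3) * br H 1 ^ 2 -
      (H ^ 3 + C (C d ^ 2 * X) * X ^ 2 * H - C (C d ^ 3 * X) * X ^ 3) := by
    rw [EE]; ring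
  rw [e]
  exact sub_mem (mul_mem (add_mem (add_mem (one_mem _) h1) h2) (pow_mem (graded_br h) 2))
    (sub_mem (add_mem (pow_mem h 3) (mul_mem h3 h)) h4)

lemma exists_expansion (d : k) (M : ℕ) (hM : Big k (2 * M + 1)) : ∃ H : k[X][X],
    H ∈ graded k ∧ H.coeff 0 = 1 ∧ X ^ (M + 1) ∣ EE X (C d) H 1 := by
  induction M with
  | zero =>
    refine ⟨1, one_mem _, by simp, ?_⟩
    rw [zero_add, pow_one, X_dvd_iff, coeff_zero_eq_eval_zero]
    simp [EE, br]
  | succ m ih =>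
    obtain ⟨H, hH, h0, E, hE⟩ := ih (hM.mono (by omega))
    have h2 : ((2 * m + 3 : ℕ) : k) ≠ 0 := hM _ (by omega) (by omega)
    set g : k[X] := C (((2 * m + 3 : ℕ) : k)⁻¹) * E.coeff 0 with hg
    obtain ⟨Z, hZ⟩ := EE_step X (C d) H 1 (C g) m
    have hEd : (E.coeff 0).natDegree ≤ m + 1 := by
      have := graded_EE hH d (m + 1)
      rwa [hE, coeff_X_pow_mul', if_pos le_rfl, Nat.sub_self] at this
    refine ⟨H + X ^ (m + 1) * C g, add_mem hH ?_, ?_, ?_⟩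
    · rw [mul_comm]
      exact graded_monomial ((natDegree_C_mul_le _ _).trans hEd)
    · simp [h0]
    · rw [hZ, hE, ← mul_add]
      refine dvd_add ?_ (Dvd.intro _ rfl)
      rw [show m + 1 + 1 = (m + 1) + 1 from rfl, pow_succ X (m + 1)]
      refine mul_dvd_mul_left _ ?_
      rw [X_dvd_iff, coeff_zero_eq_eval_zero]
      rw [coeff_zero_eq_eval_zero] at h0
      have hgE : (2 * (m : k[X]) + 3) * g = E.eval 0 := by
        rw [hg, coeff_zero_eq_eval_zero, ← mul_assoc]
        have : (2 * (m : k[X]) + 3) = C ((2 * m + 3 : ℕ) : k) := by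
          rw [map_natCast]; push_cast; ring
        rw [this, ← C_mul, mul_inv_cancel₀ h2, C_1, one_mul]
      simp only [eval_add, eval_sub, eval_mul, eval_pow, eval_neg, eval_C, eval_one,
        eval_natCast, eval_ofNat, eval_zero_br, h0]
      linear_combination -hgE

lemma expansion_unique {c d : k} {H P Q : k[X]} {M : ℕ} (hM : Big k (2 * M + 1))
    (h0 : H.eval 0 = 1) (hH : X ^ (M + 1) ∣ EE c d H 1) (hE : EE c d P Q = 0)
    (hPQ : P.eval 0 = Q.eval 0) (hQ : Q.eval 0 ≠ 0) : X ^ (M + 1) ∣ P - Q * H := by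
  have key : ∀ m ≤ M, X ^ (m + 1) ∣ P - Q * H := by
    intro m
    induction m with
    | zero =>
      intro _
      rw [zero_add, pow_one, X_dvd_iff, coeff_zero_eq_eval_zero]
      simp [h0, hPQ]
    | succ m ih =>
      intro hm
      obtain ⟨S, hS⟩ := ih (by omega)
      have hP : P = Q * H + X ^ (m + 1) * S := by rw [← hS]; ring
      obtain ⟨Z, hZ⟩ := EE_step c d (Q * H) Q S m
      rw [← hP, hE] at hZ
      have h1 : EE c d (Q * H) Q = Q ^ 4 * EE c d H 1 := by
        simpa only [mul_one] using EE_mul c d Q H 1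
      obtain ⟨E, hE'⟩ : X ^ (m + 2) ∣ EE c d (Q * H) Q := by
        rw [h1]
        exact ((pow_dvd_pow X (by omega)).trans hH).mul_left _
      rw [hS, pow_succ]
      refine mul_dvd_mul_left _ ?_
      rw [X_dvd_iff, coeff_zero_eq_eval_zero]
      have h2 : 2 * br (Q * H) Q * (-(m : k[X]) * S * Q) - 3 * Q * (Q * H) ^ 2 * S =
          - (X * (E + Z)) := by
        apply mul_left_cancel₀ (pow_ne_zero (m + 1) (X_ne_zero (R := k)))
        rw [hE'] at hZ
        linear_combination -hZ
      have h3 := congrArg (eval 0) h2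
      simp only [eval_add, eval_sub, eval_mul, eval_pow, eval_neg, eval_X,
        eval_natCast, eval_ofNat, eval_zero_br, h0, zero_mul, neg_zero] at h3
      have h4 : ((2 * m + 3 : ℕ) : k) * (Q.eval 0) ^ 3 * S.eval 0 = 0 := by
        push_cast
        linear_combination -h3
      exact (mul_eq_zero.1 h4).resolve_left
        (mul_ne_zero (hM _ (by omega) (by omega)) (pow_ne_zero 3 hQ))
  exact key M le_rfl

lemma natDegree_br_le {P Q : k[X]} {n : ℕ} (hP : P.natDegree ≤ n) (hQ : Q.natDegree ≤ n) :
    (br P Q).natDegree ≤ 2 * n := by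
  have h1 : ∀ {f g : k[X]}, f.natDegree ≤ n → g.natDegree ≤ n →
      (X * (derivative f * g)).natDegree ≤ 2 * n := by
    intro f g hf hg
    by_cases h : f.natDegree = 0
    · rw [natDegree_eq_zero.1 h |>.choose_spec.symm]; simp
    · have h2 := natDegree_derivative_lt h
      have h3 := natDegree_mul_le (p := derivative f) (q := g)
      have h4 := natDegree_mul_le (p := (X : k[X])) (q := derivative f * g)
      rw [natDegree_X] at h4
      omega
  have e : br P Q = P * Q - X * (derivative P * Q) + X * (derivative Q * P) := by rw [br]; ring
  rw [e]
  have h2 : (P * Q).natDegree ≤ 2 * n := natDegree_mul_le.trans (by omega)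
  exact natDegree_add_le_of_degree_le ((natDegree_sub_le _ _).trans (max_le h2 (h1 hP hQ)))
    (h1 hQ hP)

lemma natDegree_EE_le {c d : k} {P Q : k[X]} {n : ℕ} (hP : P.natDegree ≤ n)
    (hQ : Q.natDegree ≤ n) : (EE c d P Q).natDegree ≤ 4 * n + 3 := by
  have hb := natDegree_br_le hP hQ
  have e1 : (1 + C c * X ^ 2 + C c * X ^ 3 : k[X]).natDegree ≤ 3 := by compute_degree
  have hm : ∀ {f g : k[X]} {a b e : ℕ}, f.natDegree ≤ a → g.natDegree ≤ b → a + b ≤ e →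
      (f * g).natDegree ≤ e := fun hf hg h => natDegree_mul_le.trans (by omega)
  have hp : ∀ {f : k[X]} {a : ℕ} (i : ℕ), f.natDegree ≤ a → (f ^ i).natDegree ≤ i * a :=
    fun i hf => natDegree_pow_le.trans (Nat.mul_le_mul_left i hf)
  have hX : ∀ i, (X ^ i : k[X]).natDegree ≤ i := fun i => (natDegree_X_pow i).le
  have hC : ∀ e : k, (C e : k[X]).natDegree ≤ 0 := fun e => (natDegree_C e).le
  have f1 : (P ^ 3).natDegree ≤ 3 * n + 3 := (hp 3 hP).trans (by omega)
  have f2 : (C (d ^ 2 * c) * X ^ 2 * P * Q ^ 2).natDegree ≤ 3 * n + 3 :=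
    hm (hm (hm (hC _) (hX 2) le_rfl) hP le_rfl) (hp 2 hQ) (by omega)
  have f3 : (C (d ^ 3 * c) * X ^ 3 * Q ^ 3).natDegree ≤ 3 * n + 3 :=
    hm (hm (hC _) (hX 3) le_rfl) (hp 3 hQ) (by omega)
  have f4 : ((1 + C c * X ^ 2 + C c * X ^ 3) * br P Q ^ 2).natDegree ≤ 4 * n + 3 :=
    hm e1 (hp 2 hb) (by omega)
  have f5 := hm hQ ((natDegree_sub_le _ _).trans
    (max_le (natDegree_add_le_of_degree_le f1 f2) f3)) (show n + (3 * n + 3) ≤ 4 * n + 3 by omega)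
  exact (natDegree_sub_le _ _).trans (max_le f4 f5)

end Expansion

section Reversal

variable {k : Type*} [Field k]

lemma exists_reversal {U : k[X]} {u : ℕ} (hU : U.natDegree ≤ u) : ∃ P : k[X],
    P.natDegree ≤ u ∧ P.eval 0 = U.coeff u ∧ ∀ w : k, w ≠ 0 →
      P.eval w = w ^ u * U.eval w⁻¹ ∧ w * (derivative P).eval w =
        u * w ^ u * U.eval w⁻¹ - w ^ u * w⁻¹ * (derivative U).eval w⁻¹ := by
  have hsum := U.as_sum_range_C_mul_X_pow' (n := u + 1) (by omega)
  refine ⟨∑ i ∈ Finset.range (u + 1), C (U.coeff i) * X ^ (u - i), ?_, ?_, fun w hw => ?_⟩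
  · exact natDegree_sum_le_of_forall_le _ _ fun i _ =>
      (natDegree_C_mul_X_pow_le _ _).trans (Nat.sub_le _ _)
  · rw [eval_finsetSum, Finset.sum_eq_single u]
    · simp
    · intro i hi hiu
      have : u - i ≠ 0 := by have := Finset.mem_range.1 hi; omega
      simp [this]
    · simp
  · have hp : ∀ i ∈ Finset.range (u + 1), w ^ (u - i) = w ^ u * w⁻¹ ^ i := by
      intro i hi
      rw [pow_sub₀ _ hw (by have := Finset.mem_range.1 hi; omega), inv_pow]
    constructor
    · conv_rhs => rw [hsum]
      rw [eval_finsetSum, eval_finsetSum, Finset.mul_sum]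
      refine Finset.sum_congr rfl fun i hi => ?_
      simp only [eval_mul, eval_C, eval_pow, eval_X, hp i hi]; ring
    · conv_rhs => rw [hsum]
      rw [derivative_sum, derivative_sum, eval_finsetSum, eval_finsetSum, eval_finsetSum,
        Finset.mul_sum, Finset.mul_sum, Finset.mul_sum, ← Finset.sum_sub_distrib]
      refine Finset.sum_congr rfl fun i hi => ?_
      have hi' := Finset.mem_range.1 hi
      have h1 : ∀ (j : ℕ) (v : k), v * eval v (derivative (X ^ j)) = j * v ^ j := by
        intro j v
        rcases j with _ | j
        · simp
        · rw [derivative_X_pow, Nat.add_sub_cancel]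
          simp only [eval_mul, eval_C, eval_pow, eval_X]; ring
      have h2 := h1 (u - i) w
      have h3 := h1 i w⁻¹
      rw [hp i hi, Nat.cast_sub (by omega)] at h2
      rw [derivative_C_mul, derivative_C_mul]
      simp only [eval_mul, eval_C, eval_pow, eval_X]
      linear_combination U.coeff i * h2 + U.coeff i * w ^ u * h3

lemma EE_of_poly [Infinite k] {c d : k} {U V : k[X]} {u : ℕ} (hU : U.natDegree = u + 1)
    (hV : V.natDegree ≤ u) (hV0 : V ≠ 0)
    (h : fpoly c c * (derivative U * V - U * derivative V) ^ 2 =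
      V * (U ^ 3 + C (d ^ 2 * c) * U * V ^ 2 + C (-d ^ 3 * c) * V ^ 3)) :
    ∃ P Q : k[X], P.natDegree ≤ u + 1 ∧ Q.natDegree ≤ u + 1 ∧ Q.eval 0 ≠ 0 ∧
      P.eval 0 = Q.eval 0 ∧ EE c d P Q = 0 := by
  obtain ⟨P, hPd, hP0, hP⟩ := exists_reversal hU.le
  obtain ⟨Q, hQd, hQ0, hQ⟩ := exists_reversal hV
  have hE : EE c d P Q = 0 := by
    refine Polynomial.eq_zero_of_infinite_isRoot _ (Set.Infinite.mono (s := {0}ᶜ) ?_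
      (Set.finite_singleton (0 : k)).infinite_compl)
    intro w hw
    have hw : w ≠ 0 := hw
    obtain ⟨p1, p2⟩ := hP w hw
    obtain ⟨q1, q2⟩ := hQ w hw
    have h1 := congrArg (eval w⁻¹) h
    simp only [fpoly, eval_mul, eval_add, eval_sub, eval_pow, eval_X, eval_C] at h1
    have hi : w * w⁻¹ = 1 := mul_inv_cancel₀ hw
    set v := w⁻¹
    set U0 := eval v U
    set U1 := eval v (derivative U)
    set V0 := eval v V
    set V1 := eval v (derivative V)
    have hb : (br P Q).eval w = (w ^ u) ^ 2 * (U1 * V0 - U0 * V1) := by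
      have : (br P Q).eval w = P.eval w * Q.eval w - (w * (derivative P).eval w * Q.eval w -
          P.eval w * (w * (derivative Q).eval w)) := by
        simp only [br, eval_sub, eval_mul, eval_X]; ring
      rw [this, p2, q2, p1, q1]
      push_cast
      linear_combination ((w ^ u) ^ 2 * (U1 * V0 - U0 * V1)) * hi
    have hf : 1 + c * w ^ 2 + c * w ^ 3 = w ^ 3 * (v ^ 3 + c * v + c) := by
      linear_combination (-(w ^ 2 * v ^ 2 + w * v + 1) - c * w ^ 2) * hi
    show eval w (EE c d P Q) = 0
    simp only [EE, eval_mul, eval_add, eval_sub, eval_pow, eval_X, eval_C, eval_one, hb]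
    rw [hf, p1, q1]
    rw [pow_succ w u]
    linear_combination (w ^ 3 * (w ^ u) ^ 4) * h1
  have hU0 : P.eval 0 ≠ 0 := by
    rw [hP0, ← hU, coeff_natDegree, Ne, leadingCoeff_eq_zero]
    rintro rfl; simp at hU
  have hQne : Q ≠ 0 := by
    rintro rfl
    refine hV0 (Polynomial.eq_zero_of_infinite_isRoot _ (Set.Infinite.mono (s := {0}ᶜ) ?_
      (Set.finite_singleton (0 : k)).infinite_compl))
    intro w hw
    have hw : w ≠ 0 := hw
    have := (hQ w⁻¹ (inv_ne_zero hw)).1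
    rw [inv_inv, eval_zero, eq_comm, mul_eq_zero] at this
    exact this.resolve_left (pow_ne_zero _ (inv_ne_zero hw))
  have hc := congrArg (eval 0) hE
  have hQ0' : Q.eval 0 ≠ 0 := by
    intro hz
    obtain ⟨s, G, hG, hGx, -⟩ := exists_root_factor hQne hz
    rw [C_0, sub_zero] at hG
    have hb : br P Q = X ^ (s + 1) * (P * G - derivative P * X * G +
        P * (C ((s + 1 : ℕ) : k) * G + X * derivative G)) := by
      rw [hG]
      simp only [br, derivative_mul, derivative_X_pow, Nat.add_sub_cancel, map_natCast]
      ring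
    set W := P * G - derivative P * X * G + P * (C ((s + 1 : ℕ) : k) * G + X * derivative G)
    rw [EE, hb] at hE
    nth_rewrite 1 [hG] at hE
    have h2 : (1 + C c * X ^ 2 + C c * X ^ 3) * X ^ (s + 1) * W ^ 2 = 
        G * (P ^ 3 + C (d ^ 2 * c) * X ^ 2 * P * Q ^ 2 - C (d ^ 3 * c) * X ^ 3 * Q ^ 3) := by
      apply mul_left_cancel₀ (pow_ne_zero (s + 1) (X_ne_zero (R := k)))
      linear_combination hE
    have h3 := congrArg (eval 0) h2
    simp only [eval_mul, eval_add, eval_sub, eval_pow, eval_X, eval_C, eval_one] at h3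
    rw [zero_pow (by omega : s + 1 ≠ 0), zero_pow two_ne_zero, zero_pow three_ne_zero] at h3
    simp only [mul_zero, zero_mul, add_zero, sub_zero] at h3
    exact mul_ne_zero hGx (pow_ne_zero 3 hU0) h3.symm
  refine ⟨P, Q, hPd, by omega, hQ0', ?_, hE⟩
  simp only [EE, eval_mul, eval_add, eval_sub, eval_pow, eval_X, eval_C, eval_one,
    eval_zero_br, eval_zero] at hc
  apply mul_left_cancel₀ (mul_ne_zero hQ0' (pow_ne_zero 2 hU0))
  linear_combination -hc

lemma natDegree_wronskian {U V : k[X]} (hV : V ≠ 0) (hVU : V.natDegree < U.natDegree)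
    (hN : Big k U.natDegree) : (derivative U * V - U * derivative V).natDegree + 1 =
      U.natDegree + V.natDegree ∧ derivative U * V - U * derivative V ≠ 0 := by
  obtain ⟨u, hu⟩ : ∃ u, U.natDegree = u + 1 := Nat.exists_eq_succ_of_ne_zero (by omega)
  have hU : U ≠ 0 := by rintro rfl; simp at hu
  set v := V.natDegree with hv
  have hdU : (derivative U).natDegree ≤ u := (natDegree_derivative_le U).trans (by omega)
  have c1 : (derivative U * V).coeff (u + v) = (u + 1) * U.leadingCoeff * V.leadingCoeff := by
    rw [coeff_mul_add_eq_of_natDegree_le hdU hv.ge, coeff_derivative, ← hu]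
    simp only [leadingCoeff, ← hv]
    ring
  have d1 : (derivative U * V).natDegree ≤ u + v := natDegree_mul_le.trans (by omega)
  have c2 : (U * derivative V).coeff (u + v) = v * U.leadingCoeff * V.leadingCoeff ∧
      (U * derivative V).natDegree ≤ u + v := by
    rcases Nat.eq_zero_or_pos v with h0 | h0
    · have : derivative V = 0 := by
        obtain ⟨e, rfl⟩ := natDegree_eq_zero.1 (hv ▸ h0)
        exact derivative_C
      simp [this, h0]
    · have hdV : (derivative V).natDegree ≤ v - 1 := natDegree_derivative_le V
      refine ⟨?_, natDegree_mul_le.trans (by omega)⟩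
      have e : u + v = (u + 1) + (v - 1) := by omega
      rw [e, coeff_mul_add_eq_of_natDegree_le hu.le hdV, coeff_derivative, ← hu,
        Nat.sub_add_cancel h0, Nat.cast_sub h0]
      simp only [leadingCoeff, ← hv]
      push_cast
      ring
  have c3 : (derivative U * V - U * derivative V).coeff (u + v) ≠ 0 := by
    rw [coeff_sub, c1, c2.1]
    have h1 : ((u + 1 - v : ℕ) : k) ≠ 0 := hN _ (by omega) (by omega)
    rw [Nat.cast_sub (by omega)] at h1
    have h2 := mul_ne_zero (mul_ne_zero h1 (leadingCoeff_ne_zero.2 hU)) (leadingCoeff_ne_zero.2 hV)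
    push_cast at h2
    convert h2 using 1
    ring
  have h4 := le_natDegree_of_ne_zero c3
  have h5 := (natDegree_sub_le (derivative U * V) (U * derivative V)).trans (max_le d1 c2.2)
  exact ⟨by omega, by rintro h; simp [h] at c3⟩

variable [IsAlgClosed k] [NeZero (2 : k)]

lemma Ode.exists_EE {c κ : k} [(SW c c).IsElliptic] {D : ℕ}
    {K : AddSubgroup (Pt c c)} [Finite K] (hK : Nat.card K = D) (hN : Big k (46 * D))
    (h : Ode K κ (D ^ 2 * c) (-D ^ 3 * c)) : ∃ P Q : k[X], P.natDegree ≤ 46 * D ∧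
      Q.natDegree ≤ 46 * D ∧ Q.eval 0 ≠ 0 ∧ P.eval 0 = Q.eval 0 ∧ EE c (D : k) P Q = 0 := by
  have : Infinite k := IsAlgClosed.instInfinite
  obtain ⟨U, V, -, hV, -, hUd, hVU, he⟩ := h.exists_poly
  rw [card_fs, hK] at hUd
  obtain ⟨hw, hw0⟩ := natDegree_wronskian hV hVU (hN.mono hUd)
  have hdeg := congrArg natDegree he
  have hU0 : U ≠ 0 := by rintro rfl; simp at hVU
  have f1 : (U ^ 3 + C ((D : k) ^ 2 * c) * U * V ^ 2 + C (-(D : k) ^ 3 * c) * V ^ 3).natDegree =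
      3 * U.natDegree := by
    have g1 : (C ((D : k) ^ 2 * c) * U * V ^ 2).natDegree < 3 * U.natDegree := by
      refine lt_of_le_of_lt (natDegree_mul_le.trans (add_le_add (natDegree_C_mul_le _ _)
        natDegree_pow_le)) (by omega)
    have g2 : (C (-(D : k) ^ 3 * c) * V ^ 3).natDegree < 3 * U.natDegree := by
      refine lt_of_le_of_lt ((natDegree_C_mul_le _ _).trans natDegree_pow_le) (by omega)
    have g0 : (U ^ 3).natDegree = 3 * U.natDegree := natDegree_pow _ _
    rw [natDegree_add_eq_left_of_natDegree_lt, natDegree_add_eq_left_of_natDegree_lt, g0]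
    · rw [g0]; exact g1
    · rw [natDegree_add_eq_left_of_natDegree_lt (by rw [g0]; exact g1), g0]; exact g2
  have f2 : U ^ 3 + C ((D : k) ^ 2 * c) * U * V ^ 2 + C (-(D : k) ^ 3 * c) * V ^ 3 ≠ 0 := by
    intro h0; rw [h0, natDegree_zero] at f1; omega
  rw [natDegree_mul (fpoly_ne_zero c c) (pow_ne_zero 2 hw0), natDegree_pow, fpoly_natDegree,
    natDegree_mul hV f2, f1] at hdeg
  obtain ⟨P, Q, h1, h2, h3, h4, h5⟩ := EE_of_poly (u := V.natDegree) (by omega) le_rfl hV he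
  exact ⟨P, Q, by omega, by omega, h3, h4, h5⟩

end Reversal

section Detector

variable {k : Type*} [Field k]

lemma node_no_sol {ν c d : k} {n : ℕ} (hν : ν ≠ 0) (hc1 : c = -3 * ν ^ 2) (hc2 : c = 2 * ν ^ 3)
    (h3 : (3 : k) ≠ 0) (hd : d ≠ 0) (hs : ∀ s : ℕ, s ≤ n + 1 → (s : k) ^ 2 ≠ -d) {P Q : k[X]}
    (hQ : Q ≠ 0) (hP0 : P.eval 0 ≠ 0) (hPn : P.natDegree ≤ n) (hQn : Q.natDegree ≤ n)
    (h : EE c d P Q = 0) : False := by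
  set G := EuclideanDomain.gcd P Q with hG
  have hG0 : G ≠ 0 := fun h0 => hQ (EuclideanDomain.gcd_eq_zero_iff.1 h0).2
  obtain ⟨P', hP'⟩ := EuclideanDomain.gcd_dvd_left P Q
  obtain ⟨Q', hQ'⟩ := EuclideanDomain.gcd_dvd_right P Q
  rw [← hG] at hP' hQ'
  have hcop : IsCoprime P' Q' := by
    refine ⟨EuclideanDomain.gcdA P Q, EuclideanDomain.gcdB P Q, ?_⟩
    have := EuclideanDomain.gcd_eq_gcd_ab P Q
    rw [← hG] at this
    apply mul_left_cancel₀ hG0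
    linear_combination -this - EuclideanDomain.gcdA P Q * hP' - EuclideanDomain.gcdB P Q * hQ'
  have hQ'0 : Q' ≠ 0 := by rintro rfl; exact hQ (by rw [hQ', mul_zero])
  have hP'0 : P'.eval 0 ≠ 0 := fun h0 => hP0 (by rw [hP', eval_mul, h0, mul_zero])
  have hP'ne : P' ≠ 0 := by rintro rfl; simp at hP'0
  rw [hP', hQ', EE_mul, mul_eq_zero] at h
  have h := h.resolve_left (pow_ne_zero 4 hG0)
  rw [hP', natDegree_mul hG0 hP'ne] at hPn
  rw [hQ', natDegree_mul hG0 hQ'0] at hQn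
  refine node_coprime (n := n) hν h3 hd hs hcop hQ'0 hP'0 (by omega) (by omega) ?_
  rw [EE] at h
  have e1 : (C c : k[X]) = -3 * C ν ^ 2 := by rw [hc1, map_mul, map_neg, map_ofNat, map_pow]
  have e2 : (C c : k[X]) = 2 * C ν ^ 3 := by rw [hc2, map_mul, map_ofNat, map_pow]
  simp only [map_mul, map_pow, map_ofNat] at h ⊢
  linear_combination h - (X ^ 2 * br P' Q' ^ 2 - C d ^ 2 * X ^ 2 * P' * Q' ^ 3) * e1 -
    (X ^ 3 * br P' Q' ^ 2 + C d ^ 3 * X ^ 3 * Q' ^ 4) * e2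

lemma node_injective {ν c d : k} {n : ℕ} (hν : ν ≠ 0) (hc1 : c = -3 * ν ^ 2)
    (hc2 : c = 2 * ν ^ 3) (h3 : (3 : k) ≠ 0) (hd : d ≠ 0)
    (hs : ∀ s : ℕ, s ≤ n + 1 → (s : k) ^ 2 ≠ -d) {H Q : k[X]} (h0 : H.eval 0 = 1)
    (hH : X ^ (4 * n + 4) ∣ EE c d H 1) (hQn : Q.natDegree ≤ n)
    (hQ : ∀ i, n < i → i < 4 * n + 4 → (Q * H).coeff i = 0) : Q = 0 := by
  by_contra hQ0
  obtain ⟨r, Q', hr, hQ'⟩ : ∃ (r : ℕ) (Q' : k[X]), Q = X ^ r * Q' ∧ Q'.eval 0 ≠ 0 := by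
    obtain ⟨G, hG, hGx⟩ := exists_eq_pow_rootMultiplicity_mul_and_not_dvd Q hQ0 0
    rw [C_0, sub_zero] at hG hGx
    exact ⟨_, G, hG, fun h => hGx (X_dvd_iff.2 (by rwa [coeff_zero_eq_eval_zero]))⟩
  have hQ'0 : Q' ≠ 0 := by rintro rfl; simp at hQ'
  have hrn : r + Q'.natDegree ≤ n := by
    rwa [hr, natDegree_mul (pow_ne_zero _ X_ne_zero) hQ'0, natDegree_X_pow] at hQn
  have hc : ∀ i, (Q * H).coeff (i + r) = (Q' * H).coeff i := fun i => by
    rw [hr, mul_assoc, coeff_X_pow_mul]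
  set P := ∑ i ∈ Finset.range (n - r + 1), C ((Q' * H).coeff i) * X ^ i with hP
  have hPc : ∀ i, P.coeff i = if i ≤ n - r then (Q' * H).coeff i else 0 := fun i => by
    rw [hP, finsetSum_coeff]
    simp only [coeff_C_mul_X_pow]
    rw [Finset.sum_ite_eq]
    simp
  have hPn : P.natDegree ≤ n - r := natDegree_le_iff_coeff_eq_zero.2 fun i hi => by
    rw [hPc, if_neg (by omega)]
  obtain ⟨S, hS⟩ : X ^ (4 * n + 4 - r) ∣ P - Q' * H := by
    rw [X_pow_dvd_iff]
    intro i hi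
    rw [coeff_sub, hPc]
    split_ifs with h
    · rw [sub_self]
    · rw [zero_sub, ← hc, hQ _ (by omega) (by omega), neg_zero]
  have hP0 : P.eval 0 ≠ 0 := by
    rw [← coeff_zero_eq_eval_zero, hPc, if_pos (Nat.zero_le _), coeff_zero_eq_eval_zero,
      eval_mul, h0, mul_one]
    exact hQ'
  have hX : X ^ (4 * n + 4 - r) ∣ EE c d P Q' := by
    obtain ⟨j, hj⟩ : ∃ j, 4 * n + 4 - r = j + 1 := Nat.exists_eq_succ_of_ne_zero (by omega)
    obtain ⟨Z, hZ⟩ := EE_step c d (Q' * H) Q' S j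
    rw [← hj, ← hS, add_sub_cancel] at hZ
    rw [hZ]
    have h1 : EE c d (Q' * H) Q' = Q' ^ 4 * EE c d H 1 := by
      simpa only [mul_one] using EE_mul c d Q' H 1
    rw [h1]
    exact dvd_add (dvd_add (((pow_dvd_pow X (Nat.sub_le _ _)).trans hH).mul_left _)
      (Dvd.intro _ rfl)) ((pow_dvd_pow X (by omega)).mul_right _)
  refine node_no_sol hν hc1 hc2 h3 hd hs hQ'0 hP0 (by omega) (by omega) ?_
  refine eq_zero_of_dvd_of_natDegree_lt hX ?_
  rw [natDegree_X_pow]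
  exact lt_of_le_of_lt (natDegree_EE_le hPn (by omega)) (by omega)

/-- The matrix of the linear system satisfied by the coefficients of a denominator. -/
noncomputable def sysMat {R : Type*} [CommRing R] (n : ℕ) (H : R[X]) :
    Matrix (Fin (3 * n + 3)) (Fin (n + 1)) R :=
  Matrix.of fun i j => H.coeff (n + 1 + i - j)

lemma sysMat_mulVec {R : Type*} [CommRing R] {n : ℕ} (H : R[X]) (q : Fin (n + 1) → R)
    (i : Fin (3 * n + 3)) : (sysMat n H).mulVec q i =
      ((∑ j, C (q j) * X ^ (j : ℕ)) * H).coeff (n + 1 + i) := by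
  rw [Finset.sum_mul, finsetSum_coeff, Matrix.mulVec, dotProduct]
  refine Finset.sum_congr rfl fun j _ => ?_
  rw [mul_assoc, coeff_C_mul, coeff_X_pow_mul', if_pos (by omega), sysMat, Matrix.of_apply,
    mul_comm]

lemma sum_coeff_fin {R : Type*} [CommRing R] {n : ℕ} {Q : R[X]} (hQ : Q.natDegree ≤ n) :
    ∑ j : Fin (n + 1), C (Q.coeff j) * X ^ (j : ℕ) = Q := by
  rw [Fin.sum_univ_eq_sum_range (fun j => C (Q.coeff j) * X ^ j) (n + 1)]
  exact (Q.as_sum_range_C_mul_X_pow' (by omega)).symm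

lemma natDegree_det_le {n B : ℕ} {A : Matrix (Fin n) (Fin n) k[X]}
    (h : ∀ i j, (A i j).natDegree ≤ B) : A.det.natDegree ≤ n * B := by
  rw [Matrix.det_apply]
  refine natDegree_sum_le_of_forall_le _ _ fun σ _ => ?_
  have h1 : (∏ i, A (σ i) i).natDegree ≤ n * B := by
    refine (natDegree_prod_le _ _).trans ((Finset.sum_le_sum fun i _ => h _ _).trans ?_)
    simp
  rcases Int.units_eq_one_or (Equiv.Perm.sign σ) with hσ | hσ <;> rw [hσ]
  · rwa [one_smul]
  · rw [Units.neg_smul, one_smul, natDegree_neg]; exact h1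

lemma exists_leftInverse {m n : ℕ} (A : Matrix (Fin m) (Fin n) k)
    (hA : ∀ q, A.mulVec q = 0 → q = 0) : ∃ L : Matrix (Fin n) (Fin m) k, L * A = 1 := by
  obtain ⟨g, hg⟩ := LinearMap.exists_leftInverse_of_injective (Matrix.mulVecLin A)
    (LinearMap.ker_eq_bot'.2 fun q hq => hA q hq)
  refine ⟨LinearMap.toMatrix' g, ?_⟩
  have := congrArg LinearMap.toMatrix' hg
  rwa [LinearMap.toMatrix'_comp, ← Matrix.toLin'_apply', LinearMap.toMatrix'_toLin',
    LinearMap.toMatrix'_id] at this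

theorem exists_detector {d : k} {n : ℕ} (hN : Big k (8 * n + 7)) (hd : d ≠ 0)
    (hs : ∀ s : ℕ, s ≤ n + 1 → (s : k) ^ 2 ≠ -d) : ∃ Φ : k[X], Φ ≠ 0 ∧
      Φ.natDegree ≤ (n + 1) * (4 * n + 3) ∧ ∀ (c : k) (P Q : k[X]), P.natDegree ≤ n →
        Q.natDegree ≤ n → Q.eval 0 ≠ 0 → P.eval 0 = Q.eval 0 → EE c d P Q = 0 →
          Φ.eval c = 0 := by
  have h2 : (2 : k) ≠ 0 := by simpa using hN 2 (by norm_num) (by omega)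
  have h3 : (3 : k) ≠ 0 := by simpa using hN 3 (by norm_num) (by omega)
  obtain ⟨H, hH, h0, hE⟩ := exists_expansion d (4 * n + 3) (hN.mono (by omega))
  set ev : k → k[X] →+* k := fun c => evalRingHom c with hev
  have hE' : ∀ c, X ^ (4 * n + 4) ∣ EE c d (H.map (ev c)) 1 := fun c => by
    have := Polynomial.map_dvd (ev c) hE
    rwa [EE_map, Polynomial.map_pow, map_X, Polynomial.map_one, hev, coe_evalRingHom, eval_X,
      eval_C] at this
  have h0' : ∀ c, (H.map (ev c)).eval 0 = 1 := fun c => by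
    rw [← coeff_zero_eq_eval_zero, coeff_map, h0, map_one]
  have hsys : ∀ c, (sysMat n H).map (ev c) = sysMat n (H.map (ev c)) := fun c => by
    ext i j; simp [sysMat]
  set ν : k := -(3 / 2) with hν
  obtain ⟨L, hL⟩ := exists_leftInverse (sysMat n (H.map (ev (2 * ν ^ 3)))) (by
    intro q hq
    have hq0 := node_injective (n := n) (ν := ν) (Q := ∑ j : Fin (n + 1), C (q j) * X ^ (j : ℕ))
      (by rw [hν]; exact neg_ne_zero.2 (div_ne_zero h3 h2))
      (by rw [hν]; field_simp) rfl h3 hd hs (h0' _) (hE' _)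
      (natDegree_sum_le_of_forall_le _ _ fun j _ =>
        (natDegree_C_mul_X_pow_le _ _).trans (by omega)) (by
        intro i hi hi'
        have := congrFun hq ⟨i - (n + 1), by omega⟩
        rw [sysMat_mulVec] at this
        rwa [show n + 1 + (i - (n + 1)) = i by omega] at this)
    ext j
    have := congrArg (fun f => f.coeff j) hq0
    simp only [finsetSum_coeff, coeff_C_mul_X_pow, coeff_zero] at this
    rw [Finset.sum_eq_single j (by
      intro b _ hb; rw [if_neg (fun h => hb (Fin.ext h.symm))]) (by simp), if_pos rfl] at this
    exact this)
  have hdet : ∀ c, (((L.map C) * sysMat n H).det).eval c =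
      (L * sysMat n (H.map (ev c))).det := fun c => by
    rw [← coe_evalRingHom, RingHom.map_det, RingHom.mapMatrix_apply, Matrix.map_mul, ← hsys,
      Matrix.map_map]
    congr 2
    ext i j; simp
  refine ⟨((L.map C) * sysMat n H).det, ?_, ?_, ?_⟩
  · intro h
    have := hdet (2 * ν ^ 3)
    rw [h, eval_zero, hL, Matrix.det_one] at this
    exact zero_ne_one this
  · refine natDegree_det_le fun i j => ?_
    rw [Matrix.mul_apply]
    refine natDegree_sum_le_of_forall_le _ _ fun x _ => ?_
    rw [Matrix.map_apply]
    refine (natDegree_C_mul_le _ _).trans ((hH _).trans ?_)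
    omega
  · intro c P Q hP hQ hQ0 hPQ hc
    rw [hdet]
    obtain ⟨S, hS⟩ := expansion_unique (M := 4 * n + 3) (hN.mono (by omega)) (h0' c) (hE' c) hc
      hPQ hQ0
    refine Matrix.exists_mulVec_eq_zero_iff.1 ⟨fun j => Q.coeff j, fun h => hQ0 ?_, ?_⟩
    · rw [← coeff_zero_eq_eval_zero]; exact congrFun h 0
    · rw [← Matrix.mulVec_mulVec]
      have hz : (sysMat n (H.map (ev c))).mulVec (fun j => Q.coeff j) = 0 := ?_
      · rw [hz, Matrix.mulVec_zero]
      ext i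
      rw [sysMat_mulVec, sum_coeff_fin hQ]
      have : Q * H.map (ev c) = P - X ^ (4 * n + 3 + 1) * S := by rw [← hS]; ring
      rw [this, coeff_sub, coeff_eq_zero_of_natDegree_lt (by omega), coeff_X_pow_mul',
        if_neg (by omega)]
      simp

theorem exists_cm_detector [IsAlgClosed k] [NeZero (2 : k)] {D : ℕ} (hD : D ≠ 0)
    (hN : Big k ((46 * D + 8) ^ 2 + D)) : ∃ Φ : k[X], Φ ≠ 0 ∧
      Φ.natDegree ≤ (46 * D + 1) * (4 * (46 * D) + 3) ∧
        ∀ (c κ : k) [(SW c c).IsElliptic] (K : AddSubgroup (Pt c c)) [Finite K],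
          Nat.card K = D → Ode K κ (D ^ 2 * c) (-D ^ 3 * c) → Φ.eval c = 0 := by
  obtain ⟨Φ, h1, h2, h3⟩ := exists_detector (k := k) (d := (D : k)) (n := 46 * D)
    (hN.mono (by nlinarith)) (hN D hD (by nlinarith)) (fun s hs h => by
      have h4 : ((s ^ 2 + D : ℕ) : k) = 0 := by push_cast; rw [h]; ring
      exact hN (s ^ 2 + D) (by omega) (by nlinarith) h4)
  refine ⟨Φ, h1, h2, fun c κ _ K _ hK h => ?_⟩
  obtain ⟨P, Q, a1, a2, a3, a4, a5⟩ := h.exists_EE hK (hN.mono (by nlinarith))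
  exact h3 c P Q a1 a2 a3 a4 a5

end Detector

section SubgroupCount

variable {A : Type*} [AddCommGroup A]

lemma exists_dvd_int (S : AddSubgroup ℤ) {m : ℕ} (hm : m ≠ 0) (h : (m : ℤ) ∈ S) :
    ∃ d ∈ m.divisors, ∀ x : ℤ, x ∈ S ↔ (d : ℤ) ∣ x := by
  obtain ⟨a, ha⟩ := Int.subgroup_cyclic S
  rw [← AddSubgroup.zmultiples_eq_closure] at ha
  refine ⟨a.natAbs, ?_, fun x => ?_⟩
  · rw [Nat.mem_divisors]
    refine ⟨?_, hm⟩
    rw [ha, Int.mem_zmultiples_iff] at h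
    exact Int.natCast_dvd_natCast.1 (by rwa [Int.natAbs_dvd])
  · rw [ha, Int.mem_zmultiples_iff, Int.natAbs_dvd]

theorem ncard_subgroups_le {m : ℕ} (hm : m ≠ 0) {g h : A} (hg : m • g = 0) (hh : m • h = 0)
    (hgen : ∀ x : A, m • x = 0 → ∃ i j : ℤ, x = i • h + j • g) :
    {H : AddSubgroup A | ∀ P ∈ H, m • P = 0}.Finite ∧
      {H : AddSubgroup A | ∀ P ∈ H, m • P = 0}.ncard ≤ m * m.divisors.card ^ 2 := by
  set F := (m.divisors ×ˢ m.divisors) ×ˢ Finset.range m with hF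
  set f : (ℕ × ℕ) × ℕ → AddSubgroup A := fun x =>
    AddSubgroup.closure {x.1.1 • g, x.1.2 • h + x.2 • g} with hf
  have hsub : {H : AddSubgroup A | ∀ P ∈ H, m • P = 0} ⊆ ((F.image f : Finset _) : Set _) := by
    intro H hH
    obtain ⟨d, hd, hd'⟩ := exists_dvd_int (H.comap (zmultiplesHom A g)) hm (by
      simp [hg])
    obtain ⟨e, he, he'⟩ := exists_dvd_int ((H ⊔ AddSubgroup.zmultiples g).comap
      (zmultiplesHom A h)) hm (by simp [hh])
    obtain ⟨y, hy, z, hz, hyz⟩ := AddSubgroup.mem_sup.1 ((he' e).2 dvd_rfl)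
    obtain ⟨j, rfl⟩ := AddSubgroup.mem_zmultiples_iff.1 hz
    simp only [zmultiplesHom_apply, natCast_zsmul] at hyz
    have hmz : (m : ℤ) ≠ 0 := by exact_mod_cast hm
    have hj : e • h + ((-j) % (m : ℤ)).toNat • g = y := by
      have h1 : (((-j) % (m : ℤ)).toNat : ℤ) = (-j) % (m : ℤ) :=
        Int.toNat_of_nonneg (Int.emod_nonneg _ hmz)
      have h2 : ((-j) % (m : ℤ)) • g = (-j) • g := by
        have := Int.emod_add_mul_ediv (-j) m
        conv_rhs => rw [← this, add_smul, mul_comm, mul_smul, natCast_zsmul, hg, smul_zero,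
          add_zero]
      rw [← natCast_zsmul g, h1, h2, ← hyz, neg_smul]; abel
    simp only [Finset.coe_image, Set.mem_image, Finset.mem_coe]
    refine ⟨((d, e), ((-j) % (m : ℤ)).toNat), ?_, ?_⟩
    · simp only [hF, Finset.mem_product, Finset.mem_range]
      refine ⟨⟨hd, he⟩, ?_⟩
      have := Int.emod_lt_of_pos (-j) (by omega : (0 : ℤ) < m)
      have := Int.emod_nonneg (-j) hmz
      omega
    · have hdg : d • g ∈ H := by simpa using (hd' d).2 dvd_rfl
      apply le_antisymm
      · simp only [hf, AddSubgroup.closure_le, Set.insert_subset_iff, Set.singleton_subset_iff,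
          SetLike.mem_coe]
        rw [hj]
        exact ⟨hdg, hy⟩
      · intro x hx
        obtain ⟨i, j', rfl⟩ := hgen x (hH x hx)
        have h1 : i ∈ (H ⊔ AddSubgroup.zmultiples g).comap (zmultiplesHom A h) := by
          refine AddSubgroup.mem_comap.2 (AddSubgroup.mem_sup.2 ⟨_, hx, (-j') • g,
            AddSubgroup.mem_zmultiples_iff.2 ⟨_, rfl⟩, ?_⟩)
          simp
        obtain ⟨i', rfl⟩ := (he' i).1 h1
        simp only [hf]
        rw [hj]
        have h2 : (e * i' : ℤ) • h + j' • g - i' • y ∈ H := sub_mem hx (zsmul_mem hy _)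
        have h3 : (e * i' : ℤ) • h + j' • g - i' • y = (j' + i' * j) • g := by
          have h5 : y = e • h - j • g := by rw [← hyz]; abel
          rw [h5, smul_sub, mul_comm, mul_smul, natCast_zsmul, add_smul, mul_smul]; abel
        rw [h3] at h2
        obtain ⟨s, hs⟩ := (hd' (j' + i' * j)).1 h2
        have h4 : (e * i' : ℤ) • h + j' • g = s • (d • g) + i' • y := by
          rw [← sub_eq_iff_eq_add, h3, hs, mul_comm, mul_smul, natCast_zsmul]
        rw [h4]
        exact add_mem (zsmul_mem (AddSubgroup.subset_closure (by simp)) _)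
          (zsmul_mem (AddSubgroup.subset_closure (by simp)) _)
  refine ⟨(Finset.finite_toSet _).subset hsub, ?_⟩
  refine (Set.ncard_le_ncard hsub (Finset.finite_toSet _)).trans ?_
  rw [Set.ncard_coe_finset]
  refine Finset.card_image_le.trans ?_
  rw [hF, Finset.card_product, Finset.card_product, Finset.card_range]
  exact le_of_eq (by ring)

theorem exists_generators {m : ℕ} (hm : m ≠ 0)
    (hK : ∀ n, n ∣ m → Finite (nsmulAddMonoidHom n : A →+ A).ker ∧
      Nat.card (nsmulAddMonoidHom n : A →+ A).ker = n ^ 2) :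
    ∃ g h : A, m • g = 0 ∧ m • h = 0 ∧ ∀ x : A, m • x = 0 → ∃ i j : ℤ, x = i • h + j • g := by
  obtain ⟨fT, cT⟩ := hK m dvd_rfl
  have hmem : ∀ (n : ℕ) (x : A), x ∈ (nsmulAddMonoidHom n : A →+ A).ker ↔ n • x = 0 :=
    fun n x => Iff.rfl
  set T := (nsmulAddMonoidHom m : A →+ A).ker with hT
  obtain ⟨g, hg⟩ := AddMonoid.exists_addOrderOf_eq_exponent
    (AddMonoid.ExponentExists.of_finite (G := T))
  have hexp : AddMonoid.exponent T ∣ m := AddMonoid.exponent_dvd_of_forall_nsmul_eq_zero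
    fun x => Subtype.ext x.2
  have hgm : addOrderOf g = m := by
    rw [hg]
    refine Nat.le_antisymm (Nat.le_of_dvd (Nat.pos_of_ne_zero hm) hexp) ?_
    obtain ⟨f', c'⟩ := hK _ hexp
    have hle : T ≤ (nsmulAddMonoidHom (AddMonoid.exponent T) : A →+ A).ker := fun x hx =>
      congrArg Subtype.val (AddMonoid.exponent_nsmul_eq_zero (⟨x, hx⟩ : T))
    have := AddSubgroup.card_le_of_le hle
    rw [cT, c'] at this
    exact le_of_not_gt fun hlt => absurd this (not_le.2 (Nat.pow_lt_pow_left hlt two_ne_zero))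
  set Z := AddSubgroup.zmultiples g with hZ
  have cZ : Nat.card Z = m := by rw [hZ, Nat.card_zmultiples, hgm]
  have cQ : Nat.card (T ⧸ Z) = m := by
    have := AddSubgroup.card_eq_card_quotient_mul_card_addSubgroup Z
    rw [cT, cZ, sq] at this
    exact (Nat.eq_of_mul_eq_mul_right (Nat.pos_of_ne_zero hm) this).symm
  set n := AddMonoid.exponent (T ⧸ Z) with hn
  have hnm : n ∣ m := AddMonoid.exponent_dvd_of_forall_nsmul_eq_zero fun q => by
    obtain ⟨x, rfl⟩ := QuotientAddGroup.mk_surjective q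
    rw [← QuotientAddGroup.mk_nsmul, (Subtype.ext x.2 : m • x = 0), QuotientAddGroup.mk_zero]
  obtain ⟨r, hr⟩ := hnm
  have hr0 : r ≠ 0 := by rintro rfl; exact hm (by rw [hr, mul_zero])
  have hn0 : n ≠ 0 := by rintro h; exact hm (by rw [hr, h, zero_mul])
  obtain ⟨fN, cN⟩ := hK n ⟨r, hr⟩
  set N := (nsmulAddMonoidHom n : A →+ A).ker with hN
  have hNT : N ≤ T := fun x hx => by
    rw [hN, hmem] at hx
    rw [hT, hmem, hr, mul_comm, mul_smul, hx, smul_zero]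
  set φ : N →+ T ⧸ Z := (QuotientAddGroup.mk' Z).comp (AddSubgroup.inclusion hNT) with hφ
  have sφ : Function.Surjective φ := by
    intro q
    obtain ⟨x, rfl⟩ := QuotientAddGroup.mk_surjective q
    have h1 : n • (x : T ⧸ Z) = 0 := AddMonoid.exponent_nsmul_eq_zero _
    rw [← QuotientAddGroup.mk_nsmul, QuotientAddGroup.eq_zero_iff, hZ,
      AddSubgroup.mem_zmultiples_iff] at h1
    obtain ⟨j, hj⟩ := h1
    have h2 : ((r : ℤ) * j) • g = 0 := by
      rw [mul_smul, hj, natCast_zsmul, smul_smul, mul_comm, ← hr]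
      exact Subtype.ext x.2
    rw [← addOrderOf_dvd_iff_zsmul_eq_zero, hgm, hr, Nat.cast_mul, mul_comm] at h2
    obtain ⟨s, rfl⟩ := Int.dvd_of_mul_dvd_mul_left (by exact_mod_cast hr0) h2
    have h3 : n • (x - s • g) = 0 := by
      rw [smul_sub, ← hj, mul_smul, natCast_zsmul, sub_self]
    refine ⟨⟨((x - s • g : T) : A), congrArg Subtype.val h3⟩, ?_⟩
    have h4 : φ ⟨((x - s • g : T) : A), congrArg Subtype.val h3⟩ =
        ((x - s • g : T) : T ⧸ Z) := rfl
    rw [h4, QuotientAddGroup.mk_sub, sub_eq_self, QuotientAddGroup.eq_zero_iff]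
    exact zsmul_mem (AddSubgroup.mem_zmultiples g) s
  have hker : n ≤ Nat.card φ.ker := by
    have hrg : n • (r • g) = 0 := by
      rw [smul_smul, ← hr, ← hgm]; exact addOrderOf_nsmul_eq_zero g
    have ho : addOrderOf (r • g) = n := by
      rw [addOrderOf_nsmul' g hr0, hgm, hr, Nat.gcd_mul_left_left,
        Nat.mul_div_cancel _ (Nat.pos_of_ne_zero hr0)]
    set y : N := ⟨((r • g : T) : A), congrArg Subtype.val hrg⟩ with hy
    have hy1 : φ y = 0 := by
      have h4 : φ y = ((r • g : T) : T ⧸ Z) := rfl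
      rw [h4, QuotientAddGroup.eq_zero_iff]
      exact nsmul_mem (AddSubgroup.mem_zmultiples g) r
    have hy2 : addOrderOf y = n := by
      rw [← ho, ← AddSubgroup.addOrderOf_coe y, ← AddSubgroup.addOrderOf_coe (r • g)]
    rw [← hy2, ← Nat.card_zmultiples y]
    exact AddSubgroup.card_le_of_le (AddSubgroup.zmultiples_le_of_mem hy1)
  have hcard := (comap_card φ ⊤ fun q _ => sφ q).2
  rw [AddSubgroup.comap_top, AddSubgroup.card_top, AddSubgroup.card_top, cN, cQ] at hcard
  have hmn : m = n := by
    refine Nat.le_antisymm ?_ (Nat.le_of_dvd (Nat.pos_of_ne_zero hm) ⟨r, hr⟩)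
    have : m * n ≤ n * n := by rw [← sq n, hcard]; exact Nat.mul_le_mul_left _ hker
    exact Nat.le_of_mul_le_mul_right this (Nat.pos_of_ne_zero hn0)
  obtain ⟨q, hq⟩ := IsAddCyclic.of_exponent_eq_card (by rw [cQ, ← hn, hmn] :
    AddMonoid.exponent (T ⧸ Z) = Nat.card (T ⧸ Z))
  obtain ⟨h, rfl⟩ := QuotientAddGroup.mk_surjective q
  refine ⟨g, h, g.2, h.2, fun x hx => ?_⟩
  obtain ⟨i, hi⟩ := AddSubgroup.mem_zmultiples_iff.1 (hq ((⟨x, hx⟩ : T) : T ⧸ Z))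
  rw [← QuotientAddGroup.mk_zsmul, QuotientAddGroup.eq, hZ, AddSubgroup.mem_zmultiples_iff] at hi
  obtain ⟨j, hj⟩ := hi
  refine ⟨i, j, ?_⟩
  have := congrArg Subtype.val hj
  push_cast at this
  rw [this]
  abel

end SubgroupCount

section DivisorBound

lemma succ_le_mul_two_rpow {ε : ℝ} (hε : 0 < ε) : ∃ K : ℝ, 1 ≤ K ∧
    ∀ (e : ℕ) (x : ℝ), 2 ≤ x → (e : ℝ) + 1 ≤ K * x ^ ((e : ℝ) * ε) := by
  have hl : 0 < Real.log 2 := Real.log_pos one_lt_two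
  refine ⟨max 1 (ε * Real.log 2)⁻¹, le_max_left _ _, fun e x hx => ?_⟩
  set K := max 1 (ε * Real.log 2)⁻¹
  have hK1 : 1 ≤ K := le_max_left _ _
  have hK2 : 1 ≤ K * (ε * Real.log 2) := by
    have := mul_le_mul_of_nonneg_right (le_max_right 1 (ε * Real.log 2)⁻¹)
      (mul_pos hε hl).le
    rwa [inv_mul_cancel₀ (mul_pos hε hl).ne'] at this
  have h1 : (2 : ℝ) ^ ((e : ℝ) * ε) ≤ x ^ ((e : ℝ) * ε) :=
    Real.rpow_le_rpow zero_le_two hx (by positivity)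
  have h2 : (e : ℝ) * (ε * Real.log 2) + 1 ≤ (2 : ℝ) ^ ((e : ℝ) * ε) := by
    rw [Real.rpow_def_of_pos two_pos]
    refine le_trans (le_of_eq ?_) (Real.add_one_le_exp _)
    ring
  have h3 : (0 : ℝ) ≤ e := e.cast_nonneg
  calc (e : ℝ) + 1 ≤ K * ((e : ℝ) * (ε * Real.log 2) + 1) := by nlinarith
    _ ≤ _ := mul_le_mul_of_nonneg_left (h2.trans h1) (by linarith)

theorem card_divisors_le_rpow {ε : ℝ} (hε : 0 < ε) : ∃ C : ℝ, 1 ≤ C ∧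
    ∀ m : ℕ, m ≠ 0 → (m.divisors.card : ℝ) ≤ C * (m : ℝ) ^ ε := by
  obtain ⟨K, hK, hKe⟩ := succ_le_mul_two_rpow hε
  obtain ⟨P, hP⟩ := exists_nat_gt ((2 : ℝ) ^ (1 / ε))
  refine ⟨K ^ P, one_le_pow₀ hK, fun m hm => ?_⟩
  have hpos : ∀ p : ℕ, (0 : ℝ) ≤ p := fun p => p.cast_nonneg
  have hterm : ∀ p ∈ m.primeFactors, ((m.factorization p + 1 : ℕ) : ℝ) ≤
      (if p < P then K else 1) * ((p : ℝ) ^ (m.factorization p)) ^ ε := by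
    intro p hp
    have hp2 : (2 : ℝ) ≤ p := by exact_mod_cast (Nat.prime_of_mem_primeFactors hp).two_le
    rw [← Real.rpow_natCast_mul (hpos p)]
    push_cast
    split_ifs with h
    · exact hKe _ _ hp2
    · rw [one_mul, mul_comm, Real.rpow_mul_natCast (hpos p)]
      have h1 : (2 : ℝ) ≤ (p : ℝ) ^ ε := by
        have h2 : (2 : ℝ) ^ (1 / ε) ≤ p := hP.le.trans (by exact_mod_cast not_lt.1 h)
        have := Real.rpow_le_rpow (by positivity) h2 hε.le
        rwa [← Real.rpow_mul zero_le_two, one_div_mul_cancel hε.ne', Real.rpow_one] at this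
      refine le_trans ?_ (pow_le_pow_left₀ zero_le_two h1 _)
      exact_mod_cast Nat.lt_two_pow_self
  have hprod : ∏ p ∈ m.primeFactors, (if p < P then K else 1) ≤ K ^ P := by
    rw [Finset.prod_ite, Finset.prod_const, Finset.prod_const_one, mul_one]
    refine pow_le_pow_right₀ hK ?_
    refine (Finset.card_le_card (t := Finset.range P) fun p hp => ?_).trans
      (Finset.card_range P).le
    exact Finset.mem_range.2 (Finset.mem_filter.1 hp).2
  rw [Nat.card_divisors hm, Nat.cast_prod]
  refine (Finset.prod_le_prod (fun _ _ => Nat.cast_nonneg _) hterm).trans ?_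
  rw [Finset.prod_mul_distrib, Real.finsetProd_rpow _ _ (fun p _ => pow_nonneg (hpos p) _)]
  have hfac : ∏ p ∈ m.primeFactors, (p : ℝ) ^ m.factorization p = m := by
    have := Nat.prod_factorization_pow_eq_self hm
    rw [Finsupp.prod, Nat.support_factorization] at this
    exact_mod_cast this
  rw [hfac]
  exact mul_le_mul_of_nonneg_right hprod (by positivity)

end DivisorBound

section JSets

variable {k : Type*} [Field k] [IsAlgClosed k] [NeZero (2 : k)]

lemma exists_jset {a' b' : k} [(SW a' b').IsElliptic] (h3 : (3 : k) ≠ 0) {m : ℕ}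
    (hm : (m : k) ≠ 0) : ∃ S : Finset k, S.card ≤ m * m.divisors.card ^ 2 ∧
      ∀ (a b u κ : k) (C : AddSubgroup (Pt a' b')) [Finite C], (∀ P ∈ C, m • P = 0) → u ≠ 0 →
        Ode C κ (u ^ 4 * a) (u ^ 6 * b) → a ^ 3 / (4 * a ^ 3 + 27 * b ^ 2) ∈ S := by
  have hm0 : m ≠ 0 := by rintro rfl; simp at hm
  obtain ⟨g, h, hg, hh, hgen⟩ := exists_generators (A := Pt a' b') hm0 fun n hn =>
    torsion_card (fun h0 => hm (by obtain ⟨r, rfl⟩ := hn; rw [Nat.cast_mul, h0, zero_mul]))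
  obtain ⟨fin, hcard⟩ := ncard_subgroups_le hm0 hg hh hgen
  have hjex : ∀ C : AddSubgroup (Pt a' b'), ∃ j : k, ∀ (_ : Finite C) (κ α β : k),
      Ode C κ α β → α ^ 3 / (4 * α ^ 3 + 27 * β ^ 2) = j := by
    intro C
    by_cases hC : ∃ (_ : Finite C) (κ α β : k), Ode C κ α β
    · obtain ⟨fC, κ, α, β, hO⟩ := hC
      refine ⟨α ^ 3 / (4 * α ^ 3 + 27 * β ^ 2), fun _ κ' α' β' hO' => ?_⟩
      obtain ⟨-, e1, e2⟩ := Ode.unique h3 hO hO'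
      rw [e1, e2]
    · exact ⟨0, fun fC κ α β hO => absurd ⟨fC, κ, α, β, hO⟩ hC⟩
  choose jf hjf using hjex
  refine ⟨fin.toFinset.image jf, ?_, ?_⟩
  · refine Finset.card_image_le.trans ?_
    rwa [← Set.ncard_eq_toFinset_card _ fin]
  · intro a b u κ C fC hC hu hO
    refine Finset.mem_image.2 ⟨C, fin.mem_toFinset.2 hC, ?_⟩
    rw [← hjf C fC _ _ _ hO]
    have hu12 : u ^ 12 ≠ 0 := pow_ne_zero _ hu
    have e3 : (u ^ 4 * a) ^ 3 = u ^ 12 * a ^ 3 := by ring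
    have e4 : 4 * (u ^ 12 * a ^ 3) + 27 * (u ^ 6 * b) ^ 2 =
        u ^ 12 * (4 * a ^ 3 + 27 * b ^ 2) := by ring
    rw [e3, e4, mul_div_mul_left _ _ hu12]

/-- A finite family of curves through which all CM curves by `√-D` factor. -/
lemma exists_curve_list {D : ℕ} (hD : D ≠ 0) (hN : Big k ((46 * D + 8) ^ 2 + D)) :
    ∃ L : Finset (k × k), L.card ≤ (46 * D + 1) * (4 * (46 * D) + 3) + 2 ∧
      (∀ e ∈ L, 4 * e.1 ^ 3 + 27 * e.2 ^ 2 ≠ 0) ∧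
      ∀ α β : k, 4 * α ^ 3 + 27 * β ^ 2 ≠ 0 →
        (∀ (l a' b' : k) [(SW a' b').IsElliptic], l ≠ 0 → a' = l ^ 4 * α → b' = l ^ 6 * β →
          ∃ (K : AddSubgroup (Pt a' b')) (_ : Finite K) (κ : k), Nat.card K = D ∧
            Ode K κ (D ^ 2 * a') (-D ^ 3 * b')) →
        ∃ e ∈ L, ∃ l : k, l ≠ 0 ∧ e.1 = l ^ 4 * α ∧ e.2 = l ^ 6 * β := by
  have h2 : (2 : k) ≠ 0 := NeZero.ne _
  obtain ⟨Φ, hΦ0, hΦd, hΦ⟩ := exists_cm_detector hD hN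
  have hroot : ∀ {y : k} (n : ℕ), n ≠ 0 → y ≠ 0 → ∃ l : k, l ≠ 0 ∧ l ^ n = y := by
    intro y n hn hy
    obtain ⟨l, hl⟩ := IsAlgClosed.exists_pow_nat_eq y (Nat.pos_of_ne_zero hn)
    exact ⟨l, by rintro rfl; rw [zero_pow hn] at hl; exact hy hl.symm, hl⟩
  refine ⟨(insert (0, 1) (insert (1, 0) (Φ.roots.toFinset.image fun c => (c, c)))).filter
    fun e => 4 * e.1 ^ 3 + 27 * e.2 ^ 2 ≠ 0, ?_, fun e he => (Finset.mem_filter.1 he).2, ?_⟩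
  · refine (Finset.card_filter_le _ _).trans ((Finset.card_insert_le _ _).trans ?_)
    have h1 := Finset.card_insert_le ((1 : k), (0 : k))
      (Φ.roots.toFinset.image fun c : k => (c, c))
    have h2 := Finset.card_image_le (s := Φ.roots.toFinset) (f := fun c : k => (c, c))
    have h3 := (Multiset.toFinset_card_le Φ.roots).trans (Φ.card_roots'.trans hΦd)
    omega
  · intro α β hns hK
    have hns' : ∀ l : k, l ≠ 0 → 4 * (l ^ 4 * α) ^ 3 + 27 * (l ^ 6 * β) ^ 2 ≠ 0 := by
      intro l hl
      have : 4 * (l ^ 4 * α) ^ 3 + 27 * (l ^ 6 * β) ^ 2 =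
        l ^ 12 * (4 * α ^ 3 + 27 * β ^ 2) := by ring
      rw [this]; exact mul_ne_zero (pow_ne_zero _ hl) hns
    by_cases hα : α = 0
    · have hβ : β ≠ 0 := by rintro rfl; exact hns (by rw [hα]; ring)
      obtain ⟨l, hl, hl6⟩ := hroot 6 (by norm_num) (inv_ne_zero hβ)
      have e1 : l ^ 4 * α = 0 := by rw [hα, mul_zero]
      have e2 : l ^ 6 * β = 1 := by rw [hl6, inv_mul_cancel₀ hβ]
      have := hns' l hl
      rw [e1, e2] at this
      exact ⟨(0, 1), Finset.mem_filter.2 ⟨Finset.mem_insert_self _ _, this⟩, l, hl, e1.symm,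
        e2.symm⟩
    by_cases hβ : β = 0
    · obtain ⟨l, hl, hl4⟩ := hroot 4 (by norm_num) (inv_ne_zero hα)
      have e1 : l ^ 4 * α = 1 := by rw [hl4, inv_mul_cancel₀ hα]
      have e2 : l ^ 6 * β = 0 := by rw [hβ, mul_zero]
      have := hns' l hl
      rw [e1, e2] at this
      exact ⟨(1, 0), Finset.mem_filter.2 ⟨Finset.mem_insert_of_mem (Finset.mem_insert_self _ _),
        this⟩, l, hl, e1.symm, e2.symm⟩
    · obtain ⟨l, hl, hl2⟩ := hroot 2 (by norm_num) (div_ne_zero hα hβ)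
      have e : l ^ 6 * β = l ^ 4 * α := by
        have : l ^ 6 = l ^ 4 * (α / β) := by rw [← hl2]; ring
        rw [this]; field_simp
      have hn := hns' l hl
      have hroot : Φ.eval (l ^ 4 * α) = 0 := by
        rw [e] at hn
        have := isElliptic_of_ne h2 hn
        obtain ⟨K, fK, κ, cK, hO⟩ := hK l (l ^ 4 * α) (l ^ 4 * α) hl rfl e.symm
        exact hΦ _ κ K cK hO
      refine ⟨(l ^ 4 * α, l ^ 4 * α), Finset.mem_filter.2 ⟨?_, by rwa [e] at hn⟩, l, hl, rfl,
        e.symm⟩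
      refine Finset.mem_insert_of_mem (Finset.mem_insert_of_mem (Finset.mem_image.2
        ⟨l ^ 4 * α, ?_, rfl⟩))
      rw [Multiset.mem_toFinset, mem_roots hΦ0]
      exact hroot

/-- The `j`-invariants of curves with a given Frobenius trace lie in a small set. -/
theorem exists_jset_trace {D : ℕ} (hD : D ≠ 0) (hN : Big k ((46 * D + 8) ^ 2 + D)) {m : ℕ}
    (hm0 : m ≠ 0) (hm : Big k (2024 * m + 51)) : ∃ S : Finset k,
      S.card ≤ ((46 * D + 1) * (4 * (46 * D) + 3) + 2) * (m * m.divisors.card ^ 2) ∧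
      ∀ (a b t : k) [(SW a b).IsElliptic] (w : Pt (io a b a) (io a b b)) (δ : Pt a b →+ Pt a b),
        t ≠ 0 → t ^ 2 = -D * m ^ 2 → IsEndo w δ (-t) → (∀ P, δ (δ P) = -((D * m ^ 2 : ℕ) • P)) →
          hh w = D * m ^ 2 → a ^ 3 / (4 * a ^ 3 + 27 * b ^ 2) ∈ S := by
  have h2 : (2 : k) ≠ 0 := NeZero.ne _
  have h3 : (3 : k) ≠ 0 := by simpa using hm 3 (by norm_num) (by omega)
  have hmk : (m : k) ≠ 0 := hm m hm0 (by omega)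
  obtain ⟨L, hLc, hLns, hL⟩ := exists_curve_list hD hN
  have hS : ∀ e : k × k, ∃ S : Finset k, S.card ≤ m * m.divisors.card ^ 2 ∧ (e ∈ L →
      ∃ (_ : (SW e.1 e.2).IsElliptic), ∀ (a b u κ : k) (C : AddSubgroup (Pt e.1 e.2)) [Finite C],
        (∀ P ∈ C, m • P = 0) → u ≠ 0 → Ode C κ (u ^ 4 * a) (u ^ 6 * b) →
          a ^ 3 / (4 * a ^ 3 + 27 * b ^ 2) ∈ S) := by
    intro e
    by_cases he : e ∈ L
    · have := isElliptic_of_ne h2 (hLns e he)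
      obtain ⟨S, h4, h5⟩ := exists_jset (a' := e.1) (b' := e.2) h3 hmk
      exact ⟨S, h4, fun _ => ⟨this, h5⟩⟩
    · exact ⟨∅, by simp, fun h => absurd h he⟩
  choose S hSc hS using hS
  refine ⟨L.biUnion S, ?_, ?_⟩
  · refine Finset.card_biUnion_le.trans ((Finset.sum_le_sum fun e _ => hSc e).trans ?_)
    rw [Finset.sum_const, smul_eq_mul]
    exact Nat.mul_le_mul_right _ hLc
  · intro a b t _ w δ ht htm hδ hδδ hw
    obtain ⟨α, β, hns, hαβ⟩ := exists_chain ht hmk htm hδ hδδ hw hm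
    obtain ⟨e, he, l, hl, e1, e2⟩ := hL α β hns fun l a' b' _ hl h1 h2 => (hαβ l a' b' hl h1 h2).1
    obtain ⟨hell, hSe⟩ := hS e he
    obtain ⟨C, fC, κ, hC, hO⟩ := (hαβ l e.1 e.2 hl e1 e2).2
    exact Finset.mem_biUnion.2 ⟨e, he, hSe a b (l * m) κ C hC (mul_ne_zero hl hmk) hO⟩

end JSets

section PerPrime

lemma big_of_lt {k : Type*} [Field k] {p : ℕ} [CharP k p] {N : ℕ} (h : N < p) : Big k N := by
  intro n hn hnN h0
  exact absurd (Nat.le_of_dvd (Nat.pos_of_ne_zero hn) ((CharP.cast_eq_zero_iff k p n).1 h0))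
    (by omega)

section

variable (k : Type*) [Field k] [IsAlgClosed k]

theorem exists_jset_prime_aux {D : ℕ} (hD : D ≠ 0) {p : ℕ} [Fact p.Prime]
    [CharP k p] [Algebra (ZMod p) k] (hp1 : (46 * D + 8) ^ 2 + D < p) (hp2 : 2 ^ 26 ≤ p) {m : ℕ} (hm0 : m ≠ 0)
    (hmp : D * m ^ 2 < 4 * p) : ∃ S : Finset (ZMod p),
      S.card ≤ ((46 * D + 1) * (4 * (46 * D) + 3) + 2) * (m * m.divisors.card ^ 2) ∧
      ∀ a b : ZMod p, 4 * a ^ 3 + 27 * b ^ 2 ≠ 0 → (p : ℤ) - affinePoints p a b ≠ 0 →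
        ((p : ℤ) - affinePoints p a b) ^ 2 + D * m ^ 2 = 4 * p →
          a ^ 3 / (4 * a ^ 3 + 27 * b ^ 2) ∈ S := by
  have hinj : Function.Injective (algebraMap (ZMod p) k) := (algebraMap (ZMod p) k).injective
  have e4 : algebraMap (ZMod p) k 4 = 4 := map_ofNat _ 4
  have e27 : algebraMap (ZMod p) k 27 = 27 := map_ofNat _ 27
  have hbig : ∀ N, N < p → Big k N := fun N hN => big_of_lt hN
  have h2 : (2 : k) ≠ 0 := by simpa using hbig 2 (by omega) 2 (by norm_num) le_rfl
  have : NeZero (2 : k) := ⟨h2⟩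
  have hmm : m ^ 2 < 4 * p :=
    lt_of_le_of_lt (Nat.le_mul_of_pos_left _ (Nat.pos_of_ne_zero hD)) hmp
  have hm : 2024 * m + 51 < p := by
    by_contra hcon
    push Not at hcon
    nlinarith
  obtain ⟨S, hSc, hS⟩ := exists_jset_trace (k := k) hD (hbig _ hp1) hm0 (hbig _ hm)
  refine ⟨S.preimage _ hinj.injOn, ?_, ?_⟩
  · refine le_trans ?_ hSc
    exact Finset.card_le_card_of_injOn (algebraMap (ZMod p) k)
      (fun x hx => Finset.mem_preimage.1 hx) hinj.injOn
  · intro a₀ b₀ hns ht0 htm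
    set t : ℤ := (p : ℤ) - affinePoints p a₀ b₀ with ht
    have ha : (algebraMap (ZMod p) k a₀) ^ p = algebraMap (ZMod p) k a₀ := by
      rw [← map_pow, ZMod.pow_card]
    have hb : (algebraMap (ZMod p) k b₀) ^ p = algebraMap (ZMod p) k b₀ := by
      rw [← map_pow, ZMod.pow_card]
    have hns' : 4 * (algebraMap (ZMod p) k a₀) ^ 3 + 27 * (algebraMap (ZMod p) k b₀) ^ 2 ≠ 0 := by
      intro h
      refine hns (hinj ?_)
      simpa [e4, e27] using h
    have := isElliptic_of_ne h2 hns'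
    obtain ⟨-, hF⟩ := frob_char ha hb
    obtain ⟨w, ψ, hψ, hψψ, hw⟩ := hF t (by
      rw [card_fixed ha hb rfl rfl]; push_cast; rw [ht]; ring)
    rw [Finset.mem_preimage]
    have := hS (algebraMap (ZMod p) k a₀) (algebraMap (ZMod p) k b₀) (t : k) w ψ ?_ ?_ hψ ?_ ?_
    · simpa [e4, e27] using this
    · intro h
      have hdvd : (p : ℤ) ∣ t := (CharP.intCast_eq_zero_iff k p t).1 h
      have hle := Int.le_of_dvd (by positivity) ((abs_dvd_abs _ _).2 hdvd)
      have hp0 : (0 : ℤ) ≤ p := by positivity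
      have hp3 : (5 : ℤ) ≤ p := by exact_mod_cast (by omega : 5 ≤ p)
      rw [abs_of_nonneg hp0] at hle
      have h4 : t ^ 2 ≤ 4 * p := by
        have : (0 : ℤ) ≤ D * m ^ 2 := by positivity
        linarith
      rw [← sq_abs] at h4
      nlinarith
    · have := congrArg (Int.cast : ℤ → k) htm
      push_cast at this
      rw [CharP.cast_eq_zero k p, mul_zero] at this
      linear_combination this
    · intro P
      rw [hψψ, ← natCast_zsmul, ← neg_smul]
      congr 1
      push_cast
      linear_combination htm
    · have : (hh w : ℤ) = ((D * m ^ 2 : ℕ) : ℤ) := by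
        rw [hw]; push_cast; linear_combination -htm
      exact_mod_cast this

end

/-- The `j`-invariants over `𝔽_p` of curves whose Frobenius discriminant is `-D * m ^ 2`. -/
theorem exists_jset_prime {D : ℕ} (hD : D ≠ 0) {p : ℕ} [Fact p.Prime]
    (hp1 : (46 * D + 8) ^ 2 + D < p) (hp2 : 2 ^ 26 ≤ p) {m : ℕ} (hm0 : m ≠ 0)
    (hmp : D * m ^ 2 < 4 * p) : ∃ S : Finset (ZMod p),
      S.card ≤ ((46 * D + 1) * (4 * (46 * D) + 3) + 2) * (m * m.divisors.card ^ 2) ∧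
      ∀ a b : ZMod p, 4 * a ^ 3 + 27 * b ^ 2 ≠ 0 → (p : ℤ) - affinePoints p a b ≠ 0 →
        ((p : ℤ) - affinePoints p a b) ^ 2 + D * m ^ 2 = 4 * p →
          a ^ 3 / (4 * a ^ 3 + 27 * b ^ 2) ∈ S := by
  have : CharP (AlgebraicClosure (ZMod p)) p := charP_of_injective_algebraMap
    (algebraMap (ZMod p) (AlgebraicClosure (ZMod p))).injective p
  exact exists_jset_prime_aux (AlgebraicClosure (ZMod p)) hD hp1 hp2 hm0 hmp

end PerPrime

section Reduction

/-- The homogenization of an integer polynomial, evaluated at a pair of integers. -/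
def homEval (A : ℤ[X]) (a b : ℤ) : ℤ :=
  ∑ i ∈ Finset.range (A.natDegree + 1), A.coeff i * a ^ i * b ^ (A.natDegree - i)

lemma homEval_cast {K : Type*} [Field K] (A : ℤ[X]) (a b : ℤ) (hb : (b : K) ≠ 0) :
    A.eval₂ (Int.castRingHom K) (a / b) * (b : K) ^ A.natDegree = (homEval A a b : ℤ) := by
  rw [homEval, eval₂_eq_sum_range, Finset.sum_mul, Int.cast_sum]
  refine Finset.sum_congr rfl fun i hi => ?_
  have hi' : i ≤ A.natDegree := Nat.lt_succ_iff.1 (Finset.mem_range.1 hi)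
  push_cast
  rw [← Nat.sub_add_cancel hi', pow_add, Nat.add_sub_cancel, div_pow]
  simp only [eq_intCast]
  field_simp

lemma homEval_modEq (A : ℤ[X]) (a : ℤ) {b p : ℤ} (hp : p ∣ b) :
    p ∣ homEval A a b - A.leadingCoeff * a ^ A.natDegree := by
  rw [homEval, Finset.sum_range_succ, Nat.sub_self, pow_zero, mul_one, leadingCoeff,
    add_sub_cancel_right]
  refine Finset.dvd_sum fun i hi => dvd_mul_of_dvd_right (dvd_pow hp ?_) _
  have := Finset.mem_range.1 hi
  omega

variable {p : ℕ} [Fact p.Prime]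

lemma ratRed_of_mul {q : ℚ} {x y : ℤ} (hy : (y : ZMod p) ≠ 0) (h : q * y = x) :
    ratRed p q = x / y := by
  have h1 : q.num * y = x * q.den := by
    have hd : (q.den : ℚ) ≠ 0 := by exact_mod_cast q.den_nz
    have : (q.num : ℚ) * y = x * q.den := by
      rw [← h]; nth_rewrite 2 [← Rat.num_div_den q]; field_simp
    exact_mod_cast this
  have h2 : (q.den : ℤ) ∣ y := by
    refine IsCoprime.dvd_of_dvd_mul_left (x := (q.den : ℤ)) (y := q.num) ?_ ⟨x, by linarith⟩
    rw [Int.isCoprime_iff_gcd_eq_one, Int.gcd_comm]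
    exact q.reduced
  have h3 : (q.den : ZMod p) ≠ 0 := by
    intro h0
    obtain ⟨z, rfl⟩ := h2
    exact hy (by push_cast; rw [h0, zero_mul])
  have h4 : (q.num : ZMod p) * y = x * q.den := by
    have := congrArg (Int.cast : ℤ → ZMod p) h1
    push_cast at this
    exact this
  rw [ratRed]
  field_simp
  rw [h4, mul_comm]

lemma ratRed_evalQ (A : ℤ[X]) {ab : ℕ × ℕ} (hb0 : ab.2 ≠ 0) (hb : (ab.2 : ZMod p) ≠ 0) :
    ratRed p (evalQ A (fareyFrac ab)) =
      A.eval₂ (Int.castRingHom (ZMod p)) ((ab.1 : ZMod p) / ab.2) := by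
  have h1 := homEval_cast (K := ℚ) A ab.1 ab.2 (by exact_mod_cast hb0)
  have h2 := homEval_cast (K := ZMod p) A ab.1 ab.2 (by exact_mod_cast hb)
  rw [ratRed_of_mul (x := homEval A ab.1 ab.2) (y := (ab.2 : ℤ) ^ A.natDegree)
    (by push_cast; exact pow_ne_zero _ hb) (by rw [← h1]; simp [evalQ, fareyFrac]), ← h2]
  have hb' : (((ab.2 : ℤ) ^ A.natDegree : ℤ) : ZMod p) ≠ 0 := by
    push_cast; exact pow_ne_zero _ hb
  push_cast at hb' ⊢
  field_simp

lemma discQ_eq (A B : ℤ[X]) (τ : ℚ) :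
    discQ A B τ = evalQ (-16 * (4 * A ^ 3 + 27 * B ^ 2)) τ := by
  simp [discQ, evalQ, eval₂_mul, eval₂_add, eval₂_pow, eval₂_ofNat]

lemma ratRed_discQ (A B : ℤ[X]) {ab : ℕ × ℕ} (hb0 : ab.2 ≠ 0) (hb : (ab.2 : ZMod p) ≠ 0) :
    ratRed p (discQ A B (fareyFrac ab)) =
      -16 * (4 * ratRed p (evalQ A (fareyFrac ab)) ^ 3 +
        27 * ratRed p (evalQ B (fareyFrac ab)) ^ 2) := by
  rw [discQ_eq, ratRed_evalQ _ hb0 hb, ratRed_evalQ _ hb0 hb, ratRed_evalQ _ hb0 hb]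
  simp [eval₂_mul, eval₂_add, eval₂_pow, eval₂_ofNat]

/-- A nonconstant polynomial acquires a pole modulo `p` at a point with a pole. -/
lemma dvd_den_evalQ {A : ℤ[X]} (hA : A.natDegree ≠ 0) (hp : ¬ (p : ℤ) ∣ A.leadingCoeff)
    {ab : ℕ × ℕ} (hab : Nat.Coprime ab.1 ab.2) (hb0 : ab.2 ≠ 0) (hb : p ∣ ab.2) :
    (p : ℤ) ∣ (evalQ A (fareyFrac ab)).den := by
  have hpp : Prime (p : ℤ) := Nat.prime_iff_prime_int.1 Fact.out
  have hbz : (p : ℤ) ∣ (ab.2 : ℤ) := by exact_mod_cast hb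
  have h1 := homEval_cast (K := ℚ) A ab.1 ab.2 (by exact_mod_cast hb0)
  set q := evalQ A (fareyFrac ab) with hq
  have hd : (q.den : ℚ) ≠ 0 := by exact_mod_cast q.den_nz
  have h2 : q.num * (ab.2 : ℤ) ^ A.natDegree = homEval A ab.1 ab.2 * q.den := by
    have : (q.num : ℚ) * (ab.2 : ℚ) ^ A.natDegree = homEval A ab.1 ab.2 * q.den := by
      rw [← h1]
      have : A.eval₂ (Int.castRingHom ℚ) (((ab.1 : ℤ) : ℚ) / ((ab.2 : ℤ) : ℚ)) = q := by
        simp [hq, evalQ, fareyFrac]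
      rw [this]
      nth_rewrite 2 [← Rat.num_div_den q]
      push_cast
      field_simp
    exact_mod_cast this
  have h3 : (p : ℤ) ∣ homEval A ab.1 ab.2 * q.den := by
    rw [← h2]; exact dvd_mul_of_dvd_right (dvd_pow hbz hA) _
  refine (hpp.dvd_or_dvd h3).resolve_left fun h4 => ?_
  have h5 := (dvd_sub_right h4).1 (homEval_modEq A ab.1 hbz)
  rcases hpp.dvd_or_dvd h5 with h6 | h6
  · exact hp h6
  · have h7 : p ∣ ab.1 := by exact_mod_cast hpp.dvd_of_dvd_pow h6
    have := Nat.dvd_gcd h7 hb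
    rw [hab] at this
    exact (Fact.out : p.Prime).one_lt.ne' (Nat.dvd_one.1 this)

lemma exists_minor {A B : ℤ[X]} (hΔ : 4 * A ^ 3 + 27 * B ^ 2 ≠ 0) (hj : jNonconstant A B) :
    ∃ i l : ℕ, (A ^ 3).coeff l * (4 * A ^ 3 + 27 * B ^ 2).coeff i ≠
      (A ^ 3).coeff i * (4 * A ^ 3 + 27 * B ^ 2).coeff l := by
  by_contra hcon
  push Not at hcon
  obtain ⟨i, hi⟩ : ∃ i, (4 * A ^ 3 + 27 * B ^ 2).coeff i ≠ 0 := by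
    by_contra h
    push Not at h
    exact hΔ (Polynomial.ext fun i => by rw [h i, coeff_zero])
  set F := A ^ 3 with hF
  set G := 4 * F + 27 * B ^ 2 with hG
  have hiq : (G.coeff i : ℚ) ≠ 0 := by exact_mod_cast hi
  have e1 : (A.map (Int.castRingHom ℚ)) ^ 3 = F.map (Int.castRingHom ℚ) := by
    rw [hF, Polynomial.map_pow]
  have e2 : 4 * (A.map (Int.castRingHom ℚ)) ^ 3 + 27 * (B.map (Int.castRingHom ℚ)) ^ 2 =
      G.map (Int.castRingHom ℚ) := by
    rw [hG, hF]; simp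
  apply hj (-6912 * (F.coeff i / G.coeff i))
  rw [e2, e1, C_mul, mul_assoc]
  have e3 : (C (-6912 : ℚ)) = -6912 := by rw [C_neg]; congr 1
  rw [e3]
  congr 1
  ext l
  rw [coeff_C_mul, coeff_map, coeff_map]
  have := hcon i l
  have h2 : (F.coeff l : ℚ) * G.coeff i = F.coeff i * G.coeff l := by exact_mod_cast this
  simp only [eq_intCast]
  field_simp
  linear_combination h2

/-- Few residues give curves with `j`-invariant in a prescribed set. -/
lemma card_jset_preimage_le {A B : ℤ[X]} {i l : ℕ}
    (hil : ¬ (p : ℤ) ∣ (A ^ 3).coeff l * (4 * A ^ 3 + 27 * B ^ 2).coeff i -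
      (A ^ 3).coeff i * (4 * A ^ 3 + 27 * B ^ 2).coeff l) (S : Finset (ZMod p)) :
    (Finset.univ.filter fun u : ZMod p =>
      4 * A.eval₂ (Int.castRingHom _) u ^ 3 + 27 * B.eval₂ (Int.castRingHom _) u ^ 2 ≠ 0 ∧
      A.eval₂ (Int.castRingHom _) u ^ 3 / (4 * A.eval₂ (Int.castRingHom _) u ^ 3 +
        27 * B.eval₂ (Int.castRingHom _) u ^ 2) ∈ S).card ≤
      S.card * max (A ^ 3).natDegree (4 * A ^ 3 + 27 * B ^ 2).natDegree := by
  set F := A ^ 3 with hF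
  set G := 4 * F + 27 * B ^ 2 with hG
  set φ := Int.castRingHom (ZMod p)
  set H : ZMod p → (ZMod p)[X] := fun j => F.map φ - C j * G.map φ with hH
  have hH0 : ∀ j, H j ≠ 0 := by
    intro j h0
    have h1 : ∀ n, ((F.coeff n : ℤ) : ZMod p) = j * (G.coeff n : ℤ) := by
      intro n
      have := congrArg (fun q => coeff q n) h0
      simp only [hH, coeff_sub, coeff_map, coeff_C_mul, coeff_zero] at this
      exact sub_eq_zero.1 this
    apply hil
    rw [← ZMod.intCast_zmod_eq_zero_iff_dvd]
    push_cast
    rw [h1, h1]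
    ring
  have hHd : ∀ j, (H j).natDegree ≤ max F.natDegree G.natDegree := by
    intro j
    refine (natDegree_sub_le _ _).trans (max_le_max (natDegree_map_le) ?_)
    exact (natDegree_C_mul_le _ _).trans natDegree_map_le
  have hsub : (Finset.univ.filter fun u : ZMod p =>
      4 * A.eval₂ φ u ^ 3 + 27 * B.eval₂ φ u ^ 2 ≠ 0 ∧
      A.eval₂ φ u ^ 3 / (4 * A.eval₂ φ u ^ 3 + 27 * B.eval₂ φ u ^ 2) ∈ S) ⊆
      S.biUnion fun j => (H j).roots.toFinset := by
    intro u hu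
    obtain ⟨-, h1, h2⟩ := Finset.mem_filter.1 hu
    refine Finset.mem_biUnion.2 ⟨_, h2, ?_⟩
    rw [Multiset.mem_toFinset, mem_roots (hH0 _), IsRoot.def]
    simp only [hH, hF, hG, eval_sub, eval_mul, eval_C, eval_map, eval₂_add, eval₂_mul, eval₂_pow,
      eval₂_ofNat]
    rw [div_mul_cancel₀ _ h1, sub_self]
  refine (Finset.card_le_card hsub).trans (Finset.card_biUnion_le_card_mul _ _ _ fun j _ => ?_)
  exact (Multiset.toFinset_card_le _).trans ((card_roots' _).trans (hHd j))

end Reduction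

section Counting

lemma fareyPairs_card_le {T : ℝ} (hT : 0 ≤ T) : ((fareyPairs T).card : ℝ) ≤ T ^ 2 := by
  have h1 : (fareyPairs T).card ≤ ⌊T⌋₊ * ⌊T⌋₊ := by
    refine (Finset.card_filter_le _ _).trans ?_
    rw [Finset.card_product, Nat.card_Icc, Nat.add_sub_cancel]
  have h2 : (⌊T⌋₊ : ℝ) ≤ T := Nat.floor_le hT
  calc ((fareyPairs T).card : ℝ) ≤ (⌊T⌋₊ : ℝ) * ⌊T⌋₊ := by exact_mod_cast h1
    _ ≤ T ^ 2 := by rw [sq]; gcongr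

lemma card_residue_le {p : ℕ} (hp : 0 < p) (N : ℕ) (v : ZMod p) :
    (((Finset.Icc 1 N).filter fun n : ℕ => (n : ZMod p) = v).card : ℝ) ≤ N / p + 1 := by
  have : NeZero p := ⟨hp.ne'⟩
  have h1 : ((Finset.Icc 1 N).filter fun n : ℕ => (n : ZMod p) = v) =
      (Finset.Ioc 0 N).filter fun n : ℕ => n ≡ v.val [MOD p] := by
    ext n
    simp only [Finset.mem_filter, Finset.mem_Icc, Finset.mem_Ioc, ← ZMod.natCast_eq_natCast_iff,
      ZMod.natCast_val, ZMod.cast_id', id]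
    rfl
  have h2 := Nat.Ioc_filter_modEq_card 0 N hp v.val
  rw [h1]
  set c := ((Finset.Ioc 0 N).filter fun n : ℕ => n ≡ v.val [MOD p]).card with hc
  have h3 : (c : ℚ) ≤ N / p + 1 := by
    have e : (c : ℚ) = ((c : ℤ) : ℚ) := by simp
    rw [e, h2]
    have hpq : (0 : ℚ) < p := by exact_mod_cast hp
    rcases le_total (⌊((N : ℕ) - (v.val : ℚ)) / p⌋ - ⌊((0 : ℕ) - (v.val : ℚ)) / p⌋) 0 with h | h
    · rw [max_eq_right h]; push_cast; positivity
    · rw [max_eq_left h]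
      push_cast
      have h5 := Int.floor_le (((N : ℕ) - (v.val : ℚ)) / p)
      have h6 := Int.lt_floor_add_one (((0 : ℕ) - (v.val : ℚ)) / p)
      have h7 : ((N : ℕ) - (v.val : ℚ)) / p = N / p + ((0 : ℕ) - (v.val : ℚ)) / p := by
        push_cast; ring
      push_cast at h5 h6 h7
      linarith
  have := (Rat.cast_le (K := ℝ)).2 h3
  push_cast at this
  exact this

lemma card_farey_residue_le {p : ℕ} [Fact p.Prime] {T : ℝ} (hT : 0 ≤ T) (u : ZMod p) :
    (((fareyPairs T).filter fun ab => (ab.2 : ZMod p) ≠ 0 ∧ (ab.1 : ZMod p) / ab.2 = u).card : ℝ) ≤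
      T * (T / p + 1) := by
  have hp : 0 < p := (Fact.out : p.Prime).pos
  set N := ⌊T⌋₊
  have hN : (N : ℝ) ≤ T := Nat.floor_le hT
  have hsub : ((fareyPairs T).filter fun ab => (ab.2 : ZMod p) ≠ 0 ∧ (ab.1 : ZMod p) / ab.2 = u) ⊆
      (Finset.Icc 1 N).biUnion fun b =>
        ((Finset.Icc 1 N).filter fun n : ℕ => (n : ZMod p) = u * b).image fun a => (a, b) := by
    intro ab hab
    obtain ⟨h1, h2, h3⟩ := Finset.mem_filter.1 hab
    obtain ⟨h4, h5⟩ := Finset.mem_product.1 (Finset.mem_filter.1 h1).1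
    refine Finset.mem_biUnion.2 ⟨ab.2, h5, Finset.mem_image.2 ⟨ab.1, Finset.mem_filter.2
      ⟨h4, ?_⟩, rfl⟩⟩
    rw [← h3, div_mul_cancel₀ _ h2]
  calc _ ≤ ((∑ b ∈ Finset.Icc 1 N, ((Finset.Icc 1 N).filter fun n : ℕ =>
        (n : ZMod p) = u * b).card : ℕ) : ℝ) := by
        exact_mod_cast (Finset.card_le_card hsub).trans (Finset.card_biUnion_le.trans
          (Finset.sum_le_sum fun b _ => Finset.card_image_le))
    _ ≤ ∑ b ∈ Finset.Icc 1 N, ((N : ℝ) / p + 1) := by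
        push_cast
        exact Finset.sum_le_sum fun b _ => card_residue_le hp N _
    _ = N * (N / p + 1) := by
        rw [Finset.sum_const, Nat.card_Icc, Nat.add_sub_cancel, nsmul_eq_mul]
    _ ≤ _ := by gcongr

lemma exists_int_of_squarefree {d : ℤ} (hd : Squarefree d) {z : ℤ} {r : ℚ}
    (h : (z : ℚ) = d * r ^ 2) : ∃ m : ℕ, z = d * m ^ 2 := by
  have hden : (r.den : ℚ) ≠ 0 := by exact_mod_cast r.den_nz
  have h1 : z * (r.den : ℤ) ^ 2 = d * r.num ^ 2 := by
    have : (z : ℚ) * (r.den : ℚ) ^ 2 = d * r.num ^ 2 := by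
      rw [h]
      nth_rewrite 1 [← Rat.num_div_den r]
      field_simp
    exact_mod_cast this
  have hcop : IsCoprime ((r.den : ℤ) ^ 2) (r.num ^ 2) := by
    refine IsCoprime.pow ?_
    rw [Int.isCoprime_iff_gcd_eq_one, Int.gcd_comm]
    exact r.reduced
  have h2 : (r.den : ℤ) * r.den ∣ d := by
    rw [← sq]
    exact hcop.dvd_of_dvd_mul_right ⟨z, by linarith⟩
  have h3 := Int.isUnit_iff.1 (hd _ h2)
  have h4 : (r.den : ℤ) = 1 := h3.resolve_right (by have : (0 : ℤ) ≤ r.den := by positivity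
                                                    omega)
  refine ⟨r.num.natAbs, ?_⟩
  rw [h4] at h1
  rw [Int.natCast_natAbs, sq_abs]
  linarith

/-- The condition under which a Farey fraction is counted at the prime `p`. -/
def Counted (A B : ℤ[X]) (d : ℤ) (ab : ℕ × ℕ) (p : ℕ) : Prop :=
  p.Prime ∧ goodRed A B (fareyFrac ab) p ∧ apFrob A B (fareyFrac ab) p ≠ 0 ∧
    ∃ r : ℚ, ((apFrob A B (fareyFrac ab) p : ℚ) ^ 2 - 4 * p) = d * r ^ 2

lemma Counted.exists_trace {A B : ℤ[X]} {d : ℤ} (hd : Squarefree d) {D : ℕ} (hD : d = -D)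
    {ab : ℕ × ℕ} {p : ℕ} (hp4 : 4 < p) (h : Counted A B d ab p) : ∃ m : ℕ, m ≠ 0 ∧
      apFrob A B (fareyFrac ab) p ^ 2 + D * m ^ 2 = 4 * p := by
  obtain ⟨hp, -, h0, r, hr⟩ := h
  set t := apFrob A B (fareyFrac ab) p
  obtain ⟨m, hm⟩ := exists_int_of_squarefree hd (z := t ^ 2 - 4 * p) (r := r) (by
    push_cast; exact hr)
  rw [hD] at hm
  refine ⟨m, ?_, by linarith⟩
  rintro rfl
  have hpp := Nat.prime_iff_prime_int.1 hp
  have ht : t ^ 2 = 4 * p := by push_cast at hm; linarith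
  obtain ⟨s, hs⟩ := hpp.dvd_of_dvd_pow (n := 2) (a := t) ⟨4, by linarith⟩
  rw [hs] at ht
  have hpz : (p : ℤ) ≠ 0 := hpp.ne_zero
  have h5 : (p : ℤ) * s ^ 2 = 4 := mul_left_cancel₀ hpz (by linear_combination ht)
  have := Int.le_of_dvd (by norm_num) (Dvd.intro _ h5)
  omega

lemma not_dvd_of_natAbs_lt {p : ℕ} {n : ℤ} (hn : n ≠ 0) (h : n.natAbs < p) : ¬ (p : ℤ) ∣ n := by
  intro hdvd
  exact absurd (Nat.le_of_dvd (Int.natAbs_pos.2 hn) (Int.natCast_dvd.1 hdvd)) (by omega)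

lemma natDegree_ne_zero_or {A B : ℤ[X]} (hΔ : 4 * A ^ 3 + 27 * B ^ 2 ≠ 0)
    (hj : jNonconstant A B) : A.natDegree ≠ 0 ∨ B.natDegree ≠ 0 := by
  by_contra hcon
  push Not at hcon
  obtain ⟨i, l, hil⟩ := exists_minor hΔ hj
  rw [eq_C_of_natDegree_eq_zero hcon.1, eq_C_of_natDegree_eq_zero hcon.2] at hil
  have e : (4 * (C (A.coeff 0)) ^ 3 + 27 * (C (B.coeff 0)) ^ 2 : ℤ[X]) =
      C (4 * A.coeff 0 ^ 3 + 27 * B.coeff 0 ^ 2) := by simp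
  rw [e, ← C_pow] at hil
  simp only [coeff_C] at hil
  split_ifs at hil <;> simp at hil

end Counting

section PrimeCount

lemma Counted.coprime_den {A B : ℤ[X]} {d : ℤ} {T : ℝ} {p : ℕ} [Fact p.Prime]
    (hAB : A.natDegree ≠ 0 ∨ B.natDegree ≠ 0) (hA : A.leadingCoeff.natAbs < p)
    (hB : B.leadingCoeff.natAbs < p) {ab : ℕ × ℕ} (hab : ab ∈ fareyPairs T)
    (h : Counted A B d ab p) : ab.2 ≠ 0 ∧ (ab.2 : ZMod p) ≠ 0 := by
  obtain ⟨h1, hcop⟩ := Finset.mem_filter.1 hab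
  have hb0 : ab.2 ≠ 0 := by
    have := (Finset.mem_Icc.1 (Finset.mem_product.1 h1).2).1
    omega
  refine ⟨hb0, fun h0 => ?_⟩
  have hdvd : p ∣ ab.2 := (ZMod.natCast_eq_zero_iff _ _).1 h0
  have key : ∀ {Q : ℤ[X]}, Q.natDegree ≠ 0 → Q.leadingCoeff.natAbs < p →
      (p : ℤ) ∣ (evalQ Q (fareyFrac ab)).den := fun hQ hlt =>
    dvd_den_evalQ hQ (not_dvd_of_natAbs_lt
      (leadingCoeff_ne_zero.2 (by rintro rfl; simp at hQ)) hlt) hcop hb0 hdvd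
  rcases hAB with hQ | hQ
  · exact h.2.1.1 (key hQ hA)
  · exact h.2.1.2.1 (key hQ hB)

/-- The number of Farey fractions counted at a given large prime. -/
theorem exists_card_counted_le {A B : ℤ[X]} (hΔ : 4 * A ^ 3 + 27 * B ^ 2 ≠ 0)
    (hj : jNonconstant A B) {d : ℤ} (hd : Squarefree d) {D : ℕ} (hD0 : D ≠ 0) (hD : d = -D) :
    ∃ P₀ K : ℕ, ∀ p : ℕ, P₀ < p → ∀ (T : ℝ), 0 ≤ T → ∀ M : ℕ, (∀ n : ℕ, n ^ 2 ≤ 4 * p → n ≤ M) →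
      (((fareyPairs T).filter fun ab => Counted A B d ab p).card : ℝ) ≤
        ∑ mt ∈ (Finset.Icc 1 M ×ˢ Finset.Icc 1 M).filter
          (fun mt : ℕ × ℕ => mt.2 ^ 2 + D * mt.1 ^ 2 = 4 * p),
          (K * (mt.1 * mt.1.divisors.card ^ 2) : ℝ) * (T * (T / p + 1)) := by
  obtain ⟨i, l, hil⟩ := exists_minor hΔ hj
  have hAB := natDegree_ne_zero_or hΔ hj
  set μ := (A ^ 3).coeff l * (4 * A ^ 3 + 27 * B ^ 2).coeff i -
      (A ^ 3).coeff i * (4 * A ^ 3 + 27 * B ^ 2).coeff l with hμ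
  have hμ0 : μ ≠ 0 := sub_ne_zero.2 hil
  set δ := max (A ^ 3).natDegree (4 * A ^ 3 + 27 * B ^ 2).natDegree
  set K₀ := (46 * D + 1) * (4 * (46 * D) + 3) + 2
  refine ⟨2 ^ 26 + ((46 * D + 8) ^ 2 + D) + μ.natAbs + A.leadingCoeff.natAbs +
    B.leadingCoeff.natAbs, K₀ * δ, fun p hp T hT M hM => ?_⟩
  by_cases hpp : p.Prime
  swap
  · rw [Finset.filter_false_of_mem fun ab _ h => hpp h.1]
    rw [Finset.card_empty, Nat.cast_zero]
    exact Finset.sum_nonneg fun _ _ => by positivity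
  have : Fact p.Prime := ⟨hpp⟩
  have hS : ∀ m : ℕ, ∃ S : Finset (ZMod p), (m ≠ 0 → D * m ^ 2 < 4 * p →
      S.card ≤ K₀ * (m * m.divisors.card ^ 2) ∧
      ∀ a b : ZMod p, 4 * a ^ 3 + 27 * b ^ 2 ≠ 0 → (p : ℤ) - affinePoints p a b ≠ 0 →
        ((p : ℤ) - affinePoints p a b) ^ 2 + D * m ^ 2 = 4 * p →
          a ^ 3 / (4 * a ^ 3 + 27 * b ^ 2) ∈ S) := by
    intro m
    by_cases hm : m ≠ 0 ∧ D * m ^ 2 < 4 * p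
    · obtain ⟨S, hS⟩ := exists_jset_prime (p := p) hD0 (by omega) (by omega) hm.1 hm.2
      exact ⟨S, fun _ _ => hS⟩
    · exact ⟨∅, fun h1 h2 => absurd ⟨h1, h2⟩ hm⟩
  choose S hS using hS
  set U : ℕ → Finset (ZMod p) := fun m => Finset.univ.filter fun u : ZMod p =>
      4 * A.eval₂ (Int.castRingHom _) u ^ 3 + 27 * B.eval₂ (Int.castRingHom _) u ^ 2 ≠ 0 ∧
      A.eval₂ (Int.castRingHom _) u ^ 3 / (4 * A.eval₂ (Int.castRingHom _) u ^ 3 +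
        27 * B.eval₂ (Int.castRingHom _) u ^ 2) ∈ S m with hU
  set I := (Finset.Icc 1 M ×ˢ Finset.Icc 1 M).filter
          (fun mt : ℕ × ℕ => mt.2 ^ 2 + D * mt.1 ^ 2 = 4 * p) with hI
  set V : ZMod p → Finset (ℕ × ℕ) := fun u =>
    (fareyPairs T).filter fun ab => (ab.2 : ZMod p) ≠ 0 ∧ (ab.1 : ZMod p) / ab.2 = u with hV
  have hsub : ((fareyPairs T).filter fun ab => Counted A B d ab p) ⊆
      I.biUnion fun mt => (U mt.1).biUnion V := by
    intro ab hab
    obtain ⟨h1, h2⟩ := Finset.mem_filter.1 hab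
    obtain ⟨hb0, hb⟩ := h2.coprime_den hAB (by omega) (by omega) h1
    obtain ⟨m, hm0, hm⟩ := h2.exists_trace hd hD (by omega)
    have hdisc := h2.2.1.2.2
    rw [ratRed_discQ A B hb0 hb] at hdisc
    have hns := right_ne_zero_of_mul hdisc
    have ht0 := h2.2.2.1
    have htn : (apFrob A B (fareyFrac ab) p).natAbs ^ 2 + D * m ^ 2 = 4 * p := by
      zify
      rw [sq_abs]
      exact hm
    have hDm : D * m ^ 2 < 4 * p := by
      have : 0 < (apFrob A B (fareyFrac ab) p).natAbs ^ 2 := pow_pos (Int.natAbs_pos.2 ht0) 2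
      omega
    have hmm : m ^ 2 ≤ D * m ^ 2 := Nat.le_mul_of_pos_left _ (Nat.pos_of_ne_zero hD0)
    have hmem := (hS m hm0 hDm).2 _ _ hns ht0 hm
    rw [ratRed_evalQ A hb0 hb, ratRed_evalQ B hb0 hb] at hmem hns
    refine Finset.mem_biUnion.2 ⟨(m, (apFrob A B (fareyFrac ab) p).natAbs), ?_, ?_⟩
    · refine Finset.mem_filter.2 ⟨Finset.mem_product.2 ⟨Finset.mem_Icc.2
        ⟨Nat.pos_of_ne_zero hm0, hM _ (hmm.trans hDm.le)⟩, Finset.mem_Icc.2 ⟨Int.natAbs_pos.2 ht0,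
        hM _ ((Nat.le_add_right _ _).trans htn.le)⟩⟩, htn⟩
    · exact Finset.mem_biUnion.2 ⟨(ab.1 : ZMod p) / ab.2, Finset.mem_filter.2
        ⟨Finset.mem_univ _, hns, hmem⟩, Finset.mem_filter.2 ⟨h1, hb, rfl⟩⟩
  calc _ ≤ ((∑ mt ∈ I, ∑ u ∈ U mt.1, (V u).card : ℕ) : ℝ) := by
        exact_mod_cast (Finset.card_le_card hsub).trans (Finset.card_biUnion_le.trans
          (Finset.sum_le_sum fun b _ => Finset.card_biUnion_le))
    _ ≤ _ := ?_
  push_cast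
  refine Finset.sum_le_sum fun mt hmt => ?_
  obtain ⟨h1, h2⟩ := Finset.mem_filter.1 hmt
  obtain ⟨h3, h4⟩ := Finset.mem_product.1 h1
  have hm1 := (Finset.mem_Icc.1 h3).1
  have ht1 := (Finset.mem_Icc.1 h4).1
  have ht2 : 0 < mt.2 ^ 2 := pow_pos ht1 2
  have hUc : (U mt.1).card ≤ K₀ * (mt.1 * mt.1.divisors.card ^ 2) * δ :=
    (card_jset_preimage_le (not_dvd_of_natAbs_lt hμ0 (by omega)) (S mt.1)).trans
      (Nat.mul_le_mul_right _ (hS mt.1 (by omega) (by omega)).1)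
  have hUc' : ((U mt.1).card : ℝ) ≤ K₀ * δ * (mt.1 * mt.1.divisors.card ^ 2) := by
    have : ((U mt.1).card : ℝ) ≤ ((K₀ * (mt.1 * mt.1.divisors.card ^ 2) * δ : ℕ) : ℝ) := by
      exact_mod_cast hUc
    refine this.trans (le_of_eq ?_)
    push_cast; ring
  calc _ ≤ ∑ u ∈ U mt.1, T * (T / p + 1) :=
        Finset.sum_le_sum fun u _ => card_farey_residue_le hT u
    _ = (U mt.1).card * (T * (T / p + 1)) := by rw [Finset.sum_const, nsmul_eq_mul]
    _ ≤ _ := mul_le_mul_of_nonneg_right hUc' (by positivity)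

end PrimeCount

section FinalSum

lemma sum_rpow_le {δ : ℝ} (hδ : 0 < δ) (hδ6 : δ ≤ 1 / 6) {T : ℝ} (hT : 0 ≤ T) (M : ℕ) :
    ∑ m ∈ Finset.Icc 1 M, (m : ℝ) ^ (1 + δ) * (T * (4 * T / m ^ 2 + 1)) ≤
      28 * T ^ 2 * (M : ℝ) ^ ((1 : ℝ) / 3) + T * (M : ℝ) ^ (2 + δ) := by
  rcases Nat.eq_zero_or_pos M with rfl | hM
  · simp only [zero_lt_one, Finset.Icc_eq_empty_of_lt, Finset.sum_empty]
    positivity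
  have hM1 : (1 : ℝ) ≤ M := by exact_mod_cast hM
  have hM0 : (0 : ℝ) < M := by linarith
  have h1 : ∀ m ∈ Finset.Icc 1 M, (m : ℝ) ^ (1 + δ) * (T * (4 * T / m ^ 2 + 1)) ≤
      4 * T ^ 2 * (M : ℝ) ^ ((1 : ℝ) / 6) * (m : ℝ)⁻¹ + T * (M : ℝ) ^ (1 + δ) := by
    intro m hm
    obtain ⟨hm1, hm2⟩ := Finset.mem_Icc.1 hm
    have hm1' : (1 : ℝ) ≤ m := by exact_mod_cast hm1
    have hm2' : (m : ℝ) ≤ M := by exact_mod_cast hm2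
    have hm0 : (0 : ℝ) < m := by linarith
    have e1 : (m : ℝ) ^ (1 + δ) ≤ (M : ℝ) ^ (1 + δ) :=
      Real.rpow_le_rpow hm0.le hm2' (by linarith)
    have e2 : (m : ℝ) ^ δ ≤ (M : ℝ) ^ ((1 : ℝ) / 6) :=
      (Real.rpow_le_rpow hm0.le hm2' hδ.le).trans (Real.rpow_le_rpow_of_exponent_le hM1 hδ6)
    have e3 : (m : ℝ) ^ (1 + δ) = m * (m : ℝ) ^ δ := by
      rw [Real.rpow_add hm0, Real.rpow_one]
    have e4 : (m : ℝ) ^ (1 + δ) * (T * (4 * T / m ^ 2 + 1)) =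
        4 * T ^ 2 * (m : ℝ) ^ δ * (m : ℝ)⁻¹ + T * (m : ℝ) ^ (1 + δ) := by
      rw [mul_add, mul_one, mul_add]
      congr 1
      · rw [e3]; field_simp
      · ring
    rw [e4]
    gcongr
  have hharm : ∑ m ∈ Finset.Icc 1 M, (m : ℝ)⁻¹ ≤ 7 * (M : ℝ) ^ ((1 : ℝ) / 6) := by
    have e1 := harmonic_le_one_add_log M
    rw [harmonic_eq_sum_Icc] at e1
    push_cast at e1
    have e2 := Real.log_le_rpow_div hM0.le (ε := 1 / 6) (by norm_num)
    have e3 : 1 ≤ (M : ℝ) ^ ((1 : ℝ) / 6) := Real.one_le_rpow hM1 (by norm_num)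
    have e4 : (M : ℝ) ^ ((1 : ℝ) / 6) / (1 / 6) = 6 * (M : ℝ) ^ ((1 : ℝ) / 6) := by ring
    linarith
  refine (Finset.sum_le_sum h1).trans ?_
  rw [Finset.sum_add_distrib, ← Finset.mul_sum, Finset.sum_const, Nat.card_Icc,
    Nat.add_sub_cancel, nsmul_eq_mul]
  have e5 : (M : ℝ) ^ ((1 : ℝ) / 3) = (M : ℝ) ^ ((1 : ℝ) / 6) * (M : ℝ) ^ ((1 : ℝ) / 6) := by
    rw [← Real.rpow_add hM0]; norm_num
  have e6 : (M : ℝ) ^ (2 + δ) = M * (M : ℝ) ^ (1 + δ) := by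
    rw [← Real.rpow_one_add' hM0.le (by linarith)]; ring_nf
  rw [e5, e6]
  refine add_le_add ?_ (le_of_eq (by ring))
  calc _ ≤ 4 * T ^ 2 * (M : ℝ) ^ ((1 : ℝ) / 6) * (7 * (M : ℝ) ^ ((1 : ℝ) / 6)) := by gcongr
    _ = _ := by ring

/-- Interchange of summation over primes and representations. -/
lemma sum_representations_le {D : ℕ} (hD : D ≠ 0) {W : ℕ → ℝ} (hW : ∀ m, 0 ≤ W m) {T : ℝ}
    (hT : 0 ≤ T) (M X : ℕ) :
    ∑ p ∈ Finset.range X, ∑ mt ∈ (Finset.Icc 1 M ×ˢ Finset.Icc 1 M).filter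
          (fun mt : ℕ × ℕ => mt.2 ^ 2 + D * mt.1 ^ 2 = 4 * p), W mt.1 * (T * (T / p + 1)) ≤
      M * ∑ m ∈ Finset.Icc 1 M, W m * (T * (4 * T / m ^ 2 + 1)) := by
  have h1 : ∀ p ∈ Finset.range X, ∑ mt ∈ (Finset.Icc 1 M ×ˢ Finset.Icc 1 M).filter
          (fun mt : ℕ × ℕ => mt.2 ^ 2 + D * mt.1 ^ 2 = 4 * p), W mt.1 * (T * (T / p + 1)) ≤
      ∑ mt ∈ Finset.Icc 1 M ×ˢ Finset.Icc 1 M, if mt.2 ^ 2 + D * mt.1 ^ 2 = 4 * p then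
        W mt.1 * (T * (4 * T / mt.1 ^ 2 + 1)) else 0 := by
    intro p _
    rw [Finset.sum_filter]
    refine Finset.sum_le_sum fun mt hmt => ?_
    split_ifs with h
    · have hm1 := (Finset.mem_Icc.1 (Finset.mem_product.1 hmt).1).1
      have hm0 : (0 : ℝ) < mt.1 := by exact_mod_cast hm1
      have hle : mt.1 ^ 2 ≤ 4 * p := by
        have := Nat.le_mul_of_pos_left (mt.1 ^ 2) (Nat.pos_of_ne_zero hD)
        omega
      have hle' : (mt.1 : ℝ) ^ 2 ≤ 4 * p := by exact_mod_cast hle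
      have hp : (0 : ℝ) < p := by nlinarith
      have : T / p ≤ 4 * T / mt.1 ^ 2 := by
        rw [div_le_div_iff₀ hp (by positivity)]
        nlinarith
      have := hW mt.1
      gcongr
    · exact le_rfl
  refine (Finset.sum_le_sum h1).trans ?_
  rw [Finset.sum_comm, Finset.sum_product, Finset.mul_sum]
  refine Finset.sum_le_sum fun m _ => ?_
  have hnn : 0 ≤ W m * (T * (4 * T / m ^ 2 + 1)) := mul_nonneg (hW m) (by positivity)
  calc _ ≤ ∑ t ∈ Finset.Icc 1 M, W m * (T * (4 * T / m ^ 2 + 1)) := by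
        refine Finset.sum_le_sum fun t _ => ?_
        rw [← Finset.sum_filter, Finset.sum_const, nsmul_eq_mul]
        refine mul_le_of_le_one_left hnn ?_
        have : ((Finset.range X).filter fun p => t ^ 2 + D * m ^ 2 = 4 * p).card ≤ 1 := by
          refine Finset.card_le_one.2 fun a ha b hb => ?_
          have e1 := (Finset.mem_filter.1 ha).2
          have e2 := (Finset.mem_filter.1 hb).2
          omega
        exact_mod_cast this
    _ = _ := by rw [Finset.sum_const, Nat.card_Icc, Nat.add_sub_cancel, nsmul_eq_mul]

lemma sum_piField_le (A B : ℤ[X]) (d : ℤ) (x T : ℝ) :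
    ∑ ab ∈ fareyPairs T, (if discQ A B (fareyFrac ab) ≠ 0 then
      ((PiField A B (fareyFrac ab) d x : ℝ)) else 0) ≤
    ∑ p ∈ Finset.range (⌊x⌋₊ + 1),
      (((fareyPairs T).filter fun ab => Counted A B d ab p).card : ℝ) := by
  have h1 : ∀ ab ∈ fareyPairs T, (if discQ A B (fareyFrac ab) ≠ 0 then
      ((PiField A B (fareyFrac ab) d x : ℝ)) else 0) ≤
      ∑ p ∈ Finset.range (⌊x⌋₊ + 1), if Counted A B d ab p then (1 : ℝ) else 0 := by
    intro ab _
    have e : (PiField A B (fareyFrac ab) d x : ℝ) =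
        ∑ p ∈ Finset.range (⌊x⌋₊ + 1), if Counted A B d ab p then (1 : ℝ) else 0 := by
      rw [Finset.sum_boole, PiField]
      exact congrArg Nat.cast (congrArg Finset.card (Finset.ext fun p => by
        rw [Finset.mem_filter, Finset.mem_filter]; rfl))
    rw [← e]
    split_ifs
    · exact le_rfl
    · exact Nat.cast_nonneg _
  refine (Finset.sum_le_sum h1).trans (le_of_eq ?_)
  rw [Finset.sum_comm]
  exact Finset.sum_congr rfl fun p _ => Finset.sum_boole _ _

lemma floor_sqrt_rpow_le {x : ℝ} (hx : 0 < x) {e : ℝ} (he : 0 ≤ e) :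
    (⌊√(4 * x)⌋₊ : ℝ) ^ e ≤ 4 ^ (e / 2) * x ^ (e / 2) := by
  refine (Real.rpow_le_rpow (Nat.cast_nonneg _) (Nat.floor_le (Real.sqrt_nonneg _)) he).trans ?_
  rw [Real.sqrt_eq_rpow, ← Real.rpow_mul (by positivity), ← Real.mul_rpow (by norm_num) hx.le]
  ring_nf
  exact le_rfl

end FinalSum
end FrobeniusField

/-- Average Lang–Trotter bound for Frobenius fields: for the imaginary quadratic
field `𝕂 = ℚ(√d)`, `Σ_{τ ∈ F(T), Δ(τ) ≠ 0} Π_{E(τ)}(𝕂, x) ≤ C·(T²·x^{2/3} + T·x^{3/2+ε})`. -/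
theorem avg_lang_trotter_field (A B : Polynomial ℤ)
    (hΔ : 4 * A ^ 3 + 27 * B ^ 2 ≠ 0) (hj : jNonconstant A B)
    (d : ℤ) (hd : Squarefree d) (hdneg : d < 0)
    (ε : ℝ) (hε : 0 < ε) :
    ∃ C : ℝ, 0 < C ∧ ∀ x T : ℝ, 0 < x → 0 < T →
      ∑ ab ∈ fareyPairs T,
          (if discQ A B (fareyFrac ab) ≠ 0 then
            ((PiField A B (fareyFrac ab) d x : ℝ)) else 0) ≤
        C * (T ^ 2 * x ^ ((2 : ℝ) / 3) + T * x ^ ((3 : ℝ) / 2 + ε)) := by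
  classical
  obtain ⟨D, hD⟩ : ∃ D : ℕ, d = -D := ⟨d.natAbs, by omega⟩
  have hD0 : D ≠ 0 := by omega
  obtain ⟨P₀, K, hcount⟩ := FrobeniusField.exists_card_counted_le hΔ hj hd hD0 hD
  set δ := min (1 / 6) ε with hδ
  have hδ0 : 0 < δ := lt_min (by norm_num) hε
  obtain ⟨C₁, hC1, hdiv⟩ := FrobeniusField.card_divisors_le_rpow (half_pos hδ0)
  set c := (K : ℝ) * C₁ ^ 2 with hc
  have hc0 : 0 ≤ c := by positivity
  have hW : ∀ m : ℕ, (K * (m * m.divisors.card ^ 2) : ℝ) ≤ c * (m : ℝ) ^ (1 + δ) := by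
    intro m
    rcases Nat.eq_zero_or_pos m with rfl | hm
    · simp only [Nat.cast_zero, zero_mul, mul_zero]; positivity
    have hm0 : (0 : ℝ) < m := by exact_mod_cast hm
    have e1 : (m : ℝ) ^ (1 + δ) = m * ((m : ℝ) ^ (δ / 2)) ^ 2 := by
      rw [← Real.rpow_mul_natCast hm0.le, Real.rpow_add hm0, Real.rpow_one]
      norm_num
    have e2 := pow_le_pow_left₀ (Nat.cast_nonneg _) (hdiv m hm.ne') 2
    calc (K * (m * m.divisors.card ^ 2) : ℝ) ≤ K * (m * (C₁ * (m : ℝ) ^ (δ / 2)) ^ 2) := by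
          gcongr
      _ = _ := by rw [e1, hc]; ring
  set C₂ := (P₀ + 1 : ℝ) + c * (28 * 4 ^ ((4 : ℝ) / 3 / 2) + 4 ^ ((3 + δ) / 2)) with hC2
  refine ⟨C₂, by positivity, fun x T hx hT => (FrobeniusField.sum_piField_le A B d x T).trans ?_⟩
  rcases lt_or_ge x 1 with hx1 | hx1
  · have : ⌊x⌋₊ = 0 := Nat.floor_eq_zero.2 hx1
    rw [this, zero_add, Finset.sum_range_one, Finset.filter_false_of_mem fun ab _ h =>
      Nat.not_prime_zero h.1, Finset.card_empty, Nat.cast_zero]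
    positivity
  set M := ⌊√(4 * x)⌋₊ with hM
  set X := ⌊x⌋₊ + 1
  have hMp : ∀ p ∈ Finset.range X, ∀ n : ℕ, n ^ 2 ≤ 4 * p → n ≤ M := by
    intro p hp n hn
    refine Nat.le_floor (Real.le_sqrt_of_sq_le ?_)
    have h1 : (p : ℝ) ≤ x := (Nat.cast_le.2 (Nat.lt_succ_iff.1 (Finset.mem_range.1 hp))).trans
      (Nat.floor_le hx.le)
    have h2 : (n : ℝ) ^ 2 ≤ 4 * p := by exact_mod_cast hn
    linarith
  have hterm : ∀ p ∈ Finset.range X,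
      (((fareyPairs T).filter fun ab => FrobeniusField.Counted A B d ab p).card : ℝ) ≤
      (if p < P₀ + 1 then T ^ 2 else 0) + ∑ mt ∈ (Finset.Icc 1 M ×ˢ Finset.Icc 1 M).filter
          (fun mt : ℕ × ℕ => mt.2 ^ 2 + D * mt.1 ^ 2 = 4 * p),
          (c * (mt.1 : ℝ) ^ (1 + δ)) * (T * (T / p + 1)) := by
    intro p hp
    split_ifs with h
    · refine le_add_of_le_of_nonneg ?_ (Finset.sum_nonneg fun _ _ => by positivity)
      exact (Nat.cast_le.2 (Finset.card_filter_le _ _)).trans (FrobeniusField.fareyPairs_card_le hT.le)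
    · rw [zero_add]
      refine (hcount p (by omega) T hT.le M (hMp p hp)).trans (Finset.sum_le_sum fun mt _ => ?_)
      exact mul_le_mul_of_nonneg_right (hW _) (by positivity)
  refine (Finset.sum_le_sum hterm).trans ?_
  rw [Finset.sum_add_distrib]
  have hsmall : ∑ p ∈ Finset.range X, (if p < P₀ + 1 then T ^ 2 else 0) ≤ (P₀ + 1) * T ^ 2 := by
    rw [← Finset.sum_filter, Finset.sum_const, nsmul_eq_mul]
    refine mul_le_mul_of_nonneg_right ?_ (by positivity)
    have := (Finset.card_le_card (t := Finset.range (P₀ + 1)) fun p hp =>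
      Finset.mem_range.2 (Finset.mem_filter.1 hp).2 :
        ((Finset.range X).filter fun p => p < P₀ + 1).card ≤ _)
    rw [Finset.card_range] at this
    exact_mod_cast this
  have hbig := FrobeniusField.sum_representations_le hD0 (W := fun m => c * (m : ℝ) ^ (1 + δ))
    (fun m => by positivity) hT.le M X
  have hsum : (M : ℝ) * ∑ m ∈ Finset.Icc 1 M,
      c * (m : ℝ) ^ (1 + δ) * (T * (4 * T / m ^ 2 + 1)) ≤
      c * (28 * T ^ 2 * (M : ℝ) ^ ((4 : ℝ) / 3) + T * (M : ℝ) ^ (3 + δ)) := by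
    have e1 := mul_le_mul_of_nonneg_left (FrobeniusField.sum_rpow_le hδ0 (min_le_left _ _) hT.le M)
      (mul_nonneg hc0 (Nat.cast_nonneg M))
    have e2 : (M : ℝ) ^ ((4 : ℝ) / 3) = M * (M : ℝ) ^ ((1 : ℝ) / 3) := by
      rw [← Real.rpow_one_add' (Nat.cast_nonneg M) (by norm_num)]; norm_num
    have e3 : (M : ℝ) ^ (3 + δ) = M * (M : ℝ) ^ (2 + δ) := by
      rw [← Real.rpow_one_add' (Nat.cast_nonneg M) (by linarith)]; ring_nf
    rw [e2, e3]
    simp only [mul_assoc c, ← Finset.mul_sum]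
    linarith
  have hM1 := FrobeniusField.floor_sqrt_rpow_le hx (e := 4 / 3) (by norm_num)
  have hM2 := FrobeniusField.floor_sqrt_rpow_le hx (e := 3 + δ) (by linarith)
  have hx1' : x ^ ((4 : ℝ) / 3 / 2) = x ^ ((2 : ℝ) / 3) := by norm_num
  have hx2 : x ^ ((3 + δ) / 2) ≤ x ^ ((3 : ℝ) / 2 + ε) :=
    Real.rpow_le_rpow_of_exponent_le hx1 (by linarith [min_le_right (1 / 6) ε])
  have hx3 : 1 ≤ x ^ ((2 : ℝ) / 3) := Real.one_le_rpow hx1 (by norm_num)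
  rw [hx1'] at hM1
  set Y := x ^ ((2 : ℝ) / 3)
  set Z := x ^ ((3 : ℝ) / 2 + ε)
  have hZ : 0 ≤ Z := by positivity
  set u := (4 : ℝ) ^ ((4 : ℝ) / 3 / 2)
  set v := (4 : ℝ) ^ ((3 + δ) / 2)
  have hu : 0 ≤ u := by positivity
  have hv : 0 ≤ v := by positivity
  calc _ ≤ (P₀ + 1) * T ^ 2 + c * (28 * T ^ 2 * (u * Y) + T * (v * Z)) := by
        refine add_le_add hsmall (hbig.trans (hsum.trans ?_))
        have : (M : ℝ) ^ (3 + δ) ≤ v * Z := hM2.trans (by gcongr)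
        gcongr
    _ ≤ (P₀ + 1) * (T ^ 2 * Y + T * Z) + c * ((28 * u + v) * (T ^ 2 * Y + T * Z)) := by
        have h1 : T ^ 2 ≤ T ^ 2 * Y := le_mul_of_one_le_right (by positivity) hx3
        have h2 : 0 ≤ T * Z := by positivity
        have h3 : 0 ≤ T ^ 2 * Y := by positivity
        gcongr
        · linarith
        · nlinarith [mul_nonneg hu h2, mul_nonneg hv h3]
    _ = _ := by rw [hC2]; ring
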